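/- Let H ∈ (0,1/2) and T ∈ (0,∞). Almost surely, lim_{ε→0⁺} sup_{t ≤ T} sup over all partitions P of ℝ with mesh |P| ≤ ε of |V_{0,t}(P, B) − c_H t| = 0. -/

import Mathlib

open MeasureTheory ProbabilityTheory Filter Set ENNReal Asymptotics
open scoped NNReal Classical Topology

noncomputable section

/-- The grid `εℤ` of levels. -/
def lvGrid (ε : ℝ) : Set ℝ := {x | ∃ k : ℤ, x = ε * k}

/-- The successive times at which the path `w` crosses to a new point of the grid `εℤ`,
with values in `ℝ≥0∞` (`∞` meaning "never", corresponding to the convention `inf ∅ = +∞`). -/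
def hitT (ε : ℝ) (w : ℝ → ℝ) : ℕ → ℝ≥0∞
  | 0 => 0
  | n + 1 =>
      ⨅ (r : ℝ) (_ : hitT ε w n < ENNReal.ofReal r ∧ w r ∈ lvGrid ε ∧
          w r ≠ w ((hitT ε w n).toReal)), ENNReal.ofReal r

/-- `K_{s,t}(ε,w)`: the number of `ε`-level crossings of `w` in the interval `[s,t]`,
namely `#{n ≥ 2 : T_n(ε, w_{s+·}) ≤ t-s} + 1_{w_s ∈ εℤ}·1_{T_1(ε, w_{s+·}) ≤ t-s}`,
as an extended natural number. -/
def crossK (ε : ℝ) (w : ℝ → ℝ) (s t : ℝ) : ℕ∞ :=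
  {n : ℕ | 2 ≤ n ∧ hitT ε (fun r => w (s + r)) n ≤ ENNReal.ofReal (t - s)}.encard
    + (if w s ∈ lvGrid ε ∧ hitT ε (fun r => w (s + r)) 1 ≤ ENNReal.ofReal (t - s)
        then 1 else 0)

/-- `K_{s,t}(ε,w)` as an extended nonnegative real. -/
def crossKe (ε : ℝ) (w : ℝ → ℝ) (s t : ℝ) : ℝ≥0∞ := (crossK ε w s t : ℝ≥0∞)

/-- `K_{s,t}(ε,w)` as a real number (junk value `0` if the count is infinite). -/
def crossKR (ε : ℝ) (w : ℝ → ℝ) (s t : ℝ) : ℝ := (crossKe ε w s t).toReal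

/-- The averaged crossing count `K̄_{s,t}(ε,w) = ε⁻¹ ∫_{-ε/2}^{ε/2} K_{s,t}(ε, w+ρ) dρ`. -/
def avgK (ε : ℝ) (w : ℝ → ℝ) (s t : ℝ) : ℝ≥0∞ :=
  ENNReal.ofReal ε⁻¹ * ∫⁻ ρ in Set.Ioo (-(ε / 2)) (ε / 2), crossKe ε (fun r => w r + ρ) s t

/-- `B` is a fractional Brownian motion with Hurst parameter `H` under `P`:
a centered Gaussian process with continuous paths, `B 0 = 0`, and
`E[(B_t - B_s)^2] = a_H |t-s|^(2H)` for some constant `a_H > 0`. -/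
def IsFBM {Ω : Type*} [MeasurableSpace Ω] (H : ℝ) (P : Measure Ω) (B : ℝ → Ω → ℝ) : Prop :=
  (∀ ω, Continuous fun t => B t ω) ∧ (∀ ω, B 0 ω = 0) ∧ (∀ t, Measurable (B t)) ∧
  (∀ (n : ℕ) (t : Fin n → ℝ) (c : Fin n → ℝ), ∃ v : ℝ≥0,
      Measure.map (fun ω => ∑ i, c i * B (t i) ω) P = gaussianReal 0 v) ∧
  (∃ aH : ℝ, 0 < aH ∧ ∀ s t : ℝ, ∫ ω, (B t ω - B s ω) ^ 2 ∂P = aH * |t - s| ^ (2 * H))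

/-- The constant `c_H = sup_{t>0} t⁻¹ E[K̄_{0,t}(1,B)] (= lim_{t→∞} t⁻¹ E[K̄_{0,t}(1,B)]`,
the limit existing by superadditivity and Fekete's lemma), as an extended nonnegative real. -/
def cHe {Ω : Type*} [MeasurableSpace Ω] (P : Measure Ω) (B : ℝ → Ω → ℝ) : ℝ≥0∞ :=
  ⨆ (t : ℝ) (_ : 0 < t), (ENNReal.ofReal t)⁻¹ * ∫⁻ ω, avgK 1 (fun r => B r ω) 0 t ∂P

/-- The constant `c_H` as a real number. -/
def cH {Ω : Type*} [MeasurableSpace Ω] (P : Measure Ω) (B : ℝ → Ω → ℝ) : ℝ :=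
  (cHe P B).toReal

/-- The set of pairs (u,v) realizing an upcrossing of the interval `[0,ε]` by `w`
during `[s,t]`. -/
def upSet (ε : ℝ) (w : ℝ → ℝ) (s t : ℝ) : Set (ℝ × ℝ) :=
  {p | p.1 ∈ Set.Icc s t ∧ p.2 ∈ Set.Icc s t ∧ p.1 < p.2 ∧ w p.1 = 0 ∧ w p.2 = ε ∧
    ∀ r ∈ Set.Ioo p.1 p.2, w r ∈ Set.Ioo 0 ε}

/-- `U_{s,t}(ε,w)`: the number of upcrossings of `[0,ε]` by `w` during `[s,t]`. -/
def upE (ε : ℝ) (w : ℝ → ℝ) (s t : ℝ) : ℕ∞ := (upSet ε w s t).encard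

/-- `U_{s,t}(ε,w)` as a real number (junk value `0` if the count is infinite). -/
def upR (ε : ℝ) (w : ℝ → ℝ) (s t : ℝ) : ℝ := ((upE ε w s t : ℝ≥0∞)).toReal

/-- The set of pairs (u,v) realizing a downcrossing of the interval `[0,ε]` by `w`
during `[s,t]`. -/
def downSet (ε : ℝ) (w : ℝ → ℝ) (s t : ℝ) : Set (ℝ × ℝ) :=
  {p | p.1 ∈ Set.Icc s t ∧ p.2 ∈ Set.Icc s t ∧ p.1 < p.2 ∧ w p.1 = ε ∧ w p.2 = 0 ∧
    ∀ r ∈ Set.Ioo p.1 p.2, w r ∈ Set.Ioo 0 ε}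

/-- `D_{s,t}(ε,w)`: the number of downcrossings of `[0,ε]` by `w` during `[s,t]`. -/
def downE (ε : ℝ) (w : ℝ → ℝ) (s t : ℝ) : ℕ∞ := (downSet ε w s t).encard

/-- `D_{s,t}(ε,w)` as a real number (junk value `0` if the count is infinite). -/
def downR (ε : ℝ) (w : ℝ → ℝ) (s t : ℝ) : ℝ := ((downE ε w s t : ℝ≥0∞)).toReal

/-- A partition `P` of the real line: a strictly increasing two-sided sequence `(y_n)_{n∈ℤ}`
of reals tending to `±∞`, viewed as the collection of intervals `[y_n, y_{n+1}]`. -/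
structure RPartition where
  y : ℤ → ℝ
  mono : StrictMono y
  tendsto_top : Tendsto y atTop atTop
  tendsto_bot : Tendsto y atBot atBot

/-- The mesh `|P|` of a partition of `ℝ`. -/
def RPartition.mesh (Q : RPartition) : ℝ≥0∞ :=
  ⨆ n : ℤ, ENNReal.ofReal (Q.y (n + 1) - Q.y n)

/-- `V_{s,t}(P,w) = Σ_{[a,b]∈P} (b-a)^(1/H) (U_{s,t}(b-a, w-a) + D_{s,t}(b-a, w-a))`:
the (1/H)-th variation of `w` on `[s,t]` along the Lebesgue partition generated by the
partition `P` of `ℝ`. -/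
def Vvar (H : ℝ) (Q : RPartition) (w : ℝ → ℝ) (s t : ℝ) : ℝ :=
  ∑' n : ℤ, (Q.y (n + 1) - Q.y n) ^ (1 / H) *
    (upR (Q.y (n + 1) - Q.y n) (fun r => w r - Q.y n) s t +
      downR (Q.y (n + 1) - Q.y n) (fun r => w r - Q.y n) s t)

section
namespace LC

/-! ### Alternation counts -/

def Rel (a b x y : ℝ) : Prop := (x < a ∧ b < y) ∨ (b < x ∧ y < a)

/-- `Ch S w a b k y`: there is a chain of `k` alternations across `[a,b]` in `S` ending at `y`. -/
def Ch {ι : Type*} [LinearOrder ι] (S : Set ι) (w : ι → ℝ) (a b : ℝ) : ℕ → ι → Prop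
  | 0, y => y ∈ S
  | k + 1, y => y ∈ S ∧ ∃ x, x ≤ y ∧ Rel a b (w x) (w y) ∧ Ch S w a b k x

/-- The number of strict alternations of `w` across `[a,b]` along `S`. -/
def alt {ι : Type*} [LinearOrder ι] (S : Set ι) (w : ι → ℝ) (a b : ℝ) : ℝ≥0∞ :=
  ⨆ (k : ℕ) (y : ι) (_ : Ch S w a b k y), (k : ℝ≥0∞)

section basics
variable {ι : Type*} [LinearOrder ι] {κ : Type*} [LinearOrder κ]

lemma Ch.mem {S : Set ι} {w : ι → ℝ} {a b : ℝ} {k : ℕ} {y : ι} (h : Ch S w a b k y) : y ∈ S := by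
  cases k with
  | zero => exact h
  | succ k => exact h.1

lemma Rel.swap {a b x y : ℝ} (h : Rel a b x y) : Rel a b y x := by
  rcases h with h | h
  · exact Or.inr ⟨h.2, h.1⟩
  · exact Or.inl ⟨h.2, h.1⟩

lemma le_alt {S : Set ι} {w : ι → ℝ} {a b : ℝ} {k : ℕ} {y : ι} (h : Ch S w a b k y) :
    (k : ℝ≥0∞) ≤ alt S w a b :=
  le_iSup_of_le k (le_iSup_of_le y (le_iSup_of_le h le_rfl))

lemma alt_le {S : Set ι} {w : ι → ℝ} {a b : ℝ} {C : ℝ≥0∞}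
    (h : ∀ k y, Ch S w a b k y → (k : ℝ≥0∞) ≤ C) : alt S w a b ≤ C :=
  iSup_le fun k => iSup_le fun y => iSup_le fun hk => h k y hk

lemma Ch.map {S : Set ι} {w : ι → ℝ} {a b : ℝ} {S' : Set κ} {w' : κ → ℝ} {a' b' : ℝ}
    (g : ι → κ) (hg : Monotone g) (hS : MapsTo g S S')
    (hR : ∀ x ∈ S, ∀ y ∈ S, Rel a b (w x) (w y) → Rel a' b' (w' (g x)) (w' (g y))) {k : ℕ} :
    ∀ {y : ι}, Ch S w a b k y → Ch S' w' a' b' k (g y) := by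
  induction k with
  | zero => intro y h; exact hS h
  | succ k ih =>
    rintro y ⟨hy, x, hxy, hr, hc⟩
    exact ⟨hS hy, g x, hg hxy, hR x hc.mem y hy hr, ih hc⟩

lemma alt_map_le {S : Set ι} {w : ι → ℝ} {a b : ℝ} {S' : Set κ} {w' : κ → ℝ} {a' b' : ℝ}
    (g : ι → κ) (hg : Monotone g) (hS : MapsTo g S S')
    (hR : ∀ x ∈ S, ∀ y ∈ S, Rel a b (w x) (w y) → Rel a' b' (w' (g x)) (w' (g y))) :
    alt S w a b ≤ alt S' w' a' b' :=
  alt_le fun _ _ h => le_alt (h.map g hg hS hR)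

lemma alt_mono_set {S S' : Set ι} (h : S ⊆ S') (w : ι → ℝ) (a b : ℝ) :
    alt S w a b ≤ alt S' w a b :=
  alt_map_le id monotone_id h (fun _ _ _ _ hr => hr)

lemma Rel.anti {a b a' b' x y : ℝ} (ha : a ≤ a') (hb : b' ≤ b) (h : Rel a b x y) :
    Rel a' b' x y := by
  rcases h with h | h
  · exact Or.inl ⟨h.1.trans_le ha, hb.trans_lt h.2⟩
  · exact Or.inr ⟨hb.trans_lt h.1, h.2.trans_le ha⟩

lemma alt_anti {S : Set ι} {w : ι → ℝ} {a b a' b' : ℝ} (ha : a ≤ a') (hb : b' ≤ b) :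
    alt S w a b ≤ alt S w a' b' :=
  alt_map_le id monotone_id (mapsTo_id _) (fun _ _ _ _ hr => hr.anti ha hb)

lemma alt_congr {S : Set ι} {w w' : ι → ℝ} {a b a' b' : ℝ}
    (h : ∀ x ∈ S, ∀ y ∈ S, Rel a b (w x) (w y) ↔ Rel a' b' (w' x) (w' y)) :
    alt S w a b = alt S w' a' b' :=
  le_antisymm (alt_map_le id monotone_id (mapsTo_id _) (fun x hx y hy hr => (h x hx y hy).1 hr))
    (alt_map_le id monotone_id (mapsTo_id _) (fun x hx y hy hr => (h x hx y hy).2 hr))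

lemma alt_add (S : Set ι) (w : ι → ℝ) (a b ρ : ℝ) :
    alt S (fun r => w r + ρ) (a + ρ) (b + ρ) = alt S w a b := by
  apply alt_congr; intro x _ y _; simp [Rel]

lemma alt_shift (S : Set ι) (w : ι → ℝ) (a b ρ : ℝ) :
    alt S (fun r => w r - ρ) a b = alt S w (a + ρ) (b + ρ) := by
  apply alt_congr; intro x _ y _
  simp only [Rel, sub_lt_iff_lt_add, lt_sub_iff_add_lt]

lemma alt_scale (S : Set ι) (w : ι → ℝ) (a b : ℝ) {c : ℝ} (hc : 0 < c) :
    alt S (fun r => c * w r) (c * a) (c * b) = alt S w a b := by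
  apply alt_congr; intro x _ y _; simp [Rel, mul_lt_mul_iff_right₀ hc]

/-- bound of the count by a strictly increasing index -/
lemma alt_le_of_idx {S : Set ι} {w : ι → ℝ} {a b : ℝ} (idx : ι → ℕ) (L : ℕ)
    (h1 : ∀ x ∈ S, ∀ y ∈ S, x ≤ y → Rel a b (w x) (w y) → idx x < idx y)
    (h2 : ∀ y ∈ S, idx y ≤ L) : alt S w a b ≤ L := by
  have key : ∀ k y, Ch S w a b k y → k ≤ idx y := by
    intro k
    induction k with
    | zero => intro y _; exact Nat.zero_le _
    | succ k ih =>
      rintro y ⟨hy, x, hxy, hr, hc⟩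
      exact (ih x hc).trans_lt (h1 x hc.mem y hy hxy hr)
  refine alt_le fun k y h => ?_
  exact_mod_cast (key k y h).trans (h2 y h.mem)

lemma alt_eq_zero {S : Set ι} {w : ι → ℝ} {a b : ℝ}
    (h : ∀ x ∈ S, ∀ y ∈ S, ¬ Rel a b (w x) (w y)) : alt S w a b = 0 := by
  refine le_antisymm (alt_le fun k y hk => ?_) bot_le
  cases k with
  | zero => simp
  | succ k => obtain ⟨hy, x, _, hr, hc⟩ := hk; exact absurd hr (h x hc.mem y hy)

lemma alt_eq_zero_of_lt {S : Set ι} {w : ι → ℝ} {a b : ℝ}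
    (h : (∀ x ∈ S, w x ≤ b) ∨ (∀ x ∈ S, a ≤ w x)) : alt S w a b = 0 := by
  apply alt_eq_zero
  intro x hx y hy hr
  rcases h with h | h
  · have := h x hx; have := h y hy
    rcases hr with hr | hr <;> linarith [hr.1, hr.2]
  · have := h x hx; have := h y hy
    rcases hr with hr | hr <;> linarith [hr.1, hr.2]

end basics

section concat

lemma Ch.mono_set {ι : Type*} [LinearOrder ι] {S S' : Set ι} (h : S ⊆ S') {w : ι → ℝ} {a b : ℝ}
    {k : ℕ} {y : ι} (hc : Ch S w a b k y) : Ch S' w a b k y :=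
  hc.map id monotone_id h (fun _ _ _ _ hr => hr)

lemma ch_super {w : ℝ → ℝ} {a b s u t : ℝ} (hab : a ≤ b) (hsu : s ≤ u) (hut : u ≤ t) {k : ℕ} {x : ℝ}
    (h1 : Ch (Icc s u) w a b k x) : ∀ l y, Ch (Icc u t) w a b (l + 1) y →
      ∃ k', k + (l + 1) ≤ k' ∧ Ch (Icc s t) w a b k' y := by
  have hsub1 : Icc s u ⊆ Icc s t := Icc_subset_Icc le_rfl hut
  have hsub2 : Icc u t ⊆ Icc s t := Icc_subset_Icc hsu le_rfl
  intro l
  induction l with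
  | zero =>
    intro y hy
    obtain ⟨hyS, x', hx'y, hr, hc⟩ := hy
    have hx' : x' ∈ Icc u t := hc
    rcases k with _ | k
    · exact ⟨1, by simp, hsub2 hyS, x', hx'y, hr, hsub2 hx'⟩
    · have h1' := h1.mono_set hsub1
      obtain ⟨hxS, x0, hx0, hr0, hc0⟩ := h1
      have hxx' : x ≤ x' := hxS.2.trans hx'.1
      rcases hr0 with hr0 | hr0 <;> rcases hr with hr | hr
      · exact ⟨k + 1 + 2, by omega, hsub2 hyS, x', hx'y, Or.inl hr, hsub2 hx', x, hxx',
          Or.inr ⟨hr0.2, hr.1⟩, h1'⟩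
      · exact ⟨k + 1 + 1, by omega, hsub2 hyS, x, hxx'.trans hx'y, Or.inr ⟨hr0.2, hr.2⟩, h1'⟩
      · exact ⟨k + 1 + 1, by omega, hsub2 hyS, x, hxx'.trans hx'y, Or.inl ⟨hr0.2, hr.2⟩, h1'⟩
      · exact ⟨k + 1 + 2, by omega, hsub2 hyS, x', hx'y, Or.inr hr, hsub2 hx', x, hxx',
          Or.inl ⟨hr0.2, hr.1⟩, h1'⟩
  | succ l ih =>
    rintro y ⟨hyS, x', hx'y, hr, hc⟩
    obtain ⟨k', hk', hck'⟩ := ih x' hc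
    exact ⟨k' + 1, by omega, hsub2 hyS, x', hx'y, hr, hck'⟩

lemma alt_super {w : ℝ → ℝ} {a b s u t : ℝ} (hab : a ≤ b) (hsu : s ≤ u) (hut : u ≤ t) :
    alt (Icc s u) w a b + alt (Icc u t) w a b ≤ alt (Icc s t) w a b := by
  have hsub1 : Icc s u ⊆ Icc s t := Icc_subset_Icc le_rfl hut
  simp only [alt]
  rw [ENNReal.iSup_add]
  refine iSup_le fun k => ?_
  have key : ∀ x, Ch (Icc s u) w a b k x → (k : ℝ≥0∞) + alt (Icc u t) w a b ≤
      alt (Icc s t) w a b := by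
    intro x hx
    rw [alt, ENNReal.add_iSup]
    refine iSup_le fun l => ?_
    by_cases hl : ∃ y, Ch (Icc u t) w a b l y
    · obtain ⟨y, hy⟩ := hl
      have h2 : (⨆ (y : ℝ) (_ : Ch (Icc u t) w a b l y), (l : ℝ≥0∞)) ≤ l :=
        iSup_le fun y => iSup_le fun _ => le_rfl
      refine (add_le_add_right h2 _).trans ?_
      rcases l with _ | l
      · simpa using (le_alt (hx.mono_set hsub1))
      · obtain ⟨k', hk', hc⟩ := ch_super hab hsu hut hx l y hy
        refine le_trans ?_ (le_alt hc)
        exact_mod_cast hk'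
    · push Not at hl
      have h2 : (⨆ (y : ℝ) (_ : Ch (Icc u t) w a b l y), (l : ℝ≥0∞)) ≤ 0 :=
        iSup_le fun y => iSup_le fun hy => absurd hy (hl y)
      refine (add_le_add_right h2 _).trans ?_
      simpa using (le_alt (hx.mono_set hsub1))
  by_cases hk : ∃ x, Ch (Icc s u) w a b k x
  · obtain ⟨x, hx⟩ := hk
    have h2 : (⨆ (y : ℝ) (_ : Ch (Icc s u) w a b k y), (k : ℝ≥0∞)) ≤ k :=
        iSup_le fun y => iSup_le fun _ => le_rfl
    exact (add_le_add_left h2 _).trans (key x hx)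
  · push Not at hk
    have h2 : (⨆ (y : ℝ) (_ : Ch (Icc s u) w a b k y), (k : ℝ≥0∞)) ≤ 0 :=
        iSup_le fun y => iSup_le fun hy => absurd hy (hk y)
    refine (add_le_add_left h2 _).trans ?_
    rw [zero_add]
    exact alt_mono_set (Icc_subset_Icc hsu le_rfl) w a b

/-- the indicator of a straddling level -/
def strad (a b x : ℝ) : ℝ≥0∞ := if x ∈ Icc a b then 1 else 0

lemma ch_sub {w : ℝ → ℝ} {a b s u t : ℝ} (hsu : s ≤ u) (hut : u ≤ t) : ∀ (k : ℕ) (y : ℝ),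
    Ch (Icc s t) w a b k y → u < y →
      ∃ k1 k2 : ℕ, (k : ℝ≥0∞) ≤ k1 + k2 + strad a b (w u) ∧ (∃ x, Ch (Icc s u) w a b k1 x) ∧
        Ch (Icc u t) w a b k2 y := by
  have hle : ∀ (k : ℕ) (y : ℝ), Ch (Icc s t) w a b k y → y ≤ u → Ch (Icc s u) w a b k y := by
    intro k
    induction k with
    | zero => intro y hy hyu; exact ⟨hy.1, hyu⟩
    | succ k ih =>
      rintro y ⟨hy, x, hxy, hr, hc⟩ hyu
      exact ⟨⟨hy.1, hyu⟩, x, hxy, hr, ih x hc (hxy.trans hyu)⟩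
  intro k
  induction k with
  | zero =>
    intro y hy huy
    exact ⟨0, 0, by simp, ⟨s, ⟨le_rfl, hsu⟩⟩, ⟨huy.le, hy.2⟩⟩
  | succ k ih =>
    rintro y ⟨hy, x, hxy, hr, hc⟩ huy
    have hyS : y ∈ Icc u t := ⟨huy.le, hy.2⟩
    rcases lt_or_ge u x with hux | hxu
    · obtain ⟨k1, k2, h1, h2, h3⟩ := ih x hc hux
      refine ⟨k1, k2 + 1, ?_, h2, hyS, x, hxy, hr, h3⟩
      push_cast
      calc (k : ℝ≥0∞) + 1 ≤ (k1 + k2 + strad a b (w u)) + 1 := by gcongr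
        _ = _ := by ring
    · have hcx := hle k x hc hxu
      by_cases hw : w u ∈ Icc a b
      · exact ⟨k, 0, by simp [strad, hw], ⟨x, hcx⟩, hyS⟩
      · have huI : u ∈ Icc s u := ⟨hsu, le_rfl⟩
        have huI' : u ∈ Icc u t := ⟨le_rfl, hut⟩
        have hcase : w u < a ∨ b < w u := by
          by_contra hcon
          push Not at hcon
          exact hw ⟨hcon.1, hcon.2⟩
        rcases hr with hr | hr <;> rcases hcase with hu | hu
        · exact ⟨k, 1, by simp [strad, hw], ⟨x, hcx⟩, hyS, u, huy.le, Or.inl ⟨hu, hr.2⟩, huI'⟩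
        · exact ⟨k + 1, 0, by simp [strad, hw], ⟨u, huI, x, hxu, Or.inl ⟨hr.1, hu⟩, hcx⟩, hyS⟩
        · exact ⟨k + 1, 0, by simp [strad, hw], ⟨u, huI, x, hxu, Or.inr ⟨hr.1, hu⟩, hcx⟩, hyS⟩
        · exact ⟨k, 1, by simp [strad, hw], ⟨x, hcx⟩, hyS, u, huy.le, Or.inr ⟨hu, hr.2⟩, huI'⟩

lemma alt_sub {w : ℝ → ℝ} {a b s u t : ℝ} (hsu : s ≤ u) (hut : u ≤ t) :
    alt (Icc s t) w a b ≤ alt (Icc s u) w a b + alt (Icc u t) w a b + strad a b (w u) := by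
  have hle : ∀ (k : ℕ) (y : ℝ), Ch (Icc s t) w a b k y → y ≤ u → Ch (Icc s u) w a b k y := by
    intro k
    induction k with
    | zero => intro y hy hyu; exact ⟨hy.1, hyu⟩
    | succ k ih =>
      rintro y ⟨hy, x, hxy, hr, hc⟩ hyu
      exact ⟨⟨hy.1, hyu⟩, x, hxy, hr, ih x hc (hxy.trans hyu)⟩
  refine alt_le fun k y hk => ?_
  rcases lt_or_ge u y with huy | hyu
  · obtain ⟨k1, k2, h1, ⟨x, h2⟩, h3⟩ := ch_sub hsu hut k y hk huy
    exact h1.trans (by gcongr; exacts [le_alt h2, le_alt h3])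
  · exact (le_alt (hle k y hk hyu)).trans (by rw [add_assoc]; exact le_self_add)

lemma alt_blocks_le {w : ℝ → ℝ} {a b : ℝ} (hab : a ≤ b) {m : ℝ} (hm : 0 ≤ m) (s : ℝ) (n : ℕ) :
    ∑ j ∈ Finset.range n, alt (Icc (s + j * m) (s + (j + 1 : ℕ) * m)) w a b ≤
      alt (Icc s (s + n * m)) w a b := by
  induction n with
  | zero => simp
  | succ n ih =>
    rw [Finset.sum_range_succ]
    refine (add_le_add_left ih _).trans (alt_super hab ?_ ?_)
    · have : 0 ≤ (n : ℝ) * m := by positivity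
      linarith
    · push_cast; linarith

lemma alt_le_blocks {w : ℝ → ℝ} {a b : ℝ} (hab : a ≤ b) {m : ℝ} (hm : 0 ≤ m) (s : ℝ) (n : ℕ) :
    alt (Icc s (s + n * m)) w a b ≤
    ∑ j ∈ Finset.range n, (alt (Icc (s + j * m) (s + (j + 1 : ℕ) * m)) w a b
      + strad a b (w (s + j * m))) := by
  induction n with
  | zero =>
    refine alt_le fun k y hk => ?_
    cases k with
    | zero => simp
    | succ k =>
      obtain ⟨hy, x, hxy, hr, hc⟩ := hk
      have hx := hc.mem
      simp only [Nat.cast_zero, zero_mul, add_zero, Icc_self, mem_singleton_iff] at hx hy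
      subst hx; subst hy
      exfalso
      rcases hr with hr | hr <;> linarith [hr.1, hr.2]
  | succ n ih =>
    rw [Finset.sum_range_succ]
    refine (alt_sub (u := s + n * m) ?_ ?_).trans ?_
    · have : 0 ≤ (n : ℝ) * m := by positivity
      linarith
    · push_cast; linarith
    · rw [add_assoc]; gcongr

end concat

section skeleton

lemma alt_skel_mono (w : ℝ → ℝ) (a b s t : ℝ) :
    Monotone fun K : ℕ => alt (Iic (2 ^ K)) (fun l : ℕ => w (s + t * (l / 2 ^ K))) a b := by
  refine monotone_nat_of_le_succ fun K => ?_
  refine alt_map_le (fun l => 2 * l) (fun x y h => by dsimp; omega) ?_ ?_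
  · intro l hl; simp only [mem_Iic] at *; rw [pow_succ]; omega
  · intro x _ y _ h
    have e : ∀ z : ℕ, (((2 * z : ℕ) : ℝ) / 2 ^ (K + 1)) = z / 2 ^ K := by
      intro z; push_cast; rw [pow_succ]; field_simp
    simpa only [e] using h

lemma alt_eq_iSup_skel {w : ℝ → ℝ} (hw : Continuous w) (a b s : ℝ) {t : ℝ} (ht : 0 < t) :
    alt (Icc s (s + t)) w a b =
      ⨆ K : ℕ, alt (Iic (2 ^ K)) (fun l : ℕ => w (s + t * (l / 2 ^ K))) a b := by
  apply le_antisymm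
  · -- approximation
    set g : ℕ → ℝ → ℕ := fun K r => ⌊(r - s) / t * 2 ^ K⌋₊ with hg
    set G : ℕ → ℝ → ℝ := fun K r => s + t * ((g K r : ℝ) / 2 ^ K) with hG
    have hGt : ∀ r, s ≤ r → Tendsto (fun K => G K r) atTop (𝓝 r) := by
      intro r hr
      have h1 : Tendsto (fun K : ℕ => (⌊((r - s) / t) * (2 : ℝ) ^ K⌋₊ : ℝ) / (2 : ℝ) ^ K) atTop
          (𝓝 ((r - s) / t)) :=
        (tendsto_nat_floor_mul_div_atTop (R := ℝ) (by positivity [sub_nonneg.2 hr] : 0 ≤ (r - s) / t)).comp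
          (tendsto_pow_atTop_atTop_of_one_lt one_lt_two)
      have h2 := (h1.const_mul t).const_add s
      have e : s + t * ((r - s) / t) = r := by field_simp; ring
      rwa [e] at h2
    have hmono : ∀ K, Monotone (g K) := by
      intro K x y h
      apply Nat.floor_mono
      gcongr
    have hmem : ∀ K r, r ∈ Icc s (s + t) → g K r ∈ Iic (2 ^ K) := by
      intro K r hr
      simp only [mem_Iic, hg]
      apply Nat.floor_le_of_le
      push_cast
      have : (r - s) / t ≤ 1 := by rw [div_le_one ht]; linarith [hr.2]
      calc (r - s) / t * 2 ^ K ≤ 1 * 2 ^ K := by gcongr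
        _ = _ := one_mul _
    have key : ∀ k y, Ch (Icc s (s + t)) w a b k y → ∀ᶠ K in atTop,
        Ch (Iic (2 ^ K)) (fun l : ℕ => w (s + t * (l / 2 ^ K))) a b k (g K y) := by
      intro k
      induction k with
      | zero => intro y hy; exact Eventually.of_forall fun K => hmem K y hy
      | succ k ih =>
        rintro y ⟨hy, x, hxy, hr, hc⟩
        have hx := hc.mem
        have hwx : Tendsto (fun K => w (G K x)) atTop (𝓝 (w x)) :=
          (hw.tendsto x).comp (hGt x hx.1)
        have hwy : Tendsto (fun K => w (G K y)) atTop (𝓝 (w y)) :=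
          (hw.tendsto y).comp (hGt y hy.1)
        have hR : ∀ᶠ K in atTop, Rel a b (w (G K x)) (w (G K y)) := by
          rcases hr with hr | hr
          · filter_upwards [hwx.eventually (gt_mem_nhds hr.1), hwy.eventually (lt_mem_nhds hr.2)]
              with K h1 h2 using Or.inl ⟨h1, h2⟩
          · filter_upwards [hwx.eventually (lt_mem_nhds hr.1), hwy.eventually (gt_mem_nhds hr.2)]
              with K h1 h2 using Or.inr ⟨h1, h2⟩
        filter_upwards [ih x hc, hR] with K h1 h2
        exact ⟨hmem K y hy, g K x, hmono K hxy, h2, h1⟩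
    refine alt_le fun k y hk => ?_
    obtain ⟨K, hK⟩ := (key k y hk).exists
    exact (le_alt hK).trans (le_iSup (fun K : ℕ => alt (Iic (2 ^ K))
      (fun l : ℕ => w (s + t * (l / 2 ^ K))) a b) K)
  · refine iSup_le fun K => ?_
    refine alt_map_le (fun l : ℕ => s + t * ((l : ℝ) / 2 ^ K)) ?_ ?_ (fun _ _ _ _ h => h)
    · intro x y h; dsimp only; gcongr
    · intro l hl
      simp only [mem_Iic] at hl
      have h1 : (l : ℝ) / 2 ^ K ≤ 1 := by
        rw [div_le_one (by positivity)]; exact_mod_cast hl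
      have h2 : 0 ≤ (l : ℝ) / 2 ^ K := by positivity
      constructor <;> nlinarith

lemma measurable_alt_nat {Ω : Type*} [MeasurableSpace Ω] (S : Set ℕ) (X : ℕ → Ω → ℝ)
    (α β : Ω → ℝ) (hX : ∀ l, Measurable (X l)) (hα : Measurable α) (hβ : Measurable β) :
    Measurable fun ω => alt S (fun l => X l ω) (α ω) (β ω) := by
  have hRel : ∀ x y, MeasurableSet {ω | Rel (α ω) (β ω) (X x ω) (X y ω)} := by
    intro x y
    exact ((measurableSet_lt (hX x) hα).inter (measurableSet_lt hβ (hX y))).union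
      ((measurableSet_lt hβ (hX x)).inter (measurableSet_lt (hX y) hα))
  have hCh : ∀ k y, MeasurableSet {ω | Ch S (fun l => X l ω) (α ω) (β ω) k y} := by
    intro k
    induction k with
    | zero => intro y; exact MeasurableSet.const _
    | succ k ih =>
      intro y
      have : {ω | Ch S (fun l => X l ω) (α ω) (β ω) (k + 1) y} =
          {ω | y ∈ S} ∩ ⋃ x : ℕ, ({ω | x ≤ y} ∩ ({ω | Rel (α ω) (β ω) (X x ω) (X y ω)} ∩
            {ω | Ch S (fun l => X l ω) (α ω) (β ω) k x})) := by
        ext ω; simp [Ch]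
      rw [this]
      exact (MeasurableSet.const _).inter (MeasurableSet.iUnion fun x =>
        (MeasurableSet.const _).inter ((hRel x y).inter (ih x)))
  refine Measurable.iSup fun k => Measurable.iSup fun y => ?_
  have : (fun ω => ⨆ (_ : Ch S (fun l => X l ω) (α ω) (β ω) k y), (k : ℝ≥0∞)) =
      {ω | Ch S (fun l => X l ω) (α ω) (β ω) k y}.indicator (fun _ => (k : ℝ≥0∞)) := by
    ext ω
    by_cases h : Ch S (fun l => X l ω) (α ω) (β ω) k y
    · simp [h]
    · simp [h]
  rw [this]
  exact measurable_const.indicator (hCh k y)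

lemma measurable_alt_Icc {Ω : Type*} [MeasurableSpace Ω] (X : ℝ → Ω → ℝ) (s : ℝ) {t : ℝ}
    (ht : 0 < t) (hc : ∀ ω, Continuous fun r => X r ω)
    (α β : Ω → ℝ) (hX : ∀ l, Measurable (X l)) (hα : Measurable α) (hβ : Measurable β) :
    Measurable fun ω => alt (Icc s (s + t)) (fun l => X l ω) (α ω) (β ω) := by
  have : (fun ω => alt (Icc s (s + t)) (fun l => X l ω) (α ω) (β ω)) = fun ω =>
      ⨆ K : ℕ, alt (Iic (2 ^ K)) (fun l : ℕ => X (s + t * (l / 2 ^ K)) ω) (α ω) (β ω) := by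
    ext ω; exact alt_eq_iSup_skel (hc ω) _ _ _ ht
  rw [this]
  exact Measurable.iSup fun K => measurable_alt_nat _ _ _ _ (fun l => hX _) hα hβ

end skeleton

end LC
end

section
namespace LC

/-! ### Crossings -/

def Cr (w : ℝ → ℝ) (a b s t : ℝ) : Set (ℝ × ℝ) :=
  {p | p.1 ∈ Icc s t ∧ p.2 ∈ Icc s t ∧ p.1 < p.2 ∧
    ((w p.1 = a ∧ w p.2 = b) ∨ (w p.1 = b ∧ w p.2 = a)) ∧ ∀ r ∈ Ioo p.1 p.2, w r ∈ Ioo a b}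

lemma exists_up {w : ℝ → ℝ} (hw : Continuous w) {a b x y : ℝ} (hab : a < b) (hxy : x ≤ y)
    (hx : w x ≤ a) (hy : b ≤ w y) :
    ∃ u v, x ≤ u ∧ u < v ∧ v ≤ y ∧ w u = a ∧ w v = b ∧ ∀ r ∈ Ioo u v, w r ∈ Ioo a b := by
  have hS : IsCompact (Icc x y ∩ {r | w r ≤ a}) :=
    isCompact_Icc.inter_right (isClosed_le hw continuous_const)
  obtain ⟨u, hu⟩ := hS.exists_isGreatest ⟨x, ⟨le_rfl, hxy⟩, hx⟩
  have hua : w u = a := by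
    obtain ⟨r, hr, hra⟩ := intermediate_value_Icc hu.1.1.2 hw.continuousOn
      (show a ∈ Icc (w u) (w y) from ⟨hu.1.2, hab.le.trans hy⟩)
    have : r ≤ u := hu.2 ⟨⟨hu.1.1.1.trans hr.1, hr.2⟩, hra.le⟩
    have : r = u := le_antisymm this hr.1
    rw [← this, hra]
  have hS2 : IsCompact (Icc u y ∩ {r | b ≤ w r}) :=
    isCompact_Icc.inter_right (isClosed_le continuous_const hw)
  obtain ⟨v, hv⟩ := hS2.exists_isLeast ⟨y, ⟨hu.1.1.2, le_rfl⟩, hy⟩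
  have hvb : w v = b := by
    obtain ⟨r, hr, hra⟩ := intermediate_value_Icc hv.1.1.1 hw.continuousOn
      (show b ∈ Icc (w u) (w v) from ⟨hua.le.trans hab.le, hv.1.2⟩)
    have : v ≤ r := hv.2 ⟨⟨hr.1, hr.2.trans hv.1.1.2⟩, hra.ge⟩
    have : r = v := le_antisymm hr.2 this
    rw [← this, hra]
  have huv : u < v := by
    rcases hv.1.1.1.lt_or_eq with h | h
    · exact h
    · subst h; linarith
  refine ⟨u, v, hu.1.1.1, huv, hv.1.1.2, hua, hvb, fun r hr => ⟨?_, ?_⟩⟩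
  · by_contra hcon
    have := hu.2 ⟨⟨hu.1.1.1.trans hr.1.le, hr.2.le.trans hv.1.1.2⟩, not_lt.1 hcon⟩
    exact absurd hr.1 (not_lt.2 this)
  · by_contra hcon
    have := hv.2 ⟨⟨hr.1.le, hr.2.le.trans hv.1.1.2⟩, not_lt.1 hcon⟩
    exact absurd hr.2 (not_lt.2 this)

lemma exists_cr {w : ℝ → ℝ} (hw : Continuous w) {a b x y : ℝ} (hab : a < b) (hxy : x ≤ y)
    (h : (w x ≤ a ∧ b ≤ w y) ∨ (b ≤ w x ∧ w y ≤ a)) : ∃ p ∈ Cr w a b x y, True := by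
  rcases h with h | h
  · obtain ⟨u, v, h1, h2, h3, h4, h5, h6⟩ := exists_up hw hab hxy h.1 h.2
    exact ⟨(u, v), ⟨⟨h1, h2.le.trans h3⟩, ⟨h1.trans h2.le, h3⟩, h2, Or.inl ⟨h4, h5⟩, h6⟩, trivial⟩
  · obtain ⟨u, v, h1, h2, h3, h4, h5, h6⟩ := exists_up (w := fun r => -w r) hw.neg
      (neg_lt_neg hab) hxy (neg_le_neg h.1) (neg_le_neg h.2)
    refine ⟨(u, v), ⟨⟨h1, h2.le.trans h3⟩, ⟨h1.trans h2.le, h3⟩, h2,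
      Or.inr ⟨neg_injective h4, neg_injective h5⟩, fun r hr => ?_⟩, trivial⟩
    have := h6 r hr
    exact ⟨neg_lt_neg_iff.1 this.2, neg_lt_neg_iff.1 this.1⟩

lemma alt_le_encard {w : ℝ → ℝ} (hw : Continuous w) {a b s t : ℝ} (hab : a < b) :
    alt (Icc s t) w a b ≤ ((Cr w a b s t).encard : ℝ≥0∞) := by
  have key : ∀ k y, Ch (Icc s t) w a b k y → ∃ F : Finset (ℝ × ℝ), F.card = k ∧
      (F : Set (ℝ × ℝ)) ⊆ Cr w a b s t ∧ ∀ p ∈ F, p.2 ≤ y := by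
    intro k
    induction k with
    | zero => intro y _; exact ⟨∅, by simp⟩
    | succ k ih =>
      rintro y ⟨hy, x, hxy, hr, hc⟩
      obtain ⟨F, hF, hFC, hFy⟩ := ih x hc
      have hx := hc.mem
      obtain ⟨p, hp, -⟩ := exists_cr hw hab hxy
        (hr.imp (fun h => ⟨h.1.le, h.2.le⟩) (fun h => ⟨h.1.le, h.2.le⟩))
      have hpF : p ∉ F := fun h => by
        have := hFy p h
        linarith [hp.1.1, hp.2.2.1]
      refine ⟨insert p F, by rw [Finset.card_insert_of_notMem hpF, hF], ?_, ?_⟩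
      · intro q hq
        rw [Finset.coe_insert] at hq
        rcases hq with rfl | hq
        · exact ⟨⟨hx.1.trans hp.1.1, hp.1.2.trans hy.2⟩, ⟨hx.1.trans hp.2.1.1, hp.2.1.2.trans hy.2⟩,
            hp.2.2⟩
        · exact hFC hq
      · intro q hq
        rcases Finset.mem_insert.1 hq with rfl | hq
        · exact hp.2.1.2
        · exact (hFy q hq).trans hxy
  refine alt_le fun k y hk => ?_
  obtain ⟨F, hF, hFC, -⟩ := key k y hk
  have h1 := Set.encard_le_encard hFC
  rw [Set.encard_coe_eq_coe_finsetCard, hF] at h1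
  exact_mod_cast h1

lemma cr_disj {w : ℝ → ℝ} {a b s t : ℝ} {p q : ℝ × ℝ} (hp : p ∈ Cr w a b s t)
    (hq : q ∈ Cr w a b s t) (hne : p ≠ q) (hle : p.1 ≤ q.1) : p.2 ≤ q.1 := by
  by_contra hcon
  push Not at hcon
  have hends : ∀ {p : ℝ × ℝ}, p ∈ Cr w a b s t → (w p.1 ∉ Ioo a b) ∧ (w p.2 ∉ Ioo a b) := by
    rintro p ⟨-, -, -, h | h, -⟩ <;> simp [h.1, h.2]
  rcases hle.lt_or_eq with h | h
  · exact (hends hq).1 (hp.2.2.2.2 q.1 ⟨h, hcon⟩)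
  · have h2 : p.2 ≠ q.2 := fun h' => hne (Prod.ext h h')
    rcases lt_or_gt_of_ne h2 with h3 | h3
    · exact (hends hp).2 (hq.2.2.2.2 p.2 ⟨h ▸ hp.2.2.1, h3⟩)
    · exact (hends hq).2 (hp.2.2.2.2 q.2 ⟨h ▸ hq.2.2.1, h3⟩)

lemma card_le_alt {w : ℝ → ℝ} {a b a' b' s t : ℝ} (ha : a < a') (hab : a' ≤ b') (hb : b' < b) :
    ∀ (n : ℕ) (F : Finset (ℝ × ℝ)), F.card = n → (F : Set (ℝ × ℝ)) ⊆ Cr w a b s t →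
      ∀ z, (∀ p ∈ F, p.2 ≤ z) → (n : ℝ≥0∞) ≤ alt (Icc s z) w a' b' := by
  intro n
  induction n with
  | zero => intros; simp
  | succ n ih =>
    intro F hF hFC z hz
    have hne : F.Nonempty := by rw [← Finset.card_pos]; omega
    obtain ⟨p, hp, hmax⟩ := Finset.exists_max_image F (fun p => p.1) hne
    have hpC := hFC hp
    have h1 : (n : ℝ≥0∞) ≤ alt (Icc s p.1) w a' b' := by
      refine ih (F.erase p) (by rw [Finset.card_erase_of_mem hp, hF]; rfl) ?_ _ ?_
      · intro q hq; exact hFC (Finset.mem_of_mem_erase hq)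
      · intro q hq
        exact cr_disj (hFC (Finset.mem_of_mem_erase hq)) hpC (Finset.ne_of_mem_erase hq)
          (hmax q (Finset.mem_of_mem_erase hq))
    have hpz := hz p hp
    have hlt := hpC.2.2.1
    have h2 : (1 : ℝ≥0∞) ≤ alt (Icc p.1 z) w a' b' := by
      have : Ch (Icc p.1 z) w a' b' 1 p.2 := by
        refine ⟨⟨hlt.le, hpz⟩, p.1, hlt.le, ?_, ⟨le_rfl, hlt.le.trans hpz⟩⟩
        rcases hpC.2.2.2.1 with h | h
        · left; rw [h.1, h.2]; exact ⟨ha, hb⟩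
        · right; rw [h.1, h.2]; exact ⟨hb, ha⟩
      simpa using le_alt this
    push_cast
    exact (add_le_add h1 h2).trans (alt_super hab hpC.1.1 (hlt.le.trans hpz))

lemma encard_le_alt {w : ℝ → ℝ} {a b a' b' s t : ℝ} (ha : a < a') (hab : a' ≤ b') (hb : b' < b) :
    ((Cr w a b s t).encard : ℝ≥0∞) ≤ alt (Icc s t) w a' b' := by
  by_cases hfin : (Cr w a b s t).Finite
  · rw [hfin.encard_eq_coe_toFinset_card]
    have := card_le_alt (s := s) (t := t) (w := w) ha hab hb _ hfin.toFinset rfl (by simp) t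
      (fun p hp => by
        have : p ∈ Cr w a b s t := by simpa using hp
        exact this.2.1.2)
    exact_mod_cast this
  · have hinf : (Cr w a b s t).Infinite := hfin
    have : alt (Icc s t) w a' b' = ⊤ := by
      refine ENNReal.eq_top_of_forall_nnreal_le fun r => ?_
      obtain ⟨n, hn⟩ := exists_nat_ge r
      obtain ⟨F, hFC, hF⟩ := hinf.exists_subset_card_eq n
      have h3 := card_le_alt (s := s) (t := t) (w := w) ha hab hb _ F hF hFC t
        (fun p hp => (hFC hp).2.1.2)
      refine le_trans ?_ h3
      exact_mod_cast hn
    rw [this]; exact le_top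

lemma encard_cr_eq {w : ℝ → ℝ} {a b s t : ℝ} (hab : a < b) :
    (Cr w a b s t).encard = upE (b - a) (fun r => w r - a) s t + downE (b - a) (fun r => w r - a) s t := by
  unfold upE downE
  rw [← Set.encard_union_eq]
  · congr 1
    ext p
    simp only [Cr, upSet, downSet, mem_union, mem_ofPred_eq, mem_Ioo, sub_eq_zero, sub_left_inj,
      sub_pos, sub_lt_sub_iff_right]
    tauto
  · rw [Set.disjoint_left]
    rintro p h1 h2
    have e1 := h1.2.2.2.1
    have e2 := h2.2.2.2.1
    simp only at e1 e2
    linarith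

/-! ### The grid crossing count -/

section grid
variable {w : ℝ → ℝ}

def Zset : Set ℝ := Set.range ((↑) : ℤ → ℝ)

lemma lvGrid_one : lvGrid 1 = Zset := by
  ext x; simp only [lvGrid, Zset, one_mul, mem_ofPred_eq, mem_range]
  exact ⟨fun ⟨k, h⟩ => ⟨k, h.symm⟩, fun ⟨k, h⟩ => ⟨k, h.symm⟩⟩

lemma closed_sub_Z (x : ℝ) : IsClosed (Zset \ {x}) := by
  have : Zset \ {x} = ((↑) : ℤ → ℝ) '' {k : ℤ | (k : ℝ) ≠ x} := by
    ext y; constructor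
    · rintro ⟨⟨k, rfl⟩, h⟩; exact ⟨k, h, rfl⟩
    · rintro ⟨k, h, rfl⟩; exact ⟨⟨k, rfl⟩, h⟩
  rw [this]
  exact Int.isClosedEmbedding_coe_real.isClosedMap _ (isClosed_discrete _)

def Rset (w : ℝ → ℝ) (τ : ℝ) : Set ℝ := {r | τ ≤ r ∧ w r ∈ Zset \ {w τ}}

lemma hit_succ (hw : Continuous w) {n : ℕ} {τ : ℝ} (hτ : 0 ≤ τ)
    (hn : hitT 1 w n = ENNReal.ofReal τ) :
    (Rset w τ = ∅ ∧ hitT 1 w (n + 1) = ⊤) ∨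
      ∃ τ', IsLeast (Rset w τ) τ' ∧ τ < τ' ∧ hitT 1 w (n + 1) = ENNReal.ofReal τ' := by
  have hmem : ∀ r, (hitT 1 w n < ENNReal.ofReal r ∧ w r ∈ lvGrid 1 ∧
      w r ≠ w ((hitT 1 w n).toReal)) ↔ r ∈ Rset w τ := by
    intro r
    rw [hn, ENNReal.toReal_ofReal hτ, lvGrid_one, ENNReal.ofReal_lt_ofReal_iff']
    constructor
    · rintro ⟨h1, h2, h3⟩; exact ⟨h1.1.le, h2, h3⟩
    · rintro ⟨h1, h2, h3⟩
      have : τ < r := lt_of_le_of_ne h1 (fun h => h3 (by rw [h]; rfl))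
      exact ⟨⟨this, hτ.trans_lt this⟩, h2, h3⟩
  have hT : hitT 1 w (n + 1) = ⨅ (r : ℝ) (_ : r ∈ Rset w τ), ENNReal.ofReal r := by
    simp only [hitT]
    refine iInf_congr fun r => ?_
    exact iInf_congr_Prop (hmem r) (fun _ => rfl)
  rcases (Rset w τ).eq_empty_or_nonempty with he | hne
  · left; refine ⟨he, ?_⟩; rw [hT, he]; simp
  · right
    have hcl : IsClosed (Rset w τ) := isClosed_Ici.inter ((closed_sub_Z (w τ)).preimage hw)
    have hbdd : BddBelow (Rset w τ) := ⟨τ, fun r hr => hr.1⟩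
    have hl : IsLeast (Rset w τ) (sInf (Rset w τ)) :=
      ⟨hcl.csInf_mem hne hbdd, fun r hr => csInf_le hbdd hr⟩
    refine ⟨_, hl, ?_, ?_⟩
    · exact lt_of_le_of_ne hl.1.1 (fun h => hl.1.2.2 (by rw [← h]; rfl))
    · rw [hT]
      apply le_antisymm
      · exact iInf₂_le _ hl.1
      · exact le_iInf₂ fun r hr => ENNReal.ofReal_le_ofReal (hl.2 hr)

lemma hit_succ' (hw : Continuous w) {n : ℕ} {v : ℝ} (hv : hitT 1 w (n + 1) = ENNReal.ofReal v)
    (hv0 : 0 ≤ v) :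
    ∃ τ, 0 ≤ τ ∧ hitT 1 w n = ENNReal.ofReal τ ∧ τ < v ∧ IsLeast (Rset w τ) v := by
  have hne : hitT 1 w n ≠ ⊤ := by
    intro h
    have : hitT 1 w (n + 1) = ⊤ := by
      simp only [hitT, h]
      simp
    rw [hv] at this
    exact ENNReal.ofReal_ne_top this
  refine ⟨(hitT 1 w n).toReal, ENNReal.toReal_nonneg, (ENNReal.ofReal_toReal hne).symm, ?_⟩
  rcases hit_succ hw (n := n) ENNReal.toReal_nonneg (ENNReal.ofReal_toReal hne).symm with h | h
  · rw [hv] at h; exact absurd h.2 ENNReal.ofReal_ne_top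
  · obtain ⟨τ', h1, h2, h3⟩ := h
    rw [hv] at h3
    have h0 : (0:ℝ) ≤ (hitT 1 w n).toReal := ENNReal.toReal_nonneg
    have : v = τ' := by
      rwa [ENNReal.ofReal_eq_ofReal_iff hv0 (h0.trans h2.le)] at h3
    rw [this]; exact ⟨h2, h1⟩

lemma hit_mono (w : ℝ → ℝ) : Monotone (hitT 1 w) := by
  refine monotone_nat_of_le_succ fun n => ?_
  simp only [hitT]
  exact le_iInf₂ fun r hr => hr.1.le

lemma hit_lt (hw : Continuous w) {n m : ℕ} (hnm : n < m) (hm : hitT 1 w m ≠ ⊤) :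
    hitT 1 w n < hitT 1 w m := by
  obtain ⟨k, rfl⟩ : ∃ k, m = k + 1 := ⟨m - 1, by omega⟩
  obtain ⟨τ, h0, h1, h2, h3⟩ := hit_succ' hw (ENNReal.ofReal_toReal hm).symm ENNReal.toReal_nonneg
  refine (hit_mono w (show n ≤ k by omega)).trans_lt ?_
  rw [h1, ← ENNReal.ofReal_toReal hm]
  exact (ENNReal.ofReal_lt_ofReal_iff (h0.trans_lt h2)).2 h2

/-- the set of indices counted -/
def Nset (w : ℝ → ℝ) (t : ℝ) : Set ℕ :=
  {n | 1 ≤ n ∧ hitT 1 w n ≤ ENNReal.ofReal t ∧ (n = 1 → w 0 ∈ Zset)}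

lemma crossK_eq (t : ℝ) : crossK 1 w 0 t = (Nset w t).encard := by
  have e : (fun r => w (0 + r)) = w := by ext r; rw [zero_add]
  rw [crossK, e, sub_zero, lvGrid_one]
  by_cases h : w 0 ∈ Zset ∧ hitT 1 w 1 ≤ ENNReal.ofReal t
  · rw [if_pos h]
    have : Nset w t = insert 1 {n : ℕ | 2 ≤ n ∧ hitT 1 w n ≤ ENNReal.ofReal t} := by
      ext n
      simp only [Nset, mem_ofPred_eq, mem_insert_iff]
      constructor
      · rintro ⟨h1, h2, h3⟩
        rcases h1.lt_or_eq with h4 | h4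
        · right; exact ⟨h4, h2⟩
        · left; exact h4.symm
      · rintro (rfl | ⟨h1, h2⟩)
        · exact ⟨le_rfl, h.2, fun _ => h.1⟩
        · exact ⟨by omega, h2, fun h => by omega⟩
    rw [this, Set.encard_insert_of_notMem (by simp)]
  · rw [if_neg h, add_zero]
    congr 1
    ext n
    simp only [Nset, mem_ofPred_eq]
    constructor
    · rintro ⟨h1, h2⟩; exact ⟨by omega, h2, fun h => by omega⟩
    · rintro ⟨h1, h2, h3⟩
      refine ⟨?_, h2⟩
      rcases h1.lt_or_eq with h4 | h4
      · exact h4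
      · subst h4; exact absurd ⟨h3 rfl, h2⟩ h

def CrZ (w : ℝ → ℝ) (t : ℝ) : Set (ℝ × ℝ) := ⋃ k : ℤ, Cr w k (k + 1) 0 t

lemma tsum_encard_crZ (t : ℝ) :
    ∑' k : ℤ, ((Cr w k (k + 1) 0 t).encard : ℝ≥0∞) = ((CrZ w t).encard : ℝ≥0∞) := by
  let _ : MeasurableSpace (ℝ × ℝ) := ⊤
  have hd : Pairwise (Function.onFun Disjoint fun k : ℤ => Cr w k (k + 1) 0 t) := by
    intro k l hkl
    rw [Function.onFun, Set.disjoint_left]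
    rintro p h1 h2
    apply hkl
    have hmid : (p.1 + p.2) / 2 ∈ Ioo p.1 p.2 := by
      constructor <;> linarith [h1.2.2.1]
    have a1 := h1.2.2.2.2 _ hmid
    have a2 := h2.2.2.2.2 _ hmid
    have b1 : (k : ℝ) < l + 1 := a1.1.trans a2.2
    have b2 : (l : ℝ) < k + 1 := a2.1.trans a1.2
    have c1 : k < l + 1 := by exact_mod_cast b1
    have c2 : l < k + 1 := by exact_mod_cast b2
    omega
  have := measure_iUnion (μ := (Measure.count : Measure (ℝ × ℝ))) hd (fun _ => trivial)
  rw [CrZ, ← Measure.count_apply (MeasurableSpace.measurableSet_top), this]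
  refine tsum_congr fun k => ?_
  rw [Measure.count_apply (MeasurableSpace.measurableSet_top)]

lemma tau_Z (hw : Continuous w) {n : ℕ} {t τ : ℝ} (hn : n + 1 ∈ Nset w t) (hτ : 0 ≤ τ)
    (h : hitT 1 w n = ENNReal.ofReal τ) : w τ ∈ Zset := by
  cases n with
  | zero =>
    have : τ = 0 := by
      simp only [hitT] at h
      have := ENNReal.ofReal_eq_zero.1 h.symm
      linarith
    rw [this]; exact hn.2.2 rfl
  | succ n =>
    obtain ⟨τ', _, _, _, h4⟩ := hit_succ' hw h hτ
    exact h4.1.2.1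

lemma encard_Nset_le (hw : Continuous w) {t : ℝ} (ht : 0 ≤ t) :
    (Nset w t).encard ≤ (CrZ w t).encard := by
  have key : ∀ n ∈ Nset w t, ∃ p ∈ CrZ w t, hitT 1 w n = ENNReal.ofReal p.2 := by
    intro n hn
    obtain ⟨m, rfl⟩ : ∃ m, n = m + 1 := ⟨n - 1, by have := hn.1; omega⟩
    have hne : hitT 1 w (m + 1) ≠ ⊤ := (hn.2.1.trans_lt ENNReal.ofReal_lt_top).ne
    obtain ⟨v, hv0, hv⟩ : ∃ v, 0 ≤ v ∧ hitT 1 w (m + 1) = ENNReal.ofReal v :=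
      ⟨_, ENNReal.toReal_nonneg, (ENNReal.ofReal_toReal hne).symm⟩
    obtain ⟨τ, h0, h1, h2, h3⟩ := hit_succ' hw hv hv0
    obtain ⟨i, hi⟩ := tau_Z hw hn h0 h1
    obtain ⟨⟨j, hj⟩, hj'⟩ := h3.1.2
    have hvt : v ≤ t := by
      have := hn.2.1; rw [hv] at this
      exact (ENNReal.ofReal_le_ofReal_iff ht).1 this
    have hij : i ≠ j := by
      rintro rfl; exact hj' (by rw [← hj, hi]; rfl)
    -- crossing towards `v`
    have hcross : ∃ k : ℤ, ∃ p ∈ Cr w k (k + 1) τ v, True := by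
      rcases lt_or_gt_of_ne hij with h | h
      · refine ⟨i, exists_cr hw (by linarith) h2.le (Or.inl ⟨hi.ge, ?_⟩)⟩
        rw [← hj]; exact_mod_cast h
      · refine ⟨i - 1, exists_cr hw (by linarith) h2.le (Or.inr ⟨?_, ?_⟩)⟩
        · rw [← hi]; push_cast; linarith
        · rw [← hj]; have : j ≤ i - 1 := by omega
          exact_mod_cast this
    obtain ⟨k, p, hp, -⟩ := hcross
    have hp2 : p.2 = v := by
      have hz : ∀ q : ℝ, w q = k ∨ w q = k + 1 → w q ∈ Zset := by
        rintro q (h | h)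
        · exact ⟨k, h.symm⟩
        · exact ⟨k + 1, by rw [h]; push_cast; rfl⟩
      have h1z : w p.1 ∈ Zset := hz _ (by rcases hp.2.2.2.1 with h | h <;> simp [h.1])
      have h2z : w p.2 ∈ Zset := hz _ (by rcases hp.2.2.2.1 with h | h <;> simp [h.2])
      have hne12 : w p.1 ≠ w p.2 := by
        rcases hp.2.2.2.1 with h | h <;> rw [h.1, h.2] <;> simp
      by_contra hcon
      have hlt : p.2 < v := lt_of_le_of_ne hp.2.1.2 hcon
      have n1 : p.1 ∉ Rset w τ := fun h => absurd (h3.2 h) (by linarith [hp.2.2.1])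
      have n2 : p.2 ∉ Rset w τ := fun h => absurd (h3.2 h) (by linarith)
      have e1 : w p.1 = w τ := by
        by_contra hh; exact n1 ⟨hp.1.1, h1z, hh⟩
      have e2 : w p.2 = w τ := by
        by_contra hh; exact n2 ⟨hp.2.1.1, h2z, hh⟩
      exact hne12 (e1.trans e2.symm)
    refine ⟨p, mem_iUnion.2 ⟨k, ⟨h0.trans hp.1.1, hp.1.2.trans hvt⟩,
      ⟨h0.trans hp.2.1.1, hp.2.1.2.trans hvt⟩, hp.2.2⟩, by rw [hp2, hv]⟩
  choose! f hf hf2 using key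
  refine Set.encard_le_encard_of_injOn hf ?_
  intro n hn m hm hnm
  have e : hitT 1 w n = hitT 1 w m := by rw [hf2 n hn, hf2 m hm, hnm]
  have hn' : hitT 1 w n ≠ ⊤ := (hn.2.1.trans_lt ENNReal.ofReal_lt_top).ne
  have hm' : hitT 1 w m ≠ ⊤ := (hm.2.1.trans_lt ENNReal.ofReal_lt_top).ne
  rcases lt_trichotomy n m with h | h | h
  · exact absurd e (hit_lt hw h hm').ne
  · exact h
  · exact absurd e (hit_lt hw h hn').ne'

lemma encard_crZ_le (hw : Continuous w) {t : ℝ} (ht : 0 ≤ t) :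
    (CrZ w t).encard ≤ (Nset w t).encard := by
  by_cases hfin : (Nset w t).Finite
  swap
  · rw [Set.Infinite.encard_eq hfin]; exact le_top
  have key : ∀ p ∈ CrZ w t, ∃ n ∈ Nset w t, hitT 1 w n = ENNReal.ofReal p.2 := by
    intro p hp
    obtain ⟨k, hp⟩ := mem_iUnion.1 hp
    have hz : ∀ q : ℝ, w q = k ∨ w q = k + 1 → w q ∈ Zset := by
      rintro q (h | h)
      · exact ⟨k, h.symm⟩
      · exact ⟨k + 1, by rw [h]; push_cast; rfl⟩
    have h1z : w p.1 ∈ Zset := hz _ (by rcases hp.2.2.2.1 with h | h <;> simp [h.1])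
    have h2z : w p.2 ∈ Zset := hz _ (by rcases hp.2.2.2.1 with h | h <;> simp [h.2])
    have hne12 : w p.1 ≠ w p.2 := by
      rcases hp.2.2.2.1 with h | h <;> rw [h.1, h.2] <;> simp
    have hinZ : ∀ r ∈ Ioo p.1 p.2, w r ∉ Zset := by
      rintro r hr ⟨l, hl⟩
      have := hp.2.2.2.2 r hr
      rw [← hl] at this
      have a1 : k < l := by exact_mod_cast this.1
      have a2 : l < k + 1 := by exact_mod_cast this.2
      omega
    -- maximal index
    have hex : ∃ m, ENNReal.ofReal p.1 < hitT 1 w m := by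
      by_contra hcon
      push Not at hcon
      apply hfin.not_infinite
      refine Set.infinite_of_not_bddAbove ?_
      rintro ⟨b, hb⟩
      have : b + 2 ∈ Nset w t := ⟨by omega, (hcon _).trans (ENNReal.ofReal_le_ofReal hp.1.2),
        fun h => by omega⟩
      have := hb this
      omega
    set m := Nat.find hex with hm
    have hm1 : ENNReal.ofReal p.1 < hitT 1 w m := Nat.find_spec hex
    have hm0 : m ≠ 0 := by
      intro h; rw [h] at hm1; simp [hitT] at hm1
    obtain ⟨n, hn⟩ : ∃ n, m = n + 1 := ⟨m - 1, by omega⟩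
    have hn1 : hitT 1 w n ≤ ENNReal.ofReal p.1 := by
      have := Nat.find_min hex (show n < m by omega)
      exact not_lt.1 this
    rw [hn] at hm1
    obtain ⟨τ, hτ0, hτ⟩ : ∃ v, 0 ≤ v ∧ hitT 1 w n = ENNReal.ofReal v :=
      ⟨_, ENNReal.toReal_nonneg,
        (ENNReal.ofReal_toReal (hn1.trans_lt ENNReal.ofReal_lt_top).ne).symm⟩
    rw [hτ, ENNReal.ofReal_le_ofReal_iff hp.1.1] at hn1
    have hwτ : w p.1 = w τ := by
      by_contra hcon
      have hR : p.1 ∈ Rset w τ := ⟨hn1, h1z, hcon⟩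
      rcases hit_succ hw hτ0 hτ with h | ⟨τ', h1, h2, h3⟩
      · rw [h.1] at hR; exact hR
      · rw [h3] at hm1
        exact absurd hm1 (not_lt.2 (ENNReal.ofReal_le_ofReal (h1.2 hR)))
    have hR : p.2 ∈ Rset w τ := ⟨hn1.trans hp.2.2.1.le, h2z, fun h => hne12 (hwτ.trans h.symm)⟩
    rcases hit_succ hw hτ0 hτ with h | ⟨τ', h1, h2, h3⟩
    · rw [h.1] at hR; exact absurd hR (by simp)
    · have hle := h1.2 hR
      rw [h3, ENNReal.ofReal_lt_ofReal_iff'] at hm1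
      have heq : τ' = p.2 := by
        by_contra hcon
        exact hinZ τ' ⟨hm1.1, lt_of_le_of_ne hle hcon⟩ h1.1.2.1
      refine ⟨n + 1, ⟨by omega, ?_, ?_⟩, by rw [h3, heq]⟩
      · rw [h3, heq]; exact ENNReal.ofReal_le_ofReal hp.2.1.2
      · intro hh
        have : n = 0 := by omega
        subst this
        have : τ = 0 := by
          simp only [hitT] at hτ
          have := ENNReal.ofReal_eq_zero.1 hτ.symm
          linarith
        rw [← this, ← hwτ]; exact h1z
  choose! f hf hf2 using key
  refine Set.encard_le_encard_of_injOn hf ?_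
  intro p hp q hq hpq
  have e : p.2 = q.2 := by
    have := (hf2 p hp).symm.trans ((congrArg _ hpq).trans (hf2 q hq))
    obtain ⟨k, hp⟩ := mem_iUnion.1 hp
    obtain ⟨l, hq⟩ := mem_iUnion.1 hq
    rwa [ENNReal.ofReal_eq_ofReal_iff hp.2.1.1 hq.2.1.1] at this
  obtain ⟨k, hp⟩ := mem_iUnion.1 hp
  obtain ⟨l, hq⟩ := mem_iUnion.1 hq
  have hkl : k = l := by
    have m1 : (max p.1 q.1 + p.2) / 2 ∈ Ioo p.1 p.2 := by
      have := le_max_left p.1 q.1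
      have := max_lt hp.2.2.1 (e ▸ hq.2.2.1)
      constructor <;> linarith
    have m2 : (max p.1 q.1 + p.2) / 2 ∈ Ioo q.1 q.2 := by
      have := le_max_right p.1 q.1
      have := max_lt hp.2.2.1 (e ▸ hq.2.2.1)
      constructor <;> linarith
    have a1 := hp.2.2.2.2 _ m1
    have a2 := hq.2.2.2.2 _ m2
    have b1 : (k : ℝ) < l + 1 := a1.1.trans a2.2
    have b2 : (l : ℝ) < k + 1 := a2.1.trans a1.2
    have c1 : k < l + 1 := by exact_mod_cast b1
    have c2 : l < k + 1 := by exact_mod_cast b2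
    omega
  subst hkl
  by_contra hne
  rcases le_total p.1 q.1 with h | h
  · have := cr_disj hp hq hne h
    linarith [hq.2.2.1]
  · have := cr_disj hq hp (Ne.symm hne) h
    linarith [hp.2.2.1]

lemma crossKe_eq (hw : Continuous w) {t : ℝ} (ht : 0 ≤ t) :
    crossKe 1 w 0 t = ∑' k : ℤ, ((Cr w k (k + 1) 0 t).encard : ℝ≥0∞) := by
  rw [tsum_encard_crZ, crossKe, crossK_eq,
    le_antisymm (encard_Nset_le hw ht) (encard_crZ_le hw ht)]

lemma lintegral_periodize {g : ℝ → ℝ≥0∞} (hg : Measurable g) :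
    ∫⁻ ρ in Ioo (-(1 / 2 : ℝ)) (1 / 2), ∑' k : ℤ, g (k - ρ) = ∫⁻ a, g a := by
  rw [lintegral_tsum (fun k => by fun_prop)]
  have h1 : ∀ k : ℤ, ∫⁻ ρ in Ioo (-(1 / 2 : ℝ)) (1 / 2), g (k - ρ) =
      ∫⁻ a in Ioc (-(1 / 2 : ℝ) + k) (-(1 / 2) + k + 1), g a := by
    intro k
    rw [setLIntegral_congr (Ioo_ae_eq_Ico), ← lintegral_indicator measurableSet_Ico,
      ← lintegral_indicator measurableSet_Ioc]
    rw [← lintegral_sub_left_eq_self _ (k : ℝ)]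
    congr 1; ext ρ
    simp only [indicator, mem_Ico, mem_Ioc]
    congr 1
    · apply propext; constructor <;> rintro ⟨h1, h2⟩ <;> constructor <;> linarith
    · rw [_root_.sub_sub_cancel]
  simp_rw [h1]
  rw [← lintegral_iUnion (fun k => measurableSet_Ioc) (pairwise_disjoint_Ioc_add_intCast _),
    iUnion_Ioc_add_intCast, setLIntegral_univ]

lemma measurable_alt_level (hw : Continuous w) (s : ℝ) {t : ℝ} (ht : 0 < t) (x y : ℝ) :
    Measurable fun a : ℝ => alt (Icc s (s + t)) w (a + x) (a + y) :=
  measurable_alt_Icc (fun r _ => w r) s ht (fun _ => hw) _ _ (fun _ => measurable_const)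
    (measurable_id.add_const x) (measurable_id.add_const y)

lemma le_avgK (hw : Continuous w) {t : ℝ} (ht : 0 < t) :
    ∫⁻ a, alt (Icc 0 t) w a (a + 1) ≤ avgK 1 w 0 t := by
  have hm := measurable_alt_level hw 0 ht 0 1
  simp only [zero_add, add_zero] at hm
  rw [avgK, ← lintegral_periodize hm]
  simp only [inv_one, ENNReal.ofReal_one, one_mul]
  refine lintegral_mono fun ρ => ?_
  have hw' : Continuous fun r => w r + ρ := hw.add continuous_const
  rw [crossKe_eq hw' ht.le]
  refine ENNReal.tsum_le_tsum fun k => ?_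
  refine le_trans (le_of_eq ?_) (alt_le_encard hw' (by linarith))
  rw [← alt_add _ _ _ _ ρ]
  congr 1 <;> ring

lemma avgK_le (hw : Continuous w) {t δ : ℝ} (ht : 0 < t) (hδ : 0 < δ) (hδ' : δ < 1 / 2) :
    avgK 1 w 0 t ≤ ∫⁻ a, alt (Icc 0 t) w (a + δ) (a + 1 - δ) := by
  have hm := measurable_alt_level hw 0 ht δ (1 - δ)
  simp only [zero_add, add_sub] at hm
  rw [avgK, ← lintegral_periodize hm]
  simp only [inv_one, ENNReal.ofReal_one, one_mul]
  refine lintegral_mono fun ρ => ?_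
  have hw' : Continuous fun r => w r + ρ := hw.add continuous_const
  simp only
  rw [crossKe_eq hw' ht.le]
  refine ENNReal.tsum_le_tsum fun k => ?_
  refine le_trans (encard_le_alt (a' := k + δ) (b' := k + 1 - δ) (by linarith) (by linarith)
    (by linarith)) (le_of_eq ?_)
  rw [← alt_add _ w _ _ ρ]
  congr 1 <;> ring

end grid

end LC
end

section
namespace LC

/-! ### Deterministic assembly -/

def dd (x y : ℝ≥0∞) : ℝ≥0∞ := (x - y) + (y - x)

lemma dd_comm (x y : ℝ≥0∞) : dd x y = dd y x := add_comm _ _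

lemma le_add_dd (x y : ℝ≥0∞) : x ≤ y + dd x y := by
  unfold dd
  rw [← add_assoc]
  exact le_add_tsub.trans le_self_add

lemma le_add_dd' (x y : ℝ≥0∞) : y ≤ x + dd x y := by rw [dd_comm]; exact le_add_dd y x

lemma dd_triangle (x y z : ℝ≥0∞) : dd x z ≤ dd x y + dd y z := by
  unfold dd
  have h1 : x - z ≤ (x - y) + (y - z) := tsub_le_tsub_add_tsub
  have h2 : z - x ≤ (z - y) + (y - x) := tsub_le_tsub_add_tsub
  calc _ ≤ ((x - y) + (y - z)) + ((z - y) + (y - x)) := add_le_add h1 h2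
    _ = _ := by ring

lemma measurable_dd {α : Type*} [MeasurableSpace α] {f g : α → ℝ≥0∞} (hf : Measurable f)
    (hg : Measurable g) : Measurable fun x => dd (f x) (g x) :=
  (hf.sub hg).add (hg.sub hf)

lemma alt_le_gap {w : ℝ → ℝ} {a b s t d : ℝ} (hd : 0 < d)
    (h : ∀ x ∈ Icc s t, ∀ y ∈ Icc s t, x ≤ y → Rel a b (w x) (w y) → d ≤ y - x) :
    alt (Icc s t) w a b ≤ (⌊(t - s) / d⌋₊ : ℕ) := by
  refine alt_le_of_idx (fun x => ⌊(x - s) / d⌋₊) _ ?_ ?_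
  · intro x hx y hy hxy hr
    have h1 := h x hx y hy hxy hr
    have h2 : 0 ≤ (x - s) / d := div_nonneg (by linarith [hx.1]) hd.le
    have : ⌊(x - s) / d⌋₊ + 1 ≤ ⌊(y - s) / d⌋₊ := by
      rw [← Nat.floor_add_one h2]
      apply Nat.floor_mono
      rw [div_add_one hd.ne']
      gcongr
      linarith
    exact this
  · intro y hy
    apply Nat.floor_mono
    gcongr
    exact hy.2

lemma alt_ne_top {w : ℝ → ℝ} (hw : Continuous w) {a b s t : ℝ} (hab : a < b) :
    alt (Icc s t) w a b ≠ ⊤ := by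
  have huc := (isCompact_Icc (a := s) (b := t)).uniformContinuousOn_of_continuous hw.continuousOn
  rw [Metric.uniformContinuousOn_iff] at huc
  obtain ⟨d, hd, h⟩ := huc (b - a) (by linarith)
  refine ne_top_of_le_ne_top (ENNReal.natCast_ne_top _) (alt_le_gap hd ?_)
  intro x hx y hy hxy hr
  by_contra hcon
  push Not at hcon
  have h1 := h x hx y hy (by rw [Real.dist_eq, abs_sub_comm, abs_of_nonneg (by linarith)]; exact hcon)
  rw [Real.dist_eq, abs_lt] at h1
  rcases hr with hr | hr <;> linarith [hr.1, hr.2, h1.1, h1.2]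

lemma encard_cr_ne_top {w : ℝ → ℝ} (hw : Continuous w) {a b s t : ℝ} (hab : a < b) :
    ((Cr w a b s t).encard : ℝ≥0∞) ≠ ⊤ :=
  ne_top_of_le_ne_top (alt_ne_top hw (a := a + (b - a) / 3) (b := b - (b - a) / 3) (by linarith))
    (encard_le_alt (by linarith) (by linarith) (by linarith))

def VE (H : ℝ) (Q : RPartition) (w : ℝ → ℝ) (t : ℝ) : ℝ≥0∞ :=
  ∑' n : ℤ, ENNReal.ofReal ((Q.y (n + 1) - Q.y n) ^ (1 / H)) *
    ((Cr w (Q.y n) (Q.y (n + 1)) 0 t).encard : ℝ≥0∞)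

lemma Qlt (Q : RPartition) (n : ℤ) : Q.y n < Q.y (n + 1) := Q.mono (by omega)

lemma Vvar_eq (H : ℝ) (Q : RPartition) {w : ℝ → ℝ} (hw : Continuous w) (t : ℝ) :
    Vvar H Q w 0 t = (VE H Q w t).toReal := by
  unfold VE Vvar
  rw [ENNReal.tsum_toReal_eq]
  · refine tsum_congr fun n => ?_
    have hfin := encard_cr_ne_top hw (Qlt Q n) (s := 0) (t := t)
    rw [ENNReal.toReal_mul, ENNReal.toReal_ofReal (by have := Qlt Q n; positivity [sub_pos.2 this])]
    congr 1
    rw [encard_cr_eq (Qlt Q n)] at hfin ⊢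
    rw [ENat.toENNReal_add] at hfin ⊢
    rw [ENNReal.toReal_add]
    · rfl
    · exact fun h => hfin (by rw [h]; simp)
    · exact fun h => hfin (by rw [h]; simp)
  · intro n
    exact ENNReal.mul_ne_top ENNReal.ofReal_ne_top (encard_cr_ne_top hw (Qlt Q n))

lemma VE_mono (H : ℝ) (Q : RPartition) (w : ℝ → ℝ) {t t' : ℝ} (h : t ≤ t') :
    VE H Q w t ≤ VE H Q w t' := by
  refine ENNReal.tsum_le_tsum fun n => ?_
  gcongr
  rintro p ⟨h1, h2, h3⟩
  exact ⟨⟨h1.1, h1.2.trans h⟩, ⟨h2.1, h2.2.trans h⟩, h3⟩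

lemma Q_iUnion (Q : RPartition) : ⋃ n : ℤ, Ico (Q.y n) (Q.y (n + 1)) = univ := by
  rw [eq_univ_iff_forall]
  intro x
  have h1 : ∃ z, Q.y z ≤ x := (Q.tendsto_bot.eventually (eventually_le_atBot x)).exists
  obtain ⟨b, hb⟩ := (Q.tendsto_top.eventually (eventually_gt_atTop x)).exists
  obtain ⟨n, hn, hmax⟩ := Int.exists_greatest_of_bdd (P := fun z => Q.y z ≤ x)
    ⟨b, fun z hz => by
      by_contra hcon
      have := Q.mono.monotone (not_le.1 hcon).le
      linarith⟩ h1
  refine mem_iUnion.2 ⟨n, hn, ?_⟩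
  by_contra hcon
  have := hmax (n + 1) (not_lt.1 hcon)
  omega

lemma Q_disj (Q : RPartition) :
    Pairwise (Function.onFun Disjoint fun n : ℤ => Ico (Q.y n) (Q.y (n + 1))) := by
  intro k l hkl
  rw [Function.onFun, Set.disjoint_left]
  rintro x h1 h2
  rcases lt_or_gt_of_ne hkl with h | h
  · have := Q.mono.monotone (show k + 1 ≤ l by omega)
    linarith [h1.2, h2.1]
  · have := Q.mono.monotone (show l + 1 ≤ k by omega)
    linarith [h2.2, h1.1]

/-- occupation measure -/
def occ (w : ℝ → ℝ) (t : ℝ) : Measure ℝ := Measure.map w (volume.restrict (Icc 0 t))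

lemma occ_univ {w : ℝ → ℝ} (hw : Continuous w) (t : ℝ) : occ w t univ = ENNReal.ofReal t := by
  rw [occ, Measure.map_apply hw.measurable MeasurableSet.univ]
  simp

lemma occ_sum {w : ℝ → ℝ} (hw : Continuous w) (t : ℝ) (Q : RPartition) :
    ∑' n : ℤ, occ w t (Ico (Q.y n) (Q.y (n + 1))) = ENNReal.ofReal t := by
  rw [← measure_iUnion (Q_disj Q) (fun _ => measurableSet_Ico), Q_iUnion, occ_univ hw]

lemma exists_L {L : ℕ → ℝ} (hL0 : Tendsto L atTop (𝓝 0)) (hL1 : ∀ θ : ℝ, 1 < θ → ∀ᶠ k in atTop,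
    L k ≤ θ * L (k + 1)) (θ : ℝ) (hθ : 1 < θ) (k₀ : ℕ) (hLpos : ∀ k, 0 < L k) :
    ∃ ε₀ : ℝ, 0 < ε₀ ∧ ∀ l : ℝ, 0 < l → l ≤ ε₀ → ∃ k, k₀ ≤ k ∧ l ≤ L k ∧ L k ≤ θ * l := by
  obtain ⟨k1, hk1⟩ := eventually_atTop.1 (hL1 θ hθ)
  set K := max k₀ k1 with hK
  refine ⟨L K, hLpos _, fun l hl hlL => ?_⟩
  have hex : ∃ j, L (K + j + 1) < l := by
    have : Tendsto (fun j => L (K + j + 1)) atTop (𝓝 0) := by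
      refine hL0.comp (tendsto_atTop_mono (f := id) (fun j => ?_) tendsto_id)
      simp only [id]; omega
    exact (this.eventually (gt_mem_nhds hl)).exists
  have hlt := Nat.find_spec hex
  set j := Nat.find hex with hj
  have hKk : k₀ ≤ K := le_max_left _ _
  have hKk' : k1 ≤ K := le_max_right _ _
  refine ⟨K + j, by omega, ?_, ?_⟩
  · rcases Nat.eq_zero_or_pos j with h0 | h0
    · rw [h0]; exact hlL
    · have := Nat.find_min hex (show j - 1 < j by omega)
      have e : K + (j - 1) + 1 = K + j := by omega
      rw [e] at this
      exact not_lt.1 this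
  · have := hk1 (K + j) (by omega)
    nlinarith

def Ak (H : ℝ) (w : ℝ → ℝ) (t L b : ℝ) : ℝ≥0∞ :=
  ENNReal.ofReal (L ^ (1 / H)) * alt (Icc 0 t) w (b - L / 2) (b + L / 2)

def Mk (c : ℝ≥0∞) (w : ℝ → ℝ) (t L b : ℝ) : ℝ≥0∞ := c * occ w t (Ico (b - L / 2) (b + L / 2))

/-- averaging lemma -/
lemma avg_interval {x y : ℝ≥0∞} {G : ℝ → ℝ≥0∞} {J : Set ℝ} (hJ : MeasurableSet J) {l : ℝ} (hl : 0 < l)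
    (hJl : volume J = ENNReal.ofReal l) (hG : Measurable G)
    (h : ∀ b ∈ J, x ≤ y + G b) : x ≤ y + (ENNReal.ofReal l)⁻¹ * ∫⁻ b in J, G b := by
  have hl0 : ENNReal.ofReal l ≠ 0 := by simpa using hl
  have hlt : ENNReal.ofReal l ≠ ⊤ := ENNReal.ofReal_ne_top
  have h1 : ∫⁻ _ in J, x ≤ ∫⁻ b in J, (y + G b) := setLIntegral_mono' hJ h
  rw [lintegral_add_right _ hG, setLIntegral_const, setLIntegral_const, hJl] at h1
  calc x = (ENNReal.ofReal l)⁻¹ * (x * ENNReal.ofReal l) := by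
        rw [mul_comm x, ← mul_assoc, ENNReal.inv_mul_cancel hl0 hlt, one_mul]
    _ ≤ (ENNReal.ofReal l)⁻¹ * (y * ENNReal.ofReal l + ∫⁻ b in J, G b) := by gcongr
    _ = _ := by
      rw [mul_add, mul_comm y, ← mul_assoc, ENNReal.inv_mul_cancel hl0 hlt, one_mul]

lemma Ak_measurable (H : ℝ) {w : ℝ → ℝ} (hw : Continuous w) {t : ℝ} (ht : 0 < t) (L : ℝ) :
    Measurable (Ak H w t L) := by
  have := (measurable_alt_level hw 0 ht (-(L / 2)) (L / 2)).const_mul (ENNReal.ofReal (L ^ (1 / H)))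
  simp only [zero_add, ← sub_eq_add_neg] at this
  exact this

lemma Mk_measurable (c : ℝ≥0∞) {w : ℝ → ℝ} (hw : Continuous w) (t : ℝ) (L : ℝ) :
    Measurable (Mk c w t L) := by
  unfold Mk
  refine Measurable.const_mul ?_ c
  have : ∀ b : ℝ, occ w t (Ico (b - L / 2) (b + L / 2)) =
      ∫⁻ r in Icc 0 t, (if b - L / 2 ≤ w r ∧ w r < b + L / 2 then 1 else 0) := by
    intro b
    rw [occ, Measure.map_apply hw.measurable measurableSet_Ico, ← lintegral_indicator_one
      (hw.measurable measurableSet_Ico)]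
    refine lintegral_congr fun r => ?_
    simp only [indicator, mem_preimage, mem_Ico, Pi.one_apply]
  simp_rw [this]
  refine Measurable.lintegral_prod_right' (f := fun p : ℝ × ℝ => if p.1 - L / 2 ≤ w p.2 ∧ w p.2 < p.1 + L / 2 then (1 : ℝ≥0∞) else 0) ?_
  refine Measurable.ite ?_ measurable_const measurable_const
  have h2 : Measurable fun p : ℝ × ℝ => w p.2 := hw.measurable.comp measurable_snd
  exact (measurableSet_le (by fun_prop) h2).inter (measurableSet_lt h2 (by fun_prop))

section intervals
variable {H : ℝ} {w : ℝ → ℝ} {t : ℝ} {c : ℝ≥0∞} {η L l x : ℝ}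

def Jset (η l x : ℝ) : Set ℝ := Icc (x + l / 2 - η * l / 4) (x + l / 2 + η * l / 4)

lemma vol_J (η l x : ℝ) : volume (Jset η l x) = ENNReal.ofReal (η * l / 2) := by
  rw [Jset, Real.volume_Icc]; congr 1; ring

lemma lower_int (hH : 0 < H) (hw : Continuous w) (ht : 0 < t) (hη : 0 < η) (hl : 0 < l)
    (h1 : (1 + η) * l ≤ L) (h2 : L ≤ (1 + η) * ((1 + η) * l)) :
    c * occ w t (Ico x (x + l)) ≤ ENNReal.ofReal ((1 + η) ^ (2 / H)) *
      (ENNReal.ofReal (l ^ (1 / H)) * ((Cr w x (x + l) 0 t).encard : ℝ≥0∞)) +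
      (ENNReal.ofReal (η * l / 2))⁻¹ * ∫⁻ b in Jset η l x, dd (Ak H w t L b) (Mk c w t L b) := by
  have hL : 0 < L := lt_of_lt_of_le (by positivity) h1
  refine avg_interval measurableSet_Icc (by positivity) (vol_J η l x)
    (measurable_dd (Ak_measurable H hw ht L) (Mk_measurable c hw t L)) ?_
  intro b hb
  have hηl : 0 < η * l := by positivity
  have hb1 : b - L / 2 ≤ x := by linarith [hb.2]
  have hb2 : x + l ≤ b + L / 2 := by linarith [hb.1]
  calc c * occ w t (Ico x (x + l)) ≤ Mk c w t L b := by
        unfold Mk; gcongr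
    _ ≤ Ak H w t L b + dd (Ak H w t L b) (Mk c w t L b) := le_add_dd' _ _
    _ ≤ _ := by
      gcongr
      unfold Ak
      rw [← mul_assoc, ← ENNReal.ofReal_mul (by positivity)]
      have hp : L ^ (1 / H) ≤ (1 + η) ^ (2 / H) * l ^ (1 / H) := by
        calc L ^ (1 / H) ≤ ((1 + η) * ((1 + η) * l)) ^ (1 / H) := by gcongr
          _ = (1 + η) ^ (2 / H) * l ^ (1 / H) := by
            rw [← mul_assoc, Real.mul_rpow (by positivity) hl.le, ← sq, ← Real.rpow_natCast,
              ← Real.rpow_mul (by positivity)]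
            congr 2; push_cast; ring
      refine mul_le_mul' (ENNReal.ofReal_le_ofReal hp) ?_
      exact (alt_anti hb1 hb2).trans (alt_le_encard hw (by linarith))

lemma upper_int (hH : 0 < H) (hw : Continuous w) (ht : 0 < t) (hη : 0 < η) (hη' : η < 1 / 4)
    (hl : 0 < l) (h1 : (1 - 2 * η) * l ≤ L) (h2 : L ≤ (1 - η) * l) :
    ENNReal.ofReal ((1 - 2 * η) ^ (1 / H)) *
      (ENNReal.ofReal (l ^ (1 / H)) * ((Cr w x (x + l) 0 t).encard : ℝ≥0∞)) ≤
      c * occ w t (Ico x (x + l)) +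
      (ENNReal.ofReal (η * l / 2))⁻¹ * ∫⁻ b in Jset η l x, dd (Ak H w t L b) (Mk c w t L b) := by
  have h12 : 0 < 1 - 2 * η := by linarith
  have hL : 0 < L := lt_of_lt_of_le (by positivity) h1
  refine avg_interval measurableSet_Icc (by positivity) (vol_J η l x)
    (measurable_dd (Ak_measurable H hw ht L) (Mk_measurable c hw t L)) ?_
  intro b hb
  have hηl : 0 < η * l := by positivity
  have hb1 : x < b - L / 2 := by linarith [hb.1]
  have hb2 : b + L / 2 < x + l := by linarith [hb.2]
  refine le_trans ?_ ((le_add_dd (Ak H w t L b) (Mk c w t L b)).trans ?_)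
  · unfold Ak
    rw [← mul_assoc, ← ENNReal.ofReal_mul (by positivity), ← Real.mul_rpow h12.le hl.le]
    gcongr
    exact encard_le_alt hb1 (by linarith) hb2
  · gcongr
    unfold Mk; gcongr

end intervals

lemma assembly_core {H : ℝ} {w : ℝ → ℝ} {t : ℝ} {c : ℝ≥0∞} {L : ℕ → ℝ} (hH : 0 < H)
    (hw : Continuous w) (ht : 0 < t) (hL0 : Tendsto L atTop (𝓝 0))
    (hL1 : ∀ θ : ℝ, 1 < θ → ∀ᶠ k in atTop, L k ≤ θ * L (k + 1)) (hLpos : ∀ k, 0 < L k)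
    (hE : ∀ M : ℕ, ∑' k, (ENNReal.ofReal (L k))⁻¹ * ∫⁻ b in Icc (-(M : ℝ)) M,
      dd (Ak H w t (L k) b) (Mk c w t (L k) b) ≠ ⊤)
    {η : ℝ} (hη : 0 < η) (hη' : η < 1 / 4) {e : ℝ≥0∞} (he : e ≠ 0) :
    ∃ ε₀ : ℝ, 0 < ε₀ ∧ ∀ Q : RPartition, Q.mesh ≤ ENNReal.ofReal ε₀ →
      c * ENNReal.ofReal t ≤ ENNReal.ofReal ((1 + η) ^ (2 / H)) * VE H Q w t + e ∧
      ENNReal.ofReal ((1 - 2 * η) ^ (1 / H)) * VE H Q w t ≤ c * ENNReal.ofReal t + e := by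
  obtain ⟨M0, hM0⟩ : ∃ M0 : ℝ, ∀ r ∈ Icc 0 t, |w r| ≤ M0 := by
    obtain ⟨M0, h⟩ := (isCompact_Icc (a := (0:ℝ)) (b := t)).exists_bound_of_continuousOn hw.continuousOn
    exact ⟨M0, fun r hr => by simpa using h r hr⟩
  obtain ⟨M, hM⟩ := exists_nat_ge (M0 + 1)
  set D : ℕ → ℝ → ℝ≥0∞ := fun k b => dd (Ak H w t (L k) b) (Mk c w t (L k) b) with hD
  have hDm : ∀ k, Measurable (D k) := fun k =>
    measurable_dd (Ak_measurable H hw ht (L k)) (Mk_measurable c hw t (L k))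
  set ν := (volume : Measure ℝ).restrict (Icc (-(M : ℝ)) M) with hν
  set C : ℝ≥0∞ := ENNReal.ofReal (2 / η * (1 + η) ^ 2) with hC
  have hlim := ENNReal.tendsto_sum_nat_add _ (hE M)
  have hlim2 : Tendsto (fun i => C * ∑' k, (ENNReal.ofReal (L (k + i)))⁻¹ * ∫⁻ b, D (k + i) b ∂ν)
      atTop (𝓝 0) := by
    have := ENNReal.Tendsto.const_mul hlim (Or.inr (ENNReal.ofReal_ne_top : C ≠ ⊤))
    simpa using this
  obtain ⟨k₀, hk₀⟩ := (hlim2.eventually (gt_mem_nhds (pos_iff_ne_zero.2 he))).exists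
  set S : ℝ → ℝ≥0∞ := fun b => ∑' k, (ENNReal.ofReal (L (k + k₀)))⁻¹ * D (k + k₀) b with hS
  have hSint : C * ∫⁻ b, S b ∂ν < e := by
    rw [hS, lintegral_tsum (fun k => ((hDm _).const_mul _).aemeasurable)]
    simp_rw [lintegral_const_mul _ (hDm _)]
    exact hk₀
  -- per interval error
  have herr : ∀ k l x, k₀ ≤ k → 0 < l → L k ≤ (1 + η) * ((1 + η) * l) →
      Jset η l x ⊆ Icc (-(M : ℝ)) M →
      (ENNReal.ofReal (η * l / 2))⁻¹ * ∫⁻ b in Jset η l x, D k b ≤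
        C * ∫⁻ b in Ico x (x + l), S b ∂ν := by
    intro k l x hk hl hLl hJ
    have hηl : 0 < η * l := by positivity
    have e1 : ∫⁻ b in Jset η l x, D k b = ∫⁻ b in Jset η l x, D k b ∂ν := by
      rw [hν, Measure.restrict_restrict_of_subset hJ]
    have hJs : Jset η l x ⊆ Ico x (x + l) := by
      intro b hb
      constructor
      · have := hb.1; nlinarith
      · have := hb.2; nlinarith
    have e2 : ∀ b, D k b ≤ ENNReal.ofReal (L k) * S b := by
      intro b
      have : (ENNReal.ofReal (L k))⁻¹ * D k b ≤ S b := by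
        obtain ⟨j, rfl⟩ := Nat.exists_eq_add_of_le' hk
        exact ENNReal.le_tsum (f := fun k => (ENNReal.ofReal (L (k + k₀)))⁻¹ * D (k + k₀) b) j
      calc D k b = ENNReal.ofReal (L k) * ((ENNReal.ofReal (L k))⁻¹ * D k b) := by
            rw [← mul_assoc, ENNReal.mul_inv_cancel (by simpa using hLpos k) ENNReal.ofReal_ne_top,
              one_mul]
        _ ≤ _ := by gcongr
    rw [e1]
    calc (ENNReal.ofReal (η * l / 2))⁻¹ * ∫⁻ b in Jset η l x, D k b ∂ν
        ≤ (ENNReal.ofReal (η * l / 2))⁻¹ * ∫⁻ b in Ico x (x + l), ENNReal.ofReal (L k) * S b ∂ν := by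
          refine mul_le_mul_right ?_ _
          exact (lintegral_mono e2).trans (lintegral_mono_set hJs)
      _ = ENNReal.ofReal (L k / (η * l / 2)) * ∫⁻ b in Ico x (x + l), S b ∂ν := by
          rw [lintegral_const_mul' _ _ ENNReal.ofReal_ne_top, ← mul_assoc,
            ENNReal.ofReal_div_of_pos (show 0 < η * l / 2 by positivity),
            ENNReal.div_eq_inv_mul (a := ENNReal.ofReal (L k))]
      _ ≤ _ := by
          gcongr
          refine ENNReal.ofReal_le_ofReal ?_
          rw [div_le_iff₀ (by positivity)]
          calc L k ≤ _ := hLl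
            _ = _ := by field_simp
  obtain ⟨ε1, hε1, hL1'⟩ := exists_L hL0 hL1 (1 + η) (by linarith) k₀ hLpos
  obtain ⟨ε2, hε2, hL2'⟩ := exists_L hL0 hL1 ((1 - η) / (1 - 2 * η))
    (by rw [lt_div_iff₀ (by linarith)]; linarith) k₀ hLpos
  refine ⟨min 1 (min (ε1 / 2) ε2), by positivity, fun Q hQ => ?_⟩
  have hlen : ∀ n, Q.y (n + 1) - Q.y n ≤ min 1 (min (ε1 / 2) ε2) := by
    intro n
    have h1 : ENNReal.ofReal (Q.y (n + 1) - Q.y n) ≤ Q.mesh :=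
      le_iSup (fun n : ℤ => ENNReal.ofReal (Q.y (n + 1) - Q.y n)) n
    exact (ENNReal.ofReal_le_ofReal_iff (by positivity)).1 (h1.trans hQ)
  have hnear : ∀ n, (∃ r ∈ Icc 0 t, w r ∈ Icc (Q.y n) (Q.y (n + 1))) →
      Jset η (Q.y (n + 1) - Q.y n) (Q.y n) ⊆ Icc (-(M : ℝ)) M := by
    rintro n ⟨r, hr, hwr⟩ b hb
    have h1 := hM0 r hr
    have h2 := (hlen n).trans (min_le_left _ _)
    have h3 := Qlt Q n
    rw [abs_le] at h1
    have h4 := hb.1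
    have h5 := hb.2
    have h6 : η * (Q.y (n + 1) - Q.y n) ≤ 1 * (Q.y (n + 1) - Q.y n) := by
      gcongr; linarith
    constructor <;> linarith [hwr.1, hwr.2]
  have hsumS : ∑' n : ℤ, C * ∫⁻ b in Ico (Q.y n) (Q.y (n + 1)), S b ∂ν ≤ e := by
    rw [ENNReal.tsum_mul_left, ← lintegral_iUnion (fun _ => measurableSet_Ico) (Q_disj Q),
      Q_iUnion, setLIntegral_univ]
    exact hSint.le
  constructor
  · have key : ∀ n : ℤ, c * occ w t (Ico (Q.y n) (Q.y (n + 1))) ≤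
        ENNReal.ofReal ((1 + η) ^ (2 / H)) * (ENNReal.ofReal ((Q.y (n + 1) - Q.y n) ^ (1 / H)) *
        ((Cr w (Q.y n) (Q.y (n + 1)) 0 t).encard : ℝ≥0∞)) +
        C * ∫⁻ b in Ico (Q.y n) (Q.y (n + 1)), S b ∂ν := by
      intro n
      by_cases hmeet : ∃ r ∈ Icc 0 t, w r ∈ Icc (Q.y n) (Q.y (n + 1))
      · have hJ := hnear n hmeet
        set l := Q.y (n + 1) - Q.y n with hl
        have hl0 : 0 < l := sub_pos.2 (Qlt Q n)
        have hle : (1 + η) * l ≤ ε1 := by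
          have := (hlen n).trans ((min_le_right _ _).trans (min_le_left _ _))
          nlinarith
        obtain ⟨k, hk, h1, h2⟩ := hL1' ((1 + η) * l) (by positivity) hle
        have e0 : Q.y (n + 1) = Q.y n + l := by rw [hl]; ring
        rw [e0]
        refine (lower_int hH hw ht hη hl0 h1 h2).trans ?_
        refine add_le_add_right ?_ _
        exact herr k l _ hk hl0 h2 hJ
      · have : occ w t (Ico (Q.y n) (Q.y (n + 1))) = 0 := by
          rw [occ, Measure.map_apply hw.measurable measurableSet_Ico,
            Measure.restrict_apply (hw.measurable measurableSet_Ico)]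
          convert measure_empty (μ := (volume : Measure ℝ))
          ext r
          simp only [mem_inter_iff, mem_preimage, mem_empty_iff_false, iff_false]
          rintro ⟨h1, h2⟩
          exact hmeet ⟨r, h2, h1.1, h1.2.le⟩
        rw [this, mul_zero]; exact zero_le
    have := ENNReal.tsum_le_tsum key
    rw [ENNReal.tsum_mul_left, occ_sum hw, ENNReal.tsum_add, ENNReal.tsum_mul_left] at this
    exact this.trans (add_le_add_right hsumS _)
  · have key : ∀ n : ℤ, ENNReal.ofReal ((1 - 2 * η) ^ (1 / H)) *
        (ENNReal.ofReal ((Q.y (n + 1) - Q.y n) ^ (1 / H)) *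
        ((Cr w (Q.y n) (Q.y (n + 1)) 0 t).encard : ℝ≥0∞)) ≤
        c * occ w t (Ico (Q.y n) (Q.y (n + 1))) +
        C * ∫⁻ b in Ico (Q.y n) (Q.y (n + 1)), S b ∂ν := by
      intro n
      by_cases hmeet : ∃ r ∈ Icc 0 t, w r ∈ Icc (Q.y n) (Q.y (n + 1))
      · have hJ := hnear n hmeet
        set l := Q.y (n + 1) - Q.y n with hl
        have hl0 : 0 < l := sub_pos.2 (Qlt Q n)
        have hle : (1 - 2 * η) * l ≤ ε2 := by
          have := (hlen n).trans ((min_le_right _ _).trans (min_le_right _ _))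
          nlinarith
        obtain ⟨k, hk, h1, h2⟩ := hL2' ((1 - 2 * η) * l) (by
          have : 0 < 1 - 2 * η := by linarith
          positivity) hle
        have h2' : L k ≤ (1 - η) * l := by
          rw [← mul_assoc, div_mul_cancel₀ _ (by linarith : (1 - 2 * η) ≠ 0)] at h2
          exact h2
        have e0 : Q.y (n + 1) = Q.y n + l := by rw [hl]; ring
        rw [e0]
        refine (upper_int (c := c) hH hw ht hη hη' hl0 h1 h2').trans ?_
        refine add_le_add_right ?_ _
        refine herr k l _ hk hl0 (h2'.trans ?_) hJ
        nlinarith [mul_pos hη hl0, mul_pos hη (mul_pos hη hl0)]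
      · have : Cr w (Q.y n) (Q.y (n + 1)) 0 t = ∅ := by
          rw [Set.eq_empty_iff_forall_notMem]
          rintro p hp
          refine hmeet ⟨p.1, hp.1, ?_⟩
          have := Qlt Q n
          rcases hp.2.2.2.1 with h | h
          · rw [h.1]; exact ⟨le_rfl, this.le⟩
          · rw [h.1]; exact ⟨this.le, le_rfl⟩
        rw [this]; simp
    have := ENNReal.tsum_le_tsum key
    rw [ENNReal.tsum_mul_left, ENNReal.tsum_add, ENNReal.tsum_mul_left, occ_sum hw] at this
    exact this.trans (add_le_add_right hsumS _)

lemma assembly {H : ℝ} {w : ℝ → ℝ} {t : ℝ} {c : ℝ≥0∞} {L : ℕ → ℝ} (hH : 0 < H)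
    (hw : Continuous w) (ht : 0 < t) (hc : c ≠ ⊤) (hL0 : Tendsto L atTop (𝓝 0))
    (hL1 : ∀ θ : ℝ, 1 < θ → ∀ᶠ k in atTop, L k ≤ θ * L (k + 1)) (hLpos : ∀ k, 0 < L k)
    (hE : ∀ M : ℕ, ∑' k, (ENNReal.ofReal (L k))⁻¹ * ∫⁻ b in Icc (-(M : ℝ)) M,
      dd (Ak H w t (L k) b) (Mk c w t (L k) b) ≠ ⊤)
    {δ : ℝ} (hδ : 0 < δ) :
    ∃ ε₀ : ℝ, 0 < ε₀ ∧ ∀ Q : RPartition, Q.mesh ≤ ENNReal.ofReal ε₀ →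
      VE H Q w t ≠ ⊤ ∧ |(VE H Q w t).toReal - c.toReal * t| < δ := by
  set c' := c.toReal with hc'
  have hc'0 : 0 ≤ c' := ENNReal.toReal_nonneg
  have hct : 0 ≤ c' * t := by positivity
  have hcc : c = ENNReal.ofReal c' := (ENNReal.ofReal_toReal hc).symm
  set κ := min 1 (δ / (8 * (c' * t + 1))) with hκ
  have hκ0 : 0 < κ := by positivity
  have hκ1 : κ ≤ 1 := min_le_left _ _
  have hκ2 : κ * (c' * t + 1) ≤ δ / 8 := by
    have : κ ≤ δ / (8 * (c' * t + 1)) := min_le_right _ _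
    calc κ * (c' * t + 1) ≤ δ / (8 * (c' * t + 1)) * (c' * t + 1) := by gcongr
      _ = δ / 8 := by field_simp
  set e := min 1 (δ / 4) with he
  have he0 : 0 < e := by positivity
  have he1 : e ≤ 1 := min_le_left _ _
  have he2 : e ≤ δ / 4 := min_le_right _ _
  obtain ⟨η, hη, hη', hα, hβ⟩ : ∃ η : ℝ, 0 < η ∧ η < 1 / 4 ∧ (1 + η) ^ (2 / H) ≤ 1 + κ ∧
      1 ≤ (1 + κ) * (1 - 2 * η) ^ (1 / H) := by
    have t1 : Tendsto (fun η : ℝ => (1 + η) ^ (2 / H)) (𝓝 0) (𝓝 ((1 + 0) ^ (2 / H))) :=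
      ((continuous_const.add continuous_id).tendsto 0).rpow_const (Or.inl (by simp))
    have t2 : Tendsto (fun η : ℝ => (1 + κ) * (1 - 2 * η) ^ (1 / H)) (𝓝 0)
        (𝓝 ((1 + κ) * (1 - 2 * 0) ^ (1 / H))) :=
      (((continuous_const.sub (continuous_const.mul continuous_id)).tendsto 0).rpow_const
        (Or.inl (by simp))).const_mul _
    have ev1 := t1.eventually (gt_mem_nhds (show (1 + 0 : ℝ) ^ (2 / H) < 1 + κ by simpa using hκ0))
    have ev2 := t2.eventually (lt_mem_nhds (show 1 < (1 + κ) * (1 - 2 * 0 : ℝ) ^ (1 / H) by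
      simpa using hκ0))
    have ev3 : ∀ᶠ η : ℝ in 𝓝 0, η < 1 / 4 := gt_mem_nhds (by norm_num)
    have ev : ∀ᶠ η : ℝ in 𝓝[>] 0, (0 < η ∧ η < 1 / 4 ∧ (1 + η) ^ (2 / H) ≤ 1 + κ ∧
      1 ≤ (1 + κ) * (1 - 2 * η) ^ (1 / H)) := by
      filter_upwards [nhdsWithin_le_nhds ev1, nhdsWithin_le_nhds ev2, nhdsWithin_le_nhds ev3,
        self_mem_nhdsWithin] with η h1 h2 h3 h4
      exact ⟨h4, h3, h1.le, h2.le⟩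
    exact ev.exists
  obtain ⟨ε₀, hε₀, hmain⟩ := assembly_core hH hw ht hL0 hL1 hLpos hE hη hη'
    (e := ENNReal.ofReal e) (by simpa using he0)
  refine ⟨ε₀, hε₀, fun Q hQ => ?_⟩
  obtain ⟨h1, h2⟩ := hmain Q hQ
  set β := (1 - 2 * η) ^ (1 / H) with hβd
  have hβ0 : 0 < β := by
    have : 0 < 1 - 2 * η := by linarith
    positivity
  have hrhs : c * ENNReal.ofReal t + ENNReal.ofReal e = ENNReal.ofReal (c' * t + e) := by
    rw [hcc, ← ENNReal.ofReal_mul hc'0, ← ENNReal.ofReal_add hct he0.le]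
  rw [hrhs] at h2
  have hfin : VE H Q w t ≠ ⊤ := by
    intro htop
    rw [htop, ENNReal.mul_top (by simpa using hβ0)] at h2
    exact ENNReal.ofReal_ne_top (top_le_iff.1 h2)
  refine ⟨hfin, ?_⟩
  obtain ⟨V, hV0, hV⟩ : ∃ V : ℝ, 0 ≤ V ∧ VE H Q w t = ENNReal.ofReal V :=
    ⟨_, ENNReal.toReal_nonneg, (ENNReal.ofReal_toReal hfin).symm⟩
  rw [hV, ENNReal.toReal_ofReal hV0]
  rw [hV, ← ENNReal.ofReal_mul hβ0.le, ENNReal.ofReal_le_ofReal_iff (by positivity)] at h2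
  rw [hV, hcc, ← ENNReal.ofReal_mul hc'0, ← ENNReal.ofReal_mul (by positivity),
    ← ENNReal.ofReal_add (by positivity) he0.le, ENNReal.ofReal_le_ofReal_iff (by positivity)] at h1
  have h3 : V ≤ (1 + κ) * (c' * t + e) := by
    calc V ≤ ((1 + κ) * β) * V := by nlinarith
      _ = (1 + κ) * (β * V) := by ring
      _ ≤ _ := by gcongr
  have h4 : c' * t ≤ (1 + κ) * V + e := h1.trans (by gcongr)
  have h5 : V ≤ 2 * (c' * t + 1) := by nlinarith
  rw [abs_lt]
  constructor
  · nlinarith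
  · nlinarith

lemma polya {H : ℝ} {w : ℝ → ℝ} {c T : ℝ} (hw : Continuous w) (hc : 0 ≤ c) (hT : 0 < T)
    (h : ∀ j J : ℕ, 0 < j → 0 < J → ∀ δ : ℝ, 0 < δ → ∃ ε₀ : ℝ, 0 < ε₀ ∧ ∀ Q : RPartition,
      Q.mesh ≤ ENNReal.ofReal ε₀ →
      VE H Q w (T * j / J) ≠ ⊤ ∧ |(VE H Q w (T * j / J)).toReal - c * (T * j / J)| < δ)
    {δ : ℝ} (hδ : 0 < δ) :
    ∃ ε₀ : ℝ, 0 < ε₀ ∧ ∀ Q : RPartition, Q.mesh ≤ ENNReal.ofReal ε₀ → ∀ t ∈ Icc (0 : ℝ) T,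
      |Vvar H Q w 0 t - c * t| < δ := by
  obtain ⟨J, hJ⟩ := exists_nat_gt (2 * c * T / δ)
  have hJ0 : 0 < J := by
    have : (0 : ℝ) < J := lt_of_le_of_lt (by positivity) hJ
    exact_mod_cast this
  have hJR : (0 : ℝ) < J := by exact_mod_cast hJ0
  have hstep : c * (T / J) < δ / 2 := by
    rw [div_lt_iff₀ hδ] at hJ
    rw [← mul_div_assoc, div_lt_iff₀ hJR]
    linarith
  choose ε hε hmain using fun j : ℕ => h (j + 1) J (by omega) hJ0 (δ / 2) (by positivity)
  have hne : (Finset.range (J + 1)).Nonempty := ⟨0, by simp⟩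
  refine ⟨(Finset.range (J + 1)).inf' hne ε, ?_, ?_⟩
  · exact (Finset.lt_inf'_iff hne).2 fun j _ => hε j
  intro Q hQ t ht
  have hall : ∀ j ∈ Finset.range (J + 1), Q.mesh ≤ ENNReal.ofReal (ε j) := fun j hj =>
    hQ.trans (ENNReal.ofReal_le_ofReal (Finset.inf'_le _ hj))
  rw [Vvar_eq H Q hw]
  set j := ⌊t * J / T⌋₊ with hj
  have hx0 : 0 ≤ t * J / T := by have := ht.1; positivity
  have hj1 : (j : ℝ) ≤ t * J / T := Nat.floor_le hx0
  have hj2 : t * J / T < j + 1 := Nat.lt_floor_add_one _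
  have hjJ : j ≤ J := by
    apply Nat.floor_le_of_le
    rw [div_le_iff₀ hT]
    nlinarith [ht.2]
  have hl1 : T * j / J ≤ t := by
    rw [div_le_iff₀ hJR]
    rw [le_div_iff₀ hT] at hj1
    linarith
  have hl2 : t ≤ T * (j + 1 : ℕ) / J := by
    rw [le_div_iff₀ hJR]
    rw [div_lt_iff₀ hT] at hj2
    push_cast; linarith
  obtain ⟨f1, f2⟩ := hmain j Q (hall j (by simp; omega))
  have hup : (VE H Q w t).toReal ≤ (VE H Q w (T * (j + 1 : ℕ) / J)).toReal :=
    ENNReal.toReal_mono f1 (VE_mono H Q w hl2)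
  have hfin : VE H Q w t ≠ ⊤ := ne_top_of_le_ne_top f1 (VE_mono H Q w hl2)
  have e1 : T * ((j + 1 : ℕ) : ℝ) / J = T * j / J + T / J := by push_cast; ring
  rw [abs_lt] at f2 ⊢
  have hc1 : c * (T * j / J) ≤ c * t := by gcongr
  have hc2 : c * t ≤ c * (T * (j + 1 : ℕ) / J) := by gcongr
  have hce : c * (T * (j + 1 : ℕ) / J) = c * (T * j / J) + c * (T / J) := by rw [e1, mul_add]
  have hlow : c * (T * j / J) - δ / 2 < (VE H Q w t).toReal := by
    rcases Nat.eq_zero_or_pos j with h0 | h0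
    · rw [h0]; simp only [Nat.cast_zero, mul_zero, zero_div]
      have := ENNReal.toReal_nonneg (a := VE H Q w t)
      linarith
    · obtain ⟨i, hi⟩ : ∃ i, j = i + 1 := ⟨j - 1, by omega⟩
      obtain ⟨g1, g2⟩ := hmain i Q (hall i (by simp; omega))
      rw [← hi, abs_lt] at g2
      have := ENNReal.toReal_mono hfin (VE_mono H Q w hl1)
      linarith [g2.1]
  constructor
  · linarith
  · linarith [f2.2, hup, hce, hc1, hstep]

end LC
end

section
namespace LC

/-! ### Gaussian tools -/

section gauss
variable {κ : Type*} [Fintype κ]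

lemma continuous_chr (u : κ → ℝ) :
    Continuous fun x : κ → ℝ => Complex.exp (((∑ k, u k * x k : ℝ) : ℂ) * Complex.I) := by
  fun_prop

/-- `μ` has characteristic function `exp (-q/2)`. -/
def IsG (μ : Measure (κ → ℝ)) (q : (κ → ℝ) → ℝ) : Prop :=
  ∀ u : κ → ℝ, ∫ x, Complex.exp (((∑ k, u k * x k : ℝ) : ℂ) * Complex.I) ∂μ
    = Complex.exp (((-(q u) / 2 : ℝ) : ℂ))

lemma ext_char {μ ν : Measure (κ → ℝ)} [IsFiniteMeasure μ] [IsFiniteMeasure ν]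
    (h : ∀ u : κ → ℝ, ∫ x, Complex.exp (((∑ k, u k * x k : ℝ) : ℂ) * Complex.I) ∂μ
      = ∫ x, Complex.exp (((∑ k, u k * x k : ℝ) : ℂ) * Complex.I) ∂ν) : μ = ν := by
  refine Measure.ext_of_charFunDual (funext fun L => ?_)
  rw [charFunDual_apply, charFunDual_apply]
  have hL : ∀ x : κ → ℝ, L x = ∑ k, L (Pi.single k 1) * x k := by
    intro x
    conv_lhs => rw [← Finset.univ_sum_single x]
    rw [map_sum]
    refine Finset.sum_congr rfl fun k _ => ?_
    have : Pi.single k (x k) = x k • (Pi.single k (1 : ℝ) : κ → ℝ) := by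
      rw [← Pi.single_smul]; simp
    rw [this, map_smul, smul_eq_mul, mul_comm]
  have h' := h (fun k => L (Pi.single k 1))
  simp_rw [← hL] at h'
  exact h'

lemma IsG.unique {μ ν : Measure (κ → ℝ)} [IsFiniteMeasure μ] [IsFiniteMeasure ν] {q}
    (h : IsG μ q) (h' : IsG ν q) : μ = ν := ext_char fun u => (h u).trans (h' u).symm

lemma quad_nonneg {S : κ → κ → ℝ} (hsym : ∀ i j, S i j = S j i)
    (hoff : ∀ i j, i ≠ j → S i j ≤ 0) (hrow : ∀ i, 0 ≤ ∑ j, S i j) (u : κ → ℝ) :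
    0 ≤ ∑ i, ∑ j, S i j * u i * u j := by
  have e : ∑ i, ∑ j, S i j * u i * u j =
      ∑ i, ∑ j, (-(1 / 2) * S i j * (u i - u j) ^ 2) + ∑ i, (∑ j, S i j) * u i ^ 2 := by
    have h1 : ∑ i, ∑ j, S i j * u j ^ 2 = ∑ i, ∑ j, S i j * u i ^ 2 := by
      rw [Finset.sum_comm]
      refine Finset.sum_congr rfl fun i _ => Finset.sum_congr rfl fun j _ => ?_
      rw [hsym]
    simp_rw [Finset.sum_mul]
    have h2 : ∑ i, ∑ j, (-(1 / 2) * S i j * (u i - u j) ^ 2) =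
        ∑ i, ∑ j, S i j * u i * u j - (1 / 2) * ∑ i, ∑ j, S i j * u i ^ 2
          - (1 / 2) * ∑ i, ∑ j, S i j * u j ^ 2 := by
      simp_rw [Finset.mul_sum, ← Finset.sum_sub_distrib]
      refine Finset.sum_congr rfl fun i _ => Finset.sum_congr rfl fun j _ => ?_
      ring
    rw [h2, h1]; ring
  rw [e]
  refine add_nonneg (Finset.sum_nonneg fun i _ => Finset.sum_nonneg fun j _ => ?_)
    (Finset.sum_nonneg fun i _ => mul_nonneg (hrow i) (sq_nonneg _))
  by_cases hij : i = j
  · subst hij; simp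
  · have := hoff i j hij
    have h3 := sq_nonneg (u i - u j)
    nlinarith

lemma exists_IsG {S : κ → κ → ℝ} (hsym : ∀ i j, S i j = S j i)
    (hoff : ∀ i j, i ≠ j → S i j ≤ 0) (hrow : ∀ i, 0 ≤ ∑ j, S i j) :
    ∃ μ : Measure (κ → ℝ), IsProbabilityMeasure μ ∧ IsG μ (fun u => ∑ i, ∑ j, S i j * u i * u j) := by
  have hq : ∀ u : κ → ℝ, u ⬝ᵥ (Matrix.of S).mulVec u = ∑ i, ∑ j, S i j * u i * u j := by
    intro u
    simp only [dotProduct, Matrix.mulVec, Matrix.of_apply, Finset.mul_sum]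
    refine Finset.sum_congr rfl fun i _ => Finset.sum_congr rfl fun j _ => ?_
    ring
  have hS : (Matrix.of S).PosSemidef := by
    refine Matrix.PosSemidef.of_dotProduct_mulVec_nonneg ?_ ?_
    · ext i j; simp [hsym]
    · intro u
      rw [star_trivial, hq]
      exact quad_nonneg hsym hoff hrow u
  refine ⟨(multivariateGaussian 0 (Matrix.of S)).map (WithLp.ofLp), ?_, ?_⟩
  · exact Measure.isProbabilityMeasure_map (by fun_prop)
  · intro u
    rw [integral_map (by fun_prop) (continuous_chr u).aestronglyMeasurable]
    have := charFun_multivariateGaussian (μ := 0) hS (WithLp.toLp 2 u)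
    rw [charFun_apply] at this
    have e1 : ∀ x : EuclideanSpace ℝ κ, inner ℝ x (WithLp.toLp 2 u) = ∑ k, u k * x k := by
      intro x; rw [PiLp.inner_apply]; simp
    simp_rw [e1] at this
    rw [this]
    simp only [inner_zero_right]
    congr 1
    rw [← hq]
    simp
    ring

lemma IsG.add {κ' : Type*} [Fintype κ'] {μ : Measure (κ → ℝ)} {ν : Measure (κ' → ℝ)}
    [IsProbabilityMeasure μ] [IsProbabilityMeasure ν] {q q'} (hμ : IsG μ q) (hν : IsG ν q')
    (f : (κ' → ℝ) → (κ → ℝ)) (hf : Measurable f) (g : (κ → ℝ) → (κ' → ℝ))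
    (hfg : ∀ u x, ∑ k, u k * f x k = ∑ k, g u k * x k) :
    IsG ((μ.prod ν).map fun p => p.1 + f p.2) (fun u => q u + q' (g u)) := by
  intro u
  rw [integral_map (by fun_prop) (continuous_chr u).aestronglyMeasurable]
  have e : ∀ p : (κ → ℝ) × (κ' → ℝ),
      Complex.exp (((∑ k, u k * (p.1 + f p.2) k : ℝ) : ℂ) * Complex.I) =
      Complex.exp (((∑ k, u k * p.1 k : ℝ) : ℂ) * Complex.I) *
      Complex.exp (((∑ k, g u k * p.2 k : ℝ) : ℂ) * Complex.I) := by
    intro p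
    rw [← Complex.exp_add, ← add_mul, ← Complex.ofReal_add]
    congr 4
    rw [← hfg, ← Finset.sum_add_distrib]
    refine Finset.sum_congr rfl fun k _ => ?_
    simp only [Pi.add_apply]; ring
  simp_rw [e]
  rw [integral_prod_mul (fun x : κ → ℝ => Complex.exp (((∑ k, u k * x k : ℝ) : ℂ) * Complex.I))
    (fun x : κ' → ℝ => Complex.exp (((∑ k, g u k * x k : ℝ) : ℂ) * Complex.I)), hμ u, hν (g u),
    ← Complex.exp_add, ← Complex.ofReal_add]
  congr 2; ring

lemma isG_gaussianReal (v : ℝ≥0) :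
    IsG ((gaussianReal 0 v).map fun x => fun _ : Unit => x) (fun u => v * u () ^ 2) := by
  intro u
  rw [integral_map (by fun_prop) (continuous_chr u).aestronglyMeasurable]
  have := charFun_gaussianReal (μ := 0) (v := v) (u ())
  rw [charFun_apply_real] at this
  simp only [Finset.univ_unique, Finset.sum_singleton] at *
  convert this using 2
  · push_cast; simp
  · push_cast; ring_nf

lemma pdf_lip {v : ℝ≥0} (hv : v ≠ 0) (x y : ℝ) :
    gaussianPDFReal 0 v x ≤ gaussianPDFReal 0 v y + |x - y| / v := by
  have hv' : (0 : ℝ) < v := by positivity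
  have hd : ∀ x, HasDerivAt (gaussianPDFReal 0 v)
      ((√(2 * Real.pi * v))⁻¹ * (Real.exp (-(x - 0) ^ 2 / (2 * v)) * (-(x / v)))) x := by
    intro x
    unfold gaussianPDFReal
    refine HasDerivAt.const_mul _ (HasDerivAt.exp ?_)
    have h1 : HasDerivAt (fun x : ℝ => -(x - 0) ^ 2 / (2 * (v : ℝ))) (-(2 * x) / (2 * v)) x := by
      have := (((hasDerivAt_id x).sub_const 0).pow 2).neg.div_const (2 * (v : ℝ))
      simpa using this
    convert h1 using 1
    field_simp
  have hb : ∀ x ∈ (univ : Set ℝ), ‖(√(2 * Real.pi * v))⁻¹ *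
      (Real.exp (-(x - 0) ^ 2 / (2 * v)) * (-(x / v)))‖ ≤ 1 / v := by
    intro x _
    rw [norm_mul, norm_mul, norm_neg, Real.norm_eq_abs, Real.norm_eq_abs, Real.norm_eq_abs, abs_div,
      abs_of_pos hv', Real.abs_exp, abs_of_pos (by positivity), sub_zero]
    have h1 : Real.exp (-x ^ 2 / (2 * v)) * |x| ≤ √v := by
      have h2 : |x| / √v ≤ Real.exp (x ^ 2 / (2 * v)) := by
        have h3 := Real.add_one_le_exp (x ^ 2 / (2 * v))
        have h4 : (|x| / √v) ^ 2 = x ^ 2 / v := by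
          rw [div_pow, sq_abs, Real.sq_sqrt hv'.le]
        have h5 : x ^ 2 / (2 * v) = (|x| / √v) ^ 2 / 2 := by rw [h4]; field_simp
        nlinarith [sq_nonneg (|x| / √v - 1)]
      rw [neg_div, Real.exp_neg, inv_mul_le_iff₀ (Real.exp_pos _)]
      rw [div_le_iff₀ (by positivity)] at h2
      linarith
    have h6 : √v ≤ √(2 * Real.pi * v) := by
      apply Real.sqrt_le_sqrt
      nlinarith [Real.pi_gt_three]
    have h7 : 0 < √(v : ℝ) := by positivity
    calc (√(2 * Real.pi * v))⁻¹ * (Real.exp (-x ^ 2 / (2 * v)) * (|x| / v))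
        = (√(2 * Real.pi * v))⁻¹ * (Real.exp (-x ^ 2 / (2 * v)) * |x|) * (1 / v) := by ring
      _ ≤ (√v)⁻¹ * √v * (1 / v) := by gcongr
      _ = 1 / v := by rw [inv_mul_cancel₀ h7.ne', one_mul]
  have := convex_univ.norm_image_sub_le_of_norm_hasDerivWithin_le
    (fun x _ => (hd x).hasDerivWithinAt) hb (mem_univ y) (mem_univ x)
  rw [Real.norm_eq_abs, Real.norm_eq_abs] at this
  have h2 := (abs_le.1 this).2
  have : 1 / (v : ℝ) * |x - y| = |x - y| / v := by ring
  linarith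

lemma smooth1 {v : ℝ≥0} (hv : v ≠ 0) {G : ℝ → ℝ≥0∞} (hG : Measurable G) (z : ℝ) :
    ∫⁻ x, G x ∂(gaussianReal 0 v) ≤
      ∫⁻ x, G (x + z) ∂(gaussianReal 0 v) + ENNReal.ofReal (|z| / v) * ∫⁻ x, G x := by
  rw [gaussianReal_of_var_ne_zero 0 hv,
    lintegral_withDensity_eq_lintegral_mul _ (measurable_gaussianPDF 0 v) hG,
    lintegral_withDensity_eq_lintegral_mul _ (measurable_gaussianPDF 0 v) (by fun_prop)]
  have e : ∫⁻ x, (gaussianPDF 0 v * fun x => G (x + z)) x = ∫⁻ x, gaussianPDF 0 v (x - z) * G x := by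
    rw [← lintegral_add_right_eq_self (fun x => gaussianPDF 0 v (x - z) * G x) z]
    simp
  rw [e, ← lintegral_const_mul _ hG, ← lintegral_add_left (by
    have := measurable_gaussianPDF 0 v
    fun_prop)]
  refine lintegral_mono fun x => ?_
  rw [← add_mul]
  simp only [Pi.mul_apply]
  gcongr
  rw [gaussianPDF, gaussianPDF, ← ENNReal.ofReal_add (gaussianPDFReal_nonneg _ _ _) (by positivity)]
  refine ENNReal.ofReal_le_ofReal ((pdf_lip hv x (x - z)).trans ?_)
  simp

/-- smoothing in the coordinate `m` -/
lemma lemmaB {μ R : Measure (κ → ℝ)} [IsProbabilityMeasure μ] [IsProbabilityMeasure R] {q q'}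
    (hμ : IsG μ q) (hR : IsG R q') (m : κ) {v : ℝ≥0} (hv : v ≠ 0)
    (hq : ∀ u, q u = q' u + v * u m ^ 2) {G : (κ → ℝ) → ℝ≥0∞} (hG : Measurable G) (z : ℝ) :
    ∫⁻ x, G x ∂μ ≤ ∫⁻ x, G (x + Pi.single m z) ∂μ +
      ENNReal.ofReal (|z| / v) * ∫⁻ x, (∫⁻ ζ : ℝ, G (x + Pi.single m ζ)) ∂μ := by
  have hsm : Measurable fun z : ℝ => (Pi.single m z : κ → ℝ) := by
    refine measurable_pi_iff.2 fun k => ?_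
    by_cases h : k = m
    · subst h; simpa using measurable_id'
    · simp [Pi.single_eq_of_ne h]
  have hlaw : μ = (R.prod (gaussianReal 0 v)).map fun p => p.1 + Pi.single m p.2 := by
    have hS : IsG ((R.prod ((gaussianReal 0 v).map fun x => fun _ : Unit => x)).map
        fun p => p.1 + Pi.single m (p.2 ())) q := by
      have : q = fun u => q' u + (fun w : Unit → ℝ => v * w () ^ 2) (fun _ => u m) := by
        funext u; exact hq u
      rw [this]
      have : IsProbabilityMeasure ((gaussianReal 0 v).map fun x => fun _ : Unit => x) :=
        Measure.isProbabilityMeasure_map (by fun_prop)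
      refine hR.add (isG_gaussianReal v) (fun x => Pi.single m (x ()))
        (hsm.comp (measurable_pi_apply _)) (fun u _ => u m) ?_
      intro u x
      simp [Pi.single_apply]
    have : IsProbabilityMeasure ((gaussianReal 0 v).map fun x => fun _ : Unit => x) :=
      Measure.isProbabilityMeasure_map (by fun_prop)
    have hm1 : Measurable fun p : (κ → ℝ) × (Unit → ℝ) => p.1 + Pi.single m (p.2 ()) :=
      measurable_fst.add (hsm.comp ((measurable_pi_apply _).comp measurable_snd))
    have := Measure.isProbabilityMeasure_map (μ := R.prod ((gaussianReal 0 v).map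
      fun x => fun _ : Unit => x)) hm1.aemeasurable
    rw [hμ.unique hS, ← Measure.map_id (μ := R), Measure.map_prod_map _ _ measurable_id (by fun_prop),
      Measure.map_map hm1 (by fun_prop), Measure.map_id]
    rfl
  have hm2 : Measurable fun p : (κ → ℝ) × ℝ => p.1 + Pi.single m p.2 :=
    measurable_fst.add (hsm.comp measurable_snd)
  have key : ∀ F : (κ → ℝ) → ℝ≥0∞, Measurable F → ∫⁻ x, F x ∂μ =
      ∫⁻ r, (∫⁻ ζ, F (r + Pi.single m ζ) ∂(gaussianReal 0 v)) ∂ R := by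
    intro F hF
    rw [hlaw, lintegral_map hF hm2]
    exact lintegral_prod _ (hF.comp hm2).aemeasurable
  have hGz : Measurable fun x : κ → ℝ => G (x + Pi.single m z) := hG.comp (measurable_id'.add measurable_const)
  have hGI : Measurable fun x : κ → ℝ => ∫⁻ ζ : ℝ, G (x + (Pi.single m ζ : κ → ℝ)) :=
    Measurable.lintegral_prod_right' (f := fun p : (κ → ℝ) × ℝ => G (p.1 + Pi.single m p.2))
      (hG.comp hm2)
  rw [key G hG, key _ hGz, key _ hGI]
  have h3 : ∀ r : κ → ℝ, ∫⁻ ζ', (∫⁻ ζ : ℝ, G (r + Pi.single m ζ' + Pi.single m ζ))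
      ∂(gaussianReal 0 v) = ∫⁻ ζ : ℝ, G (r + Pi.single m ζ) := by
    intro r
    have : ∀ ζ' : ℝ, ∫⁻ ζ : ℝ, G (r + Pi.single m ζ' + Pi.single m ζ) =
        ∫⁻ ζ : ℝ, G (r + Pi.single m ζ) := by
      intro ζ'
      rw [← lintegral_add_left_eq_self (μ := volume) (fun ζ : ℝ => G (r + (Pi.single m ζ : κ → ℝ))) ζ']
      refine lintegral_congr fun ζ => ?_
      rw [Pi.single_add, add_assoc]
    simp_rw [this]; simp
  simp_rw [h3]
  rw [← lintegral_const_mul _ hGI, ← lintegral_add_left (by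
    exact Measurable.lintegral_prod_right' (ν := gaussianReal 0 v)
      (f := fun p : (κ → ℝ) × ℝ => G (p.1 + Pi.single m p.2 + Pi.single m z))
      (hG.comp (hm2.add_const _)))]
  refine lintegral_mono fun r => ?_
  refine (smooth1 hv (G := fun ζ => G (r + Pi.single m ζ)) (by
    exact hG.comp (hsm.const_add r)) z).trans (le_of_eq ?_)
  congr 1
  refine lintegral_congr fun ζ => ?_
  rw [Pi.single_add, add_assoc]

lemma sum_isG {ν : Measure (κ → ℝ)} [IsProbabilityMeasure ν] {q} (hν : IsG ν q) (N : ℕ) :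
    IsG ((Measure.pi fun _ : Fin N => ν).map fun ξ : Fin N → κ → ℝ => ∑ i, ξ i) (fun u => N * q u) := by
  intro u
  rw [integral_map (by fun_prop) (continuous_chr u).aestronglyMeasurable]
  have e : ∀ ξ : Fin N → κ → ℝ,
      Complex.exp (((∑ k, u k * (∑ i, ξ i) k : ℝ) : ℂ) * Complex.I) =
      ∏ i, Complex.exp (((∑ k, u k * ξ i k : ℝ) : ℂ) * Complex.I) := by
    intro ξ
    have e1 : (∑ k, u k * (∑ i, ξ i) k) = ∑ i, ∑ k, u k * ξ i k := by
      rw [Finset.sum_comm]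
      refine Finset.sum_congr rfl fun k _ => ?_
      rw [Finset.sum_apply, Finset.mul_sum]
    rw [← Complex.exp_sum, ← Finset.sum_mul, ← Complex.ofReal_sum, e1]
  simp_rw [e]
  rw [integral_fintype_prod_eq_pow (fun x : κ → ℝ =>
    Complex.exp (((∑ k, u k * x k : ℝ) : ℂ) * Complex.I)), hν u, ← Complex.exp_nat_mul]
  congr 1
  simp only [Fintype.card_fin]
  push_cast; ring

/-- ANOVA bound -/
lemma anova {E : Type*} [MeasurableSpace E] [AddCommGroup E] [MeasurableAdd₂ E]
    (ν : Measure E) [IsProbabilityMeasure ν] (N : ℕ)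
    {F : E → ℝ} (hF : Measurable F) {K : ℝ} (hK : ∀ x, |F x| ≤ K) (f : E → ℝ)
    (hf : f = fun x => ∫ ξ, F (x + ∑ i, ξ i) ∂(Measure.pi fun _ : Fin N => ν)) :
    (∀ x, |f x| ≤ K) ∧ Measurable f ∧
    ∫ x, f x ∂ν = ∫ ξ, F (∑ i, ξ i) ∂(Measure.pi fun _ : Fin (N + 1) => ν) ∧
    (N + 1) * ∫ x, (f x - ∫ x, f x ∂ν) ^ 2 ∂ν ≤
      ∫ ξ, F (∑ i, ξ i) ^ 2 ∂(Measure.pi fun _ : Fin (N + 1) => ν) := by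
  have hFsum : ∀ n : ℕ, Measurable fun ξ : Fin n → E => ∑ i, ξ i := fun n => by fun_prop
  have hm2 : Measurable fun p : E × (Fin N → E) => F (p.1 + ∑ i, p.2 i) :=
    hF.comp (measurable_fst.add ((hFsum N).comp measurable_snd))
  have hfm : Measurable f := by
    rw [hf]
    exact (hm2.stronglyMeasurable.integral_prod_right').measurable
  have hfb : ∀ x, |f x| ≤ K := by
    intro x
    rw [hf]
    have := norm_integral_le_of_norm_le_const (μ := Measure.pi fun _ : Fin N => ν)
      (f := fun ξ => F (x + ∑ i, ξ i)) (C := K) (ae_of_all _ fun ξ => by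
        rw [Real.norm_eq_abs]; exact hK _)
    simpa using this
  have hK0 : 0 ≤ K := (abs_nonneg _).trans (hK 0)
  set m := ∫ x, f x ∂ν with hm
  set Pm := Measure.pi fun _ : Fin (N + 1) => ν with hPm
  have hmp : ∀ i : Fin (N + 1), MeasurePreserving
      (MeasurableEquiv.piFinSuccAbove (fun _ => E) i) Pm (ν.prod (Measure.pi fun _ : Fin N => ν)) :=
    fun i => measurePreserving_piFinSuccAbove (fun _ => ν) i
  -- transfer
  have tr : ∀ (i : Fin (N + 1)) (h : E × (Fin N → E) → ℝ),
      ∫ ξ, h (ξ i, fun j => ξ (i.succAbove j)) ∂Pm = ∫ p, h p ∂(ν.prod (Measure.pi fun _ : Fin N => ν)) := by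
    intro i h
    rw [← (hmp i).integral_comp' h]
    rfl
  have hb : ∀ {α : Type _} [MeasurableSpace α] (μ : Measure α) [IsProbabilityMeasure μ] (g : α → ℝ)
      (C : ℝ), Measurable g → (∀ x, |g x| ≤ C) → Integrable g μ := by
    intro α _ μ _ g C hg hC
    exact Integrable.of_bound hg.aestronglyMeasurable C (ae_of_all _ fun x => by
      rw [Real.norm_eq_abs]; exact hC x)
  have hmK : |m| ≤ K := by
    have := norm_integral_le_of_norm_le_const (μ := ν) (f := f) (C := K) (ae_of_all _ fun ξ => by
        rw [Real.norm_eq_abs]; exact hfb _)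
    simpa using this
  set u : E → ℝ := fun x => f x - m with hu
  have hum : Measurable u := hfm.sub_const _
  have hub : ∀ x, |u x| ≤ 2 * K := fun x => by
    have := abs_sub (f x) m
    have h1 := hfb x
    simp only [hu]; linarith
  have hu0 : ∫ x, u x ∂ν = 0 := by
    simp only [hu]
    rw [integral_sub (hb ν f K hfm hfb) (integrable_const _)]
    simp [hm]
  set Φ : (Fin (N + 1) → E) → ℝ := fun ξ => F (∑ i, ξ i) - m with hΦ
  have hΦm : Measurable Φ := (hF.comp (hFsum _)).sub_const _
  have hΦb : ∀ ξ, |Φ ξ| ≤ 2 * K := fun x => by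
    have := abs_sub (F (∑ i, x i)) m
    have h1 := hK (∑ i, x i)
    simp only [hΦ]; linarith
  set V := ∫ x, u x ^ 2 ∂ν with hV
  have fub : ∀ g : E → ℝ, Measurable g → (∀ x, |g x| ≤ 2 * K) → ∀ i : Fin (N + 1),
      ∫ ξ, F (∑ i, ξ i) * g (ξ i) ∂Pm = ∫ x, f x * g x ∂ν := by
    intro g hg hgb i
    have h1 := tr i (fun p => F (p.1 + ∑ j, p.2 j) * g p.1)
    have h2 : ∀ ξ : Fin (N + 1) → E, ∑ i, ξ i = ξ i + ∑ j, ξ (i.succAbove j) := fun ξ =>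
      Fin.sum_univ_succAbove _ i
    simp only [← h2] at h1
    have hInteg : Integrable (fun p : E × (Fin N → E) => F (p.1 + ∑ j, p.2 j) * g p.1)
        (ν.prod (Measure.pi fun _ : Fin N => ν)) :=
      hb _ _ (K * (2 * K)) (hm2.mul (hg.comp measurable_fst)) (fun p => by
        rw [abs_mul]; gcongr
        · exact hK _
        · exact hgb _)
    rw [h1, integral_prod _ hInteg]
    refine integral_congr_ae (ae_of_all _ fun x => ?_)
    simp only
    rw [integral_mul_const, hf]
  have hmean : ∫ ξ, F (∑ i, ξ i) ∂Pm = m := by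
    by_cases hK1 : K = 0
    · have h1 : ∀ x, F x = 0 := fun x => by have := hK x; rw [hK1] at this; simpa using this
      have h2 : ∀ x, f x = 0 := fun x => by have := hfb x; rw [hK1] at this; simpa using this
      simp [hm, h1, h2]
    have hK2 : 0 < K := lt_of_le_of_ne hK0 (Ne.symm hK1)
    have := fub (fun _ => K) measurable_const (fun x => by rw [abs_of_nonneg hK0]; linarith) 0
    rw [integral_mul_const, integral_mul_const] at this
    exact mul_right_cancel₀ hK1 this
  have hΦu : ∀ i, ∫ ξ, Φ ξ * u (ξ i) ∂Pm = V := by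
    intro i
    have h1 : ∀ ξ, Φ ξ * u (ξ i) = F (∑ i, ξ i) * u (ξ i) - m * u (ξ i) := fun ξ => by
      simp only [hΦ]; ring
    have h3 : ∫ ξ, u (ξ i) ∂Pm = 0 := by
      have := tr i (fun p => u p.1)
      simp only at this
      rw [this]
      have := integral_prod_mul (μ := ν) (ν := Measure.pi fun _ : Fin N => ν) u (fun _ => (1:ℝ))
      simp only [mul_one] at this
      rw [this, hu0, zero_mul]
    simp_rw [h1]
    rw [integral_sub, fub u hum hub i, integral_const_mul, h3, mul_zero, sub_zero]
    · have h4 : ∀ x, f x * u x = u x ^ 2 + m * u x := fun x => by simp only [hu]; ring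
      simp_rw [h4]
      rw [integral_add, integral_const_mul, hu0, mul_zero, add_zero]
      · exact hb _ _ ((2 * K) ^ 2) (hum.pow_const _) (fun x => by rw [abs_pow]; gcongr; exact hub x)
      · exact (hb _ _ (2 * K) hum hub).const_mul _
    · refine hb _ _ (K * (2 * K)) ((hF.comp (hFsum _)).mul (hum.comp (measurable_pi_apply i))) fun ξ => ?_
      rw [abs_mul]; gcongr
      · exact hK _
      · exact hub _
    · exact (hb _ _ (2 * K) (hum.comp (measurable_pi_apply i)) (fun ξ => hub _)).const_mul _
  have huu : ∀ i j, ∫ ξ, u (ξ i) * u (ξ j) ∂Pm = if i = j then V else 0 := by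
    intro i j
    split_ifs with hij
    · subst hij
      have := tr i (fun p => u p.1 ^ 2)
      simp only at this
      simp_rw [← sq]
      rw [this]
      have := integral_prod_mul (μ := ν) (ν := Measure.pi fun _ : Fin N => ν)
        (fun x => u x ^ 2) (fun _ => (1:ℝ))
      simp only [mul_one] at this
      rw [this]; simp [hV]
    · obtain ⟨j', hj'⟩ := Fin.exists_succAbove_eq (Ne.symm hij)
      have := tr i (fun p => u p.1 * u (p.2 j'))
      simp only [hj'] at this
      rw [this, integral_prod_mul u (fun x : Fin N → E => u (x j')), hu0, zero_mul]
  have hexp : ∀ ξ, (Φ ξ - ∑ i, u (ξ i)) ^ 2 = Φ ξ ^ 2 - 2 * ∑ i, Φ ξ * u (ξ i) +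
      ∑ i, ∑ j, u (ξ i) * u (ξ j) := by
    intro ξ
    rw [← Finset.mul_sum, ← Finset.sum_mul_sum]; ring
  have iΦ2 : Integrable (fun ξ => Φ ξ ^ 2) Pm :=
    hb _ _ ((2 * K) ^ 2) (hΦm.pow_const _) (fun x => by rw [abs_pow]; gcongr; exact hΦb x)
  have iΦu : ∀ i, Integrable (fun ξ => Φ ξ * u (ξ i)) Pm := fun i =>
    hb _ _ ((2 * K) * (2 * K)) (hΦm.mul (hum.comp (measurable_pi_apply i))) (fun x => by
      rw [abs_mul]; gcongr
      · exact hΦb _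
      · exact hub _)
  have iuu : ∀ i j, Integrable (fun ξ => u (ξ i) * u (ξ j)) Pm := fun i j =>
    hb _ _ ((2 * K) * (2 * K)) ((hum.comp (measurable_pi_apply i)).mul
      (hum.comp (measurable_pi_apply j))) (fun x => by
      rw [abs_mul]; gcongr
      · exact hub _
      · exact hub _)
  have hpos : 0 ≤ ∫ ξ, (Φ ξ - ∑ i, u (ξ i)) ^ 2 ∂Pm := integral_nonneg fun ξ => sq_nonneg _
  simp_rw [hexp] at hpos
  rw [integral_add, integral_sub iΦ2, integral_const_mul, integral_finsetSum _ (fun i _ => iΦu i),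
    integral_finsetSum _ (fun i _ => integrable_finsetSum _ fun j _ => iuu i j)] at hpos
  rotate_left
  · exact (integrable_finsetSum _ fun i _ => iΦu i).const_mul _
  · exact iΦ2.sub ((integrable_finsetSum _ fun i _ => iΦu i).const_mul _)
  · exact integrable_finsetSum _ fun i _ => integrable_finsetSum _ fun j _ => iuu i j
  have e5 : ∀ i : Fin (N + 1), ∫ ξ, ∑ j, u (ξ i) * u (ξ j) ∂Pm = V := by
    intro i
    rw [integral_finsetSum _ fun j _ => iuu i j]
    simp_rw [huu]
    simp
  simp_rw [hΦu, e5] at hpos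
  simp only [Finset.sum_const, Finset.card_univ, Fintype.card_fin, nsmul_eq_mul] at hpos
  have iF : Integrable (fun ξ => F (∑ i, ξ i)) Pm := hb _ _ K (hF.comp (hFsum _)) fun _ => hK _
  have iF2 : Integrable (fun ξ => F (∑ i, ξ i) ^ 2) Pm :=
    hb _ _ (K ^ 2) ((hF.comp (hFsum _)).pow_const _) (fun x => by rw [abs_pow]; gcongr; exact hK _)
  have e6 : ∫ ξ, Φ ξ ^ 2 ∂Pm = ∫ ξ, F (∑ i, ξ i) ^ 2 ∂Pm - m ^ 2 := by
    have : ∀ ξ, Φ ξ ^ 2 = F (∑ i, ξ i) ^ 2 - 2 * m * F (∑ i, ξ i) + m ^ 2 := fun ξ => by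
      simp only [hΦ]; ring
    simp_rw [this]
    have hsub : Integrable (fun ξ => F (∑ i, ξ i) ^ 2 - 2 * m * F (∑ i, ξ i)) Pm :=
      iF2.sub (iF.const_mul _)
    rw [integral_add hsub (integrable_const _),
      integral_sub iF2 (iF.const_mul _), integral_const_mul, hmean]
    simp; ring
  refine ⟨hfb, hfm, hmean.symm, ?_⟩
  push_cast at hpos
  nlinarith [sq_nonneg m]

lemma IsG.map_scale {μ : Measure (κ → ℝ)} {q} (hμ : IsG μ q) (c : ℝ) :
    IsG (μ.map fun x => c • x) (fun u => q (c • u)) := by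
  intro u
  rw [integral_map (by fun_prop) (continuous_chr u).aestronglyMeasurable, ← hμ (c • u)]
  refine integral_congr_ae (ae_of_all _ fun x => ?_)
  simp only [Pi.smul_apply, smul_eq_mul]
  congr 4
  ext k; ring

lemma IsG.map_lin {κ' : Type*} [Fintype κ'] {μ : Measure (κ → ℝ)} {q} (hμ : IsG μ q)
    (f : (κ → ℝ) → (κ' → ℝ)) (hf : Measurable f) (g : (κ' → ℝ) → (κ → ℝ))
    (hfg : ∀ u x, ∑ k, u k * f x k = ∑ k, g u k * x k) :
    IsG (μ.map f) (fun u => q (g u)) := by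
  intro u
  rw [integral_map hf.aemeasurable (continuous_chr u).aestronglyMeasurable, ← hμ (g u)]
  refine integral_congr_ae (ae_of_all _ fun x => ?_)
  simp only [hfg]

lemma lemmaA_real {ι ι' : Type*} [Fintype ι] [Fintype ι'] {μ R : Measure (ι ⊕ ι' → ℝ)}
    [IsProbabilityMeasure μ] [IsProbabilityMeasure R] {q q'} (hμ : IsG μ q) (hR : IsG R q') (N : ℕ)
    (hscale : ∀ (c : ℝ) u, q (c • u) = c ^ 2 * q u)
    (hq : ∀ u, q u = q' u + N / (N + 1) * (q (Sum.elim (fun i => u (Sum.inl i)) 0) +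
      q (Sum.elim 0 (fun i => u (Sum.inr i)))))
    {F : (ι → ℝ) → ℝ} (hF : Measurable F) {K : ℝ} (hFK : ∀ x, |F x| ≤ K)
    {G : (ι' → ℝ) → ℝ} (hG : Measurable G) (hGK : ∀ x, |G x| ≤ K) :
    ∫ x, F (fun i => x (Sum.inl i)) * G (fun i => x (Sum.inr i)) ∂μ ≤
      (∫ x, F (fun i => x (Sum.inl i)) ∂μ) * (∫ x, G (fun i => x (Sum.inr i)) ∂μ) +
      1 / (2 * (N + 1)) * (∫ x, F (fun i => x (Sum.inl i)) ^ 2 ∂μ +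
        ∫ x, G (fun i => x (Sum.inr i)) ^ 2 ∂μ) := by
  have hN : (0 : ℝ) < N + 1 := by positivity
  set μx := μ.map (fun x i => x (Sum.inl i)) with hμx
  set μy := μ.map (fun x i => x (Sum.inr i)) with hμy
  have hmx : Measurable fun (x : ι ⊕ ι' → ℝ) (i : ι) => x (Sum.inl i) := by fun_prop
  have hmy : Measurable fun (x : ι ⊕ ι' → ℝ) (i : ι') => x (Sum.inr i) := by fun_prop
  have : IsProbabilityMeasure μx := Measure.isProbabilityMeasure_map hmx.aemeasurable
  have : IsProbabilityMeasure μy := Measure.isProbabilityMeasure_map hmy.aemeasurable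
  have gx : ∀ (u : ι → ℝ) (x : ι ⊕ ι' → ℝ), ∑ k, u k * x (Sum.inl k) =
      ∑ k, (Sum.elim u 0 : ι ⊕ ι' → ℝ) k * x k := by intro u x; simp
  have gy : ∀ (u : ι' → ℝ) (x : ι ⊕ ι' → ℝ), ∑ k, u k * x (Sum.inr k) =
      ∑ k, (Sum.elim 0 u : ι ⊕ ι' → ℝ) k * x k := by intro u x; simp
  have Gx : IsG μx (fun u => q (Sum.elim u 0)) := hμ.map_lin _ hmx (fun u => Sum.elim u 0) gx
  have Gy : IsG μy (fun u => q (Sum.elim 0 u)) := hμ.map_lin _ hmy (fun u => Sum.elim 0 u) gy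
  set s : ℝ := √((N + 1 : ℝ)⁻¹) with hs
  have hs2 : s ^ 2 = (N + 1 : ℝ)⁻¹ := Real.sq_sqrt (by positivity)
  set νx := μx.map (fun x => s • x) with hνx
  set νy := μy.map (fun x => s • x) with hνy
  have : IsProbabilityMeasure νx := Measure.isProbabilityMeasure_map (by fun_prop)
  have : IsProbabilityMeasure νy := Measure.isProbabilityMeasure_map (by fun_prop)
  have Hx : IsG νx (fun u => (N + 1 : ℝ)⁻¹ * q (Sum.elim u 0)) := by
    have := Gx.map_scale s
    convert this using 2 with u
    rw [← hs2, ← hscale]; congr 1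
    ext k; rcases k with k | k <;> simp
  have Hy : IsG νy (fun u => (N + 1 : ℝ)⁻¹ * q (Sum.elim 0 u)) := by
    have := Gy.map_scale s
    convert this using 2 with u
    rw [← hs2, ← hscale]; congr 1
    ext k; rcases k with k | k <;> simp
  have hq0 : q 0 = 0 := by have := hscale 0 0; simpa using this
  -- marginals of R
  have Rx : R.map (fun x i => x (Sum.inl i)) = νx := by
    have h1 := hR.map_lin _ hmx (fun u => Sum.elim u 0) gx
    have : IsProbabilityMeasure (R.map fun (x : ι ⊕ ι' → ℝ) (i : ι) => x (Sum.inl i)) :=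
      Measure.isProbabilityMeasure_map hmx.aemeasurable
    refine IsG.unique h1 ?_
    convert Hx using 2 with u
    have := hq (Sum.elim u 0)
    have e0 : (Sum.elim 0 (fun i => (Sum.elim u 0 : ι ⊕ ι' → ℝ) (Sum.inr i)) : ι ⊕ ι' → ℝ) = 0 := by
      ext k; rcases k with k | k <;> simp
    rw [e0, hq0] at this
    simp only [Sum.elim_inl] at this
    field_simp at this ⊢
    linarith
  have Ry : R.map (fun x i => x (Sum.inr i)) = νy := by
    have h1 := hR.map_lin _ hmy (fun u => Sum.elim 0 u) gy
    have : IsProbabilityMeasure (R.map fun (x : ι ⊕ ι' → ℝ) (i : ι') => x (Sum.inr i)) :=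
      Measure.isProbabilityMeasure_map hmy.aemeasurable
    refine IsG.unique h1 ?_
    convert Hy using 2 with u
    have := hq (Sum.elim 0 u)
    have e0 : (Sum.elim (fun i => (Sum.elim 0 u : ι ⊕ ι' → ℝ) (Sum.inl i)) 0 : ι ⊕ ι' → ℝ) = 0 := by
      ext k; rcases k with k | k <;> simp
    rw [e0, hq0] at this
    simp only [Sum.elim_inr] at this
    field_simp at this ⊢
    linarith
  -- sums
  set Px := Measure.pi fun _ : Fin N => νx with hPx
  set Py := Measure.pi fun _ : Fin N => νy with hPy
  have sx : ∀ n : ℕ, Measurable fun ξ : Fin n → ι → ℝ => ∑ i, ξ i := fun n => by fun_prop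
  have sy : ∀ n : ℕ, Measurable fun ξ : Fin n → ι' → ℝ => ∑ i, ξ i := fun n => by fun_prop
  have ex : Measurable fun x : ι → ℝ => (Sum.elim x 0 : ι ⊕ ι' → ℝ) := by
    refine measurable_pi_iff.2 fun k => ?_
    rcases k with k | k
    · exact measurable_pi_apply k
    · exact measurable_const
  have ey : Measurable fun x : ι' → ℝ => (Sum.elim 0 x : ι ⊕ ι' → ℝ) := by
    refine measurable_pi_iff.2 fun k => ?_
    rcases k with k | k
    · exact measurable_const
    · exact measurable_pi_apply k
  have hlaw : μ = ((R.prod Px).prod Py).map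
      fun p : ((ι ⊕ ι' → ℝ) × (Fin N → ι → ℝ)) × (Fin N → ι' → ℝ) =>
      p.1.1 + (Sum.elim (∑ i, p.1.2 i) 0 : ι ⊕ ι' → ℝ) + (Sum.elim 0 (∑ i, p.2 i) : ι ⊕ ι' → ℝ) := by
    have p1 : IsProbabilityMeasure (Px.map fun ξ : Fin N → ι → ℝ => ∑ i, ξ i) :=
      Measure.isProbabilityMeasure_map (sx N).aemeasurable
    have p2 : IsProbabilityMeasure (Py.map fun ξ : Fin N → ι' → ℝ => ∑ i, ξ i) :=
      Measure.isProbabilityMeasure_map (sy N).aemeasurable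
    have m1 : Measurable fun p : (ι ⊕ ι' → ℝ) × (ι → ℝ) => p.1 + (Sum.elim p.2 0 : ι ⊕ ι' → ℝ) :=
      measurable_fst.add (ex.comp measurable_snd)
    have m2 : Measurable fun p : (ι ⊕ ι' → ℝ) × (ι' → ℝ) => p.1 + (Sum.elim 0 p.2 : ι ⊕ ι' → ℝ) :=
      measurable_fst.add (ey.comp measurable_snd)
    have h1 := hR.add (sum_isG Hx N) (fun x => (Sum.elim x 0 : ι ⊕ ι' → ℝ)) ex
      (fun u i => u (Sum.inl i)) (by intro u x; simp)
    have p3 := Measure.isProbabilityMeasure_map (μ := R.prod (Px.map fun ξ => ∑ i, ξ i))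
      m1.aemeasurable
    have h2 := h1.add (sum_isG Hy N) (fun x => (Sum.elim 0 x : ι ⊕ ι' → ℝ)) ey
      (fun u i => u (Sum.inr i)) (by intro u x; simp)
    have p4 := Measure.isProbabilityMeasure_map
      (μ := (((R.prod (Px.map fun ξ => ∑ i, ξ i)).map fun p : (ι ⊕ ι' → ℝ) × (ι → ℝ) => p.1 + (Sum.elim p.2 0 : ι ⊕ ι' → ℝ)).prod
        (Py.map fun ξ => ∑ i, ξ i))) m2.aemeasurable
    have h3 : IsG μ (fun u => q' u + N * ((N + 1 : ℝ)⁻¹ * q (Sum.elim (fun i => u (Sum.inl i)) 0)) +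
        N * ((N + 1 : ℝ)⁻¹ * q (Sum.elim 0 (fun i => u (Sum.inr i))))) := by
      convert hμ using 2 with u
      rw [hq u]; ring
    rw [h3.unique h2]
    have m3 : Measurable fun p : (ι ⊕ ι' → ℝ) × (Fin N → ι → ℝ) =>
        p.1 + (Sum.elim (∑ i, p.2 i) 0 : ι ⊕ ι' → ℝ) :=
      m1.comp (measurable_fst.prodMk ((sx N).comp measurable_snd))
    have e1 : ((R.prod (Px.map fun ξ => ∑ i, ξ i)).map fun p : (ι ⊕ ι' → ℝ) × (ι → ℝ) => p.1 + (Sum.elim p.2 0 : ι ⊕ ι' → ℝ)) =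
        (R.prod Px).map fun p : (ι ⊕ ι' → ℝ) × (Fin N → ι → ℝ) => p.1 + (Sum.elim (∑ i, p.2 i) 0 : ι ⊕ ι' → ℝ) := by
      conv_lhs => rw [← Measure.map_id (μ := R)]
      rw [Measure.map_prod_map _ _ measurable_id (sx N),
        Measure.map_map m1 (measurable_id.prodMap (sx N))]
      rfl
    rw [e1, Measure.map_prod_map _ _ m3 (sy N), Measure.map_map m2 (m3.prodMap (sy N))]
    rfl
  -- full laws of the sums
  have fullx : (Measure.pi fun _ : Fin (N + 1) => νx).map (fun ξ => ∑ i, ξ i) = μx := by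
    have p1 : IsProbabilityMeasure ((Measure.pi fun _ : Fin (N + 1) => νx).map
      fun ξ : Fin (N + 1) → ι → ℝ => ∑ i, ξ i) := Measure.isProbabilityMeasure_map (sx _).aemeasurable
    refine IsG.unique (sum_isG Hx (N + 1)) ?_
    convert Gx using 2 with u
    push_cast; field_simp
  have fully : (Measure.pi fun _ : Fin (N + 1) => νy).map (fun ξ => ∑ i, ξ i) = μy := by
    have p1 : IsProbabilityMeasure ((Measure.pi fun _ : Fin (N + 1) => νy).map
      fun ξ : Fin (N + 1) → ι' → ℝ => ∑ i, ξ i) := Measure.isProbabilityMeasure_map (sy _).aemeasurable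
    refine IsG.unique (sum_isG Hy (N + 1)) ?_
    convert Gy using 2 with u
    push_cast; field_simp
  obtain ⟨fb, fm, fmean, fvar⟩ := anova νx N hF hFK _ rfl
  obtain ⟨gb, gm, gmean, gvar⟩ := anova νy N hG hGK _ rfl
  set f := fun x => ∫ ξ, F (x + ∑ i, ξ i) ∂Px with hf
  set g := fun x => ∫ ξ, G (x + ∑ i, ξ i) ∂Py with hg
  have tx : ∀ h : (ι → ℝ) → ℝ, Measurable h → ∫ x, h (fun i => x (Sum.inl i)) ∂μ =
      ∫ ξ, h (∑ i, ξ i) ∂(Measure.pi fun _ : Fin (N + 1) => νx) := by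
    intro h hh
    rw [← integral_map (φ := fun ξ : Fin (N + 1) → ι → ℝ => ∑ i, ξ i) (f := h) (sx _).aemeasurable
      hh.aestronglyMeasurable, fullx, hμx, integral_map hmx.aemeasurable hh.aestronglyMeasurable]
  have ty : ∀ h : (ι' → ℝ) → ℝ, Measurable h → ∫ x, h (fun i => x (Sum.inr i)) ∂μ =
      ∫ ξ, h (∑ i, ξ i) ∂(Measure.pi fun _ : Fin (N + 1) => νy) := by
    intro h hh
    rw [← integral_map (φ := fun ξ : Fin (N + 1) → ι' → ℝ => ∑ i, ξ i) (f := h) (sy _).aemeasurable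
      hh.aestronglyMeasurable, fully, hμy, integral_map hmy.aemeasurable hh.aestronglyMeasurable]
  rw [tx F hF, ty G hG, tx (fun x => F x ^ 2) (hF.pow_const _), ty (fun x => G x ^ 2) (hG.pow_const _),
    ← fmean, ← gmean]
  have hK0 : 0 ≤ K := (abs_nonneg _).trans (hFK 0)
  have hb : ∀ {α : Type _} [MeasurableSpace α] (μ : Measure α) [IsProbabilityMeasure μ] (g : α → ℝ)
      (C : ℝ), Measurable g → (∀ x, |g x| ≤ C) → Integrable g μ := by
    intro α _ μ _ g C hg hC
    exact Integrable.of_bound hg.aestronglyMeasurable C (ae_of_all _ fun x => by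
      rw [Real.norm_eq_abs]; exact hC x)
  have hcross : ∫ x, F (fun i => x (Sum.inl i)) * G (fun i => x (Sum.inr i)) ∂μ =
      ∫ r, f (fun i => r (Sum.inl i)) * g (fun i => r (Sum.inr i)) ∂ R := by
    have m1 : Measurable fun p : ((ι ⊕ ι' → ℝ) × (Fin N → ι → ℝ)) × (Fin N → ι' → ℝ) =>
        p.1.1 + (Sum.elim (∑ i, p.1.2 i) 0 : ι ⊕ ι' → ℝ) + (Sum.elim 0 (∑ i, p.2 i) : ι ⊕ ι' → ℝ) :=
      (measurable_fst.fst.add (ex.comp ((sx N).comp measurable_fst.snd))).add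
        (ey.comp ((sy N).comp measurable_snd))
    have m2 : Measurable fun x : ι ⊕ ι' → ℝ => F (fun i => x (Sum.inl i)) * G (fun i => x (Sum.inr i)) :=
      (hF.comp hmx).mul (hG.comp hmy)
    rw [hlaw, integral_map m1.aemeasurable m2.aestronglyMeasurable]
    have e1 : ∀ p : ((ι ⊕ ι' → ℝ) × (Fin N → ι → ℝ)) × (Fin N → ι' → ℝ),
        F (fun i => (p.1.1 + (Sum.elim (∑ i, p.1.2 i) 0 : ι ⊕ ι' → ℝ) + (Sum.elim 0 (∑ i, p.2 i) : ι ⊕ ι' → ℝ)) (Sum.inl i)) *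
        G (fun i => (p.1.1 + (Sum.elim (∑ i, p.1.2 i) 0 : ι ⊕ ι' → ℝ) + (Sum.elim 0 (∑ i, p.2 i) : ι ⊕ ι' → ℝ)) (Sum.inr i)) =
        F ((fun i => p.1.1 (Sum.inl i)) + ∑ i, p.1.2 i) * G ((fun i => p.1.1 (Sum.inr i)) + ∑ i, p.2 i) := by
      intro p
      congr 2 <;> ext i <;> simp
    simp_rw [e1]
    have i1 : Integrable (fun p : ((ι ⊕ ι' → ℝ) × (Fin N → ι → ℝ)) × (Fin N → ι' → ℝ) =>
        F ((fun i => p.1.1 (Sum.inl i)) + ∑ i, p.1.2 i) * G ((fun i => p.1.1 (Sum.inr i)) + ∑ i, p.2 i))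
        ((R.prod Px).prod Py) := by
      refine hb _ _ (K * K) ?_ ?_
      · refine (hF.comp ?_).mul (hG.comp ?_)
        · exact (hmx.comp measurable_fst.fst).add ((sx N).comp measurable_fst.snd)
        · exact (hmy.comp measurable_fst.fst).add ((sy N).comp measurable_snd)
      · intro p; rw [abs_mul]; gcongr
        · exact hFK _
        · exact hGK _
    rw [integral_prod _ i1, integral_prod _ i1.integral_prod_left]
    refine integral_congr_ae (ae_of_all _ fun r => ?_)
    simp only [integral_const_mul, integral_mul_const, hf, hg]
  rw [hcross]
  set a := ∫ x, f x ∂νx with ha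
  set b := ∫ x, g x ∂νy with hbb
  have va : ∫ r, (f (fun i => r (Sum.inl i)) - a) ^ 2 ∂ R = ∫ x, (f x - a) ^ 2 ∂νx := by
    rw [← Rx, integral_map hmx.aemeasurable ((fm.sub_const _).pow_const _).aestronglyMeasurable]
  have vb : ∫ r, (g (fun i => r (Sum.inr i)) - b) ^ 2 ∂ R = ∫ x, (g x - b) ^ 2 ∂νy := by
    rw [← Ry, integral_map hmy.aemeasurable ((gm.sub_const _).pow_const _).aestronglyMeasurable]
  have wa : ∫ r, f (fun i => r (Sum.inl i)) ∂ R = a := by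
    rw [ha, ← Rx, integral_map hmx.aemeasurable fm.aestronglyMeasurable]
  have wb : ∫ r, g (fun i => r (Sum.inr i)) ∂ R = b := by
    rw [hbb, ← Ry, integral_map hmy.aemeasurable gm.aestronglyMeasurable]
  have fm' := fm.comp hmx
  have gm' := gm.comp hmy
  have if1 : Integrable (fun r : ι ⊕ ι' → ℝ => f (fun i => r (Sum.inl i))) R :=
    hb R _ K fm' (fun r => fb _)
  have ig1 : Integrable (fun r : ι ⊕ ι' → ℝ => g (fun i => r (Sum.inr i))) R :=
    hb R _ K gm' (fun r => gb _)
  have if2 : Integrable (fun r : ι ⊕ ι' → ℝ => (f (fun i => r (Sum.inl i)) - a) ^ 2) R :=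
    hb R _ ((K + |a|) ^ 2) ((fm'.sub_const _).pow_const _) (fun r => by
      rw [abs_pow]; gcongr
      exact (abs_sub _ _).trans (add_le_add (fb _) le_rfl))
  have ig2 : Integrable (fun r : ι ⊕ ι' → ℝ => (g (fun i => r (Sum.inr i)) - b) ^ 2) R :=
    hb R _ ((K + |b|) ^ 2) ((gm'.sub_const _).pow_const _) (fun r => by
      rw [abs_pow]; gcongr
      exact (abs_sub _ _).trans (add_le_add (gb _) le_rfl))
  have ifg : Integrable (fun r : ι ⊕ ι' → ℝ => f (fun i => r (Sum.inl i)) * g (fun i => r (Sum.inr i))) R :=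
    hb R _ (K * K) (fm'.mul gm') (fun r => by
      rw [abs_mul]; gcongr
      · exact fb _
      · exact gb _)
  have hle : ∫ r, f (fun i => r (Sum.inl i)) * g (fun i => r (Sum.inr i)) ∂ R ≤
      ∫ r, ((1 / 2) * ((f (fun i => r (Sum.inl i)) - a) ^ 2 + (g (fun i => r (Sum.inr i)) - b) ^ 2) +
        (a * g (fun i => r (Sum.inr i)) + b * f (fun i => r (Sum.inl i)) - a * b)) ∂ R := by
    refine integral_mono ifg ?_ ?_
    · exact ((if2.add ig2).const_mul _).add (((ig1.const_mul _).add (if1.const_mul _)).sub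
        (integrable_const _))
    · intro r
      simp only
      nlinarith [sq_nonneg ((f (fun i => r (Sum.inl i)) - a) - (g (fun i => r (Sum.inr i)) - b))]
  have hS1 : Integrable (fun r : ι ⊕ ι' → ℝ => (1 / 2) * ((f (fun i => r (Sum.inl i)) - a) ^ 2 +
    (g (fun i => r (Sum.inr i)) - b) ^ 2)) R := (if2.add ig2).const_mul _
  have hS2 : Integrable (fun r : ι ⊕ ι' → ℝ => a * g (fun i => r (Sum.inr i)) +
    b * f (fun i => r (Sum.inl i))) R := (ig1.const_mul _).add (if1.const_mul _)
  have hS3 : Integrable (fun r : ι ⊕ ι' → ℝ => a * g (fun i => r (Sum.inr i)) +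
    b * f (fun i => r (Sum.inl i)) - a * b) R := hS2.sub (integrable_const _)
  rw [integral_add hS1 hS3, integral_const_mul, integral_add if2 ig2, va, vb,
    integral_sub hS2 (integrable_const _), integral_add (ig1.const_mul _) (if1.const_mul _),
    integral_const_mul, integral_const_mul, wa, wb] at hle
  simp only [integral_const, probReal_univ, smul_eq_mul, one_mul] at hle
  refine hle.trans ?_
  have hNN : 1 / (2 * ((N : ℝ) + 1)) * (N + 1) = 1 / 2 := by field_simp
  have := mul_le_mul_of_nonneg_left (add_le_add fvar gvar) (by positivity : 0 ≤ 1 / (2 * ((N : ℝ) + 1)))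
  rw [← mul_add, ← mul_assoc, hNN] at this
  linarith

lemma iSup_mul_mono {f g : ℕ → ℝ≥0∞} (hf : Monotone f) (hg : Monotone g) :
    (⨆ i, f i) * (⨆ i, g i) = ⨆ i, f i * g i := by
  refine le_antisymm ?_ (iSup_le fun i => mul_le_mul' (le_iSup f i) (le_iSup g i))
  rw [ENNReal.iSup_mul]
  refine iSup_le fun i => ?_
  rw [ENNReal.mul_iSup]
  refine iSup_le fun j => ?_
  exact (mul_le_mul' (hf (le_max_left i j)) (hg (le_max_right i j))).trans
    (le_iSup (fun i => f i * g i) (max i j))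

lemma lemmaA {ι ι' : Type*} [Fintype ι] [Fintype ι'] {μ R : Measure (ι ⊕ ι' → ℝ)}
    [IsProbabilityMeasure μ] [IsProbabilityMeasure R] {q q'} (hμ : IsG μ q) (hR : IsG R q') (N : ℕ)
    (hscale : ∀ (c : ℝ) u, q (c • u) = c ^ 2 * q u)
    (hq : ∀ u, q u = q' u + N / (N + 1) * (q (Sum.elim (fun i => u (Sum.inl i)) 0) +
      q (Sum.elim 0 (fun i => u (Sum.inr i)))))
    {F : (ι → ℝ) → ℝ≥0∞} (hF : Measurable F)
    {G : (ι' → ℝ) → ℝ≥0∞} (hG : Measurable G) :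
    ∫⁻ x, F (fun i => x (Sum.inl i)) * G (fun i => x (Sum.inr i)) ∂μ ≤
      (∫⁻ x, F (fun i => x (Sum.inl i)) ∂μ) * (∫⁻ x, G (fun i => x (Sum.inr i)) ∂μ) +
      ENNReal.ofReal (1 / (2 * (N + 1))) * (∫⁻ x, F (fun i => x (Sum.inl i)) ^ 2 ∂μ +
        ∫⁻ x, G (fun i => x (Sum.inr i)) ^ 2 ∂μ) := by
  have hmx : Measurable fun (x : ι ⊕ ι' → ℝ) (i : ι) => x (Sum.inl i) := by fun_prop
  have hmy : Measurable fun (x : ι ⊕ ι' → ℝ) (i : ι') => x (Sum.inr i) := by fun_prop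
  set f : ℕ → (ι → ℝ) → ℝ≥0∞ := fun K x => min (F x) K with hf
  set g : ℕ → (ι' → ℝ) → ℝ≥0∞ := fun K x => min (G x) K with hg
  have fm : ∀ K, Measurable (f K) := fun K => hF.min measurable_const
  have gm : ∀ K, Measurable (g K) := fun K => hG.min measurable_const
  have ft : ∀ K x, f K x ≠ ⊤ := fun K x => ne_top_of_le_ne_top (natCast_ne_top K) (min_le_right _ _)
  have gt : ∀ K x, g K x ≠ ⊤ := fun K x => ne_top_of_le_ne_top (natCast_ne_top K) (min_le_right _ _)
  have fmono : Monotone f := fun K L h x => min_le_min le_rfl (by exact_mod_cast h)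
  have gmono : Monotone g := fun K L h x => min_le_min le_rfl (by exact_mod_cast h)
  have supmin : ∀ y : ℝ≥0∞, ⨆ K : ℕ, min y (K : ℝ≥0∞) = y := by
    intro y
    have : ⨆ K : ℕ, min y (K : ℝ≥0∞) = min y (⨆ K : ℕ, (K : ℝ≥0∞)) := (inf_iSup_eq _ _).symm
    rw [this, ENNReal.iSup_natCast]; simp
  have key : ∀ K, ∫⁻ x, f K (fun i => x (Sum.inl i)) * g K (fun i => x (Sum.inr i)) ∂μ ≤
      (∫⁻ x, F (fun i => x (Sum.inl i)) ∂μ) * (∫⁻ x, G (fun i => x (Sum.inr i)) ∂μ) +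
      ENNReal.ofReal (1 / (2 * (N + 1))) * (∫⁻ x, F (fun i => x (Sum.inl i)) ^ 2 ∂μ +
        ∫⁻ x, G (fun i => x (Sum.inr i)) ^ 2 ∂μ) := by
    intro K
    have hfK : ∀ x, |(f K x).toReal| ≤ K := fun x => by
      rw [abs_of_nonneg toReal_nonneg]
      exact ENNReal.toReal_le_of_le_ofReal (Nat.cast_nonneg _) (by simp [hf])
    have hgK : ∀ x, |(g K x).toReal| ≤ K := fun x => by
      rw [abs_of_nonneg toReal_nonneg]
      exact ENNReal.toReal_le_of_le_ofReal (Nat.cast_nonneg _) (by simp [hg])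
    have h := lemmaA_real hμ hR N hscale hq (F := fun x => (f K x).toReal) (fm K).ennreal_toReal hfK
      (G := fun x => (g K x).toReal) (gm K).ennreal_toReal hgK
    have conv : ∀ u : (ι ⊕ ι' → ℝ) → ℝ≥0∞, Measurable u → (∃ C : ℝ≥0, ∀ x, u x ≤ C) →
        ENNReal.ofReal (∫ x, (u x).toReal ∂μ) = ∫⁻ x, u x ∂μ := by
      rintro u hu ⟨C, hC⟩
      rw [integral_toReal hu.aemeasurable (ae_of_all _ fun x => (hC x).trans_lt coe_lt_top),
        ENNReal.ofReal_toReal]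
      refine ne_top_of_le_ne_top ?_ (lintegral_mono hC)
      simp
    have c1 := conv (fun x => f K (fun i => x (Sum.inl i))) ((fm K).comp hmx) ⟨K, fun x => by
      simp [hf]⟩
    have c2 := conv (fun x => g K (fun i => x (Sum.inr i))) ((gm K).comp hmy) ⟨K, fun x => by
      simp [hg]⟩
    have c3 := conv (fun x => f K (fun i => x (Sum.inl i)) * g K (fun i => x (Sum.inr i)))
      (((fm K).comp hmx).mul ((gm K).comp hmy)) ⟨K * K, fun x => by
      push_cast
      exact mul_le_mul' (by simp [hf]) (by simp [hg])⟩
    have c4 := conv (fun x => f K (fun i => x (Sum.inl i)) ^ 2) (((fm K).comp hmx).pow_const _)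
      ⟨K ^ 2, fun x => by push_cast; exact pow_le_pow_left' (by simp [hf]) 2⟩
    have c5 := conv (fun x => g K (fun i => x (Sum.inr i)) ^ 2) (((gm K).comp hmy).pow_const _)
      ⟨K ^ 2, fun x => by push_cast; exact pow_le_pow_left' (by simp [hg]) 2⟩
    simp only [toReal_mul, toReal_pow] at c1 c2 c3 c4 c5
    have h' := ENNReal.ofReal_le_ofReal h
    have nn : ∀ u : (ι ⊕ ι' → ℝ) → ℝ≥0∞, 0 ≤ ∫ x, (u x).toReal ∂μ := fun u =>
      integral_nonneg fun x => toReal_nonneg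
    have nn2 : ∀ u : (ι ⊕ ι' → ℝ) → ℝ≥0∞, 0 ≤ ∫ x, (u x).toReal ^ 2 ∂μ := fun u =>
      integral_nonneg fun x => by positivity
    rw [c3, ENNReal.ofReal_add (mul_nonneg (nn _) (nn _)) (mul_nonneg (by positivity)
      (add_nonneg (nn2 _) (nn2 _))), ENNReal.ofReal_mul (nn _), ENNReal.ofReal_mul (by positivity),
      ENNReal.ofReal_add (nn2 _) (nn2 _), c1, c2, c4, c5] at h'
    refine h'.trans ?_
    gcongr <;> exact min_le_left _ _
  have hsup : ∫⁻ x, F (fun i => x (Sum.inl i)) * G (fun i => x (Sum.inr i)) ∂μ =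
      ⨆ K, ∫⁻ x, f K (fun i => x (Sum.inl i)) * g K (fun i => x (Sum.inr i)) ∂μ := by
    rw [← lintegral_iSup (f := fun K (x : ι ⊕ ι' → ℝ) => f K (fun i => x (Sum.inl i)) *
      g K (fun i => x (Sum.inr i))) (fun K => ((fm K).comp hmx).mul ((gm K).comp hmy))]
    · refine lintegral_congr fun x => ?_
      have e : ∀ y z : ℝ≥0∞, ⨆ K : ℕ, min y K * min z K = y * z := by
        intro y z
        conv_rhs => rw [← supmin y, ← supmin z]
        rw [iSup_mul_mono]
        · intro K L h; exact min_le_min le_rfl (by exact_mod_cast h)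
        · intro K L h; exact min_le_min le_rfl (by exact_mod_cast h)
      exact (e _ _).symm
    · intro K L h x
      exact mul_le_mul' (fmono h _) (gmono h _)
  rw [hsup]
  exact iSup_le key

end gauss

end LC
end

section
namespace LC

/-! ### Fractional Brownian motion: covariances -/

/-- Covariance of `B_t - B_s` with `B_x` up to a constant. -/
def gg (A α s t x : ℝ) : ℝ := A / 2 * (|x - s| ^ α - |x - t| ^ α)

/-- Covariance of `B_t - B_s` with `B_t' - B_s'`. -/
def cv (A α s t s' t' : ℝ) : ℝ := gg A α s t t' - gg A α s t s'

section cov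
variable {A α s t x y : ℝ}

lemma gg_reflect : gg A α s t x = - gg A α (-t) (-s) (-x) := by
  unfold gg
  rw [show -x - -t = -(x - t) by ring, show -x - -s = -(x - s) by ring, abs_neg, abs_neg]; ring

lemma cv_symm (s' t' : ℝ) : cv A α s t s' t' = cv A α s' t' s t := by
  unfold cv gg
  rw [abs_sub_comm t' s, abs_sub_comm t' t, abs_sub_comm s' s, abs_sub_comm s' t]; ring

lemma rpow_incr_anti (hα0 : 0 ≤ α) (hα : α ≤ 1) {a b d : ℝ} (ha : 0 ≤ a) (hab : a ≤ b) (hd : 0 ≤ d) :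
    (b + d) ^ α - b ^ α ≤ (a + d) ^ α - a ^ α := by
  rcases eq_or_lt_of_le (show a ≤ b + d by linarith) with h | h
  · have hd0 : d = 0 := by linarith
    subst hd0; simp
  have hc := Real.concaveOn_rpow hα0 hα
  set l := d / (b + d - a) with hl
  have hpos : 0 < b + d - a := by linarith
  have hl0 : 0 ≤ l := by positivity
  have hl1 : l ≤ 1 := by rw [hl, div_le_one hpos]; linarith
  have e : l * (b + d - a) = d := by rw [hl]; field_simp
  have h1 := hc.2 (x := a) (y := b + d) ha (by simp; linarith) (by linarith : 0 ≤ 1 - l) hl0 (by ring)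
  have h2 := hc.2 (x := a) (y := b + d) ha (by simp; linarith) hl0 (by linarith : 0 ≤ 1 - l) (by ring)
  simp only [smul_eq_mul] at h1 h2
  rw [show (1 - l) * a + l * (b + d) = a + d by linear_combination e] at h1
  rw [show l * a + (1 - l) * (b + d) = b by linear_combination -e] at h2
  nlinarith

lemma gg_anti (hA : 0 ≤ A) (hα0 : 0 ≤ α) (hα : α ≤ 1) (hst : s ≤ t) (hx : t ≤ x) (hxy : x ≤ y) :
    gg A α s t y ≤ gg A α s t x := by
  unfold gg
  have := rpow_incr_anti hα0 hα (a := x - t) (b := y - t) (d := t - s) (by linarith) (by linarith) (by linarith)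
  rw [abs_of_nonneg (by linarith : 0 ≤ y - s), abs_of_nonneg (by linarith : 0 ≤ y - t),
    abs_of_nonneg (by linarith : 0 ≤ x - s), abs_of_nonneg (by linarith : 0 ≤ x - t)]
  rw [show y - t + (t - s) = y - s by ring, show x - t + (t - s) = x - s by ring] at this
  exact mul_le_mul_of_nonneg_left this (by linarith)

lemma gg_anti' (hA : 0 ≤ A) (hα0 : 0 ≤ α) (hα : α ≤ 1) (hst : s ≤ t) (hx : y ≤ s) (hxy : x ≤ y) :
    gg A α s t y ≤ gg A α s t x := by
  rw [gg_reflect, gg_reflect (x := x)]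
  exact neg_le_neg (gg_anti hA hα0 hα (by linarith) (by linarith) (by linarith))

lemma gg_lower (hA : 0 ≤ A) (hα0 : 0 ≤ α) (hα : α ≤ 1) (hst : s < t) (hx : t ≤ x) {L : ℝ}
    (hL : x - s ≤ L) : A / 2 * (α * (t - s) * L ^ (α - 1)) ≤ gg A α s t x := by
  unfold gg
  rw [abs_of_nonneg (by linarith : 0 ≤ x - s), abs_of_nonneg (by linarith : 0 ≤ x - t)]
  refine mul_le_mul_of_nonneg_left ?_ (by linarith)
  set X := x - s with hX
  have hX0 : 0 < X := by simp only [hX]; linarith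
  have h1 := rpow_one_add_le_one_add_mul_self (s := -((t - s) / X)) (p := α) (by
    rw [neg_le_neg_iff, div_le_one hX0]; simp only [hX]; linarith) hα0 hα
  have e : x - t = X * (1 + -((t - s) / X)) := by
    field_simp; simp only [hX]; ring
  rw [e, Real.mul_rpow hX0.le (by
    rw [← sub_eq_add_neg, sub_nonneg, div_le_one hX0]; simp only [hX]; linarith)]
  have h2 := mul_le_mul_of_nonneg_left h1 (Real.rpow_nonneg hX0.le α)
  have h3 : X ^ (α - 1) = X ^ α / X := by rw [Real.rpow_sub_one hX0.ne']
  have h4 : L ^ (α - 1) ≤ X ^ (α - 1) := Real.rpow_le_rpow_of_nonpos hX0 hL (by linarith)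
  have h5 := mul_le_mul_of_nonneg_left h4 (mul_nonneg hα0 (by linarith : 0 ≤ t - s))
  rw [h3] at h5
  have : X ^ α * (1 + α * -((t - s) / X)) = X ^ α - α * (t - s) * (X ^ α / X) := by
    field_simp
    ring
  linarith

lemma gg_lower' (hA : 0 ≤ A) (hα0 : 0 ≤ α) (hα : α ≤ 1) (hst : s < t) (hx : x ≤ s) {L : ℝ}
    (hL : t - x ≤ L) : gg A α s t x ≤ - (A / 2 * (α * (t - s) * L ^ (α - 1))) := by
  rw [gg_reflect]
  have := gg_lower hA hα0 hα (s := -t) (t := -s) (x := -x) (by linarith) (by linarith)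
    (L := L) (by linarith)
  rw [show -s - -t = t - s by ring] at this
  exact neg_le_neg this

lemma gg_upper (hA : 0 ≤ A) (hα0 : 0 ≤ α) (hα : α ≤ 1) (hst : s ≤ t) {g : ℝ} (hg : 0 < g)
    (hx : t + g ≤ x) : gg A α s t x ≤ A / 2 * (α * (t - s) * g ^ (α - 1)) := by
  unfold gg
  rw [abs_of_nonneg (by linarith : 0 ≤ x - s), abs_of_nonneg (by linarith : 0 ≤ x - t)]
  refine mul_le_mul_of_nonneg_left ?_ (by linarith)
  set X := x - t with hX
  have hX0 : 0 < X := by simp only [hX]; linarith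
  have hd : 0 ≤ (t - s) / X := div_nonneg (by linarith) hX0.le
  have h1 := rpow_one_add_le_one_add_mul_self (s := (t - s) / X) (p := α) (by linarith) hα0 hα
  have e : x - s = X * (1 + (t - s) / X) := by
    field_simp; simp only [hX]; ring
  rw [e, Real.mul_rpow hX0.le (by linarith)]
  have h2 := mul_le_mul_of_nonneg_left h1 (Real.rpow_nonneg hX0.le α)
  have h3 : X ^ (α - 1) = X ^ α / X := by rw [Real.rpow_sub_one hX0.ne']
  have h4 : X ^ (α - 1) ≤ g ^ (α - 1) := Real.rpow_le_rpow_of_nonpos hg (by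
    simp only [hX]; linarith) (by linarith)
  have h5 := mul_le_mul_of_nonneg_left h4 (mul_nonneg hα0 (by linarith : 0 ≤ t - s))
  rw [h3] at h5
  have : X ^ α * (1 + α * ((t - s) / X)) = X ^ α + α * (t - s) * (X ^ α / X) := by
    field_simp
  linarith

lemma gg_upper' (hA : 0 ≤ A) (hα0 : 0 ≤ α) (hα : α ≤ 1) (hst : s ≤ t) {g : ℝ} (hg : 0 < g)
    (hx : x + g ≤ s) : -(A / 2 * (α * (t - s) * g ^ (α - 1))) ≤ gg A α s t x := by
  rw [gg_reflect]
  have := gg_upper hA hα0 hα (s := -t) (t := -s) (x := -x) (by linarith) hg (by linarith)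
  rw [show -s - -t = t - s by ring] at this
  exact neg_le_neg this

lemma gg_nonneg (hA : 0 ≤ A) (hα0 : 0 ≤ α) (hst : s ≤ t) (hx : t ≤ x) :
    0 ≤ gg A α s t x := by
  unfold gg
  rw [abs_of_nonneg (by linarith : 0 ≤ x - s), abs_of_nonneg (by linarith : 0 ≤ x - t)]
  refine mul_nonneg (by linarith) (sub_nonneg.2 ?_)
  exact Real.rpow_le_rpow (by linarith) (by linarith) hα0

lemma gg_nonpos (hA : 0 ≤ A) (hα0 : 0 ≤ α) (hst : s ≤ t) (hx : x ≤ s) :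
    gg A α s t x ≤ 0 := by
  rw [gg_reflect]
  exact neg_nonpos.2 (gg_nonneg hA hα0 (by linarith) (by linarith))

lemma cv_nonpos (hA : 0 ≤ A) (hα0 : 0 ≤ α) (hα : α ≤ 1) {s' t' : ℝ} (hst : s ≤ t) (hst' : s' ≤ t')
    (h : t ≤ s' ∨ t' ≤ s) : cv A α s t s' t' ≤ 0 := by
  rcases h with h | h
  · exact sub_nonpos.2 (gg_anti hA hα0 hα hst h hst')
  · exact sub_nonpos.2 (gg_anti' hA hα0 hα hst h hst')

end cov

/-- Fractional Brownian motion with prescribed constant. -/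
structure IsF {Ω : Type*} [MeasurableSpace Ω] (H A : ℝ) (P : Measure Ω) (B : ℝ → Ω → ℝ) : Prop where
  cont : ∀ ω, Continuous fun t => B t ω
  zero : ∀ ω, B 0 ω = 0
  meas : ∀ t, Measurable (B t)
  gauss : ∀ (n : ℕ) (t : Fin n → ℝ) (c : Fin n → ℝ), ∃ v : ℝ≥0,
      Measure.map (fun ω => ∑ i, c i * B (t i) ω) P = gaussianReal 0 v
  pos : 0 < A
  var : ∀ s t : ℝ, ∫ ω, (B t ω - B s ω) ^ 2 ∂P = A * |t - s| ^ (2 * H)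

set_option linter.unusedSectionVars false
section fbm
variable {Ω : Type*} [MeasurableSpace Ω] {H A : ℝ} {P : Measure Ω} [IsProbabilityMeasure P]
  {B : ℝ → Ω → ℝ}

lemma IsF.gauss' (hB : IsF H A P B) {ι : Type*} [Fintype ι] (t c : ι → ℝ) : ∃ v : ℝ≥0,
    Measure.map (fun ω => ∑ i, c i * B (t i) ω) P = gaussianReal 0 v := by
  obtain ⟨v, hv⟩ := hB.gauss (Fintype.card ι) (t ∘ (Fintype.equivFin ι).symm)
    (c ∘ (Fintype.equivFin ι).symm)
  refine ⟨v, ?_⟩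
  rw [← hv]
  congr 1
  ext ω
  exact (Equiv.sum_comp (Fintype.equivFin ι).symm (fun i => c i * B (t i) ω)).symm

lemma gauss_sq {X : Ω → ℝ} (hX : Measurable X) {v : ℝ≥0} (h : P.map X = gaussianReal 0 v) :
    Integrable (fun ω => X ω ^ 2) P ∧ ∫ ω, X ω ^ 2 ∂P = v := by
  have h1 : MemLp (id : ℝ → ℝ) 2 (gaussianReal 0 v) := memLp_id_gaussianReal 2
  constructor
  · have := h1.integrable_sq
    rw [← h] at this
    exact this.comp_measurable hX
  · have h2 := variance_id_gaussianReal (μ := 0) (v := v)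
    rw [variance_of_integral_eq_zero aemeasurable_id (by simp [integral_id_gaussianReal])] at h2
    rw [← h] at h2
    rw [integral_map hX.aemeasurable (by fun_prop)] at h2
    exact h2

lemma IsF.incr_gauss (hB : IsF H A P B) {κ : Type*} [Fintype κ] (s t u : κ → ℝ) : ∃ v : ℝ≥0,
    Measure.map (fun ω => ∑ k, u k * (B (t k) ω - B (s k) ω)) P = gaussianReal 0 v := by
  obtain ⟨v, hv⟩ := hB.gauss' (ι := κ ⊕ κ) (Sum.elim t s) (Sum.elim u (fun k => - u k))
  refine ⟨v, ?_⟩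
  rw [← hv]
  congr 1
  ext ω
  simp only [Fintype.sum_sum_type, Sum.elim_inl, Sum.elim_inr, ← Finset.sum_add_distrib]
  refine Finset.sum_congr rfl fun k _ => by ring

lemma IsF.int_sq (hB : IsF H A P B) (s t : ℝ) : Integrable (fun ω => (B t ω - B s ω) ^ 2) P := by
  obtain ⟨v, hv⟩ := hB.incr_gauss (κ := Unit) (fun _ => s) (fun _ => t) (fun _ => 1)
  simp at hv
  exact (gauss_sq ((hB.meas t).sub (hB.meas s)) hv).1

lemma IsF.cov (hB : IsF H A P B) (s t s' t' : ℝ) :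
    Integrable (fun ω => (B t ω - B s ω) * (B t' ω - B s' ω)) P ∧
    ∫ ω, (B t ω - B s ω) * (B t' ω - B s' ω) ∂P = cv A (2 * H) s t s' t' := by
  have e : (fun ω => (B t ω - B s ω) * (B t' ω - B s' ω)) = fun ω =>
      (1 / 2 : ℝ) * (((B t' ω - B s ω) ^ 2 + (B s' ω - B t ω) ^ 2) - ((B t' ω - B t ω) ^ 2
        + (B s' ω - B s ω) ^ 2)) := by
    ext ω; ring
  have i1 : Integrable (fun ω => (B t' ω - B s ω) ^ 2 + (B s' ω - B t ω) ^ 2) P :=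
    (hB.int_sq _ _).add (hB.int_sq _ _)
  have i2 : Integrable (fun ω => (B t' ω - B t ω) ^ 2 + (B s' ω - B s ω) ^ 2) P :=
    (hB.int_sq _ _).add (hB.int_sq _ _)
  rw [e]
  refine ⟨(i1.sub i2).const_mul _, ?_⟩
  rw [integral_const_mul, integral_sub i1 i2, integral_add (hB.int_sq _ _) (hB.int_sq _ _),
    integral_add (hB.int_sq _ _) (hB.int_sq _ _), hB.var, hB.var, hB.var, hB.var]
  unfold cv gg; ring

/-- Law of a finite family of increments. -/
lemma IsF.isG (hB : IsF H A P B) {κ : Type*} [Fintype κ] (s t : κ → ℝ) :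
    IsG (P.map fun ω k => B (t k) ω - B (s k) ω)
      (fun u => ∑ i, ∑ j, cv A (2 * H) (s i) (t i) (s j) (t j) * u i * u j) := by
  intro u
  have hm : Measurable fun ω k => B (t k) ω - B (s k) ω :=
    measurable_pi_iff.2 fun k => (hB.meas _).sub (hB.meas _)
  rw [integral_map hm.aemeasurable (continuous_chr u).aestronglyMeasurable]
  obtain ⟨v, hv⟩ := hB.incr_gauss s t u
  have hXm : Measurable fun ω => ∑ k, u k * (B (t k) ω - B (s k) ω) :=
    Finset.measurable_sum _ fun k _ => ((hB.meas _).sub (hB.meas _)).const_mul _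
  have h2 := (gauss_sq hXm hv).2
  have h3 : (v : ℝ) = ∑ i, ∑ j, cv A (2 * H) (s i) (t i) (s j) (t j) * u i * u j := by
    rw [← h2]
    have e : ∀ ω, (∑ k, u k * (B (t k) ω - B (s k) ω)) ^ 2 = ∑ i, ∑ j, u i * u j *
        ((B (t i) ω - B (s i) ω) * (B (t j) ω - B (s j) ω)) := by
      intro ω
      rw [sq, Finset.sum_mul_sum]
      refine Finset.sum_congr rfl fun i _ => Finset.sum_congr rfl fun j _ => by ring
    simp_rw [e]
    have ii : ∀ i j, Integrable (fun ω => u i * u j *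
        ((B (t i) ω - B (s i) ω) * (B (t j) ω - B (s j) ω))) P := fun i j => (hB.cov _ _ _ _).1.const_mul _
    rw [integral_finsetSum _ fun i _ => integrable_finsetSum _ fun j _ => ii i j]
    refine Finset.sum_congr rfl fun i _ => ?_
    rw [integral_finsetSum _ fun j _ => ii i j]
    refine Finset.sum_congr rfl fun j _ => ?_
    rw [integral_const_mul, (hB.cov _ _ _ _).2]; ring
  have h4 : ∫ ω, Complex.exp (((∑ k, u k * (B (t k) ω - B (s k) ω) : ℝ) : ℂ) * Complex.I) ∂P =
      charFun (gaussianReal 0 v) 1 := by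
    rw [← hv, charFun_apply_real, integral_map hXm.aemeasurable (by fun_prop)]
    simp
  rw [h4, charFun_gaussianReal]
  simp only [← h3]
  congr 1
  push_cast
  simp
  ring

end fbm

end LC
end

section
namespace LC

/-! ### Skeleton functionals -/

/-- Dyadic skeleton points of `[s,s+t]`. -/
def pt (s t : ℝ) (K l : ℕ) : ℝ := s + t * (l / 2 ^ K)

lemma pt_zero (s t : ℝ) (K : ℕ) : pt s t K 0 = s := by simp [pt]
lemma pt_top (s t : ℝ) (K : ℕ) : pt s t K (2 ^ K) = s + t := by simp [pt]
lemma pt_lt {s t : ℝ} (ht : 0 < t) (K : ℕ) {l l' : ℕ} (h : l < l') : pt s t K l < pt s t K l' := by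
  unfold pt
  have : (l : ℝ) < l' := by exact_mod_cast h
  gcongr
lemma pt_mono {s t : ℝ} (ht : 0 < t) (K : ℕ) : Monotone (pt s t K) := 
  (strictMono_nat_of_lt_succ (f := pt s t K) fun l => pt_lt ht K (Nat.lt_succ_self l)).monotone
lemma le_pt {s t : ℝ} (ht : 0 < t) (K l : ℕ) : s ≤ pt s t K l :=
  (pt_zero s t K).symm.le.trans (pt_mono ht K (Nat.zero_le l))
lemma pt_le {s t : ℝ} (ht : 0 < t) (K : ℕ) {l : ℕ} (h : l ≤ 2 ^ K) : pt s t K l ≤ s + t := by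
  rw [← pt_top s t K]; exact pt_mono ht K h

/-- partial sums -/
def ps {n : ℕ} (x : Fin n → ℝ) (l : ℕ) : ℝ := ∑ i : Fin n, if (i : ℕ) < l then x i else 0

lemma measurable_ps (n l : ℕ) : Measurable fun x : Fin n → ℝ => ps x l := by
  unfold ps
  refine Finset.measurable_sum _ fun i _ => ?_
  split_ifs
  · exact measurable_pi_apply i
  · exact measurable_const

lemma ps_incr (f : ℕ → ℝ) {n l : ℕ} (h : l ≤ n) :
    ps (fun i : Fin n => f (i + 1) - f i) l = f l - f 0 := by
  unfold ps
  rw [Fin.sum_univ_eq_sum_range (fun i => if i < l then f (i + 1) - f i else 0) n,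
    ← Finset.sum_filter]
  have : Finset.filter (fun i => i < l) (Finset.range n) = Finset.range l := by
    ext i; simp; omega
  rw [this, Finset.sum_range_sub]

/-- crossing counts of the skeleton -/
def nn {n : ℕ} (x : Fin n → ℝ) (a : ℝ) : ℝ≥0∞ := alt (Iic n) (ps x) a (a + 1)

lemma measurable_nn {Ω : Type*} [MeasurableSpace Ω] (n : ℕ) {X : Ω → Fin n → ℝ} {a : Ω → ℝ}
    (hX : Measurable X) (ha : Measurable a) : Measurable fun ω => nn (X ω) (a ω) :=
  measurable_alt_nat (Iic n) (fun l ω => ps (X ω) l) a (fun ω => a ω + 1)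
    (fun l => (measurable_ps n l).comp hX) ha (ha.add_const 1)

/-- level crossing counts -/
def Nf (w : ℝ → ℝ) (s t a : ℝ) : ℝ≥0∞ := alt (Icc s (s + t)) w a (a + 1)

/-- integrated crossing counts -/
def Kb (w : ℝ → ℝ) (s t : ℝ) : ℝ≥0∞ := ∫⁻ a, Nf w s t a

/-- skeleton increments -/
def inc (w : ℝ → ℝ) (s t : ℝ) (K : ℕ) : Fin (2 ^ K) → ℝ := fun i => w (pt s t K (i + 1)) - w (pt s t K i)

lemma nn_inc (w : ℝ → ℝ) (s t : ℝ) (K : ℕ) (a : ℝ) :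
    nn (inc w s t K) a = alt (Iic (2 ^ K)) (fun l : ℕ => w (s + t * (l / 2 ^ K))) (a + w s) (a + w s + 1) := by
  have h1 : nn (inc w s t K) a = alt (Iic (2 ^ K)) (fun l : ℕ => w (s + t * (l / 2 ^ K)) - w s) a (a + 1) := by
    refine alt_congr fun x hx y hy => ?_
    have e : ∀ l ∈ Iic (2 ^ K), ps (inc w s t K) l = w (s + t * (l / 2 ^ K)) - w s := by
      intro l hl
      have := ps_incr (fun l => w (pt s t K l)) (n := 2 ^ K) (l := l) hl
      simp only [pt_zero] at this
      exact this
    rw [e x hx, e y hy]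
  rw [h1, alt_shift]
  congr 1; ring

lemma nn_inc_mono (w : ℝ → ℝ) (s t a : ℝ) : Monotone fun K => nn (inc w s t K) a := by
  simp_rw [nn_inc]
  exact alt_skel_mono w _ _ s t

lemma nn_inc_sup {w : ℝ → ℝ} (hw : Continuous w) (s : ℝ) {t : ℝ} (ht : 0 < t) (a : ℝ) :
    ⨆ K, nn (inc w s t K) a = Nf w s t (a + w s) := by
  simp_rw [nn_inc]
  rw [Nf, alt_eq_iSup_skel hw _ _ s ht]

/-- integrated skeleton counts -/
def nb {n : ℕ} (x : Fin n → ℝ) : ℝ≥0∞ := ∫⁻ a, nn x a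

lemma measurable_nb (n : ℕ) : Measurable (nb : (Fin n → ℝ) → ℝ≥0∞) := 
  Measurable.lintegral_prod_right' (f := fun p : (Fin n → ℝ) × ℝ => nn p.1 p.2)
    (measurable_nn n measurable_fst measurable_snd)

lemma nb_inc_mono (w : ℝ → ℝ) (s t : ℝ) : Monotone fun K => nb (inc w s t K) :=
  fun _ _ h => lintegral_mono fun a => nn_inc_mono w s t a h

lemma nb_inc_sup {w : ℝ → ℝ} (hw : Continuous w) (s : ℝ) {t : ℝ} (ht : 0 < t) :
    ⨆ K, nb (inc w s t K) = Kb w s t := by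
  unfold nb Kb
  rw [← lintegral_iSup (f := fun K a => nn (inc w s t K) a)
    (fun K => measurable_nn _ measurable_const measurable_id)
    (fun K L h a => nn_inc_mono w s t a h)]
  simp_rw [nn_inc_sup hw s ht]
  exact lintegral_add_right_eq_self (fun a => Nf w s t a) (w s)

set_option linter.unusedSectionVars false
section fbm
variable {Ω : Type*} [MeasurableSpace Ω] {H A : ℝ} {P : Measure Ω} [IsProbabilityMeasure P]
  {B : ℝ → Ω → ℝ}

/-- path -/
def pth (B : ℝ → Ω → ℝ) (ω : Ω) : ℝ → ℝ := fun r => B r ω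

lemma IsF.inc_meas (hB : IsF H A P B) (s t : ℝ) (K : ℕ) : Measurable fun ω => inc (pth B ω) s t K :=
  measurable_pi_iff.2 fun _ => (hB.meas _).sub (hB.meas _)

lemma IsF.Nf_meas (hB : IsF H A P B) (s : ℝ) {t : ℝ} (ht : 0 < t) {Ω' : Type*} [MeasurableSpace Ω']
    {π : Ω' → Ω} (hπ : Measurable π) {a : Ω' → ℝ} (ha : Measurable a) :
    Measurable fun ω => Nf (pth B (π ω)) s t (a ω) :=
  measurable_alt_Icc (fun r ω => B r (π ω)) s ht (fun ω => hB.cont (π ω)) a (fun ω => a ω + 1)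
    (fun l => (hB.meas l).comp hπ) ha (ha.add_const 1)

lemma IsF.Kb_meas (hB : IsF H A P B) (s : ℝ) {t : ℝ} (ht : 0 < t) :
    Measurable fun ω => Kb (pth B ω) s t :=
  Measurable.lintegral_prod_right' (f := fun p : Ω × ℝ => Nf (pth B p.1) s t p.2)
    (hB.Nf_meas s ht measurable_fst measurable_snd)

lemma IsF.lint_Kb (hB : IsF H A P B) (s : ℝ) {t : ℝ} (ht : 0 < t) :
    ∫⁻ ω, Kb (pth B ω) s t ∂P = ⨆ K, ∫⁻ x, nb x ∂(P.map fun ω => inc (pth B ω) s t K) := by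
  have : ∀ K, ∫⁻ x, nb x ∂(P.map fun ω => inc (pth B ω) s t K) = 
      ∫⁻ ω, nb (inc (pth B ω) s t K) ∂P := fun K =>
    lintegral_map (measurable_nb _) (hB.inc_meas s t K)
  simp_rw [this]
  rw [← lintegral_iSup (f := fun K ω => nb (inc (pth B ω) s t K)) (fun K => (measurable_nb _).comp (hB.inc_meas s t K))
    (fun K L h ω => nb_inc_mono _ s t h)]
  exact lintegral_congr fun ω => (nb_inc_sup (hB.cont ω) s ht).symm

lemma IsF.law (hB : IsF H A P B) {B' : ℝ → Ω → ℝ} (hB' : IsF H A P B') (s s' t : ℝ) (K : ℕ) :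
    (P.map fun ω => inc (pth B ω) s t K) = P.map fun ω => inc (pth B' ω) s' t K := by
  have := Measure.isProbabilityMeasure_map (μ := P) (hB.inc_meas s t K).aemeasurable
  have := Measure.isProbabilityMeasure_map (μ := P) (hB'.inc_meas s' t K).aemeasurable
  have h1 := hB.isG (κ := Fin (2 ^ K)) (fun i => pt s t K i) (fun i => pt s t K (i + 1))
  have h2 := hB'.isG (κ := Fin (2 ^ K)) (fun i => pt s' t K i) (fun i => pt s' t K (i + 1))
  have e : (fun u : Fin (2 ^ K) → ℝ => ∑ i : Fin (2 ^ K), ∑ j : Fin (2 ^ K), cv A (2 * H) (pt s t K i) (pt s t K (i + 1))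
      (pt s t K j) (pt s t K (j + 1)) * u i * u j) = fun u => ∑ i : Fin (2 ^ K), ∑ j : Fin (2 ^ K), cv A (2 * H) (pt s' t K i)
      (pt s' t K (i + 1)) (pt s' t K j) (pt s' t K (j + 1)) * u i * u j := by
    funext u
    refine Finset.sum_congr rfl fun i _ => Finset.sum_congr rfl fun j _ => ?_
    unfold cv gg pt
    simp only [add_sub_add_left_eq_sub]
  rw [← e] at h2
  exact IsG.unique h1 h2

lemma IsF.lint_Kb_eq (hB : IsF H A P B) {B' : ℝ → Ω → ℝ} (hB' : IsF H A P B') (s s' : ℝ) {t : ℝ} 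
    (ht : 0 < t) : ∫⁻ ω, Kb (pth B ω) s t ∂P = ∫⁻ ω, Kb (pth B' ω) s' t ∂P := by
  rw [hB.lint_Kb s ht, hB'.lint_Kb s' ht]
  simp_rw [hB.law hB' s s' t]

end fbm

end LC
end

section
namespace LC
set_option linter.unusedSectionVars false

/-! ### Decorrelation and smoothing -/

lemma sum_cv (A α p q s t : ℝ) (K : ℕ) :
    ∑ l : Fin (2 ^ K), cv A α p q (pt s t K l) (pt s t K (l + 1)) =
      gg A α p q (s + t) - gg A α p q s := by
  unfold cv
  rw [Fin.sum_univ_eq_sum_range (fun l => gg A α p q (pt s t K (l + 1)) - gg A α p q (pt s t K l)) (2 ^ K),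
    Finset.sum_range_sub (fun l => gg A α p q (pt s t K l)), pt_zero, pt_top]

lemma cv_pt_nonpos {A α : ℝ} (hA : 0 ≤ A) (hα0 : 0 ≤ α) (hα : α ≤ 1) (s : ℝ) {t : ℝ} (ht : 0 < t) (K : ℕ)
    {i j : Fin (2 ^ K)} (h : i ≠ j) :
    cv A α (pt s t K i) (pt s t K (i + 1)) (pt s t K j) (pt s t K (j + 1)) ≤ 0 := by
  refine cv_nonpos hA hα0 hα (pt_mono ht K (Nat.le_succ _)) (pt_mono ht K (Nat.le_succ _)) ?_
  rcases lt_or_gt_of_ne h with h | h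
  · exact Or.inl (pt_mono ht K h)
  · exact Or.inr (pt_mono ht K h)

section fbm
variable {Ω : Type*} [MeasurableSpace Ω] {H A : ℝ} {P : Measure Ω} [IsProbabilityMeasure P]
  {B : ℝ → Ω → ℝ}

lemma IsF.cont' (hB : IsF H A P B) (ω : Ω) : Continuous (pth B ω) := hB.cont ω

/-- far pair bound on a skeleton -/
lemma IsF.far_skel (hB : IsF H A P B) (hH0 : 0 < H) (hH : H < 1 / 2) {s s' t g : ℝ} (ht : 0 < t) (hg : 0 < g)
    (hs : s + t + g ≤ s') (N : ℕ) (hN : (N + 1) * g ^ (2 * H - 1) ≤ 2 * t ^ (2 * H - 1)) (K : ℕ) :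
    ∫⁻ ω, nb (inc (pth B ω) s t K) * nb (inc (pth B ω) s' t K) ∂P ≤
      (∫⁻ ω, nb (inc (pth B ω) s t K) ∂P) * (∫⁻ ω, nb (inc (pth B ω) s' t K) ∂P) +
      ENNReal.ofReal (1 / (2 * (N + 1))) * (∫⁻ ω, nb (inc (pth B ω) s t K) ^ 2 ∂P +
        ∫⁻ ω, nb (inc (pth B ω) s' t K) ^ 2 ∂P) := by
  have hA := hB.pos.le
  have hα0 : 0 ≤ 2 * H := by linarith
  have hα : 2 * H ≤ 1 := by linarith
  set lo : Fin (2 ^ K) ⊕ Fin (2 ^ K) → ℝ := Sum.elim (fun i => pt s t K i) (fun i => pt s' t K i) with hlo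
  set hi : Fin (2 ^ K) ⊕ Fin (2 ^ K) → ℝ :=
    Sum.elim (fun i => pt s t K (i + 1)) (fun i => pt s' t K (i + 1)) with hhi
  have hG := hB.isG lo hi
  set S : Fin (2 ^ K) ⊕ Fin (2 ^ K) → Fin (2 ^ K) ⊕ Fin (2 ^ K) → ℝ :=
    fun i j => cv A (2 * H) (lo i) (hi i) (lo j) (hi j) with hS
  set S' : Fin (2 ^ K) ⊕ Fin (2 ^ K) → Fin (2 ^ K) ⊕ Fin (2 ^ K) → ℝ :=
    fun i j => if i.isLeft = j.isLeft then S i j / (N + 1) else S i j with hS'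
  have hN1 : (0 : ℝ) < N + 1 := by positivity
  have hSs : ∀ i j, S i j = S j i := fun i j => cv_symm _ _
  have hoff : ∀ i j, i ≠ j → S i j ≤ 0 := by
    rintro (i | i) (j | j) hij
    · exact cv_pt_nonpos hA hα0 hα s ht K (fun h => hij (by rw [h]))
    · exact cv_nonpos hA hα0 hα (pt_mono ht K (Nat.le_succ _)) (pt_mono ht K (Nat.le_succ _))
        (Or.inl ((pt_le ht K (Nat.succ_le_of_lt i.2)).trans (le_trans (by linarith) (le_pt ht K _))))
    · exact cv_nonpos hA hα0 hα (pt_mono ht K (Nat.le_succ _)) (pt_mono ht K (Nat.le_succ _))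
        (Or.inr ((pt_le ht K (Nat.succ_le_of_lt j.2)).trans (le_trans (by linarith) (le_pt ht K _))))
    · exact cv_pt_nonpos hA hα0 hα s' ht K (fun h => hij (by rw [h]))
  have key : ∀ δ : ℝ, 0 ≤ δ → A / 2 * (2 * H * δ * g ^ (2 * H - 1)) ≤
      2 * (A / 2 * (2 * H * δ * t ^ (2 * H - 1))) / (N + 1) := by
    intro δ hδ
    rw [le_div_iff₀ hN1]
    have := mul_le_mul_of_nonneg_left hN (show 0 ≤ A / 2 * (2 * H * δ) by positivity)
    linarith
  obtain ⟨R, hR, hRG⟩ := exists_IsG (S := S') (by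
      intro i j
      simp only [hS', hSs i j, eq_comm]) (by
      intro i j hij
      simp only [hS']
      split_ifs
      · exact div_nonpos_of_nonpos_of_nonneg (hoff i j hij) hN1.le
      · exact hoff i j hij) (by
      rintro (i | i)
      · rw [Fintype.sum_sum_type]
        simp only [hS', hS, hlo, hhi, Sum.elim_inl, Sum.elim_inr, Sum.isLeft_inl, Sum.isLeft_inr, if_true,
          Bool.true_eq_false, if_false]
        rw [← Finset.sum_div, sum_cv, sum_cv]
        have hlt : pt s t K i < pt s t K (i + 1) := pt_lt ht K (Nat.lt_succ_self _)
        have h0 := le_pt (s := s) ht K i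
        have h1 := pt_le (s := s) ht K (Nat.succ_le_of_lt i.2)
        have a1 := gg_lower hA hα0 hα hlt h1 (L := t) (by linarith)
        have a2 := gg_lower' hA hα0 hα hlt h0 (L := t) (by linarith)
        have a3 := gg_nonneg hA hα0 hlt.le (x := s' + t) (by linarith)
        have a4 := gg_upper hA hα0 hα hlt.le hg (x := s') (by linarith)
        have a5 := key _ (sub_nonneg.2 hlt.le)
        have a6 := div_le_div_of_nonneg_right (sub_le_sub a1 a2) hN1.le
        have a7 := a5.trans (le_trans (le_of_eq (by ring)) a6)
        linarith
      · rw [Fintype.sum_sum_type]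
        simp only [hS', hS, hlo, hhi, Sum.elim_inl, Sum.elim_inr, Sum.isLeft_inl, Sum.isLeft_inr, if_true,
          Bool.false_eq_true, if_false]
        rw [← Finset.sum_div, sum_cv, sum_cv]
        have hlt : pt s' t K i < pt s' t K (i + 1) := pt_lt ht K (Nat.lt_succ_self _)
        have h0 := le_pt (s := s') ht K i
        have h1 := pt_le (s := s') ht K (Nat.succ_le_of_lt i.2)
        have a1 := gg_lower hA hα0 hα hlt h1 (L := t) (by linarith)
        have a2 := gg_lower' hA hα0 hα hlt h0 (L := t) (by linarith)
        have a3 := gg_nonpos hA hα0 hlt.le (x := s) (by linarith)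
        have a4 := gg_upper' hA hα0 hα hlt.le hg (x := s + t) (by linarith)
        have a5 := key _ (sub_nonneg.2 hlt.le)
        have a6 := div_le_div_of_nonneg_right (sub_le_sub a1 a2) hN1.le
        have a7 := a5.trans (le_trans (le_of_eq (by ring)) a6)
        linarith)
  have hm : Measurable fun ω k => B (hi k) ω - B (lo k) ω :=
    measurable_pi_iff.2 fun _ => (hB.meas _).sub (hB.meas _)
  have := Measure.isProbabilityMeasure_map (μ := P) hm.aemeasurable
  have h := lemmaA hG hRG N (by
      intro c u
      rw [Finset.mul_sum]
      refine Finset.sum_congr rfl fun i _ => ?_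
      rw [Finset.mul_sum]
      refine Finset.sum_congr rfl fun j _ => ?_
      simp only [Pi.smul_apply, smul_eq_mul]; ring) (by
      intro u
      simp only [Fintype.sum_sum_type, hS', Sum.elim_inl, Sum.elim_inr, Sum.isLeft_inl, Sum.isLeft_inr, if_true,
          Bool.false_eq_true, Bool.true_eq_false, if_false, Pi.zero_apply, mul_zero, zero_mul,
          Finset.sum_const_zero, add_zero, zero_add, hS]
      have e : ∀ (f : Fin (2 ^ K) → Fin (2 ^ K) → ℝ) (u : Fin (2 ^ K) → ℝ),
        ∑ i, ∑ j, f i j / (N + 1) * u i * u j = (∑ i, ∑ j, f i j * u i * u j) / (N + 1) := by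
        intro f u
        rw [Finset.sum_div]
        refine Finset.sum_congr rfl fun i _ => ?_
        rw [Finset.sum_div]
        refine Finset.sum_congr rfl fun j _ => ?_
        ring
      simp only [Finset.sum_add_distrib]
      rw [e (fun i j => cv A (2 * H) (lo (Sum.inl i)) (hi (Sum.inl i)) (lo (Sum.inl j)) (hi (Sum.inl j))) (fun i => u (Sum.inl i)),
        e (fun i j => cv A (2 * H) (lo (Sum.inr i)) (hi (Sum.inr i)) (lo (Sum.inr j)) (hi (Sum.inr j))) (fun i => u (Sum.inr i))]
      field_simp
      ring) (F := nb) (measurable_nb _) (G := nb) (measurable_nb _)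
  have hl : Measurable fun x : Fin (2 ^ K) ⊕ Fin (2 ^ K) → ℝ => nb (fun i => x (Sum.inl i)) :=
    (measurable_nb _).comp (by fun_prop)
  have hr : Measurable fun x : Fin (2 ^ K) ⊕ Fin (2 ^ K) → ℝ => nb (fun i => x (Sum.inr i)) :=
    (measurable_nb _).comp (by fun_prop)
  rw [lintegral_map (show Measurable fun x : Fin (2 ^ K) ⊕ Fin (2 ^ K) → ℝ => nb (fun i => x (Sum.inl i)) *
    nb (fun i => x (Sum.inr i)) from hl.mul hr) hm, lintegral_map hl hm, lintegral_map hr hm,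
    lintegral_map (hl.pow_const 2) hm, lintegral_map (hr.pow_const 2) hm] at h
  exact h

lemma IsF.far (hB : IsF H A P B) (hH0 : 0 < H) (hH : H < 1 / 2) {s s' t g : ℝ} (ht : 0 < t) (hg : 0 < g)
    (hs : s + t + g ≤ s') (N : ℕ) (hN : (N + 1) * g ^ (2 * H - 1) ≤ 2 * t ^ (2 * H - 1)) :
    ∫⁻ ω, Kb (pth B ω) s t * Kb (pth B ω) s' t ∂P ≤
      (∫⁻ ω, Kb (pth B ω) s t ∂P) * (∫⁻ ω, Kb (pth B ω) s' t ∂P) +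
      ENNReal.ofReal (1 / (2 * (N + 1))) * (∫⁻ ω, Kb (pth B ω) s t ^ 2 ∂P +
        ∫⁻ ω, Kb (pth B ω) s' t ^ 2 ∂P) := by
  have e : ∀ ω, Kb (pth B ω) s t * Kb (pth B ω) s' t =
      ⨆ K, nb (inc (pth B ω) s t K) * nb (inc (pth B ω) s' t K) := fun ω => by
    rw [← nb_inc_sup (hB.cont' ω) s ht, ← nb_inc_sup (hB.cont' ω) s' ht]
    exact iSup_mul_mono (nb_inc_mono _ s t) (nb_inc_mono _ s' t)
  have hle : ∀ s K ω, nb (inc (pth B ω) s t K) ≤ Kb (pth B ω) s t := fun s K ω => by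
    rw [← nb_inc_sup (hB.cont' ω) s ht]
    exact le_iSup (fun K => nb (inc (pth B ω) s t K)) K
  simp_rw [e]
  rw [lintegral_iSup (f := fun K ω => nb (inc (pth B ω) s t K) * nb (inc (pth B ω) s' t K))
    (fun K => ((measurable_nb _).comp (hB.inc_meas s t K)).mul ((measurable_nb _).comp (hB.inc_meas s' t K)))
    (fun K L h ω => mul_le_mul' (nb_inc_mono _ s t h) (nb_inc_mono _ s' t h))]
  refine iSup_le fun K => (hB.far_skel hH0 hH ht hg hs N hN K).trans ?_
  gcongr <;> exact hle _ _ _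

/-- smoothing on a skeleton -/
def FK (w : ℝ → ℝ) (s s' t : ℝ) (K : ℕ) (z : ℝ) : ℝ≥0∞ :=
  ∫⁻ a, nn (inc w s t K) a * nn (inc w s' t K) (a - (w s' - w s) + z)

lemma FK_mono (w : ℝ → ℝ) (s s' t z : ℝ) : Monotone fun K => FK w s s' t K z := fun _ _ h =>
  lintegral_mono fun _ => mul_le_mul' (nn_inc_mono w s t _ h) (nn_inc_mono w s' t _ h)

lemma FK_sup {w : ℝ → ℝ} (hw : Continuous w) (s s' : ℝ) {t : ℝ} (ht : 0 < t) (z : ℝ) :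
    ⨆ K, FK w s s' t K z = ∫⁻ a, Nf w s t a * Nf w s' t (a + z) := by
  unfold FK
  rw [← lintegral_iSup (f := fun K a => nn (inc w s t K) a * nn (inc w s' t K) (a - (w s' - w s) + z))
    (fun K => (measurable_nn _ measurable_const measurable_id').mul
      (measurable_nn _ measurable_const (by fun_prop)))
    (fun K L h a => mul_le_mul' (nn_inc_mono w s t _ h) (nn_inc_mono w s' t _ h))]
  have : ∀ a, ⨆ K, nn (inc w s t K) a * nn (inc w s' t K) (a - (w s' - w s) + z) =
      Nf w s t (a + w s) * Nf w s' t (a + w s + z) := by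
    intro a
    rw [← iSup_mul_mono (nn_inc_mono w s t _) (nn_inc_mono w s' t _), nn_inc_sup hw s ht,
      nn_inc_sup hw s' ht]
    congr 2; ring
  simp_rw [this]
  exact lintegral_add_right_eq_self (fun a => Nf w s t a * Nf w s' t (a + z)) (w s)

lemma IsF.smooth_skel (hB : IsF H A P B) (hH0 : 0 < H) (hH : H < 1 / 2) {s s' t D : ℝ} (ht : 0 < t)
    (hD : t ≤ D) (hs : s + t + D ≤ s') {v : ℝ≥0} (hv : (v : ℝ) = A * H * D ^ (2 * H)) (z : ℝ) (K : ℕ) :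
    ∫⁻ ω, FK (pth B ω) s s' t K 0 ∂P ≤ ∫⁻ ω, FK (pth B ω) s s' t K z ∂P +
      ENNReal.ofReal (|z| / v) * ∫⁻ ω, nb (inc (pth B ω) s t K) * nb (inc (pth B ω) s' t K) ∂P := by
  have hA := hB.pos.le
  have hα0 : 0 ≤ 2 * H := by linarith
  have hα : 2 * H ≤ 1 := by linarith
  have hD0 : 0 < D := by linarith
  have hv0 : v ≠ 0 := by
    intro h
    have : (0 : ℝ) < v := by rw [hv]; have := hB.pos; positivity
    rw [h] at this; simp at this
  set lo : Fin (2 ^ K) ⊕ (Fin (2 ^ K) ⊕ Unit) → ℝ := Sum.elim (fun i => pt s t K i)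
    (Sum.elim (fun i => pt s' t K i) (fun _ => s + t)) with hlo
  set hi : Fin (2 ^ K) ⊕ (Fin (2 ^ K) ⊕ Unit) → ℝ :=
    Sum.elim (fun i => pt s t K (i + 1)) (Sum.elim (fun i => pt s' t K (i + 1)) (fun _ => s')) with hhi
  have hG := hB.isG lo hi
  set mid : Fin (2 ^ K) ⊕ (Fin (2 ^ K) ⊕ Unit) := Sum.inr (Sum.inr ()) with hmid
  set S : Fin (2 ^ K) ⊕ (Fin (2 ^ K) ⊕ Unit) → Fin (2 ^ K) ⊕ (Fin (2 ^ K) ⊕ Unit) → ℝ :=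
    fun i j => cv A (2 * H) (lo i) (hi i) (lo j) (hi j) with hS
  set S' : Fin (2 ^ K) ⊕ (Fin (2 ^ K) ⊕ Unit) → Fin (2 ^ K) ⊕ (Fin (2 ^ K) ⊕ Unit) → ℝ :=
    fun i j => S i j - (if i = mid then (if j = mid then (v : ℝ) else 0) else 0) with hS'
  have hSs : ∀ i j, S i j = S j i := fun i j => cv_symm _ _
  have hlh : ∀ i, lo i < hi i := by
    rintro (i | i | i)
    · exact pt_lt ht K (Nat.lt_succ_self _)
    · exact pt_lt ht K (Nat.lt_succ_self _)
    · simp only [hlo, hhi, Sum.elim_inr]; linarith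
  have hslo : ∀ i, s ≤ lo i := by
    rintro (i | i | i)
    · exact le_pt ht K _
    · exact le_trans (by linarith) (le_pt (s := s') ht K _)
    · simp only [hlo, Sum.elim_inr]; linarith
  have hhis : ∀ i, hi i ≤ s' + t := by
    rintro (i | i | i)
    · exact (pt_le ht K (Nat.succ_le_of_lt i.2)).trans (by linarith)
    · exact pt_le ht K (Nat.succ_le_of_lt i.2)
    · simp only [hhi, Sum.elim_inr]; linarith
  have hoff : ∀ i j, i ≠ j → S i j ≤ 0 := by
    rintro (i | i | i) (j | j | j) hij
    · exact cv_pt_nonpos hA hα0 hα s ht K (fun h => hij (by rw [h]))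
    · exact cv_nonpos hA hα0 hα (hlh _).le (hlh _).le
        (Or.inl ((pt_le ht K (Nat.succ_le_of_lt i.2)).trans (le_trans (by linarith) (le_pt ht K _))))
    · exact cv_nonpos hA hα0 hα (hlh _).le (hlh _).le
        (Or.inl ((pt_le ht K (Nat.succ_le_of_lt i.2))))
    · exact cv_nonpos hA hα0 hα (hlh _).le (hlh _).le
        (Or.inr ((pt_le ht K (Nat.succ_le_of_lt j.2)).trans (le_trans (by linarith) (le_pt ht K _))))
    · exact cv_pt_nonpos hA hα0 hα s' ht K (fun h => hij (by rw [h]))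
    · exact cv_nonpos hA hα0 hα (hlh _).le (hlh _).le (Or.inr (le_pt ht K _))
    · exact cv_nonpos hA hα0 hα (hlh _).le (hlh _).le
        (Or.inr ((pt_le ht K (Nat.succ_le_of_lt j.2))))
    · exact cv_nonpos hA hα0 hα (hlh _).le (hlh _).le (Or.inl (le_pt ht K _))
    · exact absurd rfl hij
  have hrowS : ∀ i, ∑ j, S i j = gg A (2 * H) (lo i) (hi i) (s' + t) - gg A (2 * H) (lo i) (hi i) s := by
    intro i
    rw [Fintype.sum_sum_type, Fintype.sum_sum_type]
    simp only [hS, hlo, hhi, Sum.elim_inl, Sum.elim_inr, sum_cv]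
    simp [cv]
  obtain ⟨R, hR, hRG⟩ := exists_IsG (S := S') (by
      intro i j
      simp only [hS', hSs i j]
      congr 1
      split_ifs <;> rfl) (by
      intro i j hij
      simp only [hS']
      have h1 := hoff i j hij
      have : (0 : ℝ) ≤ v := v.2
      split_ifs <;> linarith) (by
      intro i
      have e : ∑ j, S' i j = ∑ j, S i j - (if i = mid then (v : ℝ) else 0) := by
        simp only [hS', Finset.sum_sub_distrib]
        congr 1
        split_ifs with h <;> simp
      rw [e, hrowS]
      have a3 := gg_nonneg hA hα0 (hlh i).le (hhis i)
      have a4 := gg_nonpos hA hα0 (hlh i).le (hslo i)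
      split_ifs with h
      · rw [h]
        set D0 := s' - (s + t) with hD0'
        have b1 := gg_lower hA hα0 hα (s := s + t) (t := s') (x := s' + t) (L := 2 * D0) (by linarith) (by linarith) (by linarith)
        have b2 := gg_lower' hA hα0 hα (s := s + t) (t := s') (x := s) (L := 2 * D0) (by linarith) (by linarith) (by linarith)
        have hDD : 0 < D0 := by linarith
        have b3 : (D : ℝ) ^ (2 * H) ≤ D0 ^ (2 * H) := Real.rpow_le_rpow hD0.le (by linarith) hα0
        have b4 : D0 ^ (2 * H) / 2 ≤ D0 * (2 * D0) ^ (2 * H - 1) := by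
          rw [Real.mul_rpow (by norm_num) hDD.le]
          have c1 : D0 ^ (2 * H) = D0 * D0 ^ (2 * H - 1) := by
            rw [Real.rpow_sub_one hDD.ne']; field_simp
          have c2 : (2 : ℝ)⁻¹ ≤ 2 ^ (2 * H - 1) := by
            rw [← Real.rpow_neg_one]
            exact Real.rpow_le_rpow_of_exponent_le (by norm_num) (by linarith)
          have c3 : 0 ≤ D0 ^ (2 * H) := by positivity
          calc D0 ^ (2 * H) / 2 = 2⁻¹ * D0 ^ (2 * H) := by ring
            _ ≤ 2 ^ (2 * H - 1) * D0 ^ (2 * H) := by gcongr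
            _ = _ := by rw [c1]; ring
        have b5 : (v : ℝ) ≤ 2 * (A / 2 * (2 * H * (s' - (s + t)) * (2 * D0) ^ (2 * H - 1))) := by
          rw [hv]
          calc A * H * D ^ (2 * H) ≤ A * H * D0 ^ (2 * H) := by gcongr
            _ = 2 * A * H * (D0 ^ (2 * H) / 2) := by ring
            _ ≤ 2 * A * H * (D0 * (2 * D0) ^ (2 * H - 1)) := by gcongr
            _ = _ := by ring
        simp only [hmid, hlo, hhi, Sum.elim_inr]
        linarith
      · linarith)
  have hm : Measurable fun ω k => B (hi k) ω - B (lo k) ω :=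
    measurable_pi_iff.2 fun _ => (hB.meas _).sub (hB.meas _)
  have := Measure.isProbabilityMeasure_map (μ := P) hm.aemeasurable
  set G : (Fin (2 ^ K) ⊕ (Fin (2 ^ K) ⊕ Unit) → ℝ) → ℝ≥0∞ := fun x =>
    ∫⁻ a, nn (fun i => x (Sum.inl i)) a * nn (fun i => x (Sum.inr (Sum.inl i)))
      (a - ps (fun i => x (Sum.inl i)) (2 ^ K) - x mid) with hGdef
  have hInteg : Measurable fun p : (Fin (2 ^ K) ⊕ (Fin (2 ^ K) ⊕ Unit) → ℝ) × ℝ =>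
      nn (fun i => p.1 (Sum.inl i)) p.2 * nn (fun i => p.1 (Sum.inr (Sum.inl i)))
      (p.2 - ps (fun i => p.1 (Sum.inl i)) (2 ^ K) - p.1 mid) := by
    refine (measurable_nn _ (by fun_prop) measurable_snd).mul (measurable_nn _ (by fun_prop) ?_)
    have : Measurable fun p : (Fin (2 ^ K) ⊕ (Fin (2 ^ K) ⊕ Unit) → ℝ) × ℝ =>
      ps (fun i => p.1 (Sum.inl i)) (2 ^ K) := (measurable_ps _ _).comp (by fun_prop)
    fun_prop
  have hGm : Measurable G := Measurable.lintegral_prod_right' hInteg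
  have h := lemmaB hG hRG mid hv0 (by
    intro u
    simp only [hS', sub_mul, Finset.sum_sub_distrib]
    have : ∑ i, ∑ j, (if i = mid then (if j = mid then (v : ℝ) else 0) else 0) * u i * u j = v * u mid ^ 2 := by
      rw [Finset.sum_eq_single mid, Finset.sum_eq_single mid]
      · simp; ring
      · intro b _ hb; simp [hb]
      · simp
      · intro b _ hb; simp [hb]
      · simp
    rw [this]; ring) hGm (-z)
  have hsh : ∀ (x : Fin (2 ^ K) ⊕ (Fin (2 ^ K) ⊕ Unit) → ℝ) (ζ : ℝ), G (x + Pi.single mid ζ) = ∫⁻ a, nn (fun i => x (Sum.inl i)) a *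
      nn (fun i => x (Sum.inr (Sum.inl i))) (a - ps (fun i => x (Sum.inl i)) (2 ^ K) - x mid - ζ) := by
    intro x ζ
    simp [hGdef, hmid, sub_sub, add_assoc]
  have hps : ∀ ω, ps (fun i : Fin (2 ^ K) => B (hi (Sum.inl i)) ω - B (lo (Sum.inl i)) ω) (2 ^ K) =
      B (s + t) ω - B s ω := by
    intro ω
    have := ps_incr (fun l => pth B ω (pt s t K l)) (n := 2 ^ K) (l := 2 ^ K) le_rfl
    simp only [pt_zero, pt_top] at this
    exact this
  have hval : ∀ ω ζ, G ((fun k => B (hi k) ω - B (lo k) ω) + Pi.single mid (-ζ)) = FK (pth B ω) s s' t K ζ := by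
    intro ω ζ
    rw [hsh, FK]
    refine lintegral_congr fun a => ?_
    rw [hps]
    simp only [hlo, hhi, hmid, Sum.elim_inl, Sum.elim_inr]
    congr 2
    simp only [pth]; ring
  have hval0 : ∀ ω, G (fun k => B (hi k) ω - B (lo k) ω) = FK (pth B ω) s s' t K 0 := by
    intro ω
    rw [← hval]; simp
  have hdbl : ∀ (x : Fin (2 ^ K) ⊕ (Fin (2 ^ K) ⊕ Unit) → ℝ), ∫⁻ ζ : ℝ, G (x + Pi.single mid ζ) = nb (fun i => x (Sum.inl i)) *
      nb (fun i => x (Sum.inr (Sum.inl i))) := by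
    intro x
    simp_rw [hsh]
    rw [lintegral_lintegral_swap]
    · have : ∀ a, ∫⁻ ζ : ℝ, nn (fun i => x (Sum.inl i)) a *
        nn (fun i => x (Sum.inr (Sum.inl i))) (a - ps (fun i => x (Sum.inl i)) (2 ^ K) - x mid - ζ) =
          nn (fun i => x (Sum.inl i)) a * nb (fun i => x (Sum.inr (Sum.inl i))) := by
        intro a
        rw [lintegral_const_mul _ (measurable_nn _ measurable_const (by fun_prop))]
        congr 1
        exact lintegral_sub_left_eq_self (fun b => nn (fun i => x (Sum.inr (Sum.inl i))) b) _
      simp_rw [this]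
      rw [lintegral_mul_const _ (measurable_nn _ measurable_const measurable_id')]
      rfl
    · exact ((measurable_nn _ measurable_const measurable_snd).mul
        (measurable_nn _ measurable_const (by fun_prop))).aemeasurable
  replace h : ∫⁻ x, G x ∂(P.map fun ω k => B (hi k) ω - B (lo k) ω) ≤
      ∫⁻ x, G (x + Pi.single mid (-z)) ∂(P.map fun ω k => B (hi k) ω - B (lo k) ω) +
      ENNReal.ofReal (|-z| / v) * ∫⁻ x, (∫⁻ ζ : ℝ, G (x + Pi.single mid ζ)) ∂(P.map fun ω k => B (hi k) ω - B (lo k) ω) := by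
    convert h
  simp_rw [hdbl] at h
  have hz : Measurable fun x : Fin (2 ^ K) ⊕ (Fin (2 ^ K) ⊕ Unit) → ℝ => G (x + Pi.single mid (-z)) :=
    hGm.comp (measurable_id.add_const _)
  have hl : Measurable fun x : Fin (2 ^ K) ⊕ (Fin (2 ^ K) ⊕ Unit) → ℝ => nb (fun i => x (Sum.inl i)) :=
    (measurable_nb _).comp (by fun_prop)
  have hr : Measurable fun x : Fin (2 ^ K) ⊕ (Fin (2 ^ K) ⊕ Unit) → ℝ => nb (fun i => x (Sum.inr (Sum.inl i))) :=
    (measurable_nb _).comp (by fun_prop)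
  rw [lintegral_map hGm hm, lintegral_map hz hm,
    lintegral_map (show Measurable fun x : Fin (2 ^ K) ⊕ (Fin (2 ^ K) ⊕ Unit) → ℝ => nb (fun i => x (Sum.inl i)) *
    nb (fun i => x (Sum.inr (Sum.inl i))) from hl.mul hr) hm] at h
  rw [lintegral_congr (fun ω => hval ω z), lintegral_congr hval0, abs_neg] at h
  exact h

lemma IsF.smooth (hB : IsF H A P B) (hH0 : 0 < H) (hH : H < 1 / 2) {s s' t D : ℝ} (ht : 0 < t)
    (hD : t ≤ D) (hs : s + t + D ≤ s') (z : ℝ) :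
    ∫⁻ ω, (∫⁻ a, Nf (pth B ω) s t a * Nf (pth B ω) s' t a) ∂P ≤
      ∫⁻ ω, (∫⁻ a, Nf (pth B ω) s t a * Nf (pth B ω) s' t (a + z)) ∂P +
      ENNReal.ofReal (|z| / (A * H * D ^ (2 * H))) * ∫⁻ ω, Kb (pth B ω) s t * Kb (pth B ω) s' t ∂P := by
  have hA := hB.pos
  have hD0 : 0 < D := by linarith
  have hle : ∀ s K ω, nb (inc (pth B ω) s t K) ≤ Kb (pth B ω) s t := fun s K ω => by
    rw [← nb_inc_sup (hB.cont' ω) s ht]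
    exact le_iSup (fun K => nb (inc (pth B ω) s t K)) K
  have e0 : ∀ ω, ∫⁻ a, Nf (pth B ω) s t a * Nf (pth B ω) s' t a = ⨆ K, FK (pth B ω) s s' t K 0 := by
    intro ω
    rw [FK_sup (hB.cont' ω) s s' ht]; simp
  have e1 : ∀ ω, ∫⁻ a, Nf (pth B ω) s t a * Nf (pth B ω) s' t (a + z) = ⨆ K, FK (pth B ω) s s' t K z := by
    intro ω
    rw [FK_sup (hB.cont' ω) s s' ht]
  simp_rw [e0, e1]
  have hm : ∀ K, Measurable fun ω => FK (pth B ω) s s' t K 0 := fun K =>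
    Measurable.lintegral_prod_right' (f := fun p : Ω × ℝ => nn (inc (pth B p.1) s t K) p.2 *
      nn (inc (pth B p.1) s' t K) (p.2 - (pth B p.1 s' - pth B p.1 s) + 0)) (by
        refine (measurable_nn _ ((hB.inc_meas s t K).comp measurable_fst) measurable_snd).mul
          (measurable_nn _ ((hB.inc_meas s' t K).comp measurable_fst) ?_)
        have h1 : Measurable fun p : Ω × ℝ => pth B p.1 s' := (hB.meas s').comp measurable_fst
        have h2 : Measurable fun p : Ω × ℝ => pth B p.1 s := (hB.meas s).comp measurable_fst
        exact (measurable_snd.sub (h1.sub h2)).add_const 0)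
  rw [lintegral_iSup (f := fun K ω => FK (pth B ω) s s' t K 0) hm (fun K L h ω => FK_mono _ s s' t 0 h)]
  refine iSup_le fun K => ?_
  have := hB.smooth_skel hH0 hH ht hD hs (v := ⟨A * H * D ^ (2 * H), by positivity⟩) rfl z K
  refine this.trans (add_le_add (lintegral_mono fun ω => le_iSup (fun K => FK (pth B ω) s s' t K z) K) ?_)
  change ENNReal.ofReal (|z| / (A * H * D ^ (2 * H))) * _ ≤ _
  gcongr <;> exact hle _ _ _

end fbm
end LC
end

section
namespace LC
set_option linter.unusedSectionVars false

/-! ### Moments -/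

lemma chain_det {w : ℝ → ℝ} (hw : Continuous w) (s : ℝ) {M ρ : ℝ} (hM : 0 ≤ M) (hρ0 : 0 < ρ) (hρ1 : ρ < 1)
    (h : ∀ k i : ℕ, i < 2 ^ k → |w (s + (i + 1 : ℕ) / 2 ^ k) - w (s + i / 2 ^ k)| ≤ M * ρ ^ k)
    {r : ℝ} (hr : r ∈ Icc s (s + 1)) (k : ℕ) :
    |w (s + (⌊(r - s) * 2 ^ k⌋₊ : ℕ) / 2 ^ k) - w r| ≤ M * ρ ^ k / (1 - ρ) := by
  have hx0 : 0 ≤ r - s := by linarith [hr.1]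
  have hx1 : r - s ≤ 1 := by linarith [hr.2]
  refine dist_le_of_le_geometric_of_tendsto ρ M (f := fun k : ℕ => w (s + (⌊(r - s) * 2 ^ k⌋₊ : ℕ) / 2 ^ k)) hρ1 ?_ ?_ k
  · intro k
    rw [dist_comm, Real.dist_eq]
    set j := ⌊(r - s) * 2 ^ k⌋₊ with hj
    have hj1 : (j : ℝ) ≤ (r - s) * 2 ^ k := Nat.floor_le (by positivity)
    have hj2 : (r - s) * 2 ^ k < j + 1 := Nat.lt_floor_add_one _
    have hl : 2 * j ≤ ⌊(r - s) * 2 ^ (k + 1)⌋₊ := by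
      apply Nat.le_floor; push_cast; rw [pow_succ]; linarith
    have hu : ⌊(r - s) * 2 ^ (k + 1)⌋₊ < 2 * j + 2 := by
      rw [Nat.floor_lt (by positivity)]; push_cast; rw [pow_succ]; linarith
    have hc : ⌊(r - s) * 2 ^ (k + 1)⌋₊ = 2 * j ∨ ⌊(r - s) * 2 ^ (k + 1)⌋₊ = 2 * j + 1 := by omega
    have e : s + (j : ℝ) / 2 ^ k = s + ((2 * j : ℕ) : ℝ) / 2 ^ (k + 1) := by
      push_cast; rw [pow_succ]; field_simp
    rw [e]
    rcases hc with hc | hc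
    · rw [hc]; simp; positivity
    · rw [hc]
      have hlt : 2 * j < 2 ^ (k + 1) := by
        have h3 : ((2 * j + 1 : ℕ) : ℝ) ≤ (r - s) * 2 ^ (k + 1) := by
          rw [← hc]; exact Nat.floor_le (by positivity)
        have h4 : (r - s) * 2 ^ (k + 1) ≤ 2 ^ (k + 1) := by
          have : (0 : ℝ) < 2 ^ (k + 1) := by positivity
          nlinarith
        have h5 : ((2 * j + 1 : ℕ) : ℝ) ≤ ((2 ^ (k + 1) : ℕ) : ℝ) := by push_cast at *; linarith
        have : 2 * j + 1 ≤ 2 ^ (k + 1) := by exact_mod_cast h5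
        omega
      refine (h (k + 1) (2 * j) hlt).trans ?_
      rw [pow_succ]
      have : 0 ≤ M * ρ ^ k := by positivity
      nlinarith
  · refine (hw.tendsto r).comp ?_
    have h1 : Tendsto (fun k : ℕ => (1 / 2 : ℝ) ^ k) atTop (𝓝 0) :=
      tendsto_pow_atTop_nhds_zero_of_lt_one (by norm_num) (by norm_num)
    have h2 : Tendsto (fun k : ℕ => r - (1 / 2 : ℝ) ^ k) atTop (𝓝 r) := by
      simpa using tendsto_const_nhds.sub h1
    refine tendsto_of_tendsto_of_tendsto_of_le_of_le h2 tendsto_const_nhds ?_ ?_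
    · intro k
      have hj2 : (r - s) * 2 ^ k < (⌊(r - s) * 2 ^ k⌋₊ : ℕ) + 1 := Nat.lt_floor_add_one _
      have hp : (0 : ℝ) < 2 ^ k := by positivity
      simp only
      rw [one_div, inv_pow]
      have : (r - s) ≤ ((⌊(r - s) * 2 ^ k⌋₊ : ℕ) + 1) / 2 ^ k := by
        rw [le_div_iff₀ hp]; exact hj2.le
      rw [add_div, one_div] at this
      linarith
    · intro k
      have hj1 : ((⌊(r - s) * 2 ^ k⌋₊ : ℕ) : ℝ) ≤ (r - s) * 2 ^ k := Nat.floor_le (by positivity)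
      have hp : (0 : ℝ) < 2 ^ k := by positivity
      have : ((⌊(r - s) * 2 ^ k⌋₊ : ℕ) : ℝ) / 2 ^ k ≤ r - s := by
        rw [div_le_iff₀ hp]; exact hj1
      simp only
      linarith

lemma cell_count {w : ℝ → ℝ} (hw : Continuous w) (s : ℝ) {M ρ : ℝ} (hM : 0 ≤ M) (hρ0 : 0 < ρ) (hρ1 : ρ < 1)
    (h : ∀ k i : ℕ, i < 2 ^ k → |w (s + (i + 1 : ℕ) / 2 ^ k) - w (s + i / 2 ^ k)| ≤ M * ρ ^ k) (k : ℕ)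
    (hk : 2 * (M * ρ ^ k / (1 - ρ)) ≤ 1) (a : ℝ) :
    alt (Icc s (s + 1)) w a (a + 1) ≤ ((2 ^ k : ℕ) : ℝ≥0∞) := by
  refine alt_le_of_idx (fun x => ⌊(x - s) * 2 ^ k⌋₊) _ ?_ ?_
  · intro x hx y hy hxy hr
    have hle : ⌊(x - s) * 2 ^ k⌋₊ ≤ ⌊(y - s) * 2 ^ k⌋₊ := by gcongr
    refine lt_of_le_of_ne hle fun he => ?_
    have h1 := chain_det hw s hM hρ0 hρ1 h hx k
    have h2 := chain_det hw s hM hρ0 hρ1 h hy k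
    rw [he] at h1
    rw [abs_le] at h1 h2
    rcases hr with hr | hr <;> linarith [hr.1, hr.2]
  · intro y hy
    apply Nat.floor_le_of_le
    have : (0 : ℝ) < 2 ^ k := by positivity
    push_cast
    nlinarith [hy.2]

/-- dyadic increments functional -/
def Zs (p : ℕ) (w : ℝ → ℝ) (s : ℝ) : ℝ≥0∞ := ∑' k : ℕ, ∑ i ∈ Finset.range (2 ^ k),
  ENNReal.ofReal (16 ^ k * |w (s + (i + 1 : ℕ) / 2 ^ k) - w (s + i / 2 ^ k)| ^ p)

lemma Zs_bound {p : ℕ} (hp : 4 ≤ p) : ∃ C : ℝ, 0 ≤ C ∧ ∀ w : ℝ → ℝ, Continuous w → ∀ s : ℝ,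
    (∀ a, alt (Icc s (s + 1)) w a (a + 1) ^ (4 : ℕ) ≤ 1 + ENNReal.ofReal C * Zs p w s) ∧
    ∀ r ∈ Icc s (s + 1), ENNReal.ofReal |w r - w s| ^ (4 : ℕ) ≤ 1 + ENNReal.ofReal C * Zs p w s := by
  have hp0 : p ≠ 0 := by omega
  have hpR : (0 : ℝ) < p := by positivity
  set ρ : ℝ := (1 / 16 : ℝ) ^ (1 / (p : ℝ)) with hρ
  have hρ0 : 0 < ρ := by positivity
  have hρ1 : ρ < 1 := Real.rpow_lt_one (by norm_num) (by norm_num) (by positivity)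
  have hρp : ρ ^ p = 1 / 16 := by
    rw [hρ, ← Real.rpow_natCast, ← Real.rpow_mul (by norm_num), one_div_mul_cancel hpR.ne', Real.rpow_one]
  have h1ρ : 0 < 1 - ρ := by linarith
  set C0 := 2 / (1 - ρ) with hC0
  have hC0p : 0 < C0 := by positivity
  refine ⟨16 * C0 ^ p, by positivity, ?_⟩
  intro w hw s
  by_cases hZ : Zs p w s = ⊤
  · have : 1 + ENNReal.ofReal (16 * C0 ^ p) * Zs p w s = ⊤ := by
      rw [hZ, ENNReal.mul_top (by simp; positivity)]; simp
    rw [this]; exact ⟨fun _ => le_top, fun _ _ => le_top⟩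
  set z := (Zs p w s).toReal with hz
  have hz0 : 0 ≤ z := ENNReal.toReal_nonneg
  have hZz : Zs p w s = ENNReal.ofReal z := (ENNReal.ofReal_toReal hZ).symm
  set M := z ^ (1 / (p : ℝ)) with hM
  have hM0 : 0 ≤ M := by positivity
  have hMp : M ^ p = z := by
    rw [hM, ← Real.rpow_natCast, ← Real.rpow_mul hz0, one_div_mul_cancel hpR.ne', Real.rpow_one]
  have hinc : ∀ k i : ℕ, i < 2 ^ k → |w (s + (i + 1 : ℕ) / 2 ^ k) - w (s + i / 2 ^ k)| ≤ M * ρ ^ k := by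
    intro k i hi
    set d := |w (s + (i + 1 : ℕ) / 2 ^ k) - w (s + i / 2 ^ k)| with hd
    have h1 : ENNReal.ofReal (16 ^ k * d ^ p) ≤ Zs p w s := by
      refine le_trans ?_ (ENNReal.le_tsum k)
      exact Finset.single_le_sum (f := fun i : ℕ => ENNReal.ofReal (16 ^ k * |w (s + (i + 1 : ℕ) / 2 ^ k) - w (s + i / 2 ^ k)| ^ p))
        (fun _ _ => bot_le) (Finset.mem_range.2 hi)
    rw [hZz, ENNReal.ofReal_le_ofReal_iff hz0] at h1
    refine le_of_pow_le_pow_left₀ hp0 (by positivity) ?_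
    rw [mul_pow, hMp, ← pow_mul, mul_comm k p, pow_mul, hρp, one_div, inv_pow, ← div_eq_mul_inv,
      le_div_iff₀ (by positivity)]
    linarith
  have hRHS : 1 + ENNReal.ofReal (16 * C0 ^ p) * Zs p w s = ENNReal.ofReal (1 + 16 * C0 ^ p * z) := by
    rw [hZz, ← ENNReal.ofReal_mul (by positivity), ← ENNReal.ofReal_one, ENNReal.ofReal_add (by norm_num) (by positivity)]
  rw [hRHS]
  constructor
  · intro a
    have hex : ∃ k : ℕ, C0 * M * ρ ^ k ≤ 1 := by
      have : Tendsto (fun k : ℕ => C0 * M * ρ ^ k) atTop (𝓝 (C0 * M * 0)) :=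
        (tendsto_pow_atTop_nhds_zero_of_lt_one hρ0.le hρ1).const_mul _
      rw [mul_zero] at this
      exact (this.eventually_le_const one_pos).exists
    have hk := Nat.find_spec hex
    have hmin := fun m => @Nat.find_min _ _ hex m
    set k := Nat.find hex with hkdef
    have h1 := cell_count hw s hM0 hρ0 hρ1 hinc k (by
      have : 2 * (M * ρ ^ k / (1 - ρ)) = C0 * M * ρ ^ k := by rw [hC0]; ring
      linarith) a
    have h2 : ((2 ^ k : ℕ) : ℝ≥0∞) ^ (4 : ℕ) ≤ ENNReal.ofReal (1 + 16 * C0 ^ p * z) := by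
      have : ((2 ^ k : ℕ) : ℝ≥0∞) ^ (4 : ℕ) = ENNReal.ofReal (16 ^ k) := by
        rw [← ENNReal.ofReal_natCast, ← ENNReal.ofReal_pow (by positivity)]
        congr 1
        push_cast
        rw [← pow_mul, mul_comm, pow_mul]; norm_num
      rw [this]
      apply ENNReal.ofReal_le_ofReal
      rcases Nat.eq_zero_or_pos k with h0 | h0
      · rw [h0]; simp; positivity
      · have h3 := hmin (k - 1) (by omega)
        rw [not_le] at h3
        have h4 : 1 ≤ (C0 * M * ρ ^ (k - 1)) ^ p := one_le_pow₀ h3.le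
        rw [mul_pow, mul_pow, hMp, ← pow_mul, mul_comm (k - 1) p, pow_mul, hρp, one_div, inv_pow,
          ← div_eq_mul_inv, le_div_iff₀ (by positivity), one_mul] at h4
        obtain ⟨j, hj⟩ : ∃ j, k = j + 1 := ⟨k - 1, by omega⟩
        rw [hj, Nat.add_sub_cancel] at h4
        rw [hj, pow_succ]; linarith
    exact (pow_le_pow_left' h1 4).trans h2
  · intro r hr
    rw [← ENNReal.ofReal_pow (abs_nonneg _)]
    apply ENNReal.ofReal_le_ofReal
    have h1 := chain_det hw s hM0 hρ0 hρ1 hinc hr 0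
    have hr1 : r - s ≤ 1 := by linarith [hr.2]
    rcases eq_or_lt_of_le hr1 with hr1 | hr1
    · have h0 := hinc 0 0 (by norm_num)
      simp only [zero_add, Nat.cast_one, pow_zero, div_one, Nat.cast_zero, zero_div, add_zero, mul_one] at h0
      have hrs : r = s + 1 := by linarith
      rw [hrs]
      have h2 : M ≤ C0 * M := by
        have : 1 ≤ C0 := by rw [hC0, le_div_iff₀ h1ρ]; linarith
        nlinarith
      have h3 : |w (s + 1) - w s| ≤ C0 * M := h0.trans h2
      have h4 : |w (s + 1) - w s| ^ 4 ≤ (C0 * M) ^ 4 := by gcongr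
      have h5 : (C0 * M) ^ 4 ≤ 1 + (C0 * M) ^ p := by
        have h6 : 0 ≤ C0 * M := by positivity
        rcases le_total (C0 * M) 1 with h7 | h7
        · have := pow_le_one₀ (n := 4) h6 h7
          have : 0 ≤ (C0 * M) ^ p := by positivity
          linarith
        · have := pow_le_pow_right₀ h7 hp; linarith
      rw [mul_pow C0 M p, hMp] at h5
      have : 0 ≤ C0 ^ p * z := by positivity
      linarith
    · have hf : ⌊(r - s) * 2 ^ 0⌋₊ = 0 := by
        rw [Nat.floor_eq_zero]; simpa using hr1
      rw [hf] at h1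
      simp only [pow_zero, mul_one, Nat.cast_zero, zero_div, add_zero] at h1
      rw [abs_sub_comm] at h1
      have h2 : M / (1 - ρ) ≤ C0 * M := by
        rw [hC0, div_mul_eq_mul_div]; gcongr; linarith
      have h3 : |w r - w s| ≤ C0 * M := h1.trans h2
      have h4 : |w r - w s| ^ 4 ≤ (C0 * M) ^ 4 := by gcongr
      have h5 : (C0 * M) ^ 4 ≤ 1 + (C0 * M) ^ p := by
        have h6 : 0 ≤ C0 * M := by positivity
        rcases le_total (C0 * M) 1 with h7 | h7
        · have := pow_le_one₀ (n := 4) h6 h7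
          have : 0 ≤ (C0 * M) ^ p := by positivity
          linarith
        · have := pow_le_pow_right₀ h7 hp; linarith
      rw [mul_pow C0 M p, hMp] at h5
      have : 0 ≤ C0 ^ p * z := by positivity
      linarith

section fbm
variable {Ω : Type*} [MeasurableSpace Ω] {H A : ℝ} {P : Measure Ω} [IsProbabilityMeasure P]
  {B : ℝ → Ω → ℝ}

lemma IsF.incr_law (hB : IsF H A P B) (s t : ℝ) :
    P.map (fun ω => B t ω - B s ω) = gaussianReal 0 (A * |t - s| ^ (2 * H)).toNNReal := by
  obtain ⟨v, hv⟩ := hB.incr_gauss (κ := Unit) (fun _ => s) (fun _ => t) (fun _ => 1)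
  simp at hv
  have := (gauss_sq ((hB.meas t).sub (hB.meas s)) hv).2
  have h2 := hB.var s t
  have h3 : (v : ℝ) = A * |t - s| ^ (2 * H) := by rw [← h2, ← this]; rfl
  rw [hv, ← h3, Real.toNNReal_coe]

lemma IsF.mom (hB : IsF H A P B) (p : ℕ) (s t : ℝ) :
    ∫⁻ ω, ENNReal.ofReal (|B t ω - B s ω| ^ p) ∂P =
      ENNReal.ofReal ((|t - s| ^ H) ^ p) * ∫⁻ x, ENNReal.ofReal (|x| ^ p) ∂(gaussianReal 0 A.toNNReal) := by
  have hA := hB.pos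
  have hm : Measurable fun x : ℝ => ENNReal.ofReal (|x| ^ p) := by fun_prop
  have h1 : ∫⁻ ω, ENNReal.ofReal (|B t ω - B s ω| ^ p) ∂P =
      ∫⁻ x, ENNReal.ofReal (|x| ^ p) ∂(P.map (fun ω => B t ω - B s ω)) := 
    (lintegral_map hm ((hB.meas t).sub (hB.meas s))).symm
  have h2 : gaussianReal 0 (A * |t - s| ^ (2 * H)).toNNReal =
      (gaussianReal 0 A.toNNReal).map (fun x => |t - s| ^ H * x) := by
    rw [gaussianReal_map_const_mul, mul_zero]
    congr 1
    ext
    rw [Real.coe_toNNReal _ (by positivity), NNReal.coe_mul, Real.coe_toNNReal _ hA.le]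
    change _ = (|t - s| ^ H) ^ 2 * A
    rw [mul_comm 2 H, Real.rpow_mul (abs_nonneg _)]
    norm_cast
    ring
  rw [h1, hB.incr_law, h2, lintegral_map hm (by fun_prop), ← lintegral_const_mul _ hm]
  refine lintegral_congr fun x => ?_
  rw [← ENNReal.ofReal_mul (by positivity), abs_mul, mul_pow, abs_of_nonneg (by positivity : 0 ≤ |t - s| ^ H)]

lemma mom_ne_top (p : ℕ) (hp : p ≠ 0) (v : ℝ≥0) : ∫⁻ x, ENNReal.ofReal (|x| ^ p) ∂(gaussianReal 0 v) ≠ ⊤ := by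
  have h := (memLp_id_gaussianReal (μ := 0) (v := v) (p : ℝ≥0))
  have h2 := (MemLp.integrable_norm_pow (p := p) (by exact_mod_cast h) hp)
  have h3 := h2.lintegral_lt_top
  simpa using h3.ne

lemma unit_mom (hH0 : 0 < H) : ∃ p : ℕ, 4 ≤ p ∧ ∃ C : ℝ≥0∞, C ≠ ⊤ ∧ ∀ B : ℝ → Ω → ℝ, IsF H A P B → ∀ s,
    Measurable (fun ω => Zs p (pth B ω) s) ∧ ∫⁻ ω, Zs p (pth B ω) s ∂P ≤ C := by
  obtain ⟨p, hp⟩ := exists_nat_ge (6 / H + 4)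
  have hp4 : 4 ≤ p := by
    have : (4 : ℝ) ≤ p := by have : 0 < 6 / H := by positivity
                             linarith
    exact_mod_cast this
  have hpH : 6 ≤ H * p := by
    have : 6 / H ≤ p := by linarith
    rw [div_le_iff₀ hH0] at this; linarith
  refine ⟨p, hp4, 2 * ∫⁻ x, ENNReal.ofReal (|x| ^ p) ∂(gaussianReal 0 A.toNNReal),
    ENNReal.mul_ne_top (by norm_num) (mom_ne_top p (by omega) _), ?_⟩
  intro B hB s
  have hm : ∀ (k i : ℕ), Measurable fun ω => ENNReal.ofReal (16 ^ k * |pth B ω (s + (i + 1 : ℕ) / 2 ^ k) - pth B ω (s + i / 2 ^ k)| ^ p) := by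
    intro k i
    have h1 := hB.meas (s + (i + 1 : ℕ) / 2 ^ k)
    have h2 := hB.meas (s + i / 2 ^ k)
    unfold pth
    fun_prop
  have hms : ∀ k : ℕ, Measurable fun ω => ∑ i ∈ Finset.range (2 ^ k),
      ENNReal.ofReal (16 ^ k * |pth B ω (s + (i + 1 : ℕ) / 2 ^ k) - pth B ω (s + i / 2 ^ k)| ^ p) := fun k =>
    Finset.measurable_sum _ fun i _ => hm k i
  refine ⟨Measurable.ennreal_tsum hms, ?_⟩
  unfold Zs
  rw [lintegral_tsum fun k => (hms k).aemeasurable]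
  set m := ∫⁻ x, ENNReal.ofReal (|x| ^ p) ∂(gaussianReal 0 A.toNNReal)
  have hk : ∀ k : ℕ, ∫⁻ ω, (∑ i ∈ Finset.range (2 ^ k),
      ENNReal.ofReal (16 ^ k * |pth B ω (s + (i + 1 : ℕ) / 2 ^ k) - pth B ω (s + i / 2 ^ k)| ^ p)) ∂P ≤
      (2⁻¹ : ℝ≥0∞) ^ k * m := by
    intro k
    rw [lintegral_finsetSum _ fun i _ => hm k i]
    have : ∀ i ∈ Finset.range (2 ^ k), ∫⁻ ω, ENNReal.ofReal (16 ^ k * |pth B ω (s + (i + 1 : ℕ) / 2 ^ k) - pth B ω (s + i / 2 ^ k)| ^ p) ∂P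
        ≤ ENNReal.ofReal ((1 / 4) ^ k) * m := by
      intro i _
      simp_rw [ENNReal.ofReal_mul (show (0 : ℝ) ≤ 16 ^ k by positivity)]
      rw [lintegral_const_mul' _ _ ENNReal.ofReal_ne_top]
      have := hB.mom p (s + i / 2 ^ k) (s + (i + 1 : ℕ) / 2 ^ k)
      unfold pth
      rw [this, ← mul_assoc, ← ENNReal.ofReal_mul (by positivity)]
      refine mul_le_mul' (ENNReal.ofReal_le_ofReal ?_) le_rfl
      have e : |s + ((i + 1 : ℕ) : ℝ) / 2 ^ k - (s + i / 2 ^ k)| = (1 / 2) ^ k := by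
        push_cast
        rw [show s + ((i : ℝ) + 1) / 2 ^ k - (s + i / 2 ^ k) = (1 / 2) ^ k by rw [one_div, inv_pow]; field_simp; ring]
        exact abs_of_nonneg (by positivity)
      rw [e, ← Real.rpow_mul_natCast (by positivity)]
      have h1 : ((1 / 2 : ℝ) ^ k) ^ (H * p) ≤ ((1 / 2 : ℝ) ^ k) ^ (6 : ℝ) :=
        Real.rpow_le_rpow_of_exponent_ge (by positivity) (pow_le_one₀ (by norm_num) (by norm_num)) hpH
      calc (16 : ℝ) ^ k * ((1 / 2 : ℝ) ^ k) ^ (H * p) ≤ 16 ^ k * ((1 / 2 : ℝ) ^ k) ^ (6 : ℝ) := by gcongr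
        _ = (1 / 4) ^ k := by
          rw [show (6 : ℝ) = ((6 : ℕ) : ℝ) by norm_num, Real.rpow_natCast, ← pow_mul, mul_comm k 6, pow_mul,
            ← mul_pow]; norm_num
    refine (Finset.sum_le_sum this).trans ?_
    rw [Finset.sum_const, Finset.card_range, nsmul_eq_mul, ← mul_assoc]
    refine mul_le_mul' (le_of_eq ?_) le_rfl
    rw [← ENNReal.ofReal_natCast, ← ENNReal.ofReal_mul (by positivity)]
    rw [show (2⁻¹ : ℝ≥0∞) = ENNReal.ofReal (1 / 2) by rw [one_div, ENNReal.ofReal_inv_of_pos (by norm_num)]; simp,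
      ← ENNReal.ofReal_pow (by norm_num)]
    congr 1
    push_cast
    rw [← mul_pow]; norm_num
  refine (ENNReal.tsum_le_tsum hk).trans ?_
  rw [ENNReal.tsum_mul_right, ENNReal.tsum_geometric, ENNReal.one_sub_inv_two, inv_inv]

/-- block moments -/
lemma block_mom (hH0 : 0 < H) : ∃ C : ℝ, 0 ≤ C ∧ ∀ B : ℝ → Ω → ℝ, IsF H A P B → ∀ (s : ℝ) (m : ℕ), 0 < m →
    ∃ Y : Ω → ℝ≥0∞, Measurable Y ∧ ∫⁻ ω, Y ω ^ (4 : ℕ) ∂P ≤ ENNReal.ofReal (C * m ^ 4) ∧ ∀ ω, (m : ℝ≥0∞) ≤ Y ω ∧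
      (∀ a, Nf (pth B ω) s m a ≤ Y ω) ∧ ∀ r ∈ Icc s (s + m), ENNReal.ofReal |B r ω - B s ω| ≤ Y ω := by
  obtain ⟨p, hp, C1, hC1, hu⟩ := unit_mom (Ω := Ω) (H := H) (A := A) (P := P) hH0
  obtain ⟨C2, hC2, hz⟩ := Zs_bound hp
  set C3 : ℝ≥0∞ := 8 * (2 + ENNReal.ofReal C2 * C1) with hC3
  have hC3t : C3 ≠ ⊤ := by
    refine ENNReal.mul_ne_top (by norm_num) (ENNReal.add_ne_top.2 ⟨by norm_num, ENNReal.mul_ne_top (by simp) hC1⟩)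
  refine ⟨C3.toReal, ENNReal.toReal_nonneg, ?_⟩
  intro B hB s m hm
  set y : ℕ → Ω → ℝ≥0∞ := fun i ω => (1 + ENNReal.ofReal C2 * Zs p (pth B ω) (s + i)) ^ (1 / 4 : ℝ) with hy
  have hy4 : ∀ i ω, y i ω ^ (4 : ℕ) = 1 + ENNReal.ofReal C2 * Zs p (pth B ω) (s + i) := by
    intro i ω
    rw [hy, ← ENNReal.rpow_natCast, ← ENNReal.rpow_mul]; norm_num
  have hym : ∀ i, Measurable (y i) := fun i =>
    (((hu B hB (s + i)).1.const_mul _).const_add 1).pow_const _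
  have hle : ∀ {x : ℝ≥0∞} {i : ℕ} {ω : Ω}, x ^ (4 : ℕ) ≤ 1 + ENNReal.ofReal C2 * Zs p (pth B ω) (s + i) → x ≤ y i ω := by
    intro x i ω h
    rw [← hy4] at h
    exact le_of_not_gt fun h' => absurd h (not_le.2 (ENNReal.pow_lt_pow_left (by norm_num) h'))
  refine ⟨fun ω => ∑ i ∈ Finset.range m, (y i ω + 1), Finset.measurable_sum _ fun i _ => (hym i).add_const 1, ?_, ?_⟩
  · have h1 : ∀ ω, (∑ i ∈ Finset.range m, (y i ω + 1)) ^ (4 : ℕ) ≤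
        (m : ℝ≥0∞) ^ (3 : ℕ) * ∑ i ∈ Finset.range m, 8 * (2 + ENNReal.ofReal C2 * Zs p (pth B ω) (s + i)) := by
      intro ω
      have := ENNReal.rpow_sum_le_const_mul_sum_rpow (Finset.range m) (fun i => y i ω + 1) (p := 4) (by norm_num)
      norm_num at this
      refine this.trans (mul_le_mul' le_rfl (Finset.sum_le_sum fun i _ => ?_))
      have h2 := ENNReal.rpow_sum_le_const_mul_sum_rpow (Finset.univ : Finset (Fin 2)) ![y i ω, 1] (p := 4) (by norm_num)
      simp only [Fin.sum_univ_two, Finset.card_univ, Fintype.card_fin, Matrix.cons_val_zero, Matrix.cons_val_one] at h2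
      norm_num at h2
      rw [hy4] at h2
      refine h2.trans (le_of_eq ?_)
      norm_num
      ring
    refine (lintegral_mono h1).trans ?_
    have hmz : ∀ i, Measurable fun ω => 8 * (2 + ENNReal.ofReal C2 * Zs p (pth B ω) (s + (i : ℕ))) := fun i =>
      (((hu B hB (s + i)).1.const_mul _).const_add 2).const_mul 8
    rw [lintegral_const_mul _ (Finset.measurable_sum _ fun i _ => hmz i), lintegral_finsetSum _ fun i _ => hmz i]
    have h3 : ∀ i ∈ Finset.range m, ∫⁻ ω, 8 * (2 + ENNReal.ofReal C2 * Zs p (pth B ω) (s + (i : ℕ))) ∂P ≤ C3 := by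
      intro i _
      rw [lintegral_const_mul _ (((hu B hB (s + i)).1.const_mul _).const_add 2), lintegral_add_left measurable_const,
        lintegral_const_mul _ (hu B hB (s + i)).1]
      simp only [lintegral_const, measure_univ, mul_one]
      rw [hC3]
      have := (hu B hB (s + i)).2
      gcongr
    refine (mul_le_mul' le_rfl (Finset.sum_le_sum h3)).trans (le_of_eq ?_)
    rw [Finset.sum_const, Finset.card_range, nsmul_eq_mul, ENNReal.ofReal_mul ENNReal.toReal_nonneg,
      ENNReal.ofReal_toReal hC3t, ENNReal.ofReal_pow (by positivity), ENNReal.ofReal_natCast]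
    ring
  · intro ω
    refine ⟨?_, ?_, ?_⟩
    · calc (m : ℝ≥0∞) = ∑ i ∈ Finset.range m, (1 : ℝ≥0∞) := by simp
        _ ≤ _ := Finset.sum_le_sum fun i _ => le_add_self
    · intro a
      have h1 := alt_le_blocks (w := pth B ω) (a := a) (b := a + 1) (by linarith) (m := 1) (by norm_num) s m
      rw [mul_one] at h1
      refine h1.trans (Finset.sum_le_sum fun i _ => add_le_add ?_ ?_)
      · apply hle
        have := (hz (pth B ω) (hB.cont' ω) (s + i)).1 a
        have e1 : s + (i : ℝ) * 1 = s + i := by ring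
        have e2 : s + ((i + 1 : ℕ) : ℝ) * 1 = s + i + 1 := by push_cast; ring
        rw [e1, e2]; exact this
      · unfold strad; split_ifs <;> simp
    · intro r hr
      have key : ∀ n : ℕ, n ≤ m → ∀ r ∈ Icc s (s + n), ENNReal.ofReal |B r ω - B s ω| ≤ ∑ i ∈ Finset.range n, (y i ω + 1) := by
        intro n
        induction n with
        | zero =>
          intro _ r hr
          have : r = s := by simpa using hr
          rw [this]; simp
        | succ n ih =>
          intro hn r hr
          rw [Finset.sum_range_succ]
          rcases le_total r (s + n) with h | h
          · exact (ih (by omega) r ⟨hr.1, h⟩).trans le_self_add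
          · have h1 := ih (by omega) (s + n) ⟨by simp, le_rfl⟩
            have h2 := (hz (pth B ω) (hB.cont' ω) (s + n)).2 r ⟨h, by have := hr.2; push_cast at this; linarith⟩
            have h3 := hle h2
            have h4 : |B r ω - B s ω| ≤ |B (s + n) ω - B s ω| + |B r ω - B (s + n) ω| := by
              have := abs_add_le (B (s + n) ω - B s ω) (B r ω - B (s + n) ω)
              rwa [show B (s + n) ω - B s ω + (B r ω - B (s + n) ω) = B r ω - B s ω by ring] at this
            calc ENNReal.ofReal |B r ω - B s ω| ≤ _ := ENNReal.ofReal_le_ofReal h4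
              _ ≤ _ := ENNReal.ofReal_add_le
              _ ≤ _ := add_le_add h1 (h3.trans le_self_add)
      exact key m le_rfl r hr

end fbm
end LC
end

section
namespace LC

/-! ### The constant -/

lemma Nf_blocks_le {w : ℝ → ℝ} (a : ℝ) {m : ℝ} (hm : 0 ≤ m) (s : ℝ) (n : ℕ) :
    ∑ j ∈ Finset.range n, Nf w (s + j * m) m a ≤ Nf w s (n * m) a := by
  have := alt_blocks_le (w := w) (a := a) (b := a + 1) (by linarith) hm s n
  refine le_trans (le_of_eq (Finset.sum_congr rfl fun j _ => ?_)) this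
  unfold Nf
  have e : s + (j : ℝ) * m + m = s + ((j + 1 : ℕ) : ℝ) * m := by push_cast; ring
  rw [e]

lemma Nf_le_blocks {w : ℝ → ℝ} (a : ℝ) {m : ℝ} (hm : 0 ≤ m) (s : ℝ) (n : ℕ) :
    Nf w s (n * m) a ≤ ∑ j ∈ Finset.range n, Nf w (s + j * m) m a +
      ∑ j ∈ Finset.range n, strad a (a + 1) (w (s + j * m)) := by
  have := alt_le_blocks (w := w) (a := a) (b := a + 1) (by linarith) hm s n
  rw [Finset.sum_add_distrib] at this
  refine this.trans (le_of_eq ?_)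
  congr 1
  refine Finset.sum_congr rfl fun j _ => ?_
  unfold Nf
  have e : s + (j : ℝ) * m + m = s + ((j + 1 : ℕ) : ℝ) * m := by push_cast; ring
  rw [e]

lemma strad_eq (a h x : ℝ) : strad a (a + h) x = (Icc (x - h) x).indicator 1 a := by
  unfold strad indicator
  simp only [mem_Icc, Pi.one_apply]
  congr 1
  apply propext
  constructor <;> rintro ⟨h1, h2⟩ <;> constructor <;> linarith

lemma lint_strad (h x : ℝ) : ∫⁻ a, strad a (a + h) x = ENNReal.ofReal h := by
  simp_rw [strad_eq]
  rw [lintegral_indicator_one measurableSet_Icc, Real.volume_Icc]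
  congr 1; ring

lemma measurable_strad {α : Type*} [MeasurableSpace α] {f g k : α → ℝ} (hf : Measurable f) (hg : Measurable g)
    (hk : Measurable k) : Measurable fun x => strad (f x) (g x) (k x) := by
  unfold strad
  refine Measurable.ite ?_ measurable_const measurable_const
  exact (measurableSet_le hf hk).inter (measurableSet_le hk hg)

lemma Nf_measa {w : ℝ → ℝ} (hw : Continuous w) (s : ℝ) {t : ℝ} (ht : 0 < t) : Measurable (Nf w s t) := by
  have := measurable_alt_level hw s ht 0 1
  simp only [add_zero] at this
  exact this

lemma Kb_blocks_le {w : ℝ → ℝ} (hw : Continuous w) {m : ℝ} (hm : 0 < m) (s : ℝ) (n : ℕ) :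
    ∑ j ∈ Finset.range n, Kb w (s + j * m) m ≤ Kb w s (n * m) := by
  unfold Kb
  rw [← lintegral_finsetSum _ fun j _ => Nf_measa hw _ hm]
  exact lintegral_mono fun a => Nf_blocks_le a hm.le s n

lemma Kb_le_blocks {w : ℝ → ℝ} (hw : Continuous w) {m : ℝ} (hm : 0 < m) (s : ℝ) (n : ℕ) :
    Kb w s (n * m) ≤ ∑ j ∈ Finset.range n, Kb w (s + j * m) m + n := by
  unfold Kb
  rw [← lintegral_finsetSum _ fun j _ => Nf_measa hw _ hm]
  refine (lintegral_mono fun a => Nf_le_blocks a hm.le s n).trans ?_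
  rw [lintegral_add_left (Finset.measurable_sum _ fun j _ => Nf_measa hw _ hm)]
  refine add_le_add le_rfl (le_of_eq ?_)
  rw [lintegral_finsetSum _ fun j _ => (show Measurable fun a : ℝ => strad a (a + 1) (w (s + (j : ℕ) * m)) from
    measurable_strad measurable_id (measurable_id.add_const 1) measurable_const)]
  simp_rw [lint_strad]
  simp

lemma Kb_mono (w : ℝ → ℝ) (s : ℝ) {t t' : ℝ} (h : t ≤ t') : Kb w s t ≤ Kb w s t' :=
  lintegral_mono fun _ => alt_mono_set (Icc_subset_Icc_right (by linarith)) _ _ _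

set_option linter.unusedSectionVars false
section fbm
variable {Ω : Type*} [MeasurableSpace Ω] {H A : ℝ} {P : Measure Ω} [IsProbabilityMeasure P]
  {B : ℝ → Ω → ℝ}

/-- rescaled process -/
def sc (H ℓ : ℝ) (B : ℝ → Ω → ℝ) : ℝ → Ω → ℝ := fun r ω => ℓ⁻¹ * B (ℓ ^ (1 / H) * r) ω

lemma IsF.sc (hB : IsF H A P B) (hH0 : 0 < H) {ℓ : ℝ} (hℓ : 0 < ℓ) : IsF H A P (sc H ℓ B) where
  cont ω := ((hB.cont ω).comp (continuous_const.mul continuous_id)).const_smul ℓ⁻¹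
  zero ω := by simp [LC.sc, hB.zero]
  meas t := (hB.meas _).const_mul _
  gauss n t c := by
    obtain ⟨v, hv⟩ := hB.gauss n (fun i => ℓ ^ (1 / H) * t i) (fun i => c i * ℓ⁻¹)
    refine ⟨v, ?_⟩
    rw [← hv]
    congr 1
    funext ω
    refine Finset.sum_congr rfl fun i _ => ?_
    unfold LC.sc; ring
  pos := hB.pos
  var s t := by
    have h1 : ∀ ω, (LC.sc H ℓ B t ω - LC.sc H ℓ B s ω) ^ 2 =
        (ℓ⁻¹) ^ 2 * (B (ℓ ^ (1 / H) * t) ω - B (ℓ ^ (1 / H) * s) ω) ^ 2 := by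
      intro ω; unfold LC.sc; ring
    simp_rw [h1]
    rw [integral_const_mul, hB.var, ← mul_sub, abs_mul, Real.mul_rpow (abs_nonneg _) (abs_nonneg _),
      abs_of_pos (Real.rpow_pos_of_pos hℓ _), ← Real.rpow_mul hℓ.le]
    rw [show 1 / H * (2 * H) = ((2 : ℕ) : ℝ) by push_cast; field_simp, Real.rpow_natCast]
    field_simp

lemma alt_time (w : ℝ → ℝ) {τ : ℝ} (hτ : 0 < τ) (t a b : ℝ) :
    alt (Icc 0 t) (fun r => w (τ * r)) a b = alt (Icc 0 (τ * t)) w a b := by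
  apply le_antisymm
  · refine alt_map_le (fun r => τ * r) (fun x y h => by dsimp only; gcongr) ?_ (fun x _ y _ h => h)
    intro x hx
    exact ⟨by have := hx.1; positivity, by have := hx.2; dsimp only; gcongr⟩
  · refine alt_map_le (fun r => r / τ) (fun x y h => by dsimp only; gcongr) ?_ (fun x _ y _ h => ?_)
    · intro x hx
      exact ⟨by have := hx.1; positivity, by rw [div_le_iff₀ hτ, mul_comm]; exact hx.2⟩
    · rw [mul_div_cancel₀ _ hτ.ne', mul_div_cancel₀ _ hτ.ne']; exact h

lemma Nf_sc {ℓ : ℝ} (hℓ : 0 < ℓ) (ω : Ω) (t a : ℝ) :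
    Nf (pth (sc H ℓ B) ω) 0 t a = alt (Icc 0 (ℓ ^ (1 / H) * t)) (pth B ω) (ℓ * a) (ℓ * (a + 1)) := by
  unfold Nf
  rw [← alt_time (pth B ω) (Real.rpow_pos_of_pos hℓ _) t, ← alt_scale _ (pth (sc H ℓ B) ω) a (a + 1) hℓ, zero_add]
  congr 1
  funext r
  unfold pth sc
  field_simp

/-- the constant -/
def cc (P : Measure Ω) (B : ℝ → Ω → ℝ) : ℝ≥0∞ :=
  ⨆ (t : ℝ) (_ : 0 < t), (ENNReal.ofReal t)⁻¹ * ∫⁻ ω, Kb (pth B ω) 0 t ∂P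

lemma cc_eq (hB : IsF H A P B) {B' : ℝ → Ω → ℝ} (hB' : IsF H A P B') : cc P B = cc P B' := by
  unfold cc
  refine iSup_congr fun t => iSup_congr fun ht => ?_
  rw [hB.lint_Kb_eq hB' 0 0 ht]

lemma IsF.e_le (hB : IsF H A P B) (s : ℝ) {t : ℝ} (ht : 0 < t) :
    ∫⁻ ω, Kb (pth B ω) s t ∂P ≤ cc P B * ENNReal.ofReal t := by
  rw [hB.lint_Kb_eq hB s 0 ht]
  have h : (ENNReal.ofReal t)⁻¹ * ∫⁻ ω, Kb (pth B ω) 0 t ∂P ≤ cc P B :=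
    le_iSup₂ (f := fun (t : ℝ) (_ : 0 < t) => (ENNReal.ofReal t)⁻¹ * ∫⁻ ω, Kb (pth B ω) 0 t ∂P) t ht
  have h0 : ENNReal.ofReal t ≠ 0 := by simp [ht]
  calc ∫⁻ ω, Kb (pth B ω) 0 t ∂P = ((ENNReal.ofReal t)⁻¹ * ∫⁻ ω, Kb (pth B ω) 0 t ∂P) * ENNReal.ofReal t := by
        rw [mul_comm, ← mul_assoc, ENNReal.mul_inv_cancel h0 ENNReal.ofReal_ne_top, one_mul]
    _ ≤ _ := by gcongr

lemma IsF.e_blocks (hB : IsF H A P B) (s : ℝ) {m : ℝ} (hm : 0 < m) (n : ℕ) :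
    ∫⁻ ω, ∑ j ∈ Finset.range n, Kb (pth B ω) (s + j * m) m ∂P = n * ∫⁻ ω, Kb (pth B ω) 0 m ∂P := by
  rw [lintegral_finsetSum _ fun j _ => hB.Kb_meas _ hm]
  rw [Finset.sum_congr rfl fun j _ => hB.lint_Kb_eq hB (s + (j : ℕ) * m) 0 hm]
  simp

lemma IsF.e_ge (hB : IsF H A P B) (s : ℝ) {q : ℝ} (hq : 0 < q) :
    cc P B * ENNReal.ofReal q ≤ ∫⁻ ω, Kb (pth B ω) s q ∂P + 1 := by
  rw [hB.lint_Kb_eq hB s 0 hq]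
  set e := ∫⁻ ω, Kb (pth B ω) 0 q ∂P + 1 with he
  have hq0 : ENNReal.ofReal q ≠ 0 := by simp [hq]
  rcases eq_or_ne e ⊤ with het | het
  · rw [het]; exact le_top
  rw [← ENNReal.le_div_iff_mul_le (Or.inl hq0) (Or.inl ENNReal.ofReal_ne_top)]
  refine iSup₂_le fun t ht => ?_
  rw [mul_comm, ← div_eq_mul_inv]
  have ht0 : ENNReal.ofReal t ≠ 0 := by simp [ht]
  rw [ENNReal.div_le_iff ht0 ENNReal.ofReal_ne_top]
  have key : ∀ n : ℕ, (n : ℝ≥0∞) * ∫⁻ ω, Kb (pth B ω) 0 t ∂P ≤ ENNReal.ofReal (n * t / q + 1) * e := by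
    intro n
    set N := ⌈n * t / q⌉₊ with hN
    have hN1 : (n : ℝ) * t ≤ N * q := by
      have := Nat.le_ceil (n * t / q)
      rwa [div_le_iff₀ hq] at this
    have hN2 : (N : ℝ) ≤ n * t / q + 1 := (Nat.ceil_lt_add_one (by positivity)).le
    calc (n : ℝ≥0∞) * ∫⁻ ω, Kb (pth B ω) 0 t ∂P
        = ∫⁻ ω, ∑ j ∈ Finset.range n, Kb (pth B ω) (0 + j * t) t ∂P := (hB.e_blocks 0 ht n).symm
      _ ≤ ∫⁻ ω, (∑ j ∈ Finset.range N, Kb (pth B ω) (0 + j * q) q + N) ∂P :=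
          lintegral_mono fun ω => (Kb_blocks_le (hB.cont' ω) ht 0 n).trans ((Kb_mono _ _ hN1).trans
            (Kb_le_blocks (hB.cont' ω) hq 0 N))
      _ = N * e := by
          rw [lintegral_add_left (Finset.measurable_sum _ fun j _ => hB.Kb_meas _ hq), hB.e_blocks 0 hq N,
            lintegral_const, measure_univ, he]; ring
      _ ≤ _ := by
          gcongr
          rw [← ENNReal.ofReal_natCast]
          exact ENNReal.ofReal_le_ofReal hN2
  have key2 : ∀ n : ℕ, 0 < n → ∫⁻ ω, Kb (pth B ω) 0 t ∂P ≤ ENNReal.ofReal (t / q + 1 / n) * e := by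
    intro n hn
    have hn0 : (n : ℝ≥0∞) ≠ 0 := by simp; omega
    have hnR : (0 : ℝ) < n := by exact_mod_cast hn
    have h := key n
    rw [← ENNReal.mul_le_mul_iff_right hn0 (ENNReal.natCast_ne_top n), ← mul_assoc]
    refine h.trans (le_of_eq ?_)
    rw [← ENNReal.ofReal_natCast, ← ENNReal.ofReal_mul (by positivity)]
    congr 2
    field_simp
  have hlim : Tendsto (fun n : ℕ => ENNReal.ofReal (t / q + 1 / (n : ℝ)) * e) atTop (𝓝 (ENNReal.ofReal (t / q + 0) * e)) := by
    refine ENNReal.Tendsto.mul_const (ENNReal.tendsto_ofReal (tendsto_const_nhds.add tendsto_one_div_atTop_nhds_zero_nat)) 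
      (Or.inr het)
  have := ge_of_tendsto hlim (eventually_atTop.2 ⟨1, fun n hn => key2 n hn⟩)
  refine this.trans (le_of_eq ?_)
  rw [add_zero, ENNReal.ofReal_div_of_pos hq]
  simp only [div_eq_mul_inv]
  ring

lemma cHe_eq (hB : IsF H A P B) (hH0 : 0 < H) (hfin : cc P B ≠ ⊤) : cHe P B = cc P B := by
  apply le_antisymm
  · have key : ∀ δ : ℝ, 0 < δ → δ < 1 / 2 → cHe P B ≤ ENNReal.ofReal ((1 - 2 * δ) ^ (1 - 1 / H)) * cc P B := by
      intro δ hδ hδ'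
      set l := 1 - 2 * δ with hl
      have hl0 : 0 < l := by linarith
      refine iSup₂_le fun t ht => ?_
      have ht' : 0 < l ^ (-(1 / H)) * t := by positivity
      have h1 : ∀ ω, avgK 1 (fun r => B r ω) 0 t ≤ ENNReal.ofReal l * Kb (pth (sc H l B) ω) 0 (l ^ (-(1 / H)) * t) := by
        intro ω
        refine (avgK_le (hB.cont ω) ht hδ hδ').trans (le_of_eq ?_)
        unfold Kb
        have h2 : ∀ a : ℝ, alt (Icc 0 t) (fun r => B r ω) (a + δ) (a + 1 - δ) =
            Nf (pth (sc H l B) ω) 0 (l ^ (-(1 / H)) * t) (l⁻¹ * (a + δ)) := by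
          intro a
          rw [Nf_sc hl0, ← mul_assoc, ← Real.rpow_add hl0, add_neg_cancel, Real.rpow_zero, one_mul, ← mul_assoc,
            mul_inv_cancel₀ hl0.ne', one_mul, mul_add, ← mul_assoc, mul_inv_cancel₀ hl0.ne', one_mul]
          have : a + 1 - δ = a + δ + l * 1 := by rw [hl]; ring
          rw [this]; rfl
        simp_rw [h2]
        have h3 := lintegral_add_right_eq_self (μ := volume) (fun a => Nf (pth (sc H l B) ω) 0 (l ^ (-(1 / H)) * t) (l⁻¹ * a)) δ
        rw [h3]
        have hmm : Measurable (Nf (pth (sc H l B) ω) 0 (l ^ (-(1 / H)) * t)) := Nf_measa ((hB.sc hH0 hl0).cont' ω) 0 ht'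
        rw [← lintegral_map (f := Nf (pth (sc H l B) ω) 0 (l ^ (-(1 / H)) * t)) (g := fun a : ℝ => l⁻¹ * a) hmm (by fun_prop),
          Real.map_volume_mul_left (inv_ne_zero hl0.ne'), lintegral_smul_measure, inv_inv, abs_of_pos hl0]
        rfl
      have h2 := (lintegral_mono h1).trans_eq (lintegral_const_mul (μ := P) _ ((hB.sc hH0 hl0).Kb_meas 0 ht'))
      have h3 := (hB.sc hH0 hl0).e_le 0 ht'
      rw [cc_eq (hB.sc hH0 hl0) hB] at h3
      have ht0 : ENNReal.ofReal t ≠ 0 := by simp [ht]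
      calc (ENNReal.ofReal t)⁻¹ * ∫⁻ ω, avgK 1 (fun r => B r ω) 0 t ∂P
          ≤ (ENNReal.ofReal t)⁻¹ * (ENNReal.ofReal l * (cc P B * ENNReal.ofReal (l ^ (-(1 / H)) * t))) := by
            gcongr; exact h2.trans (by gcongr)
        _ = (ENNReal.ofReal l * ENNReal.ofReal (l ^ (-(1 / H)))) * cc P B * ((ENNReal.ofReal t)⁻¹ * ENNReal.ofReal t) := by
            rw [ENNReal.ofReal_mul (p := l ^ (-(1 / H))) (by positivity)]; ring
        _ = _ := by
            rw [ENNReal.inv_mul_cancel ht0 ENNReal.ofReal_ne_top, mul_one, ← ENNReal.ofReal_mul hl0.le]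
            congr 2
            rw [sub_eq_add_neg 1 (1 / H), Real.rpow_add hl0, Real.rpow_one]
    have hlim : Tendsto (fun δ : ℝ => ENNReal.ofReal ((1 - 2 * δ) ^ (1 - 1 / H)) * cc P B) (𝓝[>] 0)
        (𝓝 (ENNReal.ofReal ((1 - 2 * 0) ^ (1 - 1 / H)) * cc P B)) := by
      refine ENNReal.Tendsto.mul_const (ENNReal.tendsto_ofReal ?_) (Or.inr hfin)
      have : ContinuousAt (fun δ : ℝ => (1 - 2 * δ) ^ (1 - 1 / H)) 0 := by
        refine ContinuousAt.rpow_const (by fun_prop) (Or.inl (by norm_num))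
      exact this.tendsto.mono_left nhdsWithin_le_nhds
    have := ge_of_tendsto hlim (b := cHe P B) (by
      filter_upwards [Ioo_mem_nhdsGT (show (0 : ℝ) < 1 / 2 by norm_num)] with δ hδ
      exact key δ hδ.1 hδ.2)
    simpa using this
  · refine iSup₂_le fun t ht => ?_
    refine le_trans ?_ (le_iSup₂ (f := fun (t : ℝ) (_ : 0 < t) =>
      (ENNReal.ofReal t)⁻¹ * ∫⁻ ω, avgK 1 (fun r => B r ω) 0 t ∂P) t ht)
    gcongr with ω
    have := le_avgK (hB.cont ω) ht
    refine le_trans (le_of_eq ?_) this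
    unfold Kb Nf
    rw [zero_add]; rfl

end fbm

end LC
end

section
namespace LC

/-! ### Second moments -/

lemma dd_self_add {x d : ℝ≥0∞} (hx : x ≠ ⊤) : dd x (x + d) = d := by
  unfold dd
  rw [tsub_eq_zero_of_le le_self_add, zero_add, ENNReal.add_sub_cancel_left hx]

lemma dd_sq (x y : ℝ≥0∞) : dd x y ^ 2 + 2 * (x * y) = x ^ 2 + y ^ 2 := by
  wlog h : x ≤ y generalizing x y
  · rw [dd_comm, mul_comm x y, this y x (le_of_not_ge h), add_comm]
  rcases eq_or_ne x ⊤ with hx | hx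
  · have hy : y = ⊤ := by rw [hx] at h; exact top_le_iff.1 h
    rw [hx, hy]; simp
  · obtain ⟨d, rfl⟩ := exists_add_of_le h
    rw [dd_self_add hx]; ring

lemma dd_le_add (x y : ℝ≥0∞) : dd x y ≤ x + y := add_le_add tsub_le_self tsub_le_self

/-- `x ≤ δ + δ⁻¹ x²` -/
lemma le_am {x δ : ℝ≥0∞} (hδ : δ ≠ 0) (hδ' : δ ≠ ⊤) : x ≤ δ + δ⁻¹ * x ^ 2 := by
  rcases le_total x δ with h | h
  · exact h.trans le_self_add
  · refine le_trans ?_ le_add_self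
    calc x = δ⁻¹ * (δ * x) := by rw [← mul_assoc, ENNReal.inv_mul_cancel hδ hδ', one_mul]
      _ ≤ δ⁻¹ * (x * x) := by gcongr
      _ = _ := by rw [sq]

lemma card_near (M J i : ℕ) : ∑ j ∈ Finset.range M, (if i + J < j ∨ j + J < i then (0 : ℝ≥0∞) else 1) ≤ 2 * J + 1 := by
  have h1 : ∑ j ∈ Finset.range M, (if i + J < j ∨ j + J < i then (0 : ℝ≥0∞) else 1) ≤
      ∑ j ∈ Finset.Icc (i - J) (i + J), 1 := by
    have : ∑ j ∈ Finset.range M, (if i + J < j ∨ j + J < i then (0 : ℝ≥0∞) else 1) =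
        ∑ j ∈ Finset.filter (fun j => ¬ (i + J < j ∨ j + J < i)) (Finset.range M), 1 := by
      rw [Finset.sum_filter]
      refine Finset.sum_congr rfl fun j _ => ?_
      by_cases h : i + J < j ∨ j + J < i <;> simp [h]
    rw [this]
    refine Finset.sum_le_sum_of_subset fun j hj => ?_
    simp only [Finset.mem_filter, Finset.mem_range] at hj
    rw [Finset.mem_Icc]; omega
  refine h1.trans ?_
  rw [Finset.sum_const, Nat.card_Icc, nsmul_eq_mul, mul_one]
  have : i + J + 1 - (i - J) ≤ 2 * J + 1 := by omega
  calc ((i + J + 1 - (i - J) : ℕ) : ℝ≥0∞) ≤ ((2 * J + 1 : ℕ) : ℝ≥0∞) := by exact_mod_cast this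
    _ = _ := by push_cast; ring

/-- counting of near and far pairs -/
lemma sum_near_far (M J : ℕ) {f u : ℕ → ℕ → ℝ≥0∞} {α β : ℝ≥0∞}
    (hfar : ∀ i j, i + J < j ∨ j + J < i → f i j ≤ u i j + α) (hnear : ∀ i j, f i j ≤ β) :
    ∑ i ∈ Finset.range M, ∑ j ∈ Finset.range M, f i j ≤
      ∑ i ∈ Finset.range M, ∑ j ∈ Finset.range M, u i j + (M * M * α + M * (2 * J + 1) * β) := by
  have h1 : ∀ i j, f i j ≤ u i j + (α + (if i + J < j ∨ j + J < i then (0 : ℝ≥0∞) else 1) * β) := by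
    intro i j
    split_ifs with h
    · simpa using hfar i j h
    · rw [one_mul, ← add_assoc]; exact (hnear i j).trans le_add_self
  refine (Finset.sum_le_sum fun i _ => Finset.sum_le_sum fun j _ => h1 i j).trans ?_
  simp_rw [Finset.sum_add_distrib]
  refine add_le_add le_rfl (add_le_add (le_of_eq ?_) ?_)
  · simp; ring
  · simp_rw [← Finset.sum_mul]
    refine mul_le_mul' ((Finset.sum_le_sum fun i _ => card_near M J i).trans (le_of_eq ?_)) le_rfl
    simp; ring

set_option linter.unusedSectionVars false
section fbm
variable {Ω : Type*} [MeasurableSpace Ω] {H A : ℝ} {P : Measure Ω} [IsProbabilityMeasure P]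
  {B : ℝ → Ω → ℝ}

lemma var_abs {X : ℕ → Ω → ℝ≥0∞} (hm : ∀ j, Measurable (X j)) {e V0 ε : ℝ≥0∞} (he : e ≠ ⊤)
    (hX : ∀ j, ∫⁻ ω, X j ω ∂P = e) (hnear : ∀ i j, ∫⁻ ω, X i ω * X j ω ∂P ≤ V0) (J : ℕ)
    (hfar : ∀ i j, i + J < j → ∫⁻ ω, X i ω * X j ω ∂P ≤ e ^ 2 + ε) (M : ℕ) :
    ∫⁻ ω, dd (∑ j ∈ Finset.range M, X j ω) (M * e) ^ 2 ∂P ≤ M * M * ε + M * (2 * J + 1) * V0 := by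
  have hS : Measurable fun ω => ∑ j ∈ Finset.range M, X j ω := Finset.measurable_sum _ fun j _ => hm j
  have h1 : ∫⁻ ω, (∑ j ∈ Finset.range M, X j ω) ^ 2 ∂P ≤ (M * e) ^ 2 + (M * M * ε + M * (2 * J + 1) * V0) := by
    have : ∀ ω, (∑ j ∈ Finset.range M, X j ω) ^ 2 = ∑ i ∈ Finset.range M, ∑ j ∈ Finset.range M, X i ω * X j ω := by
      intro ω; rw [sq, Finset.sum_mul_sum]
    simp_rw [this]
    rw [lintegral_finsetSum _ fun i _ => (show Measurable fun ω => ∑ j ∈ Finset.range M, X i ω * X j ω from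
      Finset.measurable_sum _ fun j _ => (hm i).mul (hm j))]
    simp_rw [fun i => lintegral_finsetSum (μ := P) (Finset.range M) fun j (_ : j ∈ Finset.range M) => (show Measurable fun ω => X i ω * X j ω from (hm i).mul (hm j))]
    refine (sum_near_far M J (u := fun _ _ => e ^ 2) (α := ε) (β := V0) ?_ hnear).trans (le_of_eq ?_)
    · rintro i j (h | h)
      · exact hfar i j h
      · simp_rw [mul_comm (X i _)]; exact hfar j i h
    · simp; ring
  have h2 : ∫⁻ ω, dd (∑ j ∈ Finset.range M, X j ω) (M * e) ^ 2 ∂P + 2 * (M * e) ^ 2 =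
      ∫⁻ ω, (∑ j ∈ Finset.range M, X j ω) ^ 2 ∂P + (M * e) ^ 2 := by
    have h3 : ∫⁻ ω, 2 * ((∑ j ∈ Finset.range M, X j ω) * (M * e)) ∂P = 2 * (M * e) ^ 2 := by
      rw [lintegral_const_mul _ (hS.mul_const _), lintegral_mul_const _ hS, lintegral_finsetSum _ fun j _ => hm j]
      simp_rw [hX]; simp; ring
    have h4 : ∫⁻ _, (M * e) ^ 2 ∂P = (M * e) ^ 2 := by simp
    rw [← h3, ← lintegral_add_left ((measurable_dd hS measurable_const).pow_const 2)]
    simp_rw [dd_sq]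
    rw [lintegral_add_left (hS.pow_const 2), h4]
  have h5 : ∫⁻ ω, dd (∑ j ∈ Finset.range M, X j ω) (M * e) ^ 2 ∂P + 2 * (M * e) ^ 2 ≤
      (M * M * ε + M * (2 * J + 1) * V0) + 2 * (M * e) ^ 2 := by
    rw [h2]
    refine (add_le_add h1 le_rfl).trans (le_of_eq ?_)
    ring
  exact (ENNReal.add_le_add_iff_right (ENNReal.mul_ne_top (by simp)
    (ENNReal.pow_ne_top (ENNReal.mul_ne_top (by simp) he)))).1 h5

/-- block functionals with moment control -/
structure Fam (P : Measure Ω) (C0 : ℝ≥0∞) (g : ℕ → Ω → ℝ → ℝ≥0∞) (b : ℕ → Ω → ℝ) (Y : ℕ → Ω → ℝ≥0∞) : Prop where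
  gm : ∀ j, Measurable (fun p : Ω × ℝ => g j p.1 p.2)
  bm : ∀ j, Measurable (b j)
  Ym : ∀ j, Measurable (Y j)
  Y4 : ∀ j, ∫⁻ ω, Y j ω ^ 4 ∂P ≤ C0
  Y1 : ∀ j ω, 1 ≤ Y j ω
  gle : ∀ j ω a, g j ω a ≤ Y j ω
  supp : ∀ j ω a, g j ω a ≠ 0 → ENNReal.ofReal |a - b j ω| ≤ 2 * Y j ω

variable {C0 : ℝ≥0∞} {g : ℕ → Ω → ℝ → ℝ≥0∞} {b : ℕ → Ω → ℝ} {Y : ℕ → Ω → ℝ≥0∞}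

lemma int_le_of_supp {g : ℝ → ℝ≥0∞} {Y : ℝ≥0∞} {b : ℝ} (hle : ∀ a, g a ≤ Y)
    (hs : ∀ a, g a ≠ 0 → ENNReal.ofReal |a - b| ≤ 2 * Y) : ∫⁻ a, g a ≤ 4 * Y ^ 2 := by
  rcases eq_or_ne Y ⊤ with hY | hY
  · rw [hY]; simp [ENNReal.mul_top]
  have h2 : ∀ a, g a ≤ (Icc (b - 2 * Y.toReal) (b + 2 * Y.toReal)).indicator (fun _ => Y) a := by
    intro a
    by_cases ha : g a = 0
    · rw [ha]; exact zero_le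
    · have := hs a ha
      have h3 : |a - b| ≤ 2 * Y.toReal := by
        rw [← ENNReal.ofReal_toReal hY, show (2 : ℝ≥0∞) = ENNReal.ofReal 2 by simp, ← ENNReal.ofReal_mul (by norm_num),
          ENNReal.ofReal_le_ofReal_iff (by positivity)] at this
        exact this
      rw [abs_le] at h3
      rw [indicator_of_mem (by constructor <;> linarith)]
      exact hle a
  refine (lintegral_mono h2).trans (le_of_eq ?_)
  rw [lintegral_indicator measurableSet_Icc, setLIntegral_const, Real.volume_Icc]
  have : b + 2 * Y.toReal - (b - 2 * Y.toReal) = 4 * Y.toReal := by ring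
  rw [this, ENNReal.ofReal_mul (by norm_num), ENNReal.ofReal_toReal hY]
  simp; ring

lemma Fam.int_le (h : Fam P C0 g b Y) (j : ℕ) (ω : Ω) : ∫⁻ a, g j ω a ≤ 4 * Y j ω ^ 2 :=
  int_le_of_supp (h.gle j ω) (h.supp j ω)

lemma Fam.gma (h : Fam P C0 g b Y) (j : ℕ) (ω : Ω) : Measurable (g j ω) :=
  (h.gm j).comp (measurable_const.prodMk measurable_id)

lemma Fam.int_meas (h : Fam P C0 g b Y) (j : ℕ) : Measurable fun ω => ∫⁻ a, g j ω a :=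
  Measurable.lintegral_prod_right' (f := fun p : Ω × ℝ => g j p.1 p.2) (h.gm j)

lemma pow_aux (x y : ℝ≥0∞) : x ^ 2 * y ^ 2 ≤ x ^ 4 + y ^ 4 := by
  rcases le_total x y with h | h
  · refine le_trans ?_ le_add_self
    calc x ^ 2 * y ^ 2 ≤ y ^ 2 * y ^ 2 := by gcongr
      _ = y ^ 4 := by ring
  · refine le_trans ?_ le_self_add
    calc x ^ 2 * y ^ 2 ≤ x ^ 2 * x ^ 2 := by gcongr
      _ = x ^ 4 := by ring

lemma Fam.prod_mom (h : Fam P C0 g b Y) (i j : ℕ) : ∫⁻ ω, Y i ω ^ 2 * Y j ω ^ 2 ∂P ≤ 2 * C0 := by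
  refine (lintegral_mono fun ω => pow_aux _ _).trans ?_
  rw [lintegral_add_left ((h.Ym i).pow_const 4), two_mul]
  exact add_le_add (h.Y4 i) (h.Y4 j)

lemma Fam.int_prod (h : Fam P C0 g b Y) (i j : ℕ) :
    ∫⁻ ω, (∫⁻ a, g i ω a) * (∫⁻ a, g j ω a) ∂P ≤ 32 * C0 := by
  calc ∫⁻ ω, (∫⁻ a, g i ω a) * (∫⁻ a, g j ω a) ∂P ≤ ∫⁻ ω, 16 * (Y i ω ^ 2 * Y j ω ^ 2) ∂P := by
        refine lintegral_mono fun ω => (mul_le_mul' (h.int_le i ω) (h.int_le j ω)).trans (le_of_eq ?_)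
        ring
    _ = 16 * ∫⁻ ω, Y i ω ^ 2 * Y j ω ^ 2 ∂P :=
        lintegral_const_mul _ (((h.Ym i).pow_const 2).mul ((h.Ym j).pow_const 2))
    _ ≤ 16 * (2 * C0) := by gcongr; exact h.prod_mom i j
    _ = _ := by ring

lemma Fam.prod_int (h : Fam P C0 g b Y) (i j : ℕ) (z : ℝ) :
    ∫⁻ ω, (∫⁻ a, g i ω a * g j ω (a + z)) ∂P ≤ 32 * C0 := by
  calc ∫⁻ ω, (∫⁻ a, g i ω a * g j ω (a + z)) ∂P ≤ ∫⁻ ω, 16 * (Y i ω ^ 2 * Y j ω ^ 2) ∂P := by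
        refine lintegral_mono fun ω => ?_
        have h1 : ∫⁻ a, g i ω a * g j ω (a + z) ≤ ∫⁻ a, Y i ω * g j ω (a + z) :=
          lintegral_mono fun a => mul_le_mul' (h.gle i ω a) le_rfl
        have h2 : Measurable fun a => g j ω (a + z) := (h.gma j ω).comp (measurable_id.add_const z)
        rw [lintegral_const_mul _ h2, lintegral_add_right_eq_self (fun a => g j ω a) z] at h1
        refine h1.trans ((mul_le_mul' le_rfl (h.int_le j ω)).trans ?_)
        have h3 : Y i ω ≤ Y i ω ^ 2 := le_self_pow (h.Y1 i ω) (by norm_num)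
        calc Y i ω * (4 * Y j ω ^ 2) ≤ Y i ω ^ 2 * (16 * Y j ω ^ 2) := by gcongr; norm_num
          _ = _ := by ring
    _ = 16 * ∫⁻ ω, Y i ω ^ 2 * Y j ω ^ 2 ∂P :=
        lintegral_const_mul _ (((h.Ym i).pow_const 2).mul ((h.Ym j).pow_const 2))
    _ ≤ 16 * (2 * C0) := by gcongr; exact h.prod_mom i j
    _ = _ := by ring

/-- crossing counts of blocks and occupation of blocks form families -/
lemma IsF.fam (hH0 : 0 < H) : ∃ C : ℝ, 0 ≤ C ∧ ∀ B : ℝ → Ω → ℝ, IsF H A P B → ∀ (s : ℝ) (m : ℕ), 0 < m →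
    ∃ Y : ℕ → Ω → ℝ≥0∞, 
      Fam P (ENNReal.ofReal (C * m ^ 4)) (fun j ω a => Nf (pth B ω) (s + j * m) m a) (fun j ω => B (s + j * m) ω) Y ∧
      Fam P (ENNReal.ofReal (C * m ^ 4)) (fun j ω a => ∫⁻ r in Icc (s + j * m) (s + j * m + m), strad a (a + 1) (B r ω))
        (fun j ω => B (s + j * m) ω) Y := by
  obtain ⟨C, hC, h⟩ := block_mom (Ω := Ω) (H := H) (A := A) (P := P) hH0
  refine ⟨C, hC, fun B hB s m hm => ?_⟩
  have hm' : (0 : ℝ) < m := by exact_mod_cast hm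
  choose Y hYm hY4 hY using fun j : ℕ => h B hB (s + j * m) m hm
  have hY1 : ∀ j ω, 1 ≤ Y j ω := fun j ω => le_trans (by exact_mod_cast hm) (hY j ω).1
  have hsupp : ∀ (j : ℕ) (ω : Ω) (a r : ℝ), r ∈ Icc (s + j * m) (s + j * m + m) → a ≤ B r ω → B r ω ≤ a + 1 →
      ENNReal.ofReal |a - B (s + j * m) ω| ≤ 2 * Y j ω := by
    intro j ω a r hr h1 h2
    have h3 := (hY j ω).2.2 r hr
    have h4 : |a - B (s + j * m) ω| ≤ |B r ω - B (s + j * m) ω| + 1 := by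
      rw [abs_le]; have := abs_le.1 (le_refl |B r ω - B (s + j * m) ω|)
      constructor <;> linarith
    refine (ENNReal.ofReal_le_ofReal h4).trans ?_
    rw [ENNReal.ofReal_add (abs_nonneg _) zero_le_one, ENNReal.ofReal_one, two_mul]
    exact add_le_add h3 (hY1 j ω)
  refine ⟨Y, ⟨?_, fun j => hB.meas _, hYm, hY4, hY1, ?_, ?_⟩, ⟨?_, fun j => hB.meas _, hYm, hY4, hY1, ?_, ?_⟩⟩
  · exact fun j => hB.Nf_meas _ hm' measurable_fst measurable_snd
  · exact fun j ω => (hY j ω).2.1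
  · intro j ω a hne
    by_contra hcon
    apply hne
    apply alt_eq_zero_of_lt
    have hw := hB.cont' ω
    by_contra hcon2
    push Not at hcon2
    obtain ⟨⟨x, hx, hx1⟩, y, hy, hy1⟩ := hcon2
    have hiv := isPreconnected_Icc.intermediate_value hy hx hw.continuousOn (show a ∈ Icc _ _ from ⟨hy1.le, by linarith⟩)
    obtain ⟨r, hr, hra⟩ := hiv
    change B r ω = a at hra
    exact hcon (hsupp j ω a r hr hra.ge (by linarith))
  · intro j
    have hjm : Measurable fun q : ℝ × Ω => B q.1 q.2 :=
      measurable_uncurry_of_continuous_of_measurable (u := fun r ω => B r ω) (fun ω => hB.cont ω) hB.meas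
    refine Measurable.lintegral_prod_right' (f := fun q : (Ω × ℝ) × ℝ => strad q.1.2 (q.1.2 + 1) (B q.2 q.1.1)) ?_
    exact measurable_strad (by fun_prop) (by fun_prop) (hjm.comp (measurable_snd.prodMk (measurable_fst.comp measurable_fst)))
  · intro j ω a
    refine le_trans ?_ (hY j ω).1
    calc ∫⁻ r in Icc (s + j * m) (s + j * m + m), strad a (a + 1) (B r ω) 
        ≤ ∫⁻ r in Icc (s + j * (m : ℝ)) (s + j * m + m), 1 := by
          refine lintegral_mono fun r => ?_
          unfold strad; split_ifs <;> simp
      _ = m := by simp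
  · intro j ω a hne
    by_contra hcon
    apply hne
    refine (setLIntegral_congr_fun measurableSet_Icc (g := fun _ => 0) fun r hr => ?_).trans (by simp)
    unfold strad
    rw [if_neg]
    rintro ⟨h1, h2⟩
    exact hcon (hsupp j ω a r hr h1 h2)

end fbm

end LC
end

section
namespace LC

/-! ### Law of large numbers for the integrated crossing counts -/

lemma dd_le_of {x y d : ℝ≥0∞} (h1 : x ≤ y) (h2 : y ≤ x + d) : dd x y ≤ d := by
  unfold dd
  rw [tsub_eq_zero_of_le h1, zero_add]
  exact tsub_le_iff_left.2 h2

set_option linter.unusedSectionVars false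
section fbm
variable {Ω : Type*} [MeasurableSpace Ω] {H A : ℝ} {P : Measure Ω} [IsProbabilityMeasure P]
  {B : ℝ → Ω → ℝ}

lemma IsF.cc_ne_top (hB : IsF H A P B) (hH0 : 0 < H) : cc P B ≠ ⊤ := by
  obtain ⟨C, hC, h⟩ := IsF.fam (Ω := Ω) (H := H) (A := A) (P := P) hH0
  obtain ⟨Y, hf, -⟩ := h B hB 0 1 one_pos
  have h1 := hB.e_ge 0 one_pos
  rw [ENNReal.ofReal_one, mul_one] at h1
  refine ne_top_of_le_ne_top ?_ h1
  refine ENNReal.add_ne_top.2 ⟨?_, ENNReal.one_ne_top⟩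
  have h2 : ∀ ω, Kb (pth B ω) 0 1 ≤ 4 * Y 0 ω ^ 4 := by
    intro ω
    have := hf.int_le 0 ω
    simp only [Nat.cast_zero, zero_mul, add_zero, Nat.cast_one] at this
    exact this.trans (mul_le_mul' le_rfl (pow_le_pow_right₀ (hf.Y1 0 ω) (by norm_num)))
  refine ne_top_of_le_ne_top ?_ (lintegral_mono h2)
  rw [lintegral_const_mul _ ((hf.Ym 0).pow_const 4)]
  exact ENNReal.mul_ne_top (by simp) (ne_top_of_le_ne_top ENNReal.ofReal_ne_top (hf.Y4 0))

lemma lln (hH0 : 0 < H) (hH : H < 1 / 2) : ∃ (r : ℕ) (C : ℝ), 0 ≤ C ∧ ∀ B : ℝ → Ω → ℝ, IsF H A P B → ∀ (s : ℝ) (k : ℕ), 0 < k →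
    ∫⁻ ω, dd (Kb (pth B ω) s (k ^ (r + 2) : ℕ)) (cc P B * (k ^ (r + 2) : ℕ)) ∂P ≤ ENNReal.ofReal (C * k ^ r) := by
  obtain ⟨C, hC, h⟩ := IsF.fam (Ω := Ω) (H := H) (A := A) (P := P) hH0
  obtain ⟨u, hu⟩ := exists_nat_ge (1 / (1 - 2 * H))
  have hθ : 0 < 1 - 2 * H := by linarith
  rw [div_le_iff₀ hθ] at hu
  refine ⟨8 * u + 8, 3 + 128 * C, by positivity, fun B hB s k hk => ?_⟩
  have hkR : (1 : ℝ) ≤ k := by exact_mod_cast hk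
  have hk0 : (0 : ℝ) < k := by linarith
  obtain ⟨Y, hf, -⟩ := h B hB s (k ^ 2) (by positivity)
  set q : ℝ := ((k ^ 2 : ℕ) : ℝ) with hq
  have hq0 : 0 < q := by rw [hq]; positivity
  set M : ℕ := k ^ (8 * u + 8) with hM
  have hM0 : 0 < M := by rw [hM]; positivity
  set J : ℕ := k ^ (8 * u) with hJ
  have hJ0 : 0 < J := by rw [hJ]; positivity
  set e := ∫⁻ ω, Kb (pth B ω) 0 q ∂P with he
  have het : e ≠ ⊤ := ne_top_of_le_ne_top (ENNReal.mul_ne_top (hB.cc_ne_top hH0) ENNReal.ofReal_ne_top) (hB.e_le 0 hq0)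
  set C0 := ENNReal.ofReal (C * q ^ 4) with hC0
  set X : ℕ → Ω → ℝ≥0∞ := fun j ω => Kb (pth B ω) (s + j * q) q with hX
  have hXm : ∀ j, Measurable (X j) := fun j => hB.Kb_meas _ hq0
  have hnear : ∀ i j, ∫⁻ ω, X i ω * X j ω ∂P ≤ 32 * C0 := fun i j => hf.int_prod i j
  have hXe : ∀ j, ∫⁻ ω, X j ω ∂P = e := fun j => hB.lint_Kb_eq hB _ _ hq0
  have hq4 : q ^ 4 = k ^ 8 := by rw [hq]; push_cast; ring
  have hfar : ∀ i j, i + J < j → ∫⁻ ω, X i ω * X j ω ∂P ≤ e ^ 2 + ENNReal.ofReal (32 * C) := by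
    intro i j hij
    have hN : ((k ^ 8 - 1 : ℕ) : ℝ) + 1 = k ^ 8 := by
      rw [Nat.cast_sub (Nat.one_le_pow _ _ hk)]; push_cast; ring
    have h1 := hB.far hH0 hH (s := s + i * q) (s' := s + j * q) (t := q) (g := J * q) hq0 (by positivity) (by
      have : ((i + J + 1 : ℕ) : ℝ) ≤ j := by exact_mod_cast hij
      push_cast at this
      nlinarith) (k ^ 8 - 1) (by
      rw [hN, Real.mul_rpow (by positivity) hq0.le, ← mul_assoc]
      gcongr
      have h2 : (J : ℝ) ^ (2 * H - 1) = ((J : ℝ) ^ (1 - 2 * H))⁻¹ := by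
        rw [← Real.rpow_neg (by positivity)]; simp
      rw [h2, mul_inv_le_iff₀ (by positivity)]
      have h3 : (J : ℝ) ^ (1 - 2 * H) = (k : ℝ) ^ ((8 * u : ℝ) * (1 - 2 * H)) := by
        rw [Real.rpow_mul hk0.le, hJ]
        congr 1
        push_cast
        rw [← Real.rpow_natCast]; push_cast; rfl
      have h4 : (k : ℝ) ^ 8 ≤ (J : ℝ) ^ (1 - 2 * H) := by
        rw [h3, ← Real.rpow_natCast]
        apply Real.rpow_le_rpow_of_exponent_le hkR
        push_cast; nlinarith
      have : 0 ≤ (k : ℝ) ^ 8 := by positivity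
      linarith)
    rw [hN, hB.lint_Kb_eq hB (s + i * q) 0 hq0, hB.lint_Kb_eq hB (s + j * q) 0 hq0, ← sq] at h1
    refine h1.trans (add_le_add le_rfl ?_)
    have h2 : ∫⁻ ω, Kb (pth B ω) (s + i * q) q ^ 2 ∂P ≤ 32 * C0 := by
      have := hnear i i; simp_rw [hX, ← sq] at this; exact this
    have h3 : ∫⁻ ω, Kb (pth B ω) (s + j * q) q ^ 2 ∂P ≤ 32 * C0 := by
      have := hnear j j; simp_rw [hX, ← sq] at this; exact this
    refine (mul_le_mul' le_rfl (add_le_add h2 h3)).trans (le_of_eq ?_)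
    rw [hC0, ← mul_add, ← ENNReal.ofReal_add (by positivity) (by positivity),
      show (32 : ℝ≥0∞) = ENNReal.ofReal 32 by simp, ← ENNReal.ofReal_mul (by norm_num), ← ENNReal.ofReal_mul (by positivity)]
    congr 1
    rw [hq4]
    field_simp
    ring
  have hvar := var_abs (P := P) hXm het hXe hnear J hfar M
  set S : Ω → ℝ≥0∞ := fun ω => ∑ j ∈ Finset.range M, X j ω with hS
  have hSm : Measurable S := Finset.measurable_sum _ fun j _ => hXm j
  have hvar2 : ∫⁻ ω, dd (S ω) (M * e) ^ 2 ∂P ≤ ENNReal.ofReal (128 * C * (M : ℝ) ^ 2) := by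
    refine hvar.trans ?_
    rw [hC0, show (32 : ℝ≥0∞) = ENNReal.ofReal 32 by simp, show (2 : ℝ≥0∞) = ENNReal.ofReal 2 by simp,
      show (1 : ℝ≥0∞) = ENNReal.ofReal 1 by simp, ← ENNReal.ofReal_natCast, ← ENNReal.ofReal_natCast,
      ← ENNReal.ofReal_mul (by positivity), ← ENNReal.ofReal_mul (by positivity), ← ENNReal.ofReal_mul (by positivity),
      ← ENNReal.ofReal_mul (by positivity), ← ENNReal.ofReal_add (by positivity) (by positivity),
      ← ENNReal.ofReal_mul (by positivity), ← ENNReal.ofReal_mul (by positivity), 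
      ← ENNReal.ofReal_add (by positivity) (by positivity)]
    apply ENNReal.ofReal_le_ofReal
    have h1 : (1 : ℝ) ≤ J := by exact_mod_cast hJ0
    have h2 : (M : ℝ) = J * k ^ 8 := by rw [hM, hJ]; push_cast; ring
    rw [hq4]
    have h3 : (M : ℝ) * (2 * J + 1) * (32 * (C * k ^ 8)) ≤ M * (3 * J) * (32 * (C * k ^ 8)) := by
      gcongr; linarith
    have h4 : (M : ℝ) * (3 * J) * (32 * (C * k ^ 8)) = 96 * C * (M * (J * k ^ 8)) := by ring
    rw [← h2] at h4
    nlinarith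
  have hM0' : (M : ℝ≥0∞) ≠ 0 := by simp; omega
  have hMt : (M : ℝ≥0∞) ≠ ⊤ := ENNReal.natCast_ne_top M
  have hdd : ∫⁻ ω, dd (S ω) (M * e) ∂P ≤ ENNReal.ofReal ((1 + 128 * C) * M) := by
    refine (lintegral_mono fun ω => le_am (x := dd (S ω) (M * e)) hM0' hMt).trans ?_
    rw [lintegral_add_left measurable_const, lintegral_const, measure_univ, mul_one,
      lintegral_const_mul _ ((measurable_dd hSm measurable_const).pow_const 2)]
    refine (add_le_add le_rfl (mul_le_mul' le_rfl hvar2)).trans (le_of_eq ?_)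
    have hMR : (0 : ℝ) < M := by exact_mod_cast hM0
    rw [← ENNReal.ofReal_natCast, ← ENNReal.ofReal_inv_of_pos hMR, ← ENNReal.ofReal_mul (by positivity),
      ← ENNReal.ofReal_add (by positivity) (by positivity)]
    congr 1
    field_simp
  have hmq : ((k ^ (8 * u + 8 + 2) : ℕ) : ℝ) = M * q := by rw [hM, hq]; push_cast; ring
  have hmq' : ((k ^ (8 * u + 8 + 2) : ℕ) : ℝ≥0∞) = M * ENNReal.ofReal q := by
    rw [← ENNReal.ofReal_natCast (k ^ (8 * u + 8 + 2)), hmq, ENNReal.ofReal_mul (by positivity), ENNReal.ofReal_natCast]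
  rw [hmq, hmq']
  have hfin : ∀ ω, dd (Kb (pth B ω) s (M * q)) (cc P B * (M * ENNReal.ofReal q)) ≤ M + (dd (S ω) (M * e) + M) := by
    intro ω
    refine (dd_triangle _ (S ω) _).trans (add_le_add ?_ ((dd_triangle _ (M * e) _).trans (add_le_add le_rfl ?_)))
    · rw [dd_comm]
      exact dd_le_of (Kb_blocks_le (hB.cont' ω) hq0 s M) (Kb_le_blocks (hB.cont' ω) hq0 s M)
    · rw [mul_left_comm]
      refine dd_le_of (by gcongr; exact hB.e_le 0 hq0) ?_
      refine (mul_le_mul' le_rfl (hB.e_ge 0 hq0)).trans (le_of_eq ?_)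
      rw [mul_add, mul_one]
  refine (lintegral_mono hfin).trans ?_
  rw [lintegral_add_left measurable_const, lintegral_add_right _ measurable_const, lintegral_const, measure_univ, mul_one]
  refine (add_le_add le_rfl (add_le_add hdd le_rfl)).trans (le_of_eq ?_)
  rw [← ENNReal.ofReal_natCast, ← ENNReal.ofReal_add (by positivity) (by positivity), ← ENNReal.ofReal_add (by positivity) (by positivity)]
  congr 1
  rw [hM]; push_cast; ring

end fbm

end LC
end

section
namespace LC

/-! ### Spatial smoothing -/

lemma dd_le_iff {x y d : ℝ≥0∞} : dd x y ≤ d ↔ x ≤ y + d ∧ y ≤ x + d := by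
  constructor
  · intro h
    exact ⟨(le_add_dd x y).trans (by gcongr), (le_add_dd' x y).trans (by gcongr)⟩
  · rintro ⟨h1, h2⟩
    rcases le_total x y with h | h
    · exact dd_le_of h h2
    · rw [dd_comm]; exact dd_le_of h h1

lemma dd_self (x : ℝ≥0∞) : dd x x = 0 := by simp [dd]

lemma dd_sum {ι : Type*} (s : Finset ι) (x y : ι → ℝ≥0∞) : dd (∑ i ∈ s, x i) (∑ i ∈ s, y i) ≤ ∑ i ∈ s, dd (x i) (y i) := by
  rw [dd_le_iff, ← Finset.sum_add_distrib, ← Finset.sum_add_distrib]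
  exact ⟨Finset.sum_le_sum fun i _ => le_add_dd _ _, Finset.sum_le_sum fun i _ => le_add_dd' _ _⟩

lemma dd_mul (c x y : ℝ≥0∞) : dd (c * x) (c * y) ≤ c * dd x y := by
  rw [dd_le_iff, ← mul_add, ← mul_add]
  exact ⟨mul_le_mul' le_rfl (le_add_dd _ _), mul_le_mul' le_rfl (le_add_dd' _ _)⟩

lemma dd_mul' (c x y : ℝ≥0∞) : dd (x * c) (y * c) ≤ dd x y * c := by
  rw [mul_comm x, mul_comm y, mul_comm (dd x y)]; exact dd_mul c x y

lemma dd_lint {α : Type*} [MeasurableSpace α] {μ : Measure α} {f g : α → ℝ≥0∞} (hf : Measurable f) (hg : Measurable g) :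
    dd (∫⁻ x, f x ∂μ) (∫⁻ x, g x ∂μ) ≤ ∫⁻ x, dd (f x) (g x) ∂μ := by
  rw [dd_le_iff, ← lintegral_add_left hg, ← lintegral_add_left hf]
  exact ⟨lintegral_mono fun x => le_add_dd _ _, lintegral_mono fun x => le_add_dd' _ _⟩

lemma lint_dd_strad (h x b : ℝ) :
    ∫⁻ a, dd (strad a (a + h) x) (strad a (a + h) b) ≤ ENNReal.ofReal (2 * |x - b|) := by
  wlog hxb : b ≤ x generalizing x b
  · simp_rw [dd_comm (strad _ _ x), abs_sub_comm x b]
    exact this b x (le_of_not_ge hxb)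
  have h1 : ∀ a, dd (strad a (a + h) x) (strad a (a + h) b) ≤
      (Ioc b x).indicator 1 a + (Ico (b - h) (x - h)).indicator 1 a := by
    intro a
    unfold strad indicator
    simp only [mem_Icc, mem_Ioc, mem_Ico, Pi.one_apply]
    by_cases hb : a ≤ b ∧ b ≤ a + h <;> by_cases hx : a ≤ x ∧ x ≤ a + h
    · simp [hb, hx, dd_self]
    · rw [if_pos hb, if_neg hx, if_pos (c := b - h ≤ a ∧ a < x - h)]
      · simp [dd]
      · refine ⟨by linarith [hb.2], ?_⟩
        by_contra hc
        exact hx ⟨by linarith [hb.1], by linarith⟩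
    · rw [if_neg hb, if_pos hx, if_pos (c := b < a ∧ a ≤ x)]
      · simp [dd]
      · refine ⟨?_, hx.1⟩
        by_contra hc
        exact hb ⟨by linarith, by linarith [hx.2]⟩
    · rw [if_neg hb, if_neg hx]; simp [dd]
  refine (lintegral_mono h1).trans (le_of_eq ?_)
  rw [lintegral_add_left (measurable_one.indicator measurableSet_Ioc), lintegral_indicator_one measurableSet_Ioc,
    lintegral_indicator_one measurableSet_Ico, Real.volume_Ioc, Real.volume_Ico, ← ENNReal.ofReal_add (by linarith) (by linarith),
    abs_of_nonneg (by linarith)]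
  congr 1; ring

set_option linter.unusedSectionVars false
section fbm
variable {Ω : Type*} [MeasurableSpace Ω] {H A : ℝ} {P : Measure Ω} [IsProbabilityMeasure P]
  {B : ℝ → Ω → ℝ}
variable {C0 : ℝ≥0∞} {g : ℕ → Ω → ℝ → ℝ≥0∞} {b : ℕ → Ω → ℝ} {Y : ℕ → Ω → ℝ≥0∞}

lemma Fam.gmz (hF : Fam P C0 g b Y) (j : ℕ) (z : ℝ) : Measurable fun p : Ω × ℝ => g j p.1 (p.2 + z) :=
  (hF.gm j).comp (measurable_fst.prodMk (measurable_snd.add_const z))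

lemma Fam.corr (hF : Fam P C0 g b Y) (M : ℕ) (z : ℝ) :
    ∫⁻ p, (∑ j ∈ Finset.range M, g j p.1 p.2) * (∑ j ∈ Finset.range M, g j p.1 (p.2 + z)) ∂(P.prod volume) =
      ∑ i ∈ Finset.range M, ∑ j ∈ Finset.range M, ∫⁻ ω, (∫⁻ a, g i ω a * g j ω (a + z)) ∂P := by
  have hm : ∀ i j, Measurable fun p : Ω × ℝ => g i p.1 p.2 * g j p.1 (p.2 + z) := fun i j => (hF.gm i).mul (hF.gmz j z)
  simp_rw [Finset.sum_mul_sum]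
  rw [lintegral_finsetSum _ fun i _ => (show Measurable fun p : Ω × ℝ => ∑ j ∈ Finset.range M, g i p.1 p.2 * g j p.1 (p.2 + z) from
    Finset.measurable_sum _ fun j _ => hm i j)]
  refine Finset.sum_congr rfl fun i _ => ?_
  rw [lintegral_finsetSum _ fun j _ => hm i j]
  refine Finset.sum_congr rfl fun j _ => ?_
  rw [lintegral_prod _ (hm i j).aemeasurable]

lemma Fam.dd_shift (hF : Fam P C0 g b Y) (hC0 : C0 ≠ ⊤) (M J : ℕ) {ε0 : ℝ≥0∞} {h : ℝ}
    (hs : ∀ i j z, |z| ≤ h → i + J < j → ∫⁻ ω, (∫⁻ a, g i ω a * g j ω a) ∂P ≤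
      ∫⁻ ω, (∫⁻ a, g i ω a * g j ω (a + z)) ∂P + ε0) {z : ℝ} (hz : |z| ≤ h) :
    ∫⁻ p, dd (∑ j ∈ Finset.range M, g j p.1 p.2) (∑ j ∈ Finset.range M, g j p.1 (p.2 + z)) ^ 2 ∂(P.prod volume) ≤
      2 * (M * M * ε0 + M * (2 * J + 1) * (32 * C0)) := by
  have hfm : ∀ z, Measurable fun p : Ω × ℝ => ∑ j ∈ Finset.range M, g j p.1 (p.2 + z) := fun z =>
    Finset.measurable_sum _ fun j _ => hF.gmz j z
  have hf0 : Measurable fun p : Ω × ℝ => ∑ j ∈ Finset.range M, g j p.1 p.2 := Finset.measurable_sum _ fun j _ => hF.gm j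
  have hcz := hF.corr M z
  have hc0 := hF.corr M 0
  simp_rw [add_zero, ← sq] at hc0
  set Iz := ∫⁻ p, (∑ j ∈ Finset.range M, g j p.1 p.2) * (∑ j ∈ Finset.range M, g j p.1 (p.2 + z)) ∂(P.prod volume) with hIz
  set I0 := ∫⁻ p, (∑ j ∈ Finset.range M, g j p.1 p.2) ^ 2 ∂(P.prod volume) with hI0
  have hsh : ∫⁻ p, (∑ j ∈ Finset.range M, g j p.1 (p.2 + z)) ^ 2 ∂(P.prod volume) = I0 := by
    rw [hI0, lintegral_prod _ ((hfm z).pow_const 2).aemeasurable, lintegral_prod _ (hf0.pow_const 2).aemeasurable]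
    refine lintegral_congr fun ω => ?_
    exact lintegral_add_right_eq_self (fun a => (∑ j ∈ Finset.range M, g j ω a) ^ 2) z
  have h1 : I0 ≤ Iz + (M * M * ε0 + M * (2 * J + 1) * (32 * C0)) := by
    rw [hc0, hcz]
    refine sum_near_far M J ?_ ?_
    · rintro i j (hij | hij)
      · exact hs i j z hz hij
      · have h2 := hs j i (-z) (by rwa [abs_neg]) hij
        simp_rw [mul_comm (g i _ _)]
        refine h2.trans (add_le_add (le_of_eq (lintegral_congr fun ω => ?_)) le_rfl)
        rw [← lintegral_add_right_eq_self (fun a => g j ω a * g i ω (a + -z)) z]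
        simp
    · intro i j
      have := hF.prod_int i j 0
      simpa using this
  have hfin : Iz ≠ ⊤ := by
    rw [hcz]
    refine ENNReal.sum_ne_top.2 fun i _ => ENNReal.sum_ne_top.2 fun j _ => ?_
    exact ne_top_of_le_ne_top (ENNReal.mul_ne_top (by simp) hC0) (hF.prod_int i j z)
  have h2 : ∫⁻ p, dd (∑ j ∈ Finset.range M, g j p.1 p.2) (∑ j ∈ Finset.range M, g j p.1 (p.2 + z)) ^ 2 ∂(P.prod volume) +
      2 * Iz = 2 * I0 := by
    rw [hIz, ← lintegral_const_mul _ (show Measurable fun p : Ω × ℝ => (∑ j ∈ Finset.range M, g j p.1 p.2) * (∑ j ∈ Finset.range M, g j p.1 (p.2 + z)) from hf0.mul (hfm z)), ← lintegral_add_left ((measurable_dd hf0 (hfm z)).pow_const 2)]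
    simp_rw [dd_sq]
    rw [lintegral_add_left (hf0.pow_const 2), hsh, ← hI0, two_mul]
  have h3 := (mul_le_mul' (le_refl (2 : ℝ≥0∞)) h1)
  rw [← h2, mul_add, add_comm (2 * Iz)] at h3
  exact (ENNReal.add_le_add_iff_right (ENNReal.mul_ne_top (by simp) hfin)).1 h3

/-- the localized product measure -/
def Pa (P : Measure Ω) (R : ℝ) : Measure (Ω × ℝ) := P.prod (volume.restrict (Icc (-R) R))

lemma Pa_le (R : ℝ) (f : Ω × ℝ → ℝ≥0∞) : ∫⁻ p, f p ∂(Pa P R) ≤ ∫⁻ p, f p ∂(P.prod volume) := by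
  refine lintegral_mono' ?_ le_rfl
  exact Measure.prod_mono le_rfl Measure.restrict_le_self

lemma Pa_univ {R : ℝ} (hR : 0 ≤ R) : Pa P R univ = ENNReal.ofReal (2 * R) := by
  unfold Pa
  rw [← univ_prod_univ, Measure.prod_prod, measure_univ, one_mul, Measure.restrict_apply_univ, Real.volume_Icc]
  congr 1; ring

instance (R : ℝ) : IsFiniteMeasure (Pa P R) := by unfold Pa; infer_instance

/-- the smoothed block sum -/
def smo (M : ℕ) (h : ℝ) (b : ℕ → Ω → ℝ) (G : ℕ → Ω → ℝ≥0∞) (p : Ω × ℝ) : ℝ≥0∞ :=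
  (ENNReal.ofReal h)⁻¹ * ∑ j ∈ Finset.range M, strad p.2 (p.2 + h) (b j p.1) * G j p.1

lemma measurable_smo (M : ℕ) (h : ℝ) {b : ℕ → Ω → ℝ} {G : ℕ → Ω → ℝ≥0∞} (hb : ∀ j, Measurable (b j))
    (hG : ∀ j, Measurable (G j)) : Measurable (smo M h b G) :=
  Measurable.const_mul (Finset.measurable_sum _ fun j _ => (measurable_strad measurable_snd (measurable_snd.add_const h)
    ((hb j).comp measurable_fst)).mul ((hG j).comp measurable_fst)) _

lemma Fam.smooth (hF : Fam P C0 g b Y) (hC0 : C0 ≠ ⊤) (M J : ℕ) {ε0 : ℝ≥0∞} {h : ℝ} (hh : 0 < h)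
    (hs : ∀ i j z, |z| ≤ h → i + J < j → ∫⁻ ω, (∫⁻ a, g i ω a * g j ω a) ∂P ≤
      ∫⁻ ω, (∫⁻ a, g i ω a * g j ω (a + z)) ∂P + ε0) {R : ℝ} (hR : 0 ≤ R) {δ : ℝ≥0∞} (hδ : δ ≠ 0) (hδ' : δ ≠ ⊤) :
    ∫⁻ p, dd (∑ j ∈ Finset.range M, g j p.1 p.2) (smo M h b (fun j ω => ∫⁻ a, g j ω a) p) ∂(Pa P R) ≤
      ENNReal.ofReal (2 * R) * δ + δ⁻¹ * (2 * (M * M * ε0 + M * (2 * J + 1) * (32 * C0))) +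
        (ENNReal.ofReal h)⁻¹ * (M * (16 * C0)) := by
  have hh0 : ENNReal.ofReal h ≠ 0 := by simp [hh]
  have hht : ENNReal.ofReal h ≠ ⊤ := ENNReal.ofReal_ne_top
  have hfm : Measurable fun q : (Ω × ℝ) × ℝ => ∑ j ∈ Finset.range M, g j q.1.1 (q.1.2 + q.2) :=
    Finset.measurable_sum _ fun j _ => (hF.gm j).comp ((measurable_fst.comp measurable_fst).prodMk ((measurable_snd.comp measurable_fst).add measurable_snd))
  have hf0 : Measurable fun p : Ω × ℝ => ∑ j ∈ Finset.range M, g j p.1 p.2 := Finset.measurable_sum _ fun j _ => hF.gm j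
  have hstr : ∀ (a : ℝ), Measurable fun x => strad a (a + h) x := fun a =>
    measurable_strad measurable_const measurable_const measurable_id
  -- the average
  set fb : Ω × ℝ → ℝ≥0∞ := fun p => (ENNReal.ofReal h)⁻¹ * ∫⁻ z in Icc 0 h, ∑ j ∈ Finset.range M, g j p.1 (p.2 + z) with hfb
  have hfbm : Measurable fb := (Measurable.lintegral_prod_right'
    (f := fun q : (Ω × ℝ) × ℝ => ∑ j ∈ Finset.range M, g j q.1.1 (q.1.2 + q.2)) hfm).const_mul _
  have hfb2 : ∀ p, fb p = (ENNReal.ofReal h)⁻¹ * ∑ j ∈ Finset.range M, ∫⁻ x, strad p.2 (p.2 + h) x * g j p.1 x := by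
    intro p
    rw [hfb]
    dsimp only
    congr 1
    rw [lintegral_finsetSum _ fun j _ => (show Measurable fun z => g j p.1 (p.2 + z) from (hF.gma j p.1).comp (measurable_const_add _))]
    refine Finset.sum_congr rfl fun j _ => ?_
    rw [← lintegral_indicator measurableSet_Icc, ← lintegral_add_left_eq_self (fun x => strad p.2 (p.2 + h) x * g j p.1 x) p.2]
    refine lintegral_congr fun z => ?_
    unfold indicator strad
    simp only [mem_Icc, le_add_iff_nonneg_right, add_le_add_iff_left]
    split_ifs <;> simp
  have h1 : ∫⁻ p, dd (∑ j ∈ Finset.range M, g j p.1 p.2) (fb p) ∂(Pa P R) ≤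
      ENNReal.ofReal (2 * R) * δ + δ⁻¹ * (2 * (M * M * ε0 + M * (2 * J + 1) * (32 * C0))) := by
    have h2 : ∀ p, dd (∑ j ∈ Finset.range M, g j p.1 p.2) (fb p) ≤ (ENNReal.ofReal h)⁻¹ * ∫⁻ z in Icc 0 h,
        dd (∑ j ∈ Finset.range M, g j p.1 p.2) (∑ j ∈ Finset.range M, g j p.1 (p.2 + z)) := by
      intro p
      have : ∑ j ∈ Finset.range M, g j p.1 p.2 = (ENNReal.ofReal h)⁻¹ * ∫⁻ _ in Icc 0 h, ∑ j ∈ Finset.range M, g j p.1 p.2 := by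
        rw [setLIntegral_const, Real.volume_Icc, sub_zero, mul_comm, mul_assoc, ENNReal.mul_inv_cancel hh0 hht, mul_one]
      conv_lhs => rw [this]
      refine (dd_mul _ _ _).trans (mul_le_mul' le_rfl (dd_lint measurable_const ?_))
      exact hfm.comp (measurable_const.prodMk measurable_id)
    refine (lintegral_mono h2).trans ?_
    have hFm : Measurable fun q : (Ω × ℝ) × ℝ => dd (∑ j ∈ Finset.range M, g j q.1.1 q.1.2) (∑ j ∈ Finset.range M, g j q.1.1 (q.1.2 + q.2)) :=
      measurable_dd (hf0.comp measurable_fst) hfm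
    rw [lintegral_const_mul _ (Measurable.lintegral_prod_right' (ν := volume.restrict (Icc 0 h)) (f := fun q : (Ω × ℝ) × ℝ =>
      dd (∑ j ∈ Finset.range M, g j q.1.1 q.1.2) (∑ j ∈ Finset.range M, g j q.1.1 (q.1.2 + q.2))) hFm),
      lintegral_lintegral_swap hFm.aemeasurable]
    have h3 : ∀ z ∈ Icc 0 h, ∫⁻ p, dd (∑ j ∈ Finset.range M, g j p.1 p.2) (∑ j ∈ Finset.range M, g j p.1 (p.2 + z)) ∂(Pa P R) ≤
        ENNReal.ofReal (2 * R) * δ + δ⁻¹ * (2 * (M * M * ε0 + M * (2 * J + 1) * (32 * C0))) := by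
      intro z hz
      refine (lintegral_mono fun p => le_am hδ hδ').trans ?_
      rw [lintegral_add_left measurable_const, lintegral_const, Pa_univ hR, mul_comm]
      refine add_le_add le_rfl ?_
      have hm2 : Measurable fun p : Ω × ℝ => dd (∑ j ∈ Finset.range M, g j p.1 p.2) (∑ j ∈ Finset.range M, g j p.1 (p.2 + z)) :=
        hFm.comp (measurable_id.prodMk measurable_const)
      rw [lintegral_const_mul _ (hm2.pow_const 2)]
      refine mul_le_mul' le_rfl ((Pa_le R _).trans (hF.dd_shift hC0 M J hs ?_))
      rw [abs_of_nonneg hz.1]; exact hz.2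
    refine (mul_le_mul' le_rfl (setLIntegral_mono measurable_const h3)).trans (le_of_eq ?_)
    rw [setLIntegral_const, Real.volume_Icc, sub_zero, mul_comm, mul_assoc, ENNReal.mul_inv_cancel hh0 hht, mul_one]
  have h2 : ∫⁻ p, dd (fb p) (smo M h b (fun j ω => ∫⁻ a, g j ω a) p) ∂(Pa P R) ≤ (ENNReal.ofReal h)⁻¹ * (M * (16 * C0)) := by
    have hm3 : ∀ j, Measurable fun q : (Ω × ℝ) × ℝ => dd (strad q.1.2 (q.1.2 + h) q.2) (strad q.1.2 (q.1.2 + h) (b j q.1.1)) * g j q.1.1 q.2 := by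
      intro j
      refine (measurable_dd ?_ ?_).mul ?_
      · exact measurable_strad (by fun_prop) (by fun_prop) (by fun_prop)
      · exact measurable_strad (by fun_prop) (by fun_prop) ((hF.bm j).comp (measurable_fst.comp measurable_fst))
      · exact (hF.gm j).comp ((measurable_fst.comp measurable_fst).prodMk measurable_snd)
    have h3 : ∀ p, dd (fb p) (smo M h b (fun j ω => ∫⁻ a, g j ω a) p) ≤ (ENNReal.ofReal h)⁻¹ * ∑ j ∈ Finset.range M,
        ∫⁻ x, dd (strad p.2 (p.2 + h) x) (strad p.2 (p.2 + h) (b j p.1)) * g j p.1 x := by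
      intro p
      rw [hfb2, smo]
      refine (dd_mul _ _ _).trans (mul_le_mul' le_rfl ((dd_sum _ _ _).trans (Finset.sum_le_sum fun j _ => ?_)))
      rw [← lintegral_const_mul _ (hF.gma j p.1)]
      refine (dd_lint ((hstr _).mul (hF.gma j p.1)) ((hF.gma j p.1).const_mul _)).trans (lintegral_mono fun x => ?_)
      exact dd_mul' _ _ _
    refine (lintegral_mono h3).trans ?_
    have hm4 : ∀ j, Measurable fun p : Ω × ℝ => ∫⁻ x, dd (strad p.2 (p.2 + h) x) (strad p.2 (p.2 + h) (b j p.1)) * g j p.1 x := fun j =>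
      Measurable.lintegral_prod_right' (f := fun q : (Ω × ℝ) × ℝ => dd (strad q.1.2 (q.1.2 + h) q.2) (strad q.1.2 (q.1.2 + h) (b j q.1.1)) * g j q.1.1 q.2) (hm3 j)
    rw [lintegral_const_mul _ (Finset.measurable_sum _ fun j _ => hm4 j), lintegral_finsetSum _ fun j _ => hm4 j]
    refine mul_le_mul' le_rfl ?_
    have h5 : ∀ j ∈ Finset.range M, ∫⁻ p, (∫⁻ x, dd (strad p.2 (p.2 + h) x) (strad p.2 (p.2 + h) (b j p.1)) * g j p.1 x) ∂(Pa P R) ≤ 16 * C0 := by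
      intro j _
      refine (Pa_le R _).trans ?_
      rw [lintegral_prod _ (hm4 j).aemeasurable]
      have h6 : ∀ ω, ∫⁻ a, (∫⁻ x, dd (strad a (a + h) x) (strad a (a + h) (b j ω)) * g j ω x) ≤ 16 * Y j ω ^ 4 := by
        intro ω
        have hm5 : Measurable fun q : ℝ × ℝ => dd (strad q.1 (q.1 + h) q.2) (strad q.1 (q.1 + h) (b j ω)) * g j ω q.2 :=
          (hm3 j).comp (show Measurable fun q : ℝ × ℝ => (((ω, q.1), q.2) : (Ω × ℝ) × ℝ) by fun_prop)
        rw [lintegral_lintegral_swap hm5.aemeasurable]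
        have h7 : ∀ x, ∫⁻ a, dd (strad a (a + h) x) (strad a (a + h) (b j ω)) * g j ω x ≤ 4 * Y j ω * g j ω x := by
          intro x
          have hm6 : Measurable fun a => dd (strad a (a + h) x) (strad a (a + h) (b j ω)) :=
            measurable_dd (measurable_strad measurable_id (measurable_id.add_const h) measurable_const)
              (measurable_strad measurable_id (measurable_id.add_const h) measurable_const)
          rw [lintegral_mul_const _ hm6]
          by_cases hx : g j ω x = 0
          · rw [hx]; simp
          · refine mul_le_mul' ((lint_dd_strad h x (b j ω)).trans ?_) le_rfl
            rw [ENNReal.ofReal_mul (by norm_num)]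
            refine (mul_le_mul' le_rfl (hF.supp j ω x hx)).trans (le_of_eq ?_)
            rw [← mul_assoc]; norm_num
        refine (lintegral_mono h7).trans ?_
        rw [lintegral_const_mul _ (hF.gma j ω)]
        calc 4 * Y j ω * ∫⁻ a, g j ω a ≤ 4 * Y j ω * (4 * Y j ω ^ 2) := by gcongr; exact hF.int_le j ω
          _ = 16 * Y j ω ^ 3 := by ring
          _ ≤ _ := mul_le_mul' le_rfl (pow_le_pow_right₀ (hF.Y1 j ω) (by norm_num))
      refine (lintegral_mono h6).trans ?_
      rw [lintegral_const_mul _ ((hF.Ym j).pow_const 4)]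
      gcongr
      exact hF.Y4 j
    refine (Finset.sum_le_sum h5).trans (le_of_eq ?_)
    simp
  have hsm : Measurable (smo M h b (fun j ω => ∫⁻ a, g j ω a)) := measurable_smo M h hF.bm hF.int_meas
  refine (lintegral_mono fun p => dd_triangle _ (fb p) _).trans ?_
  rw [lintegral_add_left (measurable_dd hf0 hfbm)]
  exact add_le_add h1 h2

end fbm

end LC
end

section
namespace LC

/-! ### The master estimate -/

/-- occupation counts -/
def Mo (w : ℝ → ℝ) (s t a : ℝ) : ℝ≥0∞ := ∫⁻ r in Icc s (s + t), strad a (a + 1) (w r)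

lemma Mo_blocks {w : ℝ → ℝ} (hw : Continuous w) (a : ℝ) {m : ℝ} (hm : 0 ≤ m) (n : ℕ) :
    ∑ j ∈ Finset.range n, Mo w (0 + j * m) m a = Mo w 0 (n * m) a := by
  induction n with
  | zero => simp [Mo]
  | succ n ih =>
    rw [Finset.sum_range_succ, ih]
    unfold Mo
    have hnm : 0 ≤ n * m := by positivity
    simp only [zero_add]
    rw [setLIntegral_congr Ioc_ae_eq_Icc.symm, setLIntegral_congr (Ioc_ae_eq_Icc (a := n * m)).symm,
      setLIntegral_congr (Ioc_ae_eq_Icc (b := (n + 1 : ℕ) * m)).symm,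
      ← lintegral_union measurableSet_Ioc (Ioc_disjoint_Ioc_of_le le_rfl), Ioc_union_Ioc_eq_Ioc hnm (by linarith)]
    congr 3
    push_cast; ring

lemma Mo_int {w : ℝ → ℝ} (hw : Continuous w) (s : ℝ) (t : ℝ) :
    ∫⁻ a, Mo w s t a = ENNReal.ofReal t := by
  unfold Mo
  have hm : Measurable fun q : ℝ × ℝ => strad q.1 (q.1 + 1) (w q.2) :=
    measurable_strad measurable_fst (measurable_fst.add_const 1) (hw.measurable.comp measurable_snd)
  rw [lintegral_lintegral_swap hm.aemeasurable]
  simp_rw [lint_strad]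
  simp

/-- two-point overlap function -/
def GG (x : ℝ) : ℝ≥0∞ := ∫⁻ a, strad a (a + 1) 0 * strad a (a + 1) x

lemma GG_meas : Measurable GG := by
  refine Measurable.lintegral_prod_right' (f := fun q : ℝ × ℝ => strad q.2 (q.2 + 1) 0 * strad q.2 (q.2 + 1) q.1) ?_
  exact (measurable_strad measurable_snd (measurable_snd.add_const 1) measurable_const).mul
    (measurable_strad measurable_snd (measurable_snd.add_const 1) measurable_fst)

lemma lint_strad' (a : ℝ) : ∫⁻ x, strad a (a + 1) x = 1 := by
  have : ∀ x, strad a (a + 1) x = (Icc a (a + 1)).indicator 1 x := fun x => by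
    unfold strad indicator; simp only [Pi.one_apply]
  simp_rw [this]
  rw [lintegral_indicator_one measurableSet_Icc, Real.volume_Icc]
  simp

lemma GG_int : ∫⁻ x, GG x = 1 := by
  unfold GG
  have hm : Measurable fun q : ℝ × ℝ => strad q.2 (q.2 + 1) 0 * strad q.2 (q.2 + 1) q.1 :=
    (measurable_strad measurable_snd (measurable_snd.add_const 1) measurable_const).mul
      (measurable_strad measurable_snd (measurable_snd.add_const 1) measurable_fst)
  rw [lintegral_lintegral_swap hm.aemeasurable]
  have : ∀ a : ℝ, ∫⁻ x, strad a (a + 1) 0 * strad a (a + 1) x = strad a (a + 1) 0 := fun a => by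
    rw [lintegral_const_mul _ (show Measurable fun x => strad a (a + 1) x from measurable_strad measurable_const measurable_const measurable_id), lint_strad', mul_one]
  simp_rw [this, lint_strad]
  simp

lemma GG_eq (x y z : ℝ) : ∫⁻ a, strad a (a + 1) x * strad (a + z) (a + z + 1) y = GG (y - x - z) := by
  unfold GG
  rw [← lintegral_add_right_eq_self _ x]
  refine lintegral_congr fun a => ?_
  congr 1
  · unfold strad
    congr 1
    simp only [mem_Icc, eq_iff_iff]
    constructor <;> rintro ⟨h1, h2⟩ <;> constructor <;> linarith
  · unfold strad
    congr 1
    simp only [mem_Icc, eq_iff_iff]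
    constructor <;> rintro ⟨h1, h2⟩ <;> constructor <;> linarith

set_option linter.unusedSectionVars false
section fbm
variable {Ω : Type*} [MeasurableSpace Ω] {H A : ℝ} {P : Measure Ω} [IsProbabilityMeasure P]
  {B : ℝ → Ω → ℝ}

lemma IsF.joint (hB : IsF H A P B) : Measurable fun q : ℝ × Ω => B q.1 q.2 :=
  measurable_uncurry_of_continuous_of_measurable (u := fun r ω => B r ω) (fun ω => hB.cont ω) hB.meas

lemma IsF.Mo_meas (hB : IsF H A P B) (s t : ℝ) : Measurable fun p : Ω × ℝ => Mo (pth B p.1) s t p.2 := by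
  refine Measurable.lintegral_prod_right' (f := fun q : (Ω × ℝ) × ℝ => strad q.1.2 (q.1.2 + 1) (B q.2 q.1.1)) ?_
  exact measurable_strad (by fun_prop) (by fun_prop) (hB.joint.comp (measurable_snd.prodMk (measurable_fst.comp measurable_fst)))

lemma IsF.occ_corr (hB : IsF H A P B) (s s' t z : ℝ) :
    ∫⁻ ω, (∫⁻ a, Mo (pth B ω) s t a * Mo (pth B ω) s' t (a + z)) ∂P =
      ∫⁻ q in Icc s (s + t) ×ˢ Icc s' (s' + t), (∫⁻ ω, GG (B q.2 ω - B q.1 ω - z) ∂P) := by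
  have h1 : ∀ ω, ∫⁻ a, Mo (pth B ω) s t a * Mo (pth B ω) s' t (a + z) =
      ∫⁻ q in Icc s (s + t) ×ˢ Icc s' (s' + t), GG (B q.2 ω - B q.1 ω - z) := by
    intro ω
    have hw := (hB.cont' ω).measurable
    have h2 : ∀ a, Mo (pth B ω) s t a * Mo (pth B ω) s' t (a + z) =
        ∫⁻ q in Icc s (s + t) ×ˢ Icc s' (s' + t), strad a (a + 1) (pth B ω q.1) * strad (a + z) (a + z + 1) (pth B ω q.2) := by
      intro a
      unfold Mo
      rw [Measure.volume_eq_prod, ← Measure.prod_restrict]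
      exact (lintegral_prod_mul (f := fun r => strad a (a + 1) (pth B ω r)) (g := fun r => strad (a + z) (a + z + 1) (pth B ω r))
        (measurable_strad measurable_const measurable_const hw).aemeasurable
        (measurable_strad measurable_const measurable_const hw).aemeasurable).symm
    simp_rw [h2]
    rw [lintegral_lintegral_swap]
    · refine lintegral_congr fun q => ?_
      exact GG_eq _ _ _
    · refine Measurable.aemeasurable ?_
      exact (measurable_strad measurable_fst (measurable_fst.add_const 1)
        (hw.comp (measurable_fst.comp measurable_snd))).mul (measurable_strad (measurable_fst.add_const z)
          ((measurable_fst.add_const z).add_const 1) (hw.comp (measurable_snd.comp measurable_snd)))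
  simp_rw [h1]
  rw [lintegral_lintegral_swap]
  refine (GG_meas.comp (((hB.joint.comp ((measurable_snd.comp measurable_snd).prodMk measurable_fst)).sub
    (hB.joint.comp ((measurable_fst.comp measurable_snd).prodMk measurable_fst))).sub_const z)).aemeasurable

lemma IsF.smooth_occ (hB : IsF H A P B) (hH0 : 0 < H) (hH : H < 1 / 2) {s s' t D : ℝ} (ht : 0 < t)
    (hD : 0 < D) (hs : s + t + D ≤ s') (z : ℝ) :
    ∫⁻ ω, (∫⁻ a, Mo (pth B ω) s t a * Mo (pth B ω) s' t a) ∂P ≤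
      ∫⁻ ω, (∫⁻ a, Mo (pth B ω) s t a * Mo (pth B ω) s' t (a + z)) ∂P +
      ENNReal.ofReal (|z| / (A * H * D ^ (2 * H))) * (ENNReal.ofReal t * ENNReal.ofReal t) := by
  have hA := hB.pos
  have h0 := hB.occ_corr s s' t 0
  simp only [add_zero, sub_zero] at h0
  rw [h0, hB.occ_corr s s' t z]
  have hvol : volume (Icc s (s + t) ×ˢ Icc s' (s' + t)) = ENNReal.ofReal t * ENNReal.ofReal t := by
    rw [Measure.volume_eq_prod, Measure.prod_prod, Real.volume_Icc, Real.volume_Icc]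
    simp
  rw [← hvol, ← setLIntegral_const, ← lintegral_add_right _ measurable_const]
  refine setLIntegral_mono' (measurableSet_Icc.prod measurableSet_Icc) fun q hq => ?_
  obtain ⟨⟨hq1, hq2⟩, hq3, hq4⟩ := hq
  have hgap : D ≤ q.2 - q.1 := by linarith
  have hdm : Measurable fun ω => B q.2 ω - B q.1 ω := (hB.meas _).sub (hB.meas _)
  have hlaw := hB.incr_law q.1 q.2
  have hDp : 0 < D ^ (2 * H) := Real.rpow_pos_of_pos hD _
  have hv : A * D ^ (2 * H) ≤ A * |q.2 - q.1| ^ (2 * H) := by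
    rw [abs_of_nonneg (by linarith)]
    gcongr
  have hvpos : 0 < A * |q.2 - q.1| ^ (2 * H) := lt_of_lt_of_le (by positivity) hv
  have hv0 : (A * |q.2 - q.1| ^ (2 * H)).toNNReal ≠ 0 := by
    rw [Ne, Real.toNNReal_eq_zero]; linarith
  have h1 := smooth1 hv0 GG_meas (-z)
  rw [← hlaw, lintegral_map GG_meas hdm, lintegral_map (show Measurable fun x => GG (x + -z) from GG_meas.comp (measurable_id.add_const _)) hdm, GG_int, mul_one,
    abs_neg] at h1
  refine h1.trans (add_le_add le_rfl (ENNReal.ofReal_le_ofReal ?_))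
  rw [Real.coe_toNNReal _ hvpos.le]
  refine div_le_div_of_nonneg_left (abs_nonneg z) (by positivity) (le_trans ?_ hv)
  have : A * H * D ^ (2 * H) = H * (A * D ^ (2 * H)) := by ring
  rw [this]
  have h2 : 0 < A * D ^ (2 * H) := by positivity
  nlinarith

lemma IsF.master1 (hB : IsF H A P B) (hH0 : 0 < H) (hH : H < 1 / 2) {m Nb J : ℕ} (hm : 0 < m) (hJ : 0 < J) {h : ℝ} (hh : 0 < h)
    {R : ℝ} (hR : 0 ≤ R) {δ C0 κ c : ℝ≥0∞} (hδ : δ ≠ 0) (hδ' : δ ≠ ⊤) (hC0 : C0 ≠ ⊤) (hc : c ≠ ⊤) {Y : ℕ → Ω → ℝ≥0∞}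
    (hF1 : Fam P C0 (fun j ω a => Nf (pth B ω) (0 + j * m) m a) (fun j ω => B (0 + j * m) ω) Y)
    (hF2 : Fam P C0 (fun j ω a => Mo (pth B ω) (0 + j * m) m a) (fun j ω => B (0 + j * m) ω) Y)
    (hK : ∀ s, ∫⁻ ω, dd (Kb (pth B ω) s m) (c * m) ∂P ≤ κ) :
    ∫⁻ p, dd (Nf (pth B p.1) 0 (Nb * m) p.2) (c * Mo (pth B p.1) 0 (Nb * m) p.2) ∂(Pa P R) ≤
      Nb + (1 + c) * (ENNReal.ofReal (2 * R) * δ + δ⁻¹ * (2 * (Nb * Nb * (ENNReal.ofReal (h / (A * H * (J * m) ^ (2 * H))) * (32 * C0)) +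
        Nb * (2 * J + 1) * (32 * C0))) + (ENNReal.ofReal h)⁻¹ * (Nb * (16 * C0))) + Nb * κ := by
  have hA := hB.pos
  have hm' : (0 : ℝ) < m := by exact_mod_cast hm
  have hJ' : (1 : ℝ) ≤ J := by exact_mod_cast hJ
  have hJm : (m : ℝ) ≤ J * m := by nlinarith
  have hh0 : ENNReal.ofReal h ≠ 0 := by simp [hh]
  have hht : ENNReal.ofReal h ≠ ⊤ := ENNReal.ofReal_ne_top
  have hgap : ∀ i j : ℕ, i + J < j → (0 + i * m + m + J * m : ℝ) ≤ 0 + j * m := by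
    intro i j hij
    have : ((i + J + 1 : ℕ) : ℝ) ≤ j := by exact_mod_cast hij
    push_cast at this
    nlinarith
  have hz : ∀ z : ℝ, |z| ≤ h → ENNReal.ofReal (|z| / (A * H * (J * m) ^ (2 * H))) ≤ ENNReal.ofReal (h / (A * H * (J * m) ^ (2 * H))) := by
    intro z hz
    refine ENNReal.ofReal_le_ofReal ?_
    gcongr
  have hM2 : ∀ i j : ℕ, ENNReal.ofReal m * ENNReal.ofReal m ≤ 32 * C0 := by
    intro i j
    have := hF2.int_prod i j
    simp_rw [fun ω s => Mo_int (hB.cont' ω) s m] at this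
    simpa using this
  have hS1 := hF1.smooth hC0 Nb J hh (ε0 := ENNReal.ofReal (h / (A * H * (J * m) ^ (2 * H))) * (32 * C0))
    (fun i j z hz' hij => (hB.smooth hH0 hH hm' hJm (hgap i j hij) z).trans
      (add_le_add le_rfl (mul_le_mul' (hz z hz') (hF1.int_prod i j)))) hR hδ hδ'
  have hS2 := hF2.smooth hC0 Nb J hh (ε0 := ENNReal.ofReal (h / (A * H * (J * m) ^ (2 * H))) * (32 * C0))
    (fun i j z hz' hij => (hB.smooth_occ hH0 hH hm' (by linarith) (hgap i j hij) z).trans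
      (add_le_add le_rfl (mul_le_mul' (hz z hz') (hM2 i j)))) hR hδ hδ'
  set S := ENNReal.ofReal (2 * R) * δ + δ⁻¹ * (2 * (Nb * Nb * (ENNReal.ofReal (h / (A * H * (J * m) ^ (2 * H))) * (32 * C0)) +
        Nb * (2 * J + 1) * (32 * C0))) + (ENNReal.ofReal h)⁻¹ * (Nb * (16 * C0)) with hS
  simp_rw [fun ω s => Mo_int (hB.cont' ω) s m] at hS2
  set b : ℕ → Ω → ℝ := fun j ω => B (0 + j * m) ω with hb
  have hbm : ∀ j, Measurable (b j) := hF1.bm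
  have hsm1 : Measurable (smo Nb h b (fun j ω => Kb (pth B ω) (0 + j * m) m)) := measurable_smo Nb h hbm fun j => hB.Kb_meas _ hm'
  have hsm2 : Measurable (smo Nb h b (fun _ _ => ENNReal.ofReal m)) := measurable_smo Nb h hbm fun j => measurable_const
  have hsN : Measurable fun p : Ω × ℝ => ∑ j ∈ Finset.range Nb, Nf (pth B p.1) (0 + j * m) m p.2 :=
    Finset.measurable_sum _ fun j _ => hF1.gm j
  have hsM : Measurable fun p : Ω × ℝ => ∑ j ∈ Finset.range Nb, Mo (pth B p.1) (0 + j * m) m p.2 :=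
    Finset.measurable_sum _ fun j _ => hF2.gm j
  -- the steps
  have hstr : ∀ (j : ℕ) (u : ℝ), Measurable fun p : Ω × ℝ => strad p.2 (p.2 + u) (b j p.1) := fun j u =>
    measurable_strad measurable_snd (measurable_snd.add_const u) ((hbm j).comp measurable_fst)
  have s1 : ∫⁻ p, dd (Nf (pth B p.1) 0 (Nb * m) p.2) (∑ j ∈ Finset.range Nb, Nf (pth B p.1) (0 + j * m) m p.2) ∂(Pa P R) ≤ Nb := by
    have h1 : ∀ p : Ω × ℝ, dd (Nf (pth B p.1) 0 (Nb * m) p.2) (∑ j ∈ Finset.range Nb, Nf (pth B p.1) (0 + j * m) m p.2) ≤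
        ∑ j ∈ Finset.range Nb, strad p.2 (p.2 + 1) (b j p.1) := fun p => by
      rw [dd_comm]
      exact dd_le_of (Nf_blocks_le p.2 hm'.le 0 Nb) (Nf_le_blocks p.2 hm'.le 0 Nb)
    refine (lintegral_mono h1).trans ((Pa_le R _).trans ?_)
    rw [lintegral_finsetSum _ fun j _ => hstr j 1]
    have h2 : ∀ j, ∫⁻ p : Ω × ℝ, strad p.2 (p.2 + 1) (b j p.1) ∂(P.prod volume) = 1 := fun j => by
      rw [lintegral_prod _ (hstr j 1).aemeasurable]
      simp_rw [lint_strad]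
      simp
    simp [h2]
  have s3 : ∫⁻ p, dd (smo Nb h b (fun j ω => Kb (pth B ω) (0 + j * m) m) p) (smo Nb h b (fun _ _ => c * m) p) ∂(Pa P R) ≤ Nb * κ := by
    have hdm : ∀ j : ℕ, Measurable fun ω => dd (Kb (pth B ω) (0 + j * m) m) (c * m) := fun j =>
      measurable_dd (hB.Kb_meas _ hm') measurable_const
    have hm1 : ∀ j : ℕ, Measurable fun p : Ω × ℝ => strad p.2 (p.2 + h) (b j p.1) * dd (Kb (pth B p.1) (0 + j * m) m) (c * m) := fun j =>
      (hstr j h).mul ((hdm j).comp measurable_fst)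
    have h1 : ∀ p : Ω × ℝ, dd (smo Nb h b (fun j ω => Kb (pth B ω) (0 + j * m) m) p) (smo Nb h b (fun _ _ => c * m) p) ≤
        (ENNReal.ofReal h)⁻¹ * ∑ j ∈ Finset.range Nb, strad p.2 (p.2 + h) (b j p.1) * dd (Kb (pth B p.1) (0 + j * m) m) (c * m) := fun p =>
      (dd_mul _ _ _).trans (mul_le_mul' le_rfl ((dd_sum _ _ _).trans (Finset.sum_le_sum fun j _ => dd_mul _ _ _)))
    refine (lintegral_mono h1).trans ((Pa_le R _).trans ?_)
    rw [lintegral_const_mul _ (Finset.measurable_sum _ fun j _ => hm1 j), lintegral_finsetSum _ fun j _ => hm1 j]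
    have h2 : ∀ j ∈ Finset.range Nb, ∫⁻ p : Ω × ℝ, strad p.2 (p.2 + h) (b j p.1) * dd (Kb (pth B p.1) (0 + j * m) m) (c * m) ∂(P.prod volume) ≤
        ENNReal.ofReal h * κ := fun j _ => by
      rw [lintegral_prod _ (hm1 j).aemeasurable]
      have h3 : ∀ ω, ∫⁻ a, strad a (a + h) (b j ω) * dd (Kb (pth B ω) (0 + j * m) m) (c * m) =
          ENNReal.ofReal h * dd (Kb (pth B ω) (0 + j * m) m) (c * m) := fun ω => by
        rw [lintegral_mul_const _ (show Measurable fun a => strad a (a + h) (b j ω) from measurable_strad measurable_id (measurable_id.add_const h) measurable_const), lint_strad]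
      simp_rw [h3]
      rw [lintegral_const_mul _ (hdm j)]
      exact mul_le_mul' le_rfl (hK _)
    refine (mul_le_mul' le_rfl (Finset.sum_le_sum h2)).trans (le_of_eq ?_)
    rw [Finset.sum_const, Finset.card_range, nsmul_eq_mul, mul_left_comm, ← mul_assoc (ENNReal.ofReal h)⁻¹,
      ENNReal.inv_mul_cancel hh0 hht, one_mul]
  have s4 : ∫⁻ p, dd (smo Nb h b (fun _ _ => c * m) p) (c * Mo (pth B p.1) 0 (Nb * m) p.2) ∂(Pa P R) ≤ c * S := by
    have h1 : ∀ p, dd (smo Nb h b (fun _ _ => c * m) p) (c * Mo (pth B p.1) 0 (Nb * m) p.2) ≤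
        c * dd (∑ j ∈ Finset.range Nb, Mo (pth B p.1) (0 + j * m) m p.2) (smo Nb h b (fun _ _ => ENNReal.ofReal m) p) := by
      intro p
      rw [← Mo_blocks (hB.cont' p.1) p.2 hm'.le Nb, dd_comm (∑ j ∈ Finset.range Nb, _)]
      have : smo Nb h b (fun _ _ => c * m) p = c * smo Nb h b (fun _ _ => ENNReal.ofReal m) p := by
        unfold smo
        rw [mul_left_comm c, Finset.mul_sum _ _ c]
        refine congrArg _ (Finset.sum_congr rfl fun j _ => ?_)
        rw [mul_left_comm, ENNReal.ofReal_natCast]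
      rw [this]
      exact dd_mul _ _ _
    refine (lintegral_mono h1).trans ?_
    rw [lintegral_const_mul _ (measurable_dd hsM hsm2)]
    exact mul_le_mul' le_rfl hS2
  have hNm : Measurable fun p : Ω × ℝ => Nf (pth B p.1) 0 (Nb * m) p.2 := by
    rcases Nat.eq_zero_or_pos Nb with h0 | h0
    · have : ∀ p : Ω × ℝ, Nf (pth B p.1) 0 (Nb * m) p.2 = 0 := fun p => by
        have := Nf_le_blocks (w := pth B p.1) p.2 hm'.le 0 Nb
        rw [h0] at this ⊢
        simpa using this
      simp_rw [this]; exact measurable_const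
    · exact hB.Nf_meas 0 (by positivity) measurable_fst measurable_snd
  have hsm3 : Measurable (smo Nb h b (fun _ _ => c * m)) := measurable_smo Nb h hbm fun j => measurable_const
  have hall : ∀ p : Ω × ℝ, dd (Nf (pth B p.1) 0 (Nb * m) p.2) (c * Mo (pth B p.1) 0 (Nb * m) p.2) ≤
      dd (Nf (pth B p.1) 0 (Nb * m) p.2) (∑ j ∈ Finset.range Nb, Nf (pth B p.1) (0 + j * m) m p.2) +
      (dd (∑ j ∈ Finset.range Nb, Nf (pth B p.1) (0 + j * m) m p.2) (smo Nb h b (fun j ω => Kb (pth B ω) (0 + j * m) m) p) +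
      (dd (smo Nb h b (fun j ω => Kb (pth B ω) (0 + j * m) m) p) (smo Nb h b (fun _ _ => c * m) p) +
      dd (smo Nb h b (fun _ _ => c * m) p) (c * Mo (pth B p.1) 0 (Nb * m) p.2))) := fun p =>
    (dd_triangle _ _ _).trans (add_le_add le_rfl ((dd_triangle _ _ _).trans (add_le_add le_rfl (dd_triangle _ _ _))))
  refine (lintegral_mono hall).trans ?_
  rw [lintegral_add_left (measurable_dd hNm hsN), lintegral_add_left (measurable_dd hsN hsm1), lintegral_add_left (measurable_dd hsm1 hsm3)]
  refine (add_le_add s1 (add_le_add hS1 (add_le_add s3 s4))).trans (le_of_eq ?_)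
  rw [add_mul, one_mul]
  ring

end fbm

end LC
end

section
namespace LC

/-! ### Choice of exponents -/

lemma conv (Nb J : ℕ) (E C0 d d' h' R2 c κ U : ℝ≥0)
    (hreal : (Nb : ℝ) + (1 + c) * (R2 * d + d' * (2 * (Nb * Nb * (E * (32 * C0)) + Nb * (2 * J + 1) * (32 * C0))) + h' * (Nb * (16 * C0))) +
      Nb * κ ≤ (U : ℝ)) :
    (Nb : ℝ≥0∞) + (1 + c) * (R2 * d + d' * (2 * (Nb * Nb * (E * (32 * C0)) + Nb * (2 * J + 1) * (32 * C0))) + h' * (Nb * (16 * C0))) +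
      Nb * κ ≤ (U : ℝ≥0∞) := by
  have : Nb + (1 + c) * (R2 * d + d' * (2 * (Nb * Nb * (E * (32 * C0)) + Nb * (2 * J + 1) * (32 * C0))) + h' * (Nb * (16 * C0))) +
      Nb * κ ≤ U := by
    rw [← NNReal.coe_le_coe]
    push_cast
    exact hreal
  exact_mod_cast this

lemma expo {K H A C C1 c M0 R2 p q d r x η : ℝ} (hK : 1 ≤ K) (hH0 : 0 < H) (hA : 0 < A) (hC : 0 ≤ C) (hc : 0 ≤ c) (hC1 : 0 ≤ C1)
    (hx : x = p + q) (hq : q = r + 2) (hr : 0 ≤ r) (hη : η = 3 * q + 2) (hd : 0 ≤ d) (ha : H * x + 6 + 5 * q ≤ 2 * H * (d + q))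
    (hb : 4 + 3 * q + d ≤ (1 - H) * x) (hR : R2 ≤ 2 * M0 * K ^ (x * H)) :
    K ^ p + (1 + c) * (R2 * K ^ ((1 - H) * x - 2) + K ^ (-((1 - H) * x - 2)) *
      (2 * (K ^ p * K ^ p * (K ^ η / (A * H * (K ^ d * K ^ q) ^ (2 * H)) * (32 * (C * K ^ (4 * q)))) +
        K ^ p * (2 * K ^ d + 1) * (32 * (C * K ^ (4 * q))))) + K ^ (-η) * (K ^ p * (16 * (C * K ^ (4 * q))))) +
      K ^ p * (C1 * K ^ r) ≤ (1 + (1 + c) * (2 * M0 + 64 * (C / (A * H)) + 64 * (3 * C) + 16 * C) + C1) * K ^ (x - 2) := by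
  have hK0 : 0 < K := by linarith
  have mono : ∀ {e f : ℝ}, e ≤ f → K ^ e ≤ K ^ f := fun h => Real.rpow_le_rpow_of_exponent_le hK h
  have pos : ∀ e : ℝ, 0 < K ^ e := fun e => Real.rpow_pos_of_pos hK0 e
  have t1 : K ^ p ≤ K ^ (x - 2) := mono (by linarith)
  have t2 : R2 * K ^ ((1 - H) * x - 2) ≤ 2 * M0 * K ^ (x - 2) := by
    refine (mul_le_mul_of_nonneg_right hR (pos _).le).trans (le_of_eq ?_)
    rw [mul_assoc, ← Real.rpow_add hK0]
    congr 2; ring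
  have t3 : K ^ (-((1 - H) * x - 2)) * (K ^ p * K ^ p * (K ^ η / (A * H * (K ^ d * K ^ q) ^ (2 * H)) * (C * K ^ (4 * q)))) ≤
      C / (A * H) * K ^ (x - 2) := by
    rw [← Real.rpow_add hK0 d q, ← Real.rpow_mul hK0.le]
    have : K ^ (-((1 - H) * x - 2)) * (K ^ p * K ^ p * (K ^ η / (A * H * K ^ ((d + q) * (2 * H))) * (C * K ^ (4 * q)))) =
        C / (A * H) * K ^ (-((1 - H) * x - 2) + p + p + η + -((d + q) * (2 * H)) + 4 * q) := by
      rw [Real.rpow_add hK0, Real.rpow_add hK0, Real.rpow_add hK0, Real.rpow_add hK0, Real.rpow_add hK0, Real.rpow_neg hK0.le ((d + q) * (2 * H))]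
      have := pos ((d + q) * (2 * H))
      field_simp
    rw [this]
    refine mul_le_mul_of_nonneg_left (mono ?_) (by positivity)
    nlinarith
  have t4 : K ^ (-((1 - H) * x - 2)) * (K ^ p * (2 * K ^ d + 1) * (C * K ^ (4 * q))) ≤ 3 * C * K ^ (x - 2) := by
    have h1 : 2 * K ^ d + 1 ≤ 3 * K ^ d := by
      have := Real.one_le_rpow hK hd
      linarith
    have h2 : K ^ (-((1 - H) * x - 2)) * (K ^ p * (3 * K ^ d) * (C * K ^ (4 * q))) =
        3 * C * K ^ (-((1 - H) * x - 2) + p + d + 4 * q) := by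
      rw [Real.rpow_add hK0, Real.rpow_add hK0, Real.rpow_add hK0]
      ring
    have h3 : K ^ (-((1 - H) * x - 2)) * (K ^ p * (2 * K ^ d + 1) * (C * K ^ (4 * q))) ≤
        K ^ (-((1 - H) * x - 2)) * (K ^ p * (3 * K ^ d) * (C * K ^ (4 * q))) := by
      have := pos p; have := pos (-((1 - H) * x - 2)); have := pos (4 * q)
      gcongr
    refine h3.trans (h2.trans_le (mul_le_mul_of_nonneg_left (mono ?_) (by positivity)))
    nlinarith
  have t5 : K ^ (-η) * (K ^ p * (C * K ^ (4 * q))) ≤ C * K ^ (x - 2) := by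
    have : K ^ (-η) * (K ^ p * (C * K ^ (4 * q))) = C * K ^ (-η + p + 4 * q) := by
      rw [Real.rpow_add hK0, Real.rpow_add hK0]; ring
    rw [this]
    refine mul_le_mul_of_nonneg_left (mono ?_) hC
    linarith
  have t6 : K ^ p * (C1 * K ^ r) ≤ C1 * K ^ (x - 2) := by
    have : K ^ p * (C1 * K ^ r) = C1 * K ^ (p + r) := by rw [Real.rpow_add hK0]; ring
    rw [this]
    refine mul_le_mul_of_nonneg_left (mono ?_) hC1
    linarith
  have t7 : R2 * K ^ ((1 - H) * x - 2) + K ^ (-((1 - H) * x - 2)) *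
      (2 * (K ^ p * K ^ p * (K ^ η / (A * H * (K ^ d * K ^ q) ^ (2 * H)) * (32 * (C * K ^ (4 * q)))) +
        K ^ p * (2 * K ^ d + 1) * (32 * (C * K ^ (4 * q))))) + K ^ (-η) * (K ^ p * (16 * (C * K ^ (4 * q)))) ≤
      (2 * M0 + 64 * (C / (A * H)) + 64 * (3 * C) + 16 * C) * K ^ (x - 2) := by
    linarith [t2, t3, t4, t5]
  have t8 := mul_le_mul_of_nonneg_left t7 (show 0 ≤ 1 + c by linarith)
  linarith [t1, t6, t8]

set_option linter.unusedSectionVars false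
section fbm
variable {Ω : Type*} [MeasurableSpace Ω] {H A : ℝ} {P : Measure Ω} [IsProbabilityMeasure P]
  {B : ℝ → Ω → ℝ}

lemma master2 (hH0 : 0 < H) (hH : H < 1 / 2) {B0 : ℝ → Ω → ℝ} (hB0 : IsF H A P B0) :
    ∃ x : ℕ, 2 ≤ x ∧ ∀ M0 : ℝ, ∃ C : ℝ, ∀ B, IsF H A P B → ∀ k : ℕ, 0 < k → ∀ R, 0 ≤ R →
      R ≤ M0 * ((k : ℝ) ^ x) ^ H →
      ∫⁻ p, dd (Nf (pth B p.1) 0 ((k : ℝ) ^ x) p.2) (cc P B0 * Mo (pth B p.1) 0 ((k : ℝ) ^ x) p.2) ∂(Pa P R) ≤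
        ENNReal.ofReal (C * ((k : ℝ) ^ x / (k : ℝ) ^ 2)) := by
  obtain ⟨r, C1, hC1, hlln⟩ := lln (Ω := Ω) (H := H) (A := A) (P := P) hH0 hH
  obtain ⟨C, hC, hfam⟩ := IsF.fam (Ω := Ω) (H := H) (A := A) (P := P) hH0
  have hA := hB0.pos
  obtain ⟨q, hq⟩ : ∃ q : ℕ, q = r + 2 := ⟨_, rfl⟩
  rw [← hq] at hlln
  obtain ⟨p, hp⟩ := exists_nat_ge ((5 + 3 * q + (6 + 5 * q) / (2 * H)) / (1 / 2 - H))
  rw [div_le_iff₀ (by linarith)] at hp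
  obtain ⟨x, hx⟩ : ∃ x : ℕ, x = p + q := ⟨_, rfl⟩
  set d : ℕ := ⌈(x : ℝ) / 2 + (6 + 5 * q) / (2 * H)⌉₊ with hd
  have hd1 : (x : ℝ) / 2 + (6 + 5 * q) / (2 * H) ≤ d := Nat.le_ceil _
  have hd2 : (d : ℝ) < x / 2 + (6 + 5 * q) / (2 * H) + 1 := Nat.ceil_lt_add_one (by positivity)
  have hxr : (x : ℝ) = p + q := by rw [hx]; push_cast; ring
  have ha : H * x + 6 + 5 * q ≤ 2 * H * ((d : ℝ) + q) := by
    have h1 := mul_le_mul_of_nonneg_left hd1 (show 0 ≤ 2 * H by linarith)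
    have h2 : 2 * H * ((x : ℝ) / 2 + (6 + 5 * q) / (2 * H)) = H * x + 6 + 5 * q := by field_simp; ring
    have h3 : 0 ≤ 2 * H * (q : ℝ) := by positivity
    linarith
  have hb : 4 + 3 * q + d ≤ (1 - H) * (x : ℝ) := by
    have h1 : (p : ℝ) * (1 / 2 - H) ≤ x * (1 / 2 - H) := by
      refine mul_le_mul_of_nonneg_right ?_ (by linarith)
      rw [hxr]; linarith [Nat.cast_nonneg (α := ℝ) q]
    linarith
  have hcc := hB0.cc_ne_top hH0
  refine ⟨x, by omega, fun M0 => ⟨1 + (1 + (cc P B0).toReal) * (2 * M0 + 64 * (C / (A * H)) + 64 * (3 * C) + 16 * C) + C1, fun B hB k hk R hR hRM => ?_⟩⟩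
  · have hK : (1 : ℝ) ≤ k := by exact_mod_cast hk
    have hK0 : (0 : ℝ) < k := by linarith
    set K : ℝ := (k : ℝ) with hKdef
    have hm : 0 < k ^ q := pow_pos hk q
    obtain ⟨Y, hF1, hF2⟩ := hfam B hB 0 (k ^ q) hm
    have hpos : ∀ e : ℝ, 0 < K ^ e := fun e => Real.rpow_pos_of_pos hK0 e
    have hKl : ∀ s, ∫⁻ ω, dd (Kb (pth B ω) s (k ^ q : ℕ)) (cc P B0 * (k ^ q : ℕ)) ∂P ≤ ENNReal.ofReal (C1 * K ^ r) := by
      intro s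
      rw [cc_eq hB0 hB]
      exact hlln B hB s k hk
    have hmain := hB.master1 (m := k ^ q) (Nb := k ^ p) (J := k ^ d) hH0 hH hm (pow_pos hk d) (hpos (3 * q + 2)) hR
      (δ := ENNReal.ofReal (K ^ ((1 - H) * x - 2))) (by simp [hpos]) ENNReal.ofReal_ne_top ENNReal.ofReal_ne_top hcc hF1 hF2 hKl
    have hn : ((k ^ p : ℕ) : ℝ) * ((k ^ q : ℕ) : ℝ) = K ^ x := by push_cast; rw [hKdef, hx, pow_add]
    rw [hn] at hmain
    refine hmain.trans ?_
    rw [← ENNReal.ofReal_inv_of_pos (hpos _), ← ENNReal.ofReal_inv_of_pos (hpos _), ← ENNReal.coe_toNNReal hcc]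
    refine conv _ _ _ _ _ _ _ _ _ _ _ ?_
    have hR2 : 2 * R ≤ 2 * M0 * K ^ ((x : ℝ) * H) := by
      rw [Real.rpow_mul hK0.le, Real.rpow_natCast]; linarith
    have hfin := expo (C := C) (C1 := C1) (c := (cc P B0).toReal) hK hH0 hA hC ENNReal.toReal_nonneg hC1 hxr
      (show (q : ℝ) = r + 2 by rw [hq]; push_cast; ring) (Nat.cast_nonneg r) rfl (Nat.cast_nonneg d) ha hb hR2
    rw [Real.coe_toNNReal _ (by positivity), Real.coe_toNNReal _ (by positivity), Real.coe_toNNReal _ (by positivity),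
      Real.coe_toNNReal _ (by positivity), Real.coe_toNNReal _ (by positivity), Real.coe_toNNReal _ (by positivity),
      Real.coe_toNNReal _ (by positivity), ← Real.rpow_neg hK0.le, ← Real.rpow_neg hK0.le]
    have e1 : K ^ ((x : ℝ) - 2) = K ^ x / K ^ 2 := by
      rw [Real.rpow_sub hK0, Real.rpow_natCast]; norm_num
    have e2 : K ^ (4 * (q : ℝ)) = ((k ^ q : ℕ) : ℝ) ^ 4 := by
      rw [mul_comm, Real.rpow_mul hK0.le, Real.rpow_natCast]
      push_cast
      norm_num [hKdef]
    rw [e1, e2] at hfin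
    simp only [Real.rpow_natCast] at hfin
    push_cast at hfin ⊢
    refine hfin.trans (Real.le_coe_toNNReal _)

end fbm

end LC
end

section
namespace LC

/-! ### Unscaling and conclusion -/

lemma cov_mul {l : ℝ} (hl : 0 < l) {G : ℝ → ℝ≥0∞} (hG : Measurable G) :
    ∫⁻ b, G b = ENNReal.ofReal l * ∫⁻ x, G (l * x) := by
  have h1 : ∫⁻ x, G (l * x) = ∫⁻ y, G y ∂(Measure.map (l * ·) volume) :=
    (lintegral_map hG (measurable_const_mul l)).symm
  rw [h1, Real.map_volume_mul_left hl.ne', lintegral_smul_measure, smul_eq_mul, ← mul_assoc,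
    abs_of_pos (inv_pos.2 hl), ← ENNReal.ofReal_mul hl.le, mul_inv_cancel₀ hl.ne', ENNReal.ofReal_one, one_mul]

lemma cov_aff {l : ℝ} (hl : 0 < l) {G : ℝ → ℝ≥0∞} (hG : Measurable G) :
    ∫⁻ b, G b = ENNReal.ofReal l * ∫⁻ x, G (l * (x + 1 / 2)) := by
  rw [cov_mul hl hG, lintegral_add_right_eq_self (fun x => G (l * x)) (1 / 2)]

lemma occ_Icc {w : ℝ → ℝ} (hw : Continuous w) (t a b : ℝ) :
    occ w t (Icc a b) = ∫⁻ r in Icc 0 t, strad a b (w r) := by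
  have h : Measurable fun x => strad a b x := measurable_strad measurable_const measurable_const measurable_id
  rw [← lintegral_map h hw.measurable]
  have : ∀ x, strad a b x = (Icc a b).indicator 1 x := fun x => by
    simp [strad, indicator]
  simp_rw [this]
  rw [lintegral_indicator_one measurableSet_Icc]
  rfl

lemma occ_atoms {w : ℝ → ℝ} (hw : Continuous w) (t : ℝ) : {x : ℝ | 0 < occ w t {x}}.Countable := by
  have : IsFiniteMeasure (occ w t) := ⟨by rw [occ_univ hw]; exact ENNReal.ofReal_lt_top⟩
  exact Measure.countable_meas_pos_of_disjoint_iUnion (fun x => measurableSet_singleton x)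
    (fun x y h => by simpa using h)

lemma occ_ae {w : ℝ → ℝ} (hw : Continuous w) (t : ℝ) {l : ℝ} (hl : 0 < l) :
    ∀ᵐ x : ℝ, occ w t (Ico (l * x) (l * (x + 1))) = occ w t (Icc (l * x) (l * (x + 1))) := by
  have h1 : ((fun x : ℝ => l * (x + 1)) ⁻¹' {x : ℝ | 0 < occ w t {x}}).Countable := by
    refine (occ_atoms hw t).preimage_of_injOn ?_
    intro x _ y _ h
    have := mul_left_cancel₀ hl.ne' h
    linarith
  filter_upwards [compl_mem_ae_iff.2 (h1.measure_zero volume)] with x hx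
  have hx0 : occ w t {l * (x + 1)} = 0 := by
    by_contra h
    exact hx (pos_iff_ne_zero.2 h)
  refine le_antisymm (measure_mono Ico_subset_Icc_self) ?_
  rw [← Ico_union_right (by nlinarith : l * x ≤ l * (x + 1))]
  refine (measure_union_le _ _).trans ?_
  rw [hx0, add_zero]

set_option linter.unusedSectionVars false
section fin
variable {Ω : Type*} [MeasurableSpace Ω] {H A : ℝ} {P : Measure Ω} [IsProbabilityMeasure P]
  {B : ℝ → Ω → ℝ}

lemma Mo_sc {l : ℝ} (hl : 0 < l) {ω : Ω} (hw : Continuous (pth B ω)) {n t : ℝ} (hn : l ^ (1 / H) * n = t) (x : ℝ) :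
    ENNReal.ofReal (l ^ (1 / H)) * Mo (pth (sc H l B) ω) 0 n x = occ (pth B ω) t (Icc (l * x) (l * (x + 1))) := by
  obtain ⟨τ, hτ⟩ : ∃ τ, τ = l ^ (1 / H) := ⟨_, rfl⟩
  have hτ0 : 0 < τ := hτ ▸ Real.rpow_pos_of_pos hl _
  have hs : Measurable fun u => strad (l * x) (l * (x + 1)) (pth B ω u) :=
    measurable_strad measurable_const measurable_const hw.measurable
  rw [occ_Icc hw, ← lintegral_indicator measurableSet_Icc, cov_mul hτ0 (hs.indicator measurableSet_Icc), Mo,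
    ← lintegral_indicator measurableSet_Icc, ← hτ]
  congr 1
  refine lintegral_congr fun r => ?_
  have h1 : r ∈ Icc 0 (0 + n) ↔ τ * r ∈ Icc 0 t := by
    rw [← hn, ← hτ, zero_add, mem_Icc, mem_Icc, mul_le_mul_iff_right₀ hτ0]
    constructor
    · rintro ⟨h, h'⟩; exact ⟨by positivity, h'⟩
    · rintro ⟨h, h'⟩; exact ⟨nonneg_of_mul_nonneg_right h hτ0, h'⟩
  have h2 : strad x (x + 1) (pth (sc H l B) ω r) = strad (l * x) (l * (x + 1)) (pth B ω (τ * r)) := by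
    have : pth (sc H l B) ω r = l⁻¹ * pth B ω (τ * r) := by rw [hτ]; rfl
    rw [this]
    unfold strad
    congr 1
    rw [mem_Icc, mem_Icc, le_inv_mul_iff₀ hl, inv_mul_le_iff₀ hl]
  by_cases h : r ∈ Icc 0 (0 + n)
  · rw [indicator_of_mem h, indicator_of_mem (h1.1 h), h2]
  · rw [indicator_of_notMem h, indicator_of_notMem (fun h' => h (h1.2 h'))]

lemma unscale (c : ℝ≥0∞) {l : ℝ} (hl : 0 < l) {ω : Ω} (hw : Continuous (pth B ω)) {n t : ℝ} (ht : 0 < t)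
    (hn : l ^ (1 / H) * n = t) (M : ℝ) :
    (ENNReal.ofReal l)⁻¹ * ∫⁻ b in Icc (-M) M, dd (Ak H (pth B ω) t l b) (Mk c (pth B ω) t l b) ≤
      ENNReal.ofReal (l ^ (1 / H)) * ∫⁻ x in Icc (-(M / l + 1 / 2)) (M / l + 1 / 2),
        dd (Nf (pth (sc H l B) ω) 0 n x) (c * Mo (pth (sc H l B) ω) 0 n x) := by
  have hm : Measurable fun b => dd (Ak H (pth B ω) t l b) (Mk c (pth B ω) t l b) :=
    measurable_dd (Ak_measurable H hw ht l) (Mk_measurable c hw t l)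
  have hl0 : ENNReal.ofReal l ≠ 0 := by simpa using hl
  rw [← lintegral_indicator measurableSet_Icc, cov_aff hl (hm.indicator measurableSet_Icc), ← mul_assoc,
    ENNReal.inv_mul_cancel hl0 ENNReal.ofReal_ne_top, one_mul,
    ← lintegral_const_mul' _ _ ENNReal.ofReal_ne_top, ← lintegral_indicator measurableSet_Icc]
  refine lintegral_mono_ae ?_
  filter_upwards [occ_ae hw t hl] with x hx
  by_cases h : l * (x + 1 / 2) ∈ Icc (-M) M
  · have h' : x ∈ Icc (-(M / l + 1 / 2)) (M / l + 1 / 2) := by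
      obtain ⟨h1, h2⟩ := h
      have e : l * (M / l) = M := by field_simp
      constructor <;> by_contra hc <;> push Not at hc <;> nlinarith
    rw [indicator_of_mem h, indicator_of_mem h']
    have e1 : l * (x + 1 / 2) - l / 2 = l * x := by ring
    have e2 : l * (x + 1 / 2) + l / 2 = l * (x + 1) := by ring
    have hA : Ak H (pth B ω) t l (l * (x + 1 / 2)) = ENNReal.ofReal (l ^ (1 / H)) * Nf (pth (sc H l B) ω) 0 n x := by
      rw [Ak, e1, e2, Nf_sc hl, hn]
    have hM : Mk c (pth B ω) t l (l * (x + 1 / 2)) = ENNReal.ofReal (l ^ (1 / H)) * (c * Mo (pth (sc H l B) ω) 0 n x) := by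
      rw [Mk, e1, e2, hx, ← Mo_sc hl hw hn]
      ring
    rw [hA, hM]
    exact dd_mul _ _ _
  · rw [indicator_of_notMem h]
    exact zero_le

end fin
end LC
end

section
namespace LC

/-- the scales used in the limiting procedure -/
def Lsc (H t : ℝ) (x k : ℕ) : ℝ := (t / (((k + 1 : ℕ) : ℝ) ^ x)) ^ H

section scales
variable {H t : ℝ} {x : ℕ}

lemma Lsc_pos (ht : 0 < t) (k : ℕ) : 0 < Lsc H t x k :=
  Real.rpow_pos_of_pos (by positivity) _

lemma Lsc_pow (hH : 0 < H) (ht : 0 < t) (k : ℕ) :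
    Lsc H t x k ^ (1 / H) = t / (((k + 1 : ℕ) : ℝ) ^ x) := by
  rw [Lsc, ← Real.rpow_mul (by positivity), mul_one_div_cancel hH.ne', Real.rpow_one]

lemma Lsc_tendsto (hH : 0 < H) (hx : 2 ≤ x) : Tendsto (Lsc H t x) atTop (𝓝 0) := by
  have h1 : Tendsto (fun k : ℕ => ((k + 1 : ℕ) : ℝ) ^ x) atTop atTop :=
    (tendsto_pow_atTop (by omega)).comp (tendsto_natCast_atTop_atTop.comp (tendsto_add_atTop_nat 1))
  have h2 : Tendsto (fun k : ℕ => t / ((k + 1 : ℕ) : ℝ) ^ x) atTop (𝓝 0) := h1.const_div_atTop t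
  have h3 := h2.rpow_const (p := H) (Or.inr hH.le)
  rw [Real.zero_rpow hH.ne'] at h3
  exact h3

lemma Lsc_ratio (hH : 0 < H) (ht : 0 < t) (θ : ℝ) (hθ : 1 < θ) :
    ∀ᶠ k in atTop, Lsc H t x k ≤ θ * Lsc H t x (k + 1) := by
  have h1 : Tendsto (fun k : ℕ => ((1 + 1 / ((k : ℝ) + 1)) ^ x) ^ H) atTop (𝓝 (((1 + 0 : ℝ) ^ x) ^ H)) := by
    refine Tendsto.rpow_const ?_ (Or.inr hH.le)
    exact (tendsto_const_nhds.add tendsto_one_div_add_atTop_nhds_zero_nat).pow x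
  rw [add_zero, one_pow, Real.one_rpow] at h1
  filter_upwards [h1.eventually_lt_const hθ] with k hk
  have e : Lsc H t x k = ((1 + 1 / ((k : ℝ) + 1)) ^ x) ^ H * Lsc H t x (k + 1) := by
    unfold Lsc
    rw [← Real.mul_rpow (by positivity) (by positivity)]
    congr 1
    push_cast
    have : (1 + 1 / ((k : ℝ) + 1)) = (k + 1 + 1) / (k + 1) := by field_simp
    rw [this, div_pow]
    field_simp
  rw [e]
  exact mul_le_mul_of_nonneg_right hk.le (Lsc_pos ht _).le

lemma Lsc_R (hH : 0 < H) (ht : 0 < t) {M : ℝ} (k : ℕ) :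
    M / Lsc H t x k + 1 / 2 ≤ (M / t ^ H + 1) * ((((k + 1 : ℕ) : ℝ)) ^ x) ^ H := by
  have h1 : (1 : ℝ) ≤ (((k + 1 : ℕ) : ℝ)) ^ x := one_le_pow₀ (by push_cast; linarith [(Nat.cast_nonneg k : (0 : ℝ) ≤ k)])
  have h2 : (1 : ℝ) ≤ ((((k + 1 : ℕ) : ℝ)) ^ x) ^ H := Real.one_le_rpow h1 hH.le
  have h3 : M / Lsc H t x k = M / t ^ H * ((((k + 1 : ℕ) : ℝ)) ^ x) ^ H := by
    unfold Lsc
    rw [Real.div_rpow ht.le (by positivity)]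
    have := Real.rpow_pos_of_pos ht H
    field_simp
  rw [h3]
  nlinarith

end scales

section fin
variable {Ω : Type*} [MeasurableSpace Ω] {H A : ℝ} {P : Measure Ω} [IsProbabilityMeasure P]
  {B : ℝ → Ω → ℝ}

lemma summ_C (D : ℝ) : ∑' k : ℕ, ENNReal.ofReal (D * (1 / ((k + 1 : ℕ) : ℝ) ^ 2)) ≠ ⊤ := by
  have h : Summable fun k : ℕ => |D| * (1 / ((k + 1 : ℕ) : ℝ) ^ 2) :=
    ((summable_nat_add_iff 1).2 (Real.summable_one_div_nat_pow.2 one_lt_two)).mul_left _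
  refine ne_top_of_le_ne_top (h.tsum_ofReal_ne_top) (ENNReal.tsum_le_tsum fun k => ENNReal.ofReal_le_ofReal ?_)
  exact mul_le_mul_of_nonneg_right (le_abs_self D) (by positivity)

lemma IsF.as_sum (hB : IsF H A P B) (hH0 : 0 < H) (hH : H < 1 / 2) :
    ∃ x : ℕ, 2 ≤ x ∧ ∀ t : ℝ, 0 < t → ∀ᵐ ω ∂P, ∀ M : ℕ,
      ∑' k, (ENNReal.ofReal (Lsc H t x k))⁻¹ * ∫⁻ b in Icc (-(M : ℝ)) M,
        dd (Ak H (pth B ω) t (Lsc H t x k) b) (Mk (cc P B) (pth B ω) t (Lsc H t x k) b) ≠ ⊤ := by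
  obtain ⟨x, hx, h⟩ := master2 hH0 hH hB
  refine ⟨x, hx, fun t ht => ae_all_iff.2 fun M => ?_⟩
  obtain ⟨C, hC⟩ := h (M / t ^ H + 1)
  obtain ⟨l, hl⟩ : ∃ l : ℕ → ℝ, l = Lsc H t x := ⟨_, rfl⟩
  have hl0 : ∀ k, 0 < l k := fun k => hl ▸ Lsc_pos ht k
  have hn : ∀ k : ℕ, l k ^ (1 / H) * (((k + 1 : ℕ) : ℝ) ^ x) = t := fun k => by
    rw [hl, Lsc_pow hH0 ht]
    field_simp
  have hBs : ∀ k, IsF H A P (LC.sc H (l k) B) := fun k => hB.sc hH0 (hl0 k)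
  have hFm : ∀ k : ℕ, Measurable fun p : Ω × ℝ =>
      dd (Nf (pth (LC.sc H (l k) B) p.1) 0 (((k + 1 : ℕ) : ℝ) ^ x) p.2)
        (cc P B * Mo (pth (LC.sc H (l k) B) p.1) 0 (((k + 1 : ℕ) : ℝ) ^ x) p.2) := fun k =>
    measurable_dd ((hBs k).Nf_meas 0 (by positivity) measurable_fst measurable_snd)
      (((hBs k).Mo_meas 0 _).const_mul _)
  obtain ⟨G, hG⟩ : ∃ G : ℕ → Ω → ℝ≥0∞, G = fun k ω => ENNReal.ofReal (l k ^ (1 / H)) *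
      ∫⁻ y in Icc (-((M : ℝ) / l k + 1 / 2)) ((M : ℝ) / l k + 1 / 2),
        dd (Nf (pth (LC.sc H (l k) B) ω) 0 (((k + 1 : ℕ) : ℝ) ^ x) y)
        (cc P B * Mo (pth (LC.sc H (l k) B) ω) 0 (((k + 1 : ℕ) : ℝ) ^ x) y) := ⟨_, rfl⟩
  have hGm : ∀ k, Measurable (G k) := fun k => by
    rw [hG]
    exact (Measurable.lintegral_prod_right' (ν := volume.restrict (Icc (-((M : ℝ) / l k + 1 / 2)) ((M : ℝ) / l k + 1 / 2)))
      (hFm k)).const_mul _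
  have hGi : ∀ k, ∫⁻ ω, G k ω ∂P ≤ ENNReal.ofReal ((t * C) * (1 / ((k + 1 : ℕ) : ℝ) ^ 2)) := fun k => by
    have h1 := hC _ (hBs k) (k + 1) (Nat.succ_pos k) ((M : ℝ) / l k + 1 / 2)
      (by have := hl0 k; positivity) (by rw [hl]; exact Lsc_R hH0 ht k)
    rw [Pa, lintegral_prod _ (hFm k).aemeasurable] at h1
    rw [hG]
    simp only []
    rw [lintegral_const_mul' _ _ ENNReal.ofReal_ne_top]
    refine (mul_le_mul' le_rfl h1).trans (le_of_eq ?_)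
    rw [← ENNReal.ofReal_mul (Real.rpow_nonneg (hl0 k).le _), ← hn k]
    congr 1
    ring
  have hsum : ∫⁻ ω, ∑' k, G k ω ∂P ≠ ⊤ := by
    rw [lintegral_tsum fun k => (hGm k).aemeasurable]
    exact ne_top_of_le_ne_top (summ_C (t * C)) (ENNReal.tsum_le_tsum hGi)
  filter_upwards [ae_lt_top (Measurable.tsum hGm) hsum] with ω hω
  refine ne_top_of_le_ne_top hω.ne (ENNReal.tsum_le_tsum fun k => ?_)
  rw [← hl, hG]
  exact unscale (cc P B) (hl0 k) (hB.cont' ω) ht (hn k) M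

lemma IsF.final (hB : IsF H A P B) (hH0 : 0 < H) (hH : H < 1 / 2) {T : ℝ} (hT : 0 < T) :
    ∀ᵐ ω ∂P, ∀ δ : ℝ, 0 < δ → ∃ ε₀ : ℝ, 0 < ε₀ ∧
      ∀ Q : RPartition, Q.mesh ≤ ENNReal.ofReal ε₀ → ∀ t ∈ Set.Icc (0 : ℝ) T,
        |Vvar H Q (pth B ω) 0 t - cH P B * t| < δ := by
  obtain ⟨x, hx, h⟩ := hB.as_sum hH0 hH
  have hfin := hB.cc_ne_top hH0
  have hall : ∀ᵐ ω ∂P, ∀ j J : ℕ, 0 < j → 0 < J → ∀ M : ℕ,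
      ∑' k, (ENNReal.ofReal (Lsc H (T * j / J) x k))⁻¹ * ∫⁻ b in Icc (-(M : ℝ)) M,
        dd (Ak H (pth B ω) (T * j / J) (Lsc H (T * j / J) x k) b)
          (Mk (cc P B) (pth B ω) (T * j / J) (Lsc H (T * j / J) x k) b) ≠ ⊤ := by
    refine ae_all_iff.2 fun j => ae_all_iff.2 fun J => ?_
    by_cases hj : 0 < j
    · by_cases hJ : 0 < J
      · filter_upwards [h (T * j / J) (by positivity)] with ω hω _ _ using hω
      · exact ae_of_all _ fun ω _ h' => absurd h' hJ
    · exact ae_of_all _ fun ω h' => absurd h' hj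
  have hc : cH P B = (cc P B).toReal := by rw [cH, cHe_eq hB hH0 hfin]
  filter_upwards [hall] with ω hω δ hδ
  rw [hc]
  refine polya (hB.cont' ω) ENNReal.toReal_nonneg hT (fun j J hj hJ δ' hδ' => ?_) hδ
  have ht : 0 < T * j / J := by positivity
  exact assembly hH0 (hB.cont' ω) ht hfin (Lsc_tendsto hH0 hx) (Lsc_ratio hH0 ht) (Lsc_pos ht)
    (hω j J hj hJ) hδ'

end fin
end LC
end

/-- **Uniform convergence of variation along Lebesgue partitions.** For `H ∈ (0,1/2)`
and `T ∈ (0,∞)`, almost surely `V_{0,t}(P,B) → c_H t` as the mesh of the partition `P`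
of `ℝ` tends to `0`, uniformly over `t ≤ T` and over all such partitions. -/
theorem uniform_convergence_of_variation
    {Ω : Type*} [MeasurableSpace Ω] (P : Measure Ω) [IsProbabilityMeasure P]
    (H : ℝ) (hH : H ∈ Set.Ioo (0 : ℝ) (1 / 2)) (B : ℝ → Ω → ℝ) (hB : IsFBM H P B)
    (T : ℝ) (hT : 0 < T) :
    ∀ᵐ ω ∂P, ∀ δ : ℝ, 0 < δ → ∃ ε₀ : ℝ, 0 < ε₀ ∧
      ∀ Q : RPartition, Q.mesh ≤ ENNReal.ofReal ε₀ → ∀ t ∈ Set.Icc (0 : ℝ) T,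
        |Vvar H Q (fun r => B r ω) 0 t - cH P B * t| < δ := by
  obtain ⟨h1, h2, h3, h4, aH, h5, h6⟩ := hB
  exact LC.IsF.final (A := aH) ⟨h1, h2, h3, h4, h5, h6⟩ hH.1 hH.2 hT

end
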